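/- Let d ∈ ℕ, α ∈ (0, min(2,d)) and δ ∈ (0, d-α). For every T > 0 there is a constant c ≥ 1 such that on (0,T]×(ℝ^d\{0})×(ℝ^d\{0}) the following hold: both p̃⁰_{V_δ}(t,x,y) and p̃⁰_{V⁰_δ}(t,x,y) are bounded above and below by constant multiples of p⁰(t,x,y) H⁰(t,x) H⁰(t,y), and both p̃_{V_δ}(t,x,y) and p̃_{V⁰_δ}(t,x,y) are bounded above and below by constant multiples of p(t,x,y) H⁰(t,x) H⁰(t,y); here p̃⁰_{V_δ}, p̃⁰_{V⁰_δ}, p̃_{V_δ}, p̃_{V⁰_δ} denote the Schrödinger perturbations of p⁰ by V_δ, of p⁰ by V⁰_δ, of p by V_δ, and of p by V⁰_δ respectively, with comparability constant c. -/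

import Mathlib

open MeasureTheory Real Set Filter RealInnerProductSpace

noncomputable section

/-- Euclidean space `ℝ^d`. -/
abbrev Ed (d : ℕ) := EuclideanSpace ℝ (Fin d)

/-- Modified Bessel function of the second kind `K_ν(r)`. -/
def besselK (ν r : ℝ) : ℝ :=
  (1 / 2) * (r / 2) ^ ν * ∫ u in Ioi (0 : ℝ), u ^ (-ν - 1) * Real.exp (-u - r ^ 2 / (4 * u))

/-- Relativistic `α`-stable heat kernel with mass parameter `m`:
`p^m(t,x,y) = (2π)^{-d} ∫ exp(-i⟨y-x,z⟩) exp(-t(|z|²+m^{2/α})^{α/2}) dz`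
(the integral is real, and equals the cosine integral below). -/
def relKernel (d : ℕ) (α m t : ℝ) (x y : Ed d) : ℝ :=
  (2 * π) ^ (-(d : ℝ)) *
    ∫ z : Ed d, Real.cos ⟪y - x, z⟫ * Real.exp (-t * (‖z‖ ^ 2 + m ^ (2 / α)) ^ (α / 2))

/-- Fractional (`α`-stable) heat kernel `p⁰(t,x,y)`. -/
def fracKernel (d : ℕ) (α t : ℝ) (x y : Ed d) : ℝ :=
  (2 * π) ^ (-(d : ℝ)) * ∫ z : Ed d, Real.cos ⟪y - x, z⟫ * Real.exp (-t * ‖z‖ ^ α)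

/-- The summands of the perturbation series. -/
def pertN (d : ℕ) (k : ℝ → Ed d → Ed d → ℝ) (q : Ed d → ℝ) : ℕ → ℝ → Ed d → Ed d → ℝ
  | 0 => k
  | n + 1 => fun t x y =>
      ∫ s in Ioo (0 : ℝ) t, ∫ z : Ed d, pertN d k q n s x z * q z * k (t - s) z y

/-- Schrödinger perturbation of a transition density `k` by a potential `q`. -/
def pert (d : ℕ) (k : ℝ → Ed d → Ed d → ℝ) (q : Ed d → ℝ) (t : ℝ) (x y : Ed d) : ℝ :=
  ∑' n : ℕ, pertN d k q n t x y

/-- Radial profile of the potential `V_β`. -/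
def VProf (d : ℕ) (α β r : ℝ) : ℝ :=
  2 ^ (α / 2) * Real.Gamma (((d : ℝ) - β) / 2) / Real.Gamma (((d : ℝ) - β - α) / 2) *
    (besselK ((β + α) / 2) r / besselK (β / 2) r) * r ^ (-(α / 2))

/-- The potential `V_β(x)`. -/
def Vbeta (d : ℕ) (α β : ℝ) (x : Ed d) : ℝ := VProf d α β ‖x‖

/-- The Hardy constant `κ_β` for the fractional Laplacian. -/
def kappa (d : ℕ) (α β : ℝ) : ℝ :=
  2 ^ α * Real.Gamma ((β + α) / 2) * Real.Gamma (((d : ℝ) - β) / 2) /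
    (Real.Gamma (β / 2) * Real.Gamma (((d : ℝ) - β - α) / 2))

/-- `h^m_β(x) = ∫_0^∞ t^{(d-α-β)/α} p^m(t,x,0) dt`. -/
def hBetaM (d : ℕ) (α m β : ℝ) (x : Ed d) : ℝ :=
  ∫ t in Ioi (0 : ℝ), t ^ (((d : ℝ) - α - β) / α) * relKernel d α m t x 0

/-- `h_β = h^1_β`. -/
def hBeta (d : ℕ) (α β : ℝ) (x : Ed d) : ℝ := hBetaM d α 1 β x

/-- `V^m_β(x) = ((d-α-β)/α) h^m_{β+α}(x)/h^m_β(x)`. -/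
def VbetaM (d : ℕ) (α m β : ℝ) (x : Ed d) : ℝ :=
  (((d : ℝ) - α - β) / α) * hBetaM d α m (β + α) x / hBetaM d α m β x

/-- The function `H⁰(t,x)`. -/
def Hzero (d : ℕ) (α δ t : ℝ) (x : Ed d) : ℝ :=
  if δ ≤ ((d : ℝ) - α) / 2 then 1 + t ^ (δ / α) * ‖x‖ ^ (-δ)
  else 1 + t ^ (((d : ℝ) - α - δ) / α) * ‖x‖ ^ (-((d : ℝ) - α - δ))

/-- Density of the Lévy measure of the relativistic `α`-stable operator (mass 1). -/
def levyNu (d : ℕ) (α : ℝ) (x : Ed d) : ℝ :=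
  2 ^ ((α - (d : ℝ)) / 2 + 1) * π ^ (-(d : ℝ) / 2) * |Real.Gamma (-α / 2)|⁻¹ *
    besselK (((d : ℝ) + α) / 2) ‖x‖ / ‖x‖ ^ (((d : ℝ) + α) / 2)

noncomputable section
open scoped ENNReal NNReal Topology

/-! ## Abstract perturbation theory in `ℝ≥0∞` -/

def act {d : ℕ} (q : Ed d → ℝ≥0∞) (f : ℝ × Ed d × Ed d → ℝ≥0∞) (u : ℝ × Ed d → ℝ≥0∞) :
    ℝ × Ed d → ℝ≥0∞ :=
  fun p => ∫⁻ r : ℝ × Ed d, f (r.1, p.2, r.2) * q r.2 * u (p.1 - r.1, r.2)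

def cnv {d : ℕ} (q : Ed d → ℝ≥0∞) (f g : ℝ × Ed d × Ed d → ℝ≥0∞) :
    ℝ × Ed d × Ed d → ℝ≥0∞ :=
  fun p => ∫⁻ r : ℝ × Ed d, f (r.1, p.2.1, r.2) * q r.2 * g (p.1 - r.1, r.2, p.2.2)

/-- spatial action -/
def sact {d : ℕ} (f : ℝ × Ed d × Ed d → ℝ≥0∞) (h : Ed d → ℝ≥0∞) : ℝ × Ed d → ℝ≥0∞ :=
  fun p => ∫⁻ z : Ed d, f (p.1, p.2, z) * h z

def EN {d : ℕ} (k : ℝ × Ed d × Ed d → ℝ≥0∞) (q : Ed d → ℝ≥0∞) : ℕ → ℝ × Ed d × Ed d → ℝ≥0∞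
  | 0 => k
  | n + 1 => cnv q (EN k q n) k

def ET {d : ℕ} (k : ℝ × Ed d × Ed d → ℝ≥0∞) (q : Ed d → ℝ≥0∞) : ℝ × Ed d × Ed d → ℝ≥0∞ :=
  fun p => ∑' n, EN k q n p

section
variable {d : ℕ} {q q' : Ed d → ℝ≥0∞} {f g k : ℝ × Ed d × Ed d → ℝ≥0∞} {u v : ℝ × Ed d → ℝ≥0∞}

@[fun_prop]
lemma measurable_act (hq : Measurable q) (hf : Measurable f) (hu : Measurable u) :
    Measurable (act q f u) := by
  unfold act
  refine Measurable.lintegral_prod_right' (f := fun w : (ℝ × Ed d) × (ℝ × Ed d) =>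
    f (w.2.1, w.1.2, w.2.2) * q w.2.2 * u (w.1.1 - w.2.1, w.2.2)) ?_
  fun_prop

@[fun_prop]
lemma measurable_cnv (hq : Measurable q) (hf : Measurable f) (hg : Measurable g) :
    Measurable (cnv q f g) := by
  unfold cnv
  refine Measurable.lintegral_prod_right' (f := fun w : (ℝ × Ed d × Ed d) × (ℝ × Ed d) =>
    f (w.2.1, w.1.2.1, w.2.2) * q w.2.2 * g (w.1.1 - w.2.1, w.2.2, w.1.2.2)) ?_
  fun_prop

@[fun_prop]
lemma measurable_sact {h : Ed d → ℝ≥0∞} (hf : Measurable f) (hh : Measurable h) :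
    Measurable (sact f h) := by
  unfold sact
  refine Measurable.lintegral_prod_right' (f := fun w : (ℝ × Ed d) × (Ed d) =>
    f (w.1.1, w.1.2, w.2) * h w.2) ?_
  fun_prop

lemma cnv_eq_act (t : ℝ) (x y : Ed d) :
    cnv q f g (t, x, y) = act q f (fun p => g (p.1, p.2, y)) (t, x) := rfl

lemma act_assoc (hq : Measurable q) (hq' : Measurable q') (hf : Measurable f) (hg : Measurable g)
    (hu : Measurable u) : act q' (cnv q f g) u = act q f (act q' g u) := by
  funext ⟨t, x⟩
  simp only [act, cnv]
  have h1 : ∀ r : ℝ × Ed d, (∫⁻ w : ℝ × Ed d, f (w.1, x, w.2) * q w.2 * g (r.1 - w.1, w.2, r.2))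
      * q' r.2 * u (t - r.1, r.2) = ∫⁻ w : ℝ × Ed d, f (w.1, x, w.2) * q w.2 *
        (g (r.1 - w.1, w.2, r.2) * q' r.2 * u (t - r.1, r.2)) := by
    intro r
    rw [mul_assoc, ← lintegral_mul_const _ (by fun_prop)]
    congr 1; funext w; ring
  simp_rw [h1]
  rw [lintegral_lintegral_swap (by
    refine Measurable.aemeasurable ?_
    simp only [Function.uncurry_def]
    fun_prop)]
  congr 1; funext w
  rw [lintegral_const_mul _ (by fun_prop)]
  congr 1
  have : (volume : Measure (ℝ × Ed d)).IsAddRightInvariant := by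
    rw [Measure.volume_eq_prod]; infer_instance
  rw [← lintegral_add_right_eq_self _ ((w.1, 0) : ℝ × Ed d)]
  congr 1; funext r
  simp [sub_sub, add_comm]

lemma cnv_assoc {h : ℝ × Ed d × Ed d → ℝ≥0∞} (hq : Measurable q) (hq' : Measurable q')
    (hf : Measurable f) (hg : Measurable g)
    (hh : Measurable h) : cnv q' (cnv q f g) h = cnv q f (cnv q' g h) := by
  funext ⟨t, x, y⟩
  rw [cnv_eq_act, act_assoc hq hq' hf hg (by fun_prop)]
  rfl

@[fun_prop]
lemma measurable_EN (hk : Measurable k) (hq : Measurable q) (n : ℕ) : Measurable (EN k q n) := by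
  induction n with
  | zero => exact hk
  | succ n ih => exact measurable_cnv hq ih hk

@[fun_prop]
lemma measurable_ET (hk : Measurable k) (hq : Measurable q) : Measurable (ET k q) := by
  unfold ET; fun_prop

lemma EN_succ' (hk : Measurable k) (hq : Measurable q) (n : ℕ) :
    EN k q (n+1) = cnv q k (EN k q n) := by
  induction n with
  | zero => rfl
  | succ n ih =>
    have h2 : EN k q (n + 1 + 1) = cnv q (EN k q (n + 1)) k := rfl
    rw [h2, ih, cnv_assoc hq hq hk (measurable_EN hk hq n) hk, ← ih]; rfl

lemma act_tsum_left {F : ℕ → ℝ × Ed d × Ed d → ℝ≥0∞} (hF : ∀ n, Measurable (F n))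
    (hq : Measurable q) (hu : Measurable u) :
    act q (fun p => ∑' n, F n p) u = fun p => ∑' n, act q (F n) u p := by
  funext p
  simp only [act]
  rw [← lintegral_tsum (by fun_prop)]
  congr 1; funext r
  rw [← ENNReal.tsum_mul_right, ← ENNReal.tsum_mul_right]

lemma cnv_tsum_left {F : ℕ → ℝ × Ed d × Ed d → ℝ≥0∞} (hF : ∀ n, Measurable (F n))
    (hq : Measurable q) (hg : Measurable g) :
    cnv q (fun p => ∑' n, F n p) g = fun p => ∑' n, cnv q (F n) g p := by
  funext ⟨t, x, y⟩
  rw [cnv_eq_act, act_tsum_left hF hq (by fun_prop)]; rfl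

lemma act_tsum_right {F : ℕ → ℝ × Ed d → ℝ≥0∞} (hF : ∀ n, Measurable (F n))
    (hq : Measurable q) (hf : Measurable f) :
    act q f (fun p => ∑' n, F n p) = fun p => ∑' n, act q f (F n) p := by
  funext p
  simp only [act]
  rw [← lintegral_tsum (by fun_prop)]
  congr 1; funext r
  rw [← ENNReal.tsum_mul_left]

lemma cnv_tsum_right {F : ℕ → ℝ × Ed d × Ed d → ℝ≥0∞} (hF : ∀ n, Measurable (F n))
    (hq : Measurable q) (hf : Measurable f) :
    cnv q f (fun p => ∑' n, F n p) = fun p => ∑' n, cnv q f (F n) p := by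
  funext ⟨t, x, y⟩
  rw [cnv_eq_act, act_tsum_right (fun n => by have := hF n; fun_prop) hq hf]; rfl

/-- Duhamel, right form. -/
lemma ET_duhamel (hk : Measurable k) (hq : Measurable q) (p) :
    ET k q p = k p + cnv q (ET k q) k p := by
  unfold ET
  rw [cnv_tsum_left (fun n => measurable_EN hk hq n) hq hk, tsum_eq_zero_add' ENNReal.summable]
  rfl

lemma ET_duhamel' (hk : Measurable k) (hq : Measurable q) (p) :
    ET k q p = k p + cnv q k (ET k q) p := by
  unfold ET
  rw [cnv_tsum_right (fun n => measurable_EN hk hq n) hq hk, tsum_eq_zero_add' ENNReal.summable]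
  simp_rw [EN_succ' hk hq]
  rfl

lemma le_ET (p) : k p ≤ ET k q p := by
  unfold ET; exact ENNReal.le_tsum (f := fun n => EN k q n p) 0

lemma cnv_mono {f' g' : ℝ × Ed d × Ed d → ℝ≥0∞} (hf : ∀ p, f p ≤ f' p) (hg : ∀ p, g p ≤ g' p)
    (hq : ∀ᵐ z, q z ≤ q' z) (p) : cnv q f g p ≤ cnv q' f' g' p := by
  unfold cnv
  apply lintegral_mono_ae
  have : ∀ᵐ r : ℝ × Ed d, q r.2 ≤ q' r.2 := by
    rw [Measure.volume_eq_prod]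
    exact Measure.quasiMeasurePreserving_snd.ae hq
  filter_upwards [this] with r hr
  gcongr
  · exact hf _
  · exact hg _

lemma EN_mono {k' : ℝ × Ed d × Ed d → ℝ≥0∞} (hk : ∀ p, k p ≤ k' p) (hq : ∀ᵐ z, q z ≤ q' z) (n)
    (p) : EN k q n p ≤ EN k' q' n p := by
  induction n generalizing p with
  | zero => exact hk p
  | succ n ih => exact cnv_mono ih hk hq p

lemma ET_mono {k' : ℝ × Ed d × Ed d → ℝ≥0∞} (hk : ∀ p, k p ≤ k' p) (hq : ∀ᵐ z, q z ≤ q' z)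
    (p) : ET k q p ≤ ET k' q' p :=
  ENNReal.tsum_le_tsum fun n => EN_mono hk hq n p

/-- vanishing for nonpositive times -/
lemma cnv_zero (hf : ∀ t x y, t ≤ 0 → f (t, x, y) = 0) (hg : ∀ t x y, t ≤ 0 → g (t, x, y) = 0)
    (t x y) (ht : t ≤ 0) : cnv q f g (t, x, y) = 0 := by
  unfold cnv
  rw [← lintegral_zero (μ := (volume : Measure (ℝ × Ed d)))]
  congr 1; funext r
  rcases le_or_gt r.1 0 with h | h
  · simp [hf _ _ _ h]
  · simp [hg (t - r.1) _ _ (by linarith)]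

lemma EN_zero (hk : ∀ t x y, t ≤ 0 → k (t, x, y) = 0) (n : ℕ) :
    ∀ t x y, t ≤ 0 → EN k q n (t, x, y) = 0 := by
  induction n with
  | zero => exact hk
  | succ n ih => exact cnv_zero ih hk

lemma ET_zero (hk : ∀ t x y, t ≤ 0 → k (t, x, y) = 0) (t x y) (ht : t ≤ 0) :
    ET k q (t, x, y) = 0 := by
  simp [ET, fun n => EN_zero (q := q) hk n t x y ht]

/-- Symmetry -/
lemma cnv_swap (t : ℝ) (x y : Ed d) :
    cnv q f g (t, x, y) = cnv q (fun p => g (p.1, p.2.2, p.2.1)) (fun p => f (p.1, p.2.2, p.2.1))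
      (t, y, x) := by
  unfold cnv
  have hm : MeasurePreserving (fun r : ℝ × Ed d => (t - r.1, r.2)) := by
    rw [Measure.volume_eq_prod]
    exact (Measure.measurePreserving_sub_left volume t).prod (MeasurePreserving.id _)
  have he : MeasurableEmbedding (fun r : ℝ × Ed d => (t - r.1, r.2)) := by
    have : Function.Involutive (fun r : ℝ × Ed d => (t - r.1, r.2)) := by
      intro r; simp
    exact (MeasurableEquiv.mk this.toPerm (by
      change Measurable (fun r : ℝ × Ed d => (t - r.1, r.2)); fun_prop)
      (by change Measurable (fun r : ℝ × Ed d => (t - r.1, r.2)); fun_prop)).measurableEmbedding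
  rw [← hm.lintegral_comp_emb he]
  congr 1; funext r
  simp; ring

lemma EN_symm (hk : Measurable k) (hq : Measurable q) (hs : ∀ t x y, k (t, x, y) = k (t, y, x))
    (n : ℕ) : ∀ t x y, EN k q n (t, x, y) = EN k q n (t, y, x) := by
  induction n with
  | zero => exact hs
  | succ n ih =>
    intro t x y
    rw [EN, cnv_swap]
    have e1 : (fun p : ℝ × Ed d × Ed d => k (p.1, p.2.2, p.2.1)) = k := by
      funext p; exact hs _ _ _
    have e2 : (fun p : ℝ × Ed d × Ed d => EN k q n (p.1, p.2.2, p.2.1)) = EN k q n := by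
      funext p; exact ih _ _ _
    rw [e1, e2, ← EN_succ' hk hq]; rfl

lemma ET_symm (hk : Measurable k) (hq : Measurable q) (hs : ∀ t x y, k (t, x, y) = k (t, y, x))
    (t x y) : ET k q (t, x, y) = ET k q (t, y, x) := by
  simp only [ET]
  congr 1; funext n; exact EN_symm hk hq hs n t x y

end

noncomputable section
open scoped ENNReal NNReal Topology

def onePos {d : ℕ} : ℝ × Ed d → ℝ≥0∞ := fun p => if 0 < p.1 then 1 else 0

section
variable {d : ℕ} {q q' : Ed d → ℝ≥0∞} {f g k : ℝ × Ed d × Ed d → ℝ≥0∞} {u v : ℝ × Ed d → ℝ≥0∞}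

@[fun_prop]
lemma measurable_onePos : Measurable (onePos : ℝ × Ed d → ℝ≥0∞) := by
  unfold onePos
  exact Measurable.ite (measurableSet_lt measurable_const measurable_fst) (by fun_prop) (by fun_prop)

lemma ae_fst_ne (s : ℝ) : ∀ᵐ r : ℝ × Ed d, r.1 ≠ s := by
  rw [Measure.volume_eq_prod]
  exact Measure.quasiMeasurePreserving_fst.ae (p := fun t : ℝ => t ≠ s)
    (by simp [ae_iff, measure_singleton])

lemma ae_snd {p : Ed d → Prop} (h : ∀ᵐ z, p z) : ∀ᵐ r : ℝ × Ed d, p r.2 := by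
  rw [Measure.volume_eq_prod]
  exact Measure.quasiMeasurePreserving_snd.ae h

lemma lintegral_shift (F : ℝ × Ed d → ℝ≥0∞) (s : ℝ) :
    ∫⁻ r : ℝ × Ed d, F (r.1 + s, r.2) = ∫⁻ r, F r := by
  have : (volume : Measure (ℝ × Ed d)).IsAddRightInvariant := by
    rw [Measure.volume_eq_prod]; infer_instance
  rw [← lintegral_add_right_eq_self F ((s, 0) : ℝ × Ed d)]
  congr 1; funext r
  congr 1; ext <;> simp

def CKprop (k : ℝ × Ed d × Ed d → ℝ≥0∞) : Prop :=
  ∀ s t x y, 0 < s → 0 < t → k (s + t, x, y) = ∫⁻ z, k (s, x, z) * k (t, z, y)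

lemma EN_CK (hk : Measurable k) (hq : Measurable q) (h0 : ∀ t x y, t ≤ 0 → k (t, x, y) = 0)
    (hck : CKprop k) (n : ℕ) : ∀ s t x y, 0 < s → 0 < t → EN k q n (s + t, x, y) =
      ∑ i ∈ Finset.range (n + 1), ∫⁻ z, EN k q i (s, x, z) * EN k q (n - i) (t, z, y) := by
  induction n with
  | zero => intro s t x y hs ht; simpa [EN] using hck s t x y hs ht
  | succ n ih =>
    intro s t x y hs ht
    have e1 : EN k q (n + 1) (s + t, x, y) = ∫⁻ r : ℝ × Ed d,
        ((∫⁻ w, EN k q n (r.1, x, r.2) * q r.2 * k (s - r.1, r.2, w) * k (t, w, y)) +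
          ∑ i ∈ Finset.range (n + 1), ∫⁻ w, EN k q i (s, x, w) *
            (EN k q (n - i) (r.1 - s, w, r.2) * q r.2 * k (s + t - r.1, r.2, y))) := by
      change cnv q (EN k q n) k (s + t, x, y) = _
      unfold cnv
      apply lintegral_congr_ae
      filter_upwards [ae_fst_ne s] with r hr
      rcases lt_or_gt_of_ne hr with h | h
      · have a1 : ∀ i, ∀ w, EN k q i (r.1 - s, w, r.2) = 0 := fun i w =>
          EN_zero h0 i _ _ _ (by linarith)
        simp only [a1, zero_mul, mul_zero, lintegral_zero, Finset.sum_const_zero, add_zero]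
        have : s + t - r.1 = (s - r.1) + t := by ring
        simp only [this, hck (s - r.1) t r.2 y (by linarith) ht]
        rw [← lintegral_const_mul _ (by fun_prop)]
        congr 1; funext w; ring
      · have a1 : ∀ w, k (s - r.1, r.2, w) = 0 := fun w => h0 _ _ _ (by linarith)
        simp only [a1, zero_mul, mul_zero, lintegral_zero, zero_add]
        have : r.1 = s + (r.1 - s) := by ring
        conv_lhs => rw [this]
        simp only [ih s (r.1 - s) x r.2 hs (by linarith)]
        rw [Finset.sum_mul, Finset.sum_mul]
        apply Finset.sum_congr rfl
        intro i _
        rw [mul_assoc, ← lintegral_mul_const _ (by fun_prop)]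
        congr 1; funext w
        have : s + (r.1 - s) = r.1 := by ring
        simp only [this]; ring
    rw [e1, lintegral_add_left (by
      refine Measurable.lintegral_prod_right' (f := fun w : (ℝ × Ed d) × (Ed d) =>
        EN k q n (w.1.1, x, w.1.2) * q w.1.2 * k (s - w.1.1, w.1.2, w.2) * k (t, w.2, y)) ?_
      fun_prop), lintegral_finsetSum _ (by
      intro i _
      refine Measurable.lintegral_prod_right' (f := fun w : (ℝ × Ed d) × (Ed d) =>
        EN k q i (s, x, w.2) * (EN k q (n - i) (w.1.1 - s, w.2, w.1.2) * q w.1.2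
          * k (s + t - w.1.1, w.1.2, y))) ?_
      fun_prop)]
    rw [Finset.sum_range_succ _ (n+1), add_comm]
    congr 1
    · apply Finset.sum_congr rfl
      intro i hi
      rw [lintegral_lintegral_swap (by
        refine Measurable.aemeasurable ?_
        simp only [Function.uncurry_def]
        fun_prop)]
      congr 1; funext w
      rw [lintegral_const_mul _ (by fun_prop)]
      congr 1
      have : n + 1 - i = (n - i) + 1 := by
        have := Finset.mem_range.1 hi; omega
      rw [this]
      change _ = cnv q (EN k q (n - i)) k (t, w, y)
      unfold cnv
      rw [← lintegral_shift _ s]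
      congr 1; funext r
      simp only [add_sub_cancel_right]
      congr 3; ring
    · rw [lintegral_lintegral_swap (by
        refine Measurable.aemeasurable ?_
        simp only [Function.uncurry_def]
        fun_prop)]
      congr 1; funext w
      rw [lintegral_mul_const _ (by fun_prop)]
      simp only [Nat.sub_self]; rfl

lemma ET_CK (hk : Measurable k) (hq : Measurable q) (h0 : ∀ t x y, t ≤ 0 → k (t, x, y) = 0)
    (hck : CKprop k) : CKprop (ET k q) := by
  intro s t x y hs ht
  have e1 : ET k q (s + t, x, y) = ∑' n, ∑ p ∈ Finset.HasAntidiagonal.antidiagonal n,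
      ∫⁻ z, EN k q p.1 (s, x, z) * EN k q p.2 (t, z, y) := by
    unfold ET
    congr 1; funext n
    rw [EN_CK hk hq h0 hck n s t x y hs ht, Finset.Nat.sum_antidiagonal_eq_sum_range_succ
      (fun i j => ∫⁻ z, EN k q i (s, x, z) * EN k q j (t, z, y))]
  have e2 : ∀ a : ℕ × ℕ → ℝ≥0∞, ∑' n, ∑ p ∈ Finset.HasAntidiagonal.antidiagonal n, a p = ∑' i, ∑' j, a (i, j) := by
    intro a
    rw [← ENNReal.tsum_prod, ← Finset.HasAntidiagonal.sigmaAntidiagonalEquivProd.tsum_eq a, ENNReal.tsum_sigma']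
    congr 1; funext n
    rw [tsum_fintype, Finset.univ_eq_attach, ← Finset.sum_attach]
    rfl
  rw [e1, e2 (fun p => ∫⁻ z, EN k q p.1 (s, x, z) * EN k q p.2 (t, z, y))]
  simp only [ET]
  simp_rw [← ENNReal.tsum_mul_right, ← ENNReal.tsum_mul_left]
  rw [lintegral_tsum (by fun_prop)]
  congr 1; funext i
  rw [lintegral_tsum (by fun_prop)]

def SN (k : ℝ × Ed d × Ed d → ℝ≥0∞) (q : Ed d → ℝ≥0∞) (N : ℕ) : ℝ × Ed d × Ed d → ℝ≥0∞ :=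
  fun p => ∑ n ∈ Finset.range N, EN k q n p

@[fun_prop]
lemma measurable_SN (hk : Measurable k) (hq : Measurable q) (n : ℕ) : Measurable (SN k q n) := by
  unfold SN; fun_prop

lemma act_add_left {f' : ℝ × Ed d × Ed d → ℝ≥0∞} (hf : Measurable f) (hq : Measurable q)
    (hu : Measurable u) (p) : act q (fun p => f p + f' p) u p = act q f u p + act q f' u p := by
  unfold act
  rw [← lintegral_add_left (by fun_prop)]
  congr 1; funext r; ring

lemma act_add_right (hf : Measurable f) (hq : Measurable q)
    (hu : Measurable u) (p) : act q f (fun p => u p + v p) p = act q f u p + act q f v p := by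
  unfold act
  rw [← lintegral_add_left (by fun_prop)]
  congr 1; funext r; ring

lemma act_add_pot (hf : Measurable f) (hq : Measurable q)
    (hu : Measurable u) (p) : act (fun z => q z + q' z) f u p = act q f u p + act q' f u p := by
  unfold act
  rw [← lintegral_add_left (by fun_prop)]
  congr 1; funext r; ring

lemma SN_succ (hk : Measurable k) (hq : Measurable q) (N : ℕ) :
    SN k q (N + 1) = fun p => k p + cnv q (SN k q N) k p := by
  funext p
  unfold SN
  rw [Finset.sum_range_succ', add_comm]
  congr 1
  unfold cnv
  simp_rw [Finset.sum_mul]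
  rw [lintegral_finsetSum _ (by fun_prop)]
  rfl

lemma SN_succ' (hk : Measurable k) (hq : Measurable q) (N : ℕ) :
    SN k q (N + 1) = fun p => k p + cnv q k (SN k q N) p := by
  funext p
  unfold SN
  rw [Finset.sum_range_succ', add_comm]
  congr 1
  simp_rw [EN_succ' hk hq]
  unfold cnv
  simp_rw [Finset.mul_sum]
  rw [lintegral_finsetSum _ (by fun_prop)]

lemma ET_le_of_SN {p} {c : ℝ≥0∞} (h : ∀ N, SN k q N p ≤ c) : ET k q p ≤ c :=
  ENNReal.tsum_le_of_sum_range_le h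

lemma SN_le_ET (N p) : SN k q N p ≤ ET k q p := ENNReal.sum_le_tsum _

/-- comparison principle -/
lemma ET_le_of_super (hk : Measurable k) (hq : Measurable q)
    (h : ∀ p, k p + cnv q g k p ≤ g p) (p) : ET k q p ≤ g p := by
  refine ET_le_of_SN fun N => ?_
  induction N generalizing p with
  | zero => simp [SN]
  | succ N ih =>
    rw [SN_succ hk hq]
    refine le_trans ?_ (h p)
    refine add_le_add le_rfl ?_
    exact cnv_mono ih (fun _ => le_rfl) (by simp) p

lemma sact_cnv {h : Ed d → ℝ≥0∞} (hf : Measurable f) (hg : Measurable g) (hq : Measurable q)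
    (hh : Measurable h) : sact (cnv q f g) h = act q f (sact g h) := by
  funext ⟨t, x⟩
  simp only [sact, cnv, act]
  have : ∀ z, (∫⁻ r : ℝ × Ed d, f (r.1, x, r.2) * q r.2 * g (t - r.1, r.2, z)) * h z =
    ∫⁻ r : ℝ × Ed d, f (r.1, x, r.2) * q r.2 * (g (t - r.1, r.2, z) * h z) := by
    intro z
    rw [← lintegral_mul_const _ (by fun_prop)]
    congr 1; funext w; ring
  simp_rw [this]
  rw [lintegral_lintegral_swap (by
        refine Measurable.aemeasurable ?_
        simp only [Function.uncurry_def]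
        fun_prop)]
  congr 1; funext w
  rw [lintegral_const_mul _ (by fun_prop)]

lemma sact_add {h : Ed d → ℝ≥0∞} (hf : Measurable f) (hh : Measurable h) (p) :
    sact (fun p => f p + g p) h p = sact f h p + sact g h p := by
  unfold sact
  rw [← lintegral_add_left (by fun_prop)]
  congr 1; funext z; ring

lemma act_mono {f' : ℝ × Ed d × Ed d → ℝ≥0∞} (hf : ∀ p, f p ≤ f' p)
    (hq : ∀ᵐ z, q z ≤ q' z) (hu : ∀ t, ∀ᵐ z, u (t, z) ≤ v (t, z)) (hum : Measurable u)
    (hvm : Measurable v) (p) :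
    act q f u p ≤ act q' f' v p := by
  unfold act
  apply lintegral_mono_ae
  have h2 : ∀ᵐ r : ℝ × Ed d, u (p.1 - r.1, r.2) ≤ v (p.1 - r.1, r.2) := by
    rw [Measure.volume_eq_prod]
    rw [Measure.ae_prod_iff_ae_ae]
    · exact Eventually.of_forall fun t => hu (p.1 - t)
    · exact measurableSet_le (by fun_prop) (by fun_prop)
  filter_upwards [ae_snd hq, h2] with r hr hr2
  gcongr
  exact hf _

lemma act_onePos_mul {φ : Ed d → ℝ≥0∞} (p) :
    act q f (fun r => onePos r * φ r.2) p = act (fun z => q z * φ z) f onePos p := by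
  unfold act
  congr 1; funext r; ring

lemma sact_zero {h : Ed d → ℝ≥0∞} (hf : ∀ t x y, t ≤ 0 → f (t, x, y) = 0) (t x) (ht : t ≤ 0) :
    sact f h (t, x) = 0 := by
  simp [sact, hf t _ _ ht]

lemma act_onePos_zero (hf : ∀ t x y, t ≤ 0 → f (t, x, y) = 0) (t x) (ht : t ≤ 0) :
    act q f onePos (t, x) = 0 := by
  unfold act
  rw [← lintegral_zero (μ := (volume : Measure (ℝ × Ed d)))]
  congr 1; funext r
  rcases le_or_gt r.1 0 with h | h
  · simp [hf _ _ _ h]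
  · have : ¬ (0 < t - r.1) := by linarith
    simp [onePos, this]

/-- M3: supersolutions -/
theorem ET_super {h w : Ed d → ℝ≥0∞} (hk : Measurable k) (hq : Measurable q)
    (h0 : ∀ t x y, t ≤ 0 → k (t, x, y) = 0) (hh : Measurable h) (hw : Measurable w)
    {S : Set (Ed d)} (hS : ∀ᵐ z, z ∈ S)
    (hyp : ∀ t, 0 < t → ∀ x ∈ S, sact k h (t, x) + act (fun z => q z * h z + w z) k onePos (t, x)
      ≤ h x) :
    ∀ t, 0 < t → ∀ x ∈ S, sact (ET k q) h (t, x) + act w (ET k q) onePos (t, x) ≤ h x := by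
  have key : ∀ N, ∀ t, 0 < t → ∀ x ∈ S, sact (SN k q N) h (t, x) + act w (SN k q N) onePos (t, x)
      ≤ h x := by
    intro N
    induction N with
    | zero => intro t ht x hx; simp [SN, sact, act]
    | succ N ih =>
      intro t ht x hx
      refine le_trans ?_ (hyp t ht x hx)
      rw [SN_succ' hk hq, sact_add hk hh, act_add_left hk hw (by fun_prop),
        sact_cnv hk (by fun_prop) hq hh, act_assoc hq hw hk (by fun_prop) (by fun_prop),
        act_add_pot hk (by fun_prop) (by fun_prop)]
      have : act q k (sact (SN k q N) h) (t, x) + act q k (act w (SN k q N) onePos) (t, x)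
          ≤ act (fun z => q z * h z) k onePos (t, x) := by
        rw [← act_add_right hk hq (by fun_prop), ← act_onePos_mul]
        refine act_mono (fun _ => le_rfl) (by simp) ?_ (by fun_prop) (by fun_prop) _
        intro s
        filter_upwards [hS] with z hz
        rcases le_or_gt s 0 with hs | hs
        · have z0 : ∀ t x y, t ≤ 0 → SN k q N (t, x, y) = 0 := by
            intro t x y ht
            unfold SN
            exact Finset.sum_eq_zero fun n _ => EN_zero h0 n _ _ _ ht
          rw [sact_zero z0 _ _ hs, act_onePos_zero z0 _ _ hs]
          simp
        · simpa [onePos, hs] using ih s hs z hz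
      calc _ = sact k h (t, x) + (act q k (sact (SN k q N) h) (t, x) +
            act q k (act w (SN k q N) onePos) (t, x)) + act w k onePos (t, x) := by ring
        _ ≤ sact k h (t, x) + (act (fun z => q z * h z) k onePos (t, x)) +
            act w k onePos (t, x) := by gcongr
        _ = _ := by ring
  intro t ht x hx
  have m1 : ∀ p, Monotone (fun N => SN k q N p) := by
    intro p; refine monotone_nat_of_le_succ fun N => ?_
    simp only [SN, Finset.sum_range_succ]; exact le_self_add
  have hT : ∀ p, Tendsto (fun N => SN k q N p) atTop (𝓝 (ET k q p)) := fun p =>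
    ENNReal.tendsto_nat_tsum _
  have t1 : Tendsto (fun N => sact (SN k q N) h (t, x)) atTop (𝓝 (sact (ET k q) h (t, x))) := by
    have : sact (ET k q) h (t, x) = ∑' n, sact (EN k q n) h (t, x) := by
      simp only [sact, ET]
      simp_rw [← ENNReal.tsum_mul_right]
      rw [lintegral_tsum (by fun_prop)]
    rw [this]
    convert ENNReal.tendsto_nat_tsum _ using 2 with N
    simp only [sact, SN, Finset.sum_mul]
    rw [lintegral_finsetSum _ (by fun_prop)]
  have t2 : Tendsto (fun N => act w (SN k q N) onePos (t, x)) atTop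
      (𝓝 (act w (ET k q) onePos (t, x))) := by
    have : act w (ET k q) onePos (t, x) = ∑' n, act w (EN k q n) onePos (t, x) := by
      unfold ET
      rw [act_tsum_left (by fun_prop) hw (by fun_prop)]
    rw [this]
    convert ENNReal.tendsto_nat_tsum _ using 2 with N
    simp only [act, SN, Finset.sum_mul]
    rw [lintegral_finsetSum _ (by fun_prop)]
  exact le_of_tendsto (t1.add t2) (Eventually.of_forall fun N => key N t ht x hx)

/-- M4: subsolutions -/
theorem ET_sub {φ w : Ed d → ℝ≥0∞} (hk : Measurable k) (hq : Measurable q) (hh : Measurable φ) (hw : Measurable w)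
    {S : Set (Ed d)} (hS : ∀ᵐ z, z ∈ S)
    (hyp : ∀ t, 0 < t → ∀ x ∈ S, φ x ≤
      sact k φ (t, x) + act (fun z => q z * φ z + w z) k onePos (t, x))
    (t : ℝ) (ht : 0 < t) (x : Ed d) (hx : x ∈ S)
    (hfin : act (fun z => q z * φ z) (ET k q) onePos (t, x) ≠ ∞) :
    φ x ≤ sact (ET k q) φ (t, x) + act w (ET k q) onePos (t, x) := by
  have key : ∀ N, φ x ≤ sact (SN k q (N+1)) φ (t, x) + act w (SN k q (N+1)) onePos (t, x)
      + act (fun z => q z * φ z) (EN k q N) onePos (t, x) := by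
    intro N
    induction N with
    | zero =>
      have := hyp t ht x hx
      rw [act_add_pot hk (by fun_prop) (by fun_prop)] at this
      have e : SN k q (0+1) = k := by funext p; simp [SN, EN]
      rw [e]
      refine this.trans (le_of_eq ?_)
      simp only [EN]; ring
    | succ N ih =>
      refine ih.trans ?_
      have e : SN k q (N+1+1) = fun p => SN k q (N+1) p + EN k q (N+1) p := by
        funext p; simp only [SN, Finset.sum_range_succ]
      rw [e, sact_add (by fun_prop) hh, act_add_left (by fun_prop) hw (by fun_prop)]
      have : act (fun z => q z * φ z) (EN k q N) onePos (t, x) ≤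
          sact (EN k q (N+1)) φ (t, x) + act (fun z => q z * φ z) (EN k q (N+1)) onePos (t, x) +
          act w (EN k q (N+1)) onePos (t, x) := by
        rw [← act_onePos_mul]
        simp only [EN]
        rw [sact_cnv (by fun_prop) hk hq hh, act_assoc hq (by fun_prop) (by fun_prop) hk (by fun_prop),
          act_assoc hq hw (by fun_prop) hk (by fun_prop),
          ← act_add_right (by fun_prop) hq (by fun_prop),
          ← act_add_right (by fun_prop) hq (by fun_prop)]
        refine act_mono (fun _ => le_rfl) (by simp) ?_ (by fun_prop) (by fun_prop) _
        intro s
        filter_upwards [hS] with z hz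
        rcases le_or_gt s 0 with hs | hs
        · simp [onePos, not_lt.2 hs]
        · have := hyp s hs z hz
          rw [act_add_pot hk (by fun_prop) (by fun_prop), ← add_assoc] at this
          simpa [onePos, hs] using this
      calc _ ≤ sact (SN k q (N + 1)) φ (t, x) + act w (SN k q (N + 1)) onePos (t, x) +
            (sact (EN k q (N+1)) φ (t, x) + act (fun z => q z * φ z) (EN k q (N+1)) onePos (t, x) +
          act w (EN k q (N+1)) onePos (t, x)) := by gcongr
        _ = _ := by ring
  have hsum : act (fun z => q z * φ z) (ET k q) onePos (t, x) =
      ∑' n, act (fun z => q z * φ z) (EN k q n) onePos (t, x) := by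
    unfold ET
    rw [act_tsum_left (by fun_prop) (by fun_prop) (by fun_prop)]
  rw [hsum] at hfin
  have hlim := ENNReal.tendsto_atTop_zero_of_tsum_ne_top hfin
  have key2 : ∀ N, φ x ≤ sact (ET k q) φ (t, x) + act w (ET k q) onePos (t, x)
      + act (fun z => q z * φ z) (EN k q N) onePos (t, x) := by
    intro N
    refine (key N).trans ?_
    gcongr
    · unfold sact
      refine lintegral_mono fun z => ?_
      gcongr; exact SN_le_ET _ _
    · exact act_mono (fun p => SN_le_ET _ _) (by simp) (by simp) (by fun_prop) (by fun_prop) _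
  refine ge_of_tendsto' (x := atTop) (f := fun N => sact (ET k q) φ (t, x) +
    act w (ET k q) onePos (t, x) + act (fun z => q z * φ z) (EN k q N) onePos (t, x)) ?_ key2
  simpa using tendsto_const_nhds.add hlim

end

noncomputable section
open scoped ENNReal NNReal Topology

section
variable {d : ℕ} {q q' : Ed d → ℝ≥0∞} {f g k : ℝ × Ed d × Ed d → ℝ≥0∞} {u v : ℝ × Ed d → ℝ≥0∞}

lemma exp_eq_lintegral (C t : ℝ) (hC : 0 ≤ C) (ht : 0 ≤ t) :
    ENNReal.ofReal (Real.exp (C * t)) = 1 +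
      ∫⁻ s in Ioo 0 t, ENNReal.ofReal (C * Real.exp (C * s)) := by
  have h1 : ∫ s in (0:ℝ)..t, C * Real.exp (C * s) = Real.exp (C * t) - 1 := by
    rw [intervalIntegral.integral_eq_sub_of_hasDerivAt (f := fun s => Real.exp (C * s))]
    · simp
    · intro x _
      have := ((hasDerivAt_id x).const_mul C).exp
      simpa [mul_comm] using this
    · exact Continuous.intervalIntegrable (by fun_prop) _ _
  rw [← ofReal_integral_eq_lintegral_ofReal, ← integral_Ioc_eq_integral_Ioo,
    ← intervalIntegral.integral_of_le ht, h1, ← ENNReal.ofReal_one, ← ENNReal.ofReal_add]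
  · congr 1; ring
  · norm_num
  · have : 1 ≤ Real.exp (C * t) := Real.one_le_exp (by positivity)
    linarith
  · exact (Continuous.integrableOn_Icc (by fun_prop)).mono_set Ioo_subset_Icc_self
  · exact Eventually.of_forall fun s => by positivity

lemma cnv_const_eq (hg : Measurable g) (hf : Measurable f) (h0 : ∀ t x y, t ≤ 0 → g (t, x, y) = 0)
    (hf0 : ∀ t x y, t ≤ 0 → f (t, x, y) = 0) (hq : Measurable q) (t : ℝ) (x y) :
    cnv q f g (t, x, y) = ∫⁻ s in Ioo 0 t, ∫⁻ z, f (s, x, z) * q z * g (t - s, z, y) := by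
  unfold cnv
  rw [Measure.volume_eq_prod, lintegral_prod _ (by fun_prop), ← lintegral_indicator measurableSet_Ioo]
  congr 1; funext s
  by_cases hs : s ∈ Ioo 0 t
  · rw [indicator_of_mem hs]
  · rw [indicator_of_notMem hs]
    rw [mem_Ioo, not_and_or, not_lt, not_lt] at hs
    rcases hs with hs | hs
    · simp [hf0 s _ _ hs]
    · simp [h0 (t - s) _ _ (by linarith)]

/-- M2 -/
theorem ET_add_const (hk : Measurable k) (hq : Measurable q)
    (h0 : ∀ t x y, t ≤ 0 → k (t, x, y) = 0)
    (hck : CKprop k) (C : ℝ) (hC : 0 ≤ C) (t x y) :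
    ET k (fun z => q z + ENNReal.ofReal C) (t, x, y) ≤
      ENNReal.ofReal (Real.exp (C * t)) * ET k q (t, x, y) := by
  set F := ET k q with hF
  set G : ℝ × Ed d × Ed d → ℝ≥0∞ := fun p => ENNReal.ofReal (Real.exp (C * p.1)) * F p with hG
  have hFm : Measurable F := by fun_prop
  have hGm : Measurable G := by fun_prop
  have F0 : ∀ t x y, t ≤ 0 → F (t, x, y) = 0 := fun t x y ht => ET_zero h0 t x y ht
  have G0 : ∀ t x y, t ≤ 0 → G (t, x, y) = 0 := fun t x y ht => by simp [hG, F0 t x y ht]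
  have I : G = fun p => F p + cnv (fun _ => ENNReal.ofReal C) G F p := by
    funext ⟨t, x, y⟩
    rcases le_or_gt t 0 with ht | ht
    · rw [G0 _ _ _ ht, F0 _ _ _ ht, cnv_zero G0 F0 _ _ _ ht]; simp
    · rw [cnv_const_eq hFm hGm F0 G0 (by fun_prop)]
      simp only [hG]
      rw [exp_eq_lintegral C t hC ht.le, add_mul, one_mul]
      congr 1
      rw [← lintegral_mul_const _ (by fun_prop)]
      refine setLIntegral_congr_fun measurableSet_Ioo fun s hs => ?_
      have hck2 := ET_CK hk hq h0 hck s (t - s) x y hs.1 (by linarith [hs.2])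
      simp only [add_sub_cancel, ← hF] at hck2
      simp only [hck2]
      rw [← lintegral_const_mul _ (by fun_prop)]
      congr 1; funext z
      rw [ENNReal.ofReal_mul hC]; ring
  have hle : ∀ p, ET k (fun z => q z + ENNReal.ofReal C) p ≤ G p := by
    apply ET_le_of_super hk (by fun_prop)
    intro p
    obtain ⟨t, x, y⟩ := p
    have hFd : F = fun p => k p + cnv q F k p := by
      funext p; exact ET_duhamel hk hq p
    have e1 : cnv (fun z => q z + ENNReal.ofReal C) G k (t, x, y) =
        cnv q G k (t, x, y) + cnv (fun _ => ENNReal.ofReal C) G k (t, x, y) := by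
      rw [cnv_eq_act, act_add_pot hGm hq (by fun_prop)]; rfl
    have e2 : cnv q G k (t, x, y) = cnv q F k (t, x, y) +
        cnv q (cnv (fun _ => ENNReal.ofReal C) G F) k (t, x, y) := by
      conv_lhs => rw [I]
      rw [cnv_eq_act, act_add_left hFm hq (by fun_prop)]; rfl
    have e3 : cnv (fun _ => ENNReal.ofReal C) G F (t, x, y) =
        cnv (fun _ => ENNReal.ofReal C) G k (t, x, y) +
        cnv q (cnv (fun _ => ENNReal.ofReal C) G F) k (t, x, y) := by
      rw [cnv_assoc (by fun_prop) hq hGm hFm hk]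
      conv_lhs => rw [hFd]
      rw [cnv_eq_act, act_add_right hGm (by fun_prop) (by fun_prop)]; rfl
    refine le_of_eq ?_
    calc _ = (k (t, x, y) + cnv q F k (t, x, y)) + (cnv (fun _ => ENNReal.ofReal C) G k (t, x, y) +
        cnv q (cnv (fun _ => ENNReal.ofReal C) G F) k (t, x, y)) := by rw [e1, e2]; ring
      _ = F (t, x, y) + cnv (fun _ => ENNReal.ofReal C) G F (t, x, y) := by
        rw [← e3]
        have := congrFun hFd (t, x, y)
        rw [← this]
      _ = G (t, x, y) := (congrFun I (t, x, y)).symm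
  exact hle (t, x, y)

/-- Killing -/
def kil (C : ℝ) (k : ℝ × Ed d × Ed d → ℝ≥0∞) : ℝ × Ed d × Ed d → ℝ≥0∞ :=
  fun p => ENNReal.ofReal (Real.exp (-C * p.1)) * k p

lemma EN_kil (C : ℝ) (n : ℕ) : EN (kil C k) q n = kil C (EN k q n) := by
  induction n with
  | zero => rfl
  | succ n ih =>
    simp only [EN, ih]
    funext ⟨t, x, y⟩
    simp only [cnv, kil]
    rw [← lintegral_const_mul' _ _ ENNReal.ofReal_ne_top]
    congr 1; funext r
    have : ENNReal.ofReal (Real.exp (-C * t)) = ENNReal.ofReal (Real.exp (-C * r.1)) *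
        ENNReal.ofReal (Real.exp (-C * (t - r.1))) := by
      rw [← ENNReal.ofReal_mul (by positivity), ← Real.exp_add]; congr 2; ring
    rw [this]; ring

lemma ET_kil (C : ℝ) : ET (kil C k) q = kil C (ET k q) := by
  funext p
  simp only [ET, EN_kil]
  simp only [kil, ENNReal.tsum_mul_left]; rfl

/-- Scaling -/
lemma lintegral_scale (F : ℝ × Ed d → ℝ≥0∞) (hF : Measurable F) {c l : ℝ} (hc : 0 < c) (hl : 0 < l) :
    ENNReal.ofReal (c * l ^ d) * ∫⁻ r : ℝ × Ed d, F (c * r.1, l • r.2) = ∫⁻ r, F r := by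
  have hl' : ∀ G : Ed d → ℝ≥0∞, Measurable G → ENNReal.ofReal (l ^ d) * ∫⁻ z, G (l • z) = ∫⁻ z, G z := by
    intro G hG
    have := Measure.map_addHaar_smul (volume : Measure (Ed d)) hl.ne'
    rw [← lintegral_map (f := G) hG (measurable_const_smul l), this, lintegral_smul_measure,
      smul_eq_mul, ← mul_assoc, ← ENNReal.ofReal_mul (by positivity)]
    simp [abs_of_pos, hl, hl.ne']
  have hc' : ∀ G : ℝ → ℝ≥0∞, Measurable G → ENNReal.ofReal c * ∫⁻ z, G (c * z) = ∫⁻ z, G z := by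
    intro G hG
    have := Real.map_volume_mul_left hc.ne'
    rw [← lintegral_map (f := G) hG (measurable_const_mul c), this, lintegral_smul_measure,
      smul_eq_mul, ← mul_assoc, ← ENNReal.ofReal_mul (by positivity)]
    simp [abs_of_pos, hc, hc.ne']
  rw [Measure.volume_eq_prod, lintegral_prod _ (by fun_prop), lintegral_prod _ (by fun_prop)]
  rw [← hc' _ (Measurable.lintegral_prod_right' hF), ENNReal.ofReal_mul hc.le, mul_assoc]
  congr 1
  rw [← lintegral_const_mul' _ _ ENNReal.ofReal_ne_top]
  congr 1; funext s
  exact hl' (fun z => F (c * s, z)) (by fun_prop)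

lemma EN_scale (hk : Measurable k) (hq : Measurable q) {c l : ℝ} (hc : 0 < c) (hl : 0 < l)
    (k' : ℝ × Ed d × Ed d → ℝ≥0∞)
    (hk' : ∀ t x y, k' (t, x, y) = ENNReal.ofReal (l ^ d) * k (c * t, l • x, l • y))
    (hq' : ∀ x, q' x = ENNReal.ofReal c * q (l • x)) (n : ℕ) :
    ∀ t x y, EN k' q' n (t, x, y) = ENNReal.ofReal (l ^ d) * EN k q n (c * t, l • x, l • y) := by
  induction n with
  | zero => exact hk'
  | succ n ih =>
    intro t x y
    simp only [EN, cnv]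
    rw [← lintegral_scale (fun r => EN k q n (r.1, l • x, r.2) * q r.2 * k (c * t - r.1, r.2, l • y))
      (by fun_prop) hc hl, ← mul_assoc, ← lintegral_const_mul' _ _ (by finiteness)]
    congr 1; funext r
    rw [ih, hk', hq', ENNReal.ofReal_mul hc.le, mul_sub]; ring

lemma ET_scale (hk : Measurable k) (hq : Measurable q) {c l : ℝ} (hc : 0 < c) (hl : 0 < l)
    (k' : ℝ × Ed d × Ed d → ℝ≥0∞)
    (hk' : ∀ t x y, k' (t, x, y) = ENNReal.ofReal (l ^ d) * k (c * t, l • x, l • y))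
    (hq' : ∀ x, q' x = ENNReal.ofReal c * q (l • x)) (t x y) :
    ET k' q' (t, x, y) = ENNReal.ofReal (l ^ d) * ET k q (c * t, l • x, l • y) := by
  simp only [ET, EN_scale hk hq hc hl k' hk' hq', ENNReal.tsum_mul_left]

lemma act_onePos_eq (hf : Measurable f) (hf0 : ∀ t x y, t ≤ 0 → f (t, x, y) = 0)
    (hq : Measurable q) (t : ℝ) (x) :
    act q f onePos (t, x) = ∫⁻ s in Ioo 0 t, ∫⁻ z, f (s, x, z) * q z := by
  unfold act
  rw [Measure.volume_eq_prod, lintegral_prod _ (by fun_prop), ← lintegral_indicator measurableSet_Ioo]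
  congr 1; funext s
  by_cases hs : s ∈ Ioo 0 t
  · rw [indicator_of_mem hs]; simp [onePos, hs.2]
  · rw [indicator_of_notMem hs]
    rw [mem_Ioo, not_and_or, not_lt, not_lt] at hs
    rcases hs with hs | hs
    · simp [hf0 s _ _ hs]
    · simp [onePos, not_lt.2 hs]

end

noncomputable section
open scoped ENNReal NNReal Topology

/-! ## The stable subordinator -/

lemma stab_integrable {a l : ℝ} (ha : 0 < a) (ha1 : a < 1) (hl : 0 ≤ l) :
    IntegrableOn (fun v : ℝ => (1 - Real.exp (-(l * v))) * (a * v ^ (-1 - a))) (Ioi 0) := by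
  have hmeas : Measurable (fun v : ℝ => (1 - Real.exp (-(l * v))) * (a * v ^ (-1 - a))) := by
    fun_prop
  rw [← Ioc_union_Ioi_eq_Ioi (zero_le_one' ℝ)]
  refine IntegrableOn.union ?_ ?_
  · have h1 : IntegrableOn (fun v : ℝ => l * a * v ^ (-a)) (Ioc 0 1) := by
      refine Integrable.const_mul ?_ _
      exact (intervalIntegrable_iff_integrableOn_Ioc_of_le zero_le_one).1
        (intervalIntegral.intervalIntegrable_rpow' (by linarith))
    refine Integrable.mono' h1 hmeas.aestronglyMeasurable ?_
    filter_upwards [ae_restrict_mem measurableSet_Ioc] with v hv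
    have e1 : 1 - Real.exp (-(l * v)) ≤ l * v := by
      have := Real.add_one_le_exp (-(l * v)); linarith
    have e0 : 0 ≤ 1 - Real.exp (-(l * v)) := by
      have : Real.exp (-(l * v)) ≤ 1 := Real.exp_le_one_iff.2 (by
        have := mul_nonneg hl hv.1.le; linarith)
      linarith
    have hv0 := hv.1
    rw [Real.norm_eq_abs, abs_of_nonneg (by positivity)]
    have e2 : v * v ^ (-1 - a) = v ^ (-a) := by
      have := Real.rpow_add hv0 1 (-1 - a)
      rw [Real.rpow_one] at this
      rw [← this]; congr 1; ring
    calc _ ≤ (l * v) * (a * v ^ (-1 - a)) := by gcongr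
      _ = l * a * (v * v ^ (-1 - a)) := by ring
      _ = _ := by rw [e2]
  · have h1 : IntegrableOn (fun v : ℝ => a * v ^ (-1 - a)) (Ioi 1) :=
      Integrable.const_mul (integrableOn_Ioi_rpow_of_lt (by linarith) one_pos) _
    refine Integrable.mono' h1 hmeas.aestronglyMeasurable ?_
    filter_upwards [ae_restrict_mem measurableSet_Ioi] with v hv
    have hv0 : 0 < v := lt_trans one_pos hv
    have e0 : 0 ≤ 1 - Real.exp (-(l * v)) := by
      have : Real.exp (-(l * v)) ≤ 1 := Real.exp_le_one_iff.2 (by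
        have := mul_nonneg hl hv0.le; linarith)
      linarith
    rw [Real.norm_eq_abs, abs_of_nonneg (by positivity)]
    have : 1 - Real.exp (-(l * v)) ≤ 1 := by linarith [Real.exp_pos (-(l * v))]
    calc _ ≤ 1 * (a * v ^ (-1 - a)) := by gcongr
      _ = _ := one_mul _

def stabPhi (a l : ℝ) : ℝ := ∫ v in Ioi (0:ℝ), (1 - Real.exp (-(l * v))) * (a * v ^ (-1 - a))

lemma stabPhi_scale {a l : ℝ} (hl : 0 < l) :
    stabPhi a l = l ^ a * stabPhi a 1 := by
  unfold stabPhi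
  have := integral_comp_mul_left_Ioi (fun v => (1 - Real.exp (-(1 * v))) * (a * v ^ (-1 - a))) 0 hl
  simp only [mul_zero, smul_eq_mul, one_mul] at this ⊢
  have h2 : ∫ v in Ioi (0:ℝ), (1 - Real.exp (-v)) * (a * v ^ (-1 - a)) =
      l * ∫ x in Ioi (0:ℝ), (1 - Real.exp (-(l * x))) * (a * (l * x) ^ (-1 - a)) := by
    rw [this, ← mul_assoc, mul_inv_cancel₀ hl.ne', one_mul]
  rw [h2, ← mul_assoc, ← integral_const_mul]
  refine setIntegral_congr_fun measurableSet_Ioi fun v hv => ?_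
  have hv0 : 0 < v := hv
  have : l ^ a * l * l ^ (-1 - a) = 1 := by
    nth_rewrite 2 [← Real.rpow_one l]
    rw [← Real.rpow_add hl, ← Real.rpow_add hl]; ring_nf; simp
  rw [Real.mul_rpow hl.le hv0.le]
  linear_combination (-(1 - Real.exp (-(l * v))) * (a * v ^ (-1 - a))) * this

lemma stabPhi_one_pos {a : ℝ} (ha : 0 < a) (ha1 : a < 1) : 0 < stabPhi a 1 := by
  unfold stabPhi
  have hpos : ∀ v ∈ Ioi (0:ℝ), 0 < (1 - Real.exp (-(1 * v))) * (a * v ^ (-1 - a)) := by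
    intro v hv
    have hv0 : 0 < v := hv
    have : Real.exp (-(1 * v)) < 1 := by
      rw [Real.exp_lt_one_iff]; linarith
    have h2 : 0 < 1 - Real.exp (-(1 * v)) := by linarith
    positivity
  rw [setIntegral_pos_iff_support_of_nonneg_ae]
  · have : Ioi (0:ℝ) ⊆ (Function.support fun v => (1 - Real.exp (-(1 * v))) * (a * v ^ (-1 - a)))
        ∩ Ioi 0 := fun v hv => ⟨(hpos v hv).ne', hv⟩
    refine lt_of_lt_of_le ?_ (measure_mono this)
    simp
  · filter_upwards [ae_restrict_mem measurableSet_Ioi] with v hv using (hpos v hv).le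
  · exact stab_integrable ha ha1 zero_le_one

def paretoM (a r : ℝ) : Measure ℝ :=
  (volume.restrict (Ioi r)).withDensity (fun v => ENNReal.ofReal (r ^ a * (a * v ^ (-1 - a))))

lemma pareto_integral {a r : ℝ} (ha : 0 < a) (hr : 0 < r) :
    ∫ v in Ioi r, r ^ a * (a * v ^ (-1 - a)) = 1 := by
  rw [integral_const_mul, integral_const_mul, integral_Ioi_rpow_of_lt (by linarith) hr]
  have : (-1 - a + 1) = -a := by ring
  rw [this, Real.rpow_neg hr.le]
  have := (Real.rpow_pos_of_pos hr a).ne'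
  field_simp

lemma pareto_integrable {a r : ℝ} (ha : 0 < a) (hr : 0 < r) :
    IntegrableOn (fun v => r ^ a * (a * v ^ (-1 - a))) (Ioi r) :=
  Integrable.const_mul (Integrable.const_mul (integrableOn_Ioi_rpow_of_lt (by linarith) hr) _) _

lemma pareto_prob {a r : ℝ} (ha : 0 < a) (hr : 0 < r) : IsProbabilityMeasure (paretoM a r) := by
  constructor
  unfold paretoM
  rw [withDensity_apply _ MeasurableSet.univ, Measure.restrict_univ,
    ← ofReal_integral_eq_lintegral_ofReal (pareto_integrable ha hr), pareto_integral ha hr]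
  · simp
  · filter_upwards [ae_restrict_mem measurableSet_Ioi] with v hv
    have : 0 < v := lt_trans hr hv
    positivity

lemma pareto_laplace {a r l : ℝ} (ha : 0 < a) (ha1 : a < 1) (hr : 0 < r) (hl : 0 ≤ l) :
    ∫ v, Real.exp (-(l * |v|)) ∂(paretoM a r) =
      1 - r ^ a * ∫ v in Ioi r, (1 - Real.exp (-(l * v))) * (a * v ^ (-1 - a)) := by
  unfold paretoM
  rw [integral_withDensity_eq_integral_toReal_smul (by fun_prop) (by simp)]
  have h1 : ∫ v in Ioi r, (ENNReal.ofReal (r ^ a * (a * v ^ (-1 - a)))).toReal •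
      Real.exp (-(l * |v|)) = ∫ v in Ioi r, (r ^ a * (a * v ^ (-1 - a)) -
        r ^ a * ((1 - Real.exp (-(l * v))) * (a * v ^ (-1 - a)))) := by
    refine setIntegral_congr_fun measurableSet_Ioi fun v hv => ?_
    have : 0 < v := lt_trans hr hv
    rw [ENNReal.toReal_ofReal (by positivity), abs_of_pos this, smul_eq_mul]
    ring
  rw [h1, integral_sub (pareto_integrable ha hr), pareto_integral ha hr, integral_const_mul]
  exact Integrable.const_mul ((stab_integrable ha ha1 hl).mono_set (Ioi_subset_Ioi hr.le)) _

def expI (v : ℝ) : unitInterval := ⟨Real.exp (-|v|), (Real.exp_pos _).le, by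
  rw [Real.exp_le_one_iff]; simp⟩

lemma expI_cont : Continuous expI := by
  unfold expI; fun_prop

def stabSeq (a : ℝ) (n : ℕ) : ℝ := ((n:ℝ) + 1) ^ (-(1/a))

lemma stabSeq_pos (a : ℝ) (n : ℕ) : 0 < stabSeq a n := by unfold stabSeq; positivity

lemma stabSeq_pow {a : ℝ} (ha : 0 < a) (n : ℕ) : (stabSeq a n) ^ a = ((n:ℝ) + 1)⁻¹ := by
  unfold stabSeq
  rw [← Real.rpow_mul (by positivity)]
  have : -(1 / a) * a = -1 := by field_simp
  rw [this, Real.rpow_neg_one]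

lemma stabSeq_tendsto {a : ℝ} (ha : 0 < a) : Tendsto (stabSeq a) atTop (𝓝 0) := by
  unfold stabSeq
  have h := tendsto_rpow_neg_atTop (y := 1 / a) (by positivity)
  exact h.comp (tendsto_natCast_atTop_atTop.atTop_add tendsto_const_nhds)

lemma exists_I {a : ℝ} (ha : 0 < a) (ha1 : a < 1) : ∃ μ : ProbabilityMeasure unitInterval,
    ∀ l : ℝ, 0 < l → ∫ x, (x : ℝ) ^ l ∂(μ : Measure unitInterval) =
      Real.exp (-(l ^ a * stabPhi a 1)) := by
  have hpm : ∀ n, IsProbabilityMeasure (paretoM a (stabSeq a n)) := fun n =>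
    pareto_prob ha (stabSeq_pos a n)
  let P : ℕ → Measure unitInterval := fun n =>
    (Measure.pi (fun _ : Fin (n+1) => paretoM a (stabSeq a n))).map (fun w => expI (∑ i, |w i|))
  have hmeas : ∀ n, Measurable (fun w : Fin (n+1) → ℝ => expI (∑ i, |w i|)) := by
    intro n
    exact expI_cont.measurable.comp (by fun_prop)
  have hP : ∀ n, IsProbabilityMeasure (P n) := fun n =>
    Measure.isProbabilityMeasure_map (hmeas n).aemeasurable
  let Q : ℕ → ProbabilityMeasure unitInterval := fun n => ⟨P n, hP n⟩
  have hintg : ∀ l : ℝ, 0 < l → ∀ n, ∫ x, (x : ℝ) ^ l ∂(P n) =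
      (1 + (-((stabSeq a n) ^ a * ∫ v in Ioi (stabSeq a n),
        (1 - Real.exp (-(l * v))) * (a * v ^ (-1 - a))))) ^ (n+1) := by
    intro l hl n
    simp only [P]
    rw [integral_map (hmeas n).aemeasurable (by
      have : Continuous (fun x : unitInterval => (x:ℝ) ^ l) :=
        continuous_subtype_val.rpow_const (fun _ => Or.inr hl.le)
      exact this.aestronglyMeasurable)]
    have : ∀ w : Fin (n+1) → ℝ, ((expI (∑ i, |w i|) : unitInterval) : ℝ) ^ l =
        ∏ i, Real.exp (-(l * |w i|)) := by
      intro w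
      simp only [expI]
      rw [← Real.exp_mul, ← Real.exp_sum, abs_of_nonneg (by positivity)]
      congr 1
      simp only [Finset.sum_neg_distrib, ← Finset.mul_sum]; ring
    simp_rw [this]
    rw [integral_fintype_prod_eq_prod (fun _ v => Real.exp (-(l * |v|)))]
    simp only [pareto_laplace ha ha1 (stabSeq_pos a n) hl.le, Finset.prod_const, Finset.card_univ,
      Fintype.card_fin, sub_eq_add_neg]
  have hlim : ∀ l : ℝ, 0 < l → Tendsto (fun n => ∫ x, (x : ℝ) ^ l ∂(P n)) atTop
      (𝓝 (Real.exp (-(l ^ a * stabPhi a 1)))) := by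
    intro l hl
    simp_rw [hintg l hl]
    have h1 : Tendsto (fun n => ∫ v in Ioi (stabSeq a n),
        (1 - Real.exp (-(l * v))) * (a * v ^ (-1 - a))) atTop (𝓝 (stabPhi a l)) := by
      have e : ∀ n, ∫ v in Ioi (stabSeq a n), (1 - Real.exp (-(l * v))) * (a * v ^ (-1 - a)) =
          ∫ v in Ioi 0, (Ioi (stabSeq a n)).indicator
            (fun v => (1 - Real.exp (-(l * v))) * (a * v ^ (-1 - a))) v := by
        intro n
        rw [setIntegral_indicator measurableSet_Ioi,
          inter_eq_right.2 (Ioi_subset_Ioi (stabSeq_pos a n).le)]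
      simp_rw [e]
      refine tendsto_integral_of_dominated_convergence (fun v =>
        ‖(1 - Real.exp (-(l * v))) * (a * v ^ (-1 - a))‖) ?_
        (stab_integrable ha ha1 hl.le).norm ?_ ?_
      · intro n
        refine Measurable.aestronglyMeasurable ?_
        exact Measurable.indicator (by fun_prop) measurableSet_Ioi
      · intro n
        exact Eventually.of_forall fun v => norm_indicator_le_norm_self _ _
      · filter_upwards [ae_restrict_mem measurableSet_Ioi] with v hv
        refine tendsto_const_nhds.congr' ?_
        filter_upwards [(stabSeq_tendsto ha).eventually (gt_mem_nhds hv)] with n hn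
        rw [indicator_of_mem]; exact hn
    have h2 := h1.neg
    rw [stabPhi_scale hl] at h2
    rw [← tendsto_add_atTop_iff_nat 0]
    have h3 : Tendsto (fun n : ℕ => (n:ℝ) * (fun m : ℕ => (-((stabSeq a (m-1)) ^ a *
        ∫ v in Ioi (stabSeq a (m-1)), (1 - Real.exp (-(l * v))) * (a * v ^ (-1 - a))))) n) atTop
        (𝓝 (-(l ^ a * stabPhi a 1))) := by
      rw [← tendsto_add_atTop_iff_nat 1]
      refine h2.congr fun n => ?_
      simp only [Nat.add_sub_cancel, stabSeq_pow ha]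
      push_cast
      rw [neg_mul_eq_mul_neg, ← mul_assoc, mul_inv_cancel₀ (by positivity), one_mul]
    have h4 := Real.tendsto_one_add_pow_exp_of_tendsto h3
    rw [← tendsto_add_atTop_iff_nat 1] at h4
    exact h4
  let U : Ultrafilter (ProbabilityMeasure unitInterval) := (hyperfilter ℕ).map Q
  refine ⟨U.lim, fun l hl => ?_⟩
  have hU : Tendsto Q (hyperfilter ℕ) (𝓝 U.lim) := U.le_nhds_lim
  have hcont : Continuous (fun x : unitInterval => (x:ℝ) ^ l) :=
        continuous_subtype_val.rpow_const (fun _ => Or.inr hl.le)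
  have h5 := (ProbabilityMeasure.tendsto_iff_forall_integral_tendsto.1 hU)
    (BoundedContinuousFunction.mkOfCompact ⟨_, hcont⟩)
  refine tendsto_nhds_unique h5 ?_
  exact (hlim l hl).mono_left (by
    rw [← Nat.cofinite_eq_atTop]; exact hyperfilter_le_cofinite)

theorem exists_subordinator {a : ℝ} (ha : 0 < a) (ha1 : a < 1) : ∃ η : Measure ℝ,
    IsProbabilityMeasure η ∧ η (Iic 0) = 0 ∧
    ∀ l : ℝ, 0 ≤ l → ∫ u, Real.exp (-(l * u)) ∂η = Real.exp (-(l ^ a)) := by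
  obtain ⟨μ, hμ⟩ := exists_I ha ha1
  set c0 := stabPhi a 1 with hc0
  have hc0p : 0 < c0 := stabPhi_one_pos ha ha1
  have hI : ∀ x : unitInterval, 0 ≤ (x:ℝ) ∧ (x:ℝ) ≤ 1 := fun x => ⟨x.2.1, x.2.2⟩
  have hbd : ∀ l : ℝ, 0 ≤ l → ∀ x : unitInterval, ‖(x:ℝ) ^ l‖ ≤ 1 := by
    intro l hl x
    rw [Real.norm_eq_abs, abs_of_nonneg (Real.rpow_nonneg (hI x).1 _)]
    exact Real.rpow_le_one (hI x).1 (hI x).2 hl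
  have hm : ∀ l : ℝ, AEStronglyMeasurable (fun x : unitInterval => (x:ℝ) ^ l)
      (μ : Measure unitInterval) := fun l => by
    refine Measurable.aestronglyMeasurable ?_
    fun_prop
  -- no mass at 0
  have m0 : (μ : Measure unitInterval) {x | (x:ℝ) = 0} = 0 := by
    have h1 : Tendsto (fun n : ℕ => ∫ x : unitInterval, (x:ℝ) ^ (1 / ((n:ℝ) + 1))
        ∂(μ : Measure unitInterval)) atTop (𝓝 (∫ x : unitInterval,
          ({x : unitInterval | (x:ℝ) = 0}ᶜ).indicator (fun _ => (1:ℝ)) x ∂(μ : Measure unitInterval))) := by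
      refine tendsto_integral_of_dominated_convergence (fun _ => 1) (fun n => hm _)
        (integrable_const _) (fun n => Eventually.of_forall (hbd _ (by positivity))) ?_
      refine Eventually.of_forall fun x => ?_
      by_cases hx : (x:ℝ) = 0
      · rw [indicator_of_notMem (by simpa using hx)]
        refine tendsto_const_nhds.congr fun n => ?_
        rw [hx, Real.zero_rpow (by positivity)]
      · rw [indicator_of_mem (by simpa using hx)]
        have : Tendsto (fun n : ℕ => 1 / ((n:ℝ) + 1)) atTop (𝓝 0) :=
          tendsto_one_div_add_atTop_nhds_zero_nat
        simpa using (tendsto_const_nhds (x := (x:ℝ))).rpow this (Or.inl hx)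
    have h2 : Tendsto (fun n : ℕ => ∫ x : unitInterval, (x:ℝ) ^ (1 / ((n:ℝ) + 1))
        ∂(μ : Measure unitInterval)) atTop (𝓝 1) := by
      have e : ∀ n : ℕ, ∫ x : unitInterval, (x:ℝ) ^ (1 / ((n:ℝ) + 1)) ∂(μ : Measure unitInterval)
          = Real.exp (-((1 / ((n:ℝ) + 1)) ^ a * c0)) := fun n => hμ _ (by positivity)
      simp_rw [e]
      have h3 : Tendsto (fun n : ℕ => (1 / ((n:ℝ) + 1)) ^ a) atTop (𝓝 (0 ^ a)) :=
        tendsto_one_div_add_atTop_nhds_zero_nat.rpow_const (Or.inr ha.le)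
      rw [Real.zero_rpow ha.ne'] at h3
      simpa using ((h3.mul_const c0).neg).rexp
    have h3 := tendsto_nhds_unique h1 h2
    have hms : MeasurableSet {x : unitInterval | (x:ℝ) = 0} :=
      measurableSet_eq_fun (by fun_prop) (by fun_prop)
    rw [integral_indicator_const _ hms.compl] at h3
    simp only [smul_eq_mul, mul_one] at h3
    have h4 := probReal_compl_eq_one_sub (μ := (μ : Measure unitInterval)) hms
    rw [h3] at h4
    have h5 : (μ : Measure unitInterval).real {x : unitInterval | (x:ℝ) = 0} = 0 := by linarith
    rwa [measureReal_eq_zero_iff] at h5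
  have m1 : (μ : Measure unitInterval) {x | (x:ℝ) = 1} = 0 := by
    have hle : ∀ n : ℕ, (μ : Measure unitInterval).real {x | (x:ℝ) = 1} ≤
        Real.exp (-(((n:ℝ) + 1) ^ a * c0)) := by
      intro n
      rw [← hμ _ (by positivity)]
      have hms : MeasurableSet {x : unitInterval | (x:ℝ) = 1} :=
        measurableSet_eq_fun (by fun_prop) (by fun_prop)
      have := integral_indicator_const (μ := (μ : Measure unitInterval)) (1:ℝ) hms
      simp only [smul_eq_mul, mul_one] at this
      rw [← this]
      refine integral_mono ((integrable_const _).indicator hms) ?_ ?_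
      · exact Integrable.of_bound (hm _) 1 (Eventually.of_forall (hbd _ (by positivity)))
      · intro x
        by_cases hx : (x:ℝ) = 1
        · rw [indicator_of_mem (by simpa using hx)]; simp [hx]
        · rw [indicator_of_notMem (by simpa using hx)]; exact Real.rpow_nonneg (hI x).1 _
    have hl : Tendsto (fun n : ℕ => Real.exp (-(((n:ℝ) + 1) ^ a * c0))) atTop (𝓝 0) := by
      refine Real.tendsto_exp_neg_atTop_nhds_zero.comp ?_
      refine Tendsto.atTop_mul_const hc0p ?_
      exact (tendsto_rpow_atTop ha).comp (tendsto_natCast_atTop_atTop.atTop_add tendsto_const_nhds)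
    have := ge_of_tendsto' hl hle
    have h5 : (μ : Measure unitInterval).real {x : unitInterval | (x:ℝ) = 1} = 0 :=
      le_antisymm this (by positivity)
    rwa [measureReal_eq_zero_iff] at h5
  set s := c0 ^ (-(1/a)) with hs
  have hsp : 0 < s := by positivity
  have hmm : Measurable (fun x : unitInterval => s * (-Real.log x)) := by fun_prop
  refine ⟨(μ : Measure unitInterval).map (fun x : unitInterval => s * (-Real.log (x:ℝ))),
    Measure.isProbabilityMeasure_map hmm.aemeasurable, ?_, ?_⟩
  · rw [Measure.map_apply hmm measurableSet_Iic]
    refine measure_mono_null (t := {x : unitInterval | (x:ℝ) = 0} ∪ {x | (x:ℝ) = 1}) ?_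
      (measure_union_null m0 m1)
    intro x hx
    simp only [mem_preimage, mem_Iic] at hx
    by_contra hcon
    simp only [mem_union, mem_ofPred_eq, not_or] at hcon
    have : Real.log x < 0 := Real.log_neg (lt_of_le_of_ne (hI x).1 (Ne.symm hcon.1))
      (lt_of_le_of_ne (hI x).2 hcon.2)
    nlinarith
  · intro l hl
    rw [integral_map hmm.aemeasurable (by
      refine Measurable.aestronglyMeasurable ?_
      fun_prop)]
    rcases hl.eq_or_lt with rfl | hl
    · simp [Real.zero_rpow ha.ne']
    · have h1 := hμ (l * s) (by positivity)
      have h2 : (l * s) ^ a * c0 = l ^ a := by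
        rw [Real.mul_rpow hl.le hsp.le, hs, ← Real.rpow_mul hc0p.le]
        have : -(1 / a) * a = -1 := by field_simp
        rw [this, Real.rpow_neg_one]; field_simp
      rw [h2] at h1
      rw [← h1]
      refine integral_congr_ae ?_
      have : ∀ᵐ x : unitInterval ∂(μ : Measure unitInterval), (x:ℝ) ≠ 0 := by
        rw [ae_iff]; simpa using m0
      filter_upwards [this] with x hx
      rw [Real.rpow_def_of_pos (lt_of_le_of_ne (hI x).1 (Ne.symm hx))]
      congr 1; ring

noncomputable section
open scoped ENNReal NNReal Topology

/-- uniqueness of moments on the unit interval -/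
lemma measure_I_ext (P P' : Measure unitInterval) [IsFiniteMeasure P] [IsFiniteMeasure P']
    (h : ∀ n : ℕ, ∫ x, (x:ℝ) ^ n ∂P = ∫ x, (x:ℝ) ^ n ∂P') : P = P' := by
  refine ext_of_forall_integral_eq_of_IsFiniteMeasure fun f => ?_
  have hpoly : ∀ p : Polynomial ℝ, ∫ x : unitInterval, p.eval (x:ℝ) ∂P =
      ∫ x : unitInterval, p.eval (x:ℝ) ∂P' := by
    intro p
    have hi : ∀ (ρ : Measure unitInterval) [IsFiniteMeasure ρ] (i : ℕ),
        Integrable (fun x : unitInterval => p.coeff i * (x:ℝ) ^ i) ρ := by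
      intro ρ _ i
      refine Integrable.const_mul ?_ _
      refine Integrable.of_bound (Continuous.aestronglyMeasurable (by fun_prop)) 1 ?_
      refine Eventually.of_forall fun x => ?_
      rw [Real.norm_eq_abs, abs_of_nonneg (pow_nonneg x.2.1 _)]
      exact pow_le_one₀ x.2.1 x.2.2
    simp only [Polynomial.eval_eq_sum_range]
    rw [integral_finsetSum _ (fun i _ => hi P i), integral_finsetSum _ (fun i _ => hi P' i)]
    simp only [integral_const_mul, h]
  have hf : ∀ (ρ : Measure unitInterval) [IsFiniteMeasure ρ], Integrable (fun x => f x) ρ :=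
    fun ρ _ => f.integrable ρ
  have hpi : ∀ (ρ : Measure unitInterval) [IsFiniteMeasure ρ] (p : Polynomial ℝ),
      Integrable (fun x : unitInterval => p.eval (x:ℝ)) ρ := by
    intro ρ _ p
    exact (BoundedContinuousFunction.mkOfCompact
      ⟨fun x : unitInterval => p.eval (x:ℝ), by fun_prop⟩).integrable ρ
  have key : ∀ ε > 0, |∫ x, f x ∂P - ∫ x, f x ∂P'| ≤ ε * (P.real univ + P'.real univ) := by
    intro ε hε
    obtain ⟨p, hp⟩ := exists_polynomial_near_continuousMap (0:ℝ) 1 f.toContinuousMap ε hε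
    have hpx : ∀ x : unitInterval, |f x - p.eval (x:ℝ)| ≤ ε := by
      intro x
      have := (ContinuousMap.norm_coe_le_norm (p.toContinuousMapOn (Icc 0 1) - f.toContinuousMap) x)
      rw [abs_sub_comm]
      exact this.trans hp.le
    have hd : ∀ (ρ : Measure unitInterval) [IsFiniteMeasure ρ],
        |∫ x, f x ∂ρ - ∫ x : unitInterval, p.eval (x:ℝ) ∂ρ| ≤ ε * ρ.real univ := by
      intro ρ _
      rw [← integral_sub (hf ρ) (hpi ρ p)]
      exact norm_integral_le_of_norm_le_const (f := fun x : unitInterval => f x - p.eval (x:ℝ))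
        (Eventually.of_forall hpx)
    have h1 := hd P
    have h2 := hd P'
    rw [hpoly p] at h1
    rw [abs_le] at *
    constructor <;> linarith
  by_contra hne
  have hpos : 0 < |∫ x, f x ∂P - ∫ x, f x ∂P'| := abs_pos.2 (sub_ne_zero.2 hne)
  set D := P.real univ + P'.real univ
  have hD : 0 ≤ D := by positivity
  have := key (|∫ x, f x ∂P - ∫ x, f x ∂P'| / (2 * (D + 1))) (by positivity)
  rw [div_mul_eq_mul_div, le_div_iff₀ (by positivity)] at this
  nlinarith

/-- Uniqueness of Laplace transforms. -/
lemma laplace_ext (P P' : Measure ℝ) [IsFiniteMeasure P] [IsFiniteMeasure P']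
    (h0 : P (Iio 0) = 0) (h0' : P' (Iio 0) = 0)
    (h : ∀ n : ℕ, ∫ u, Real.exp (-(n * u)) ∂P = ∫ u, Real.exp (-(n * u)) ∂P') : P = P' := by
  have hm : Measurable expI := expI_cont.measurable
  have h1 : P.map expI = P'.map expI := by
    apply measure_I_ext
    intro n
    have : ∀ (ρ : Measure ℝ), ρ (Iio 0) = 0 → ∫ x, (x:ℝ) ^ n ∂(ρ.map expI) =
        ∫ u, Real.exp (-(n * u)) ∂ρ := by
      intro ρ hR
      rw [integral_map hm.aemeasurable (Continuous.aestronglyMeasurable (by fun_prop))]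
      refine integral_congr_ae ?_
      have : ∀ᵐ u ∂ρ, 0 ≤ u := by rw [ae_iff]; simpa [Iio] using hR
      filter_upwards [this] with u hu
      simp only [expI, abs_of_nonneg hu, ← Real.exp_nat_mul]
      congr 1; ring
    rw [this P h0, this P' h0', h n]
  have hl : Measurable (fun x : unitInterval => -Real.log (x:ℝ)) := by fun_prop
  have h2 : ∀ (ρ : Measure ℝ), ρ (Iio 0) = 0 →
      (ρ.map expI).map (fun x : unitInterval => -Real.log (x:ℝ)) = ρ := by
    intro ρ hR
    rw [Measure.map_map hl hm]
    have : (fun x : unitInterval => -Real.log (x:ℝ)) ∘ expI =ᵐ[ρ] id := by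
      have : ∀ᵐ u ∂ρ, 0 ≤ u := by rw [ae_iff]; simpa [Iio] using hR
      filter_upwards [this] with u hu
      simp [expI, abs_of_nonneg hu]
    rw [Measure.map_congr this, Measure.map_id]
  rw [← h2 P h0, ← h2 P' h0', h1]

structure IsSub (a : ℝ) (η : Measure ℝ) : Prop where
  prob : IsProbabilityMeasure η
  null : η (Iic 0) = 0
  lap : ∀ l : ℝ, 0 ≤ l → ∫ u, Real.exp (-(l * u)) ∂η = Real.exp (-(l ^ a))

section
variable {a : ℝ} {η : Measure ℝ}

lemma IsSub.ae_pos (h : IsSub a η) : ∀ᵐ u ∂η, 0 < u := by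
  rw [ae_iff]; simpa [Iic] using h.null

lemma IsSub.integrable (h : IsSub a η) {l : ℝ} (hl : 0 ≤ l) :
    Integrable (fun u => Real.exp (-(l * u))) η := by
  have := h.prob
  refine Integrable.of_bound (Continuous.aestronglyMeasurable (by fun_prop)) 1 ?_
  filter_upwards [h.ae_pos] with u hu
  rw [Real.norm_eq_abs, abs_of_pos (Real.exp_pos _), Real.exp_le_one_iff]
  have := mul_nonneg hl hu.le
  linarith

lemma IsSub.llap (h : IsSub a η) {l : ℝ} (hl : 0 ≤ l) :
    ∫⁻ u, ENNReal.ofReal (Real.exp (-(l * u))) ∂η = ENNReal.ofReal (Real.exp (-(l ^ a))) := by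
  rw [← h.lap l hl, ofReal_integral_eq_lintegral_ofReal (h.integrable hl)]
  exact Eventually.of_forall fun u => (Real.exp_pos _).le

lemma IsSub.deriv (h : IsSub a η) {l : ℝ} (hl : 0 < l) :
    Integrable (fun u => u * Real.exp (-(l * u))) η ∧
    ∫ u, u * Real.exp (-(l * u)) ∂η = a * l ^ (a - 1) * Real.exp (-(l ^ a)) := by
  have := h.prob
  have hsub : Iio (0:ℝ) ⊆ ProbabilityTheory.integrableExpSet id η := by
    intro t ht
    have := h.integrable (l := -t) (by have : t < 0 := ht; linarith)
    simpa [ProbabilityTheory.integrableExpSet] using this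
  have hmem : -l ∈ interior (ProbabilityTheory.integrableExpSet id η) :=
    interior_mono hsub (by rw [interior_Iio]; simpa using hl)
  have hd := ProbabilityTheory.hasDerivAt_mgf hmem
  constructor
  · have := ProbabilityTheory.integrable_pow_mul_exp_of_mem_interior_integrableExpSet hmem 1
    simpa using this
  · have e : ProbabilityTheory.mgf id η =ᶠ[𝓝 (-l)] fun t => Real.exp (-((-t) ^ a)) := by
      filter_upwards [gt_mem_nhds (show -l < 0 by linarith)] with t ht
      have := h.lap (-t) (by linarith)
      simpa [ProbabilityTheory.mgf] using this
    have hd2 : HasDerivAt (fun t : ℝ => Real.exp (-((-t) ^ a)))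
        (Real.exp (-((-(-l)) ^ a)) * (-((-1) * a * (-(-l)) ^ (a - 1)))) (-l) := by
      have h1 : HasDerivAt (fun t : ℝ => (-t) ^ a) ((-1) * a * (-(-l)) ^ (a - 1)) (-l) :=
        (hasDerivAt_neg (-l)).rpow_const (Or.inl (by simpa using hl.ne'))
      exact h1.neg.exp
    have := hd.unique (hd2.congr_of_eventuallyEq e)
    simp only [id, neg_neg, neg_mul] at this
    rw [this]; ring

def subC (a : ℝ) : ℝ := a / Real.Gamma (1 - a)

/-- The key identity `u η(du) = c (y^{-a} dy) * η`. -/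
lemma IsSub.identity (h : IsSub a η) (ha : 0 < a) (ha1 : a < 1) {φ : ℝ → ℝ≥0∞} (hφ : Measurable φ) :
    ∫⁻ u, φ u * ENNReal.ofReal u ∂η = ENNReal.ofReal (subC a) *
      ∫⁻ v, (∫⁻ y in Ioi (0:ℝ), φ (y + v) * ENNReal.ofReal (y ^ (-a))) ∂η := by
  have := h.prob
  have hG : 0 < Real.Gamma (1 - a) := Real.Gamma_pos_of_pos (by linarith)
  have hc : 0 < subC a := by unfold subC; positivity
  set m1 : Measure ℝ := η.withDensity (fun u => ENNReal.ofReal (u * Real.exp (-u))) with hm1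
  set n1 : Measure ℝ := (volume.restrict (Ioi (0:ℝ))).withDensity
    (fun y => ENNReal.ofReal (subC a * (y ^ (-a) * Real.exp (-y)))) with hn1
  set n2 : Measure ℝ := η.withDensity (fun u => ENNReal.ofReal (Real.exp (-u))) with hn2
  set m2 : Measure ℝ := (n1.prod n2).map (fun p => p.1 + p.2) with hm2
  have L1 : ∀ l : ℝ, 0 ≤ l → ∫⁻ u, ENNReal.ofReal (Real.exp (-(l * u))) ∂m1 =
      ENNReal.ofReal (a * (l + 1) ^ (a - 1) * Real.exp (-((l + 1) ^ a))) := by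
    intro l hl
    rw [hm1, lintegral_withDensity_eq_lintegral_mul _ (by fun_prop) (by fun_prop)]
    have hd := h.deriv (l := l + 1) (by linarith)
    rw [← hd.2, ofReal_integral_eq_lintegral_ofReal hd.1]
    · refine lintegral_congr_ae ?_
      filter_upwards [h.ae_pos] with u hu
      simp only [Pi.mul_apply]
      rw [← ENNReal.ofReal_mul (by positivity), mul_assoc, ← Real.exp_add]
      congr 3; ring
    · filter_upwards [h.ae_pos] with u hu
      positivity
  have L2 : ∀ l : ℝ, 0 ≤ l → ∫⁻ u, ENNReal.ofReal (Real.exp (-(l * u))) ∂m2 =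
      ENNReal.ofReal (a * (l + 1) ^ (a - 1) * Real.exp (-((l + 1) ^ a))) := by
    intro l hl
    rw [hm2, lintegral_map (by fun_prop) (by fun_prop)]
    have : ∀ p : ℝ × ℝ, ENNReal.ofReal (Real.exp (-(l * (p.1 + p.2)))) =
        ENNReal.ofReal (Real.exp (-(l * p.1))) * ENNReal.ofReal (Real.exp (-(l * p.2))) := by
      intro p
      rw [← ENNReal.ofReal_mul (by positivity), ← Real.exp_add]; congr 2; ring
    simp_rw [this]
    rw [lintegral_prod_mul (f := fun u => ENNReal.ofReal (Real.exp (-(l * u))))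
      (g := fun u => ENNReal.ofReal (Real.exp (-(l * u)))) (by fun_prop) (by fun_prop)]
    have i2 : ∫⁻ u, ENNReal.ofReal (Real.exp (-(l * u))) ∂n2 =
        ENNReal.ofReal (Real.exp (-((l + 1) ^ a))) := by
      rw [hn2, lintegral_withDensity_eq_lintegral_mul _ (by fun_prop) (by fun_prop),
        ← h.llap (l := l + 1) (by linarith)]
      congr 1; funext u
      simp only [Pi.mul_apply]
      rw [← ENNReal.ofReal_mul (by positivity), ← Real.exp_add]; congr 2; ring
    have i1 : ∫⁻ u, ENNReal.ofReal (Real.exp (-(l * u))) ∂n1 =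
        ENNReal.ofReal (a * (l + 1) ^ (a - 1)) := by
      rw [hn1, lintegral_withDensity_eq_lintegral_mul _ (by fun_prop) (by fun_prop)]
      have hI := Real.integral_rpow_mul_exp_neg_mul_Ioi (a := 1 - a) (r := l + 1)
        (by linarith) (by linarith)
      have hintg : IntegrableOn (fun y : ℝ => y ^ (1 - a - 1) * Real.exp (-((l + 1) * y))) (Ioi 0) := by
        by_contra hcon
        rw [integral_undef hcon] at hI
        have : 0 < (1 / (l + 1)) ^ (1 - a) * Real.Gamma (1 - a) := by positivity
        linarith
      have e : a * (l + 1) ^ (a - 1) = ∫ y in Ioi (0:ℝ), subC a * (y ^ (1 - a - 1) *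
          Real.exp (-((l + 1) * y))) := by
        rw [integral_const_mul, hI]
        unfold subC
        rw [one_div, Real.inv_rpow (by linarith), ← Real.rpow_neg (by linarith)]
        have : -(1 - a) = a - 1 := by ring
        rw [this]; field_simp
      rw [e, ofReal_integral_eq_lintegral_ofReal (hintg.const_mul _)]
      · refine lintegral_congr_ae ?_
        filter_upwards [ae_restrict_mem measurableSet_Ioi] with y hy
        have hy0 : 0 < y := hy
        simp only [Pi.mul_apply]
        rw [← ENNReal.ofReal_mul (by positivity)]
        congr 1
        have : (1 - a - 1) = -a := by ring
        rw [this, mul_assoc, mul_assoc, ← Real.exp_add]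
        congr 3; ring
      · filter_upwards [ae_restrict_mem measurableSet_Ioi] with y hy
        have hy0 : 0 < y := hy
        positivity
    rw [i1, i2, ← ENNReal.ofReal_mul (by positivity)]
  have f1 : IsFiniteMeasure m1 := ⟨by
    have := L1 0 le_rfl
    simp only [zero_mul, neg_zero, Real.exp_zero, ENNReal.ofReal_one, lintegral_one] at this
    rw [this]; exact ENNReal.ofReal_lt_top⟩
  have f2 : IsFiniteMeasure m2 := ⟨by
    have := L2 0 le_rfl
    simp only [zero_mul, neg_zero, Real.exp_zero, ENNReal.ofReal_one, lintegral_one] at this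
    rw [this]; exact ENNReal.ofReal_lt_top⟩
  have z1 : m1 (Iio 0) = 0 := by
    refine (withDensity_absolutelyContinuous η _) ?_
    exact measure_mono_null Iio_subset_Iic_self h.null
  have z2 : m2 (Iio 0) = 0 := by
    rw [hm2, Measure.map_apply (by fun_prop) measurableSet_Iio]
    have a1 : ∀ᵐ y ∂n1, 0 < y :=
      (withDensity_absolutelyContinuous _ _).ae_le (ae_restrict_mem measurableSet_Ioi)
    have a2 : ∀ᵐ y ∂n2, 0 < y := (withDensity_absolutelyContinuous _ _).ae_le h.ae_pos
    have : ∀ᵐ p ∂(n1.prod n2), 0 ≤ p.1 + p.2 := by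
      filter_upwards [Measure.quasiMeasurePreserving_fst.ae a1,
        Measure.quasiMeasurePreserving_snd.ae a2] with p h1 h2
      linarith
    rw [ae_iff] at this
    convert this using 2
    ext p; simp
  have hEq : m1 = m2 := by
    apply laplace_ext m1 m2 z1 z2
    intro n
    rw [integral_eq_lintegral_of_nonneg_ae (Eventually.of_forall fun u => (Real.exp_pos _).le)
      (by fun_prop), integral_eq_lintegral_of_nonneg_ae (Eventually.of_forall fun u =>
      (Real.exp_pos _).le) (by fun_prop), L1 n (by positivity), L2 n (by positivity)]
  have hintg := congrArg (fun m : Measure ℝ => ∫⁻ u, φ u * ENNReal.ofReal (Real.exp u) ∂m) hEq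
  rw [hm1, lintegral_withDensity_eq_lintegral_mul _ (by fun_prop) (by fun_prop), hm2,
    lintegral_map (by fun_prop) (by fun_prop), lintegral_prod_symm' _ (by fun_prop)] at hintg
  have s1 : ∫⁻ u, φ u * ENNReal.ofReal u ∂η = ∫⁻ u, ((fun u => ENNReal.ofReal (u * Real.exp (-u))) *
      fun u => φ u * ENNReal.ofReal (Real.exp u)) u ∂η := by
    refine lintegral_congr_ae ?_
    filter_upwards [h.ae_pos] with u hu
    simp only [Pi.mul_apply]
    have : ENNReal.ofReal u = ENNReal.ofReal (u * Real.exp (-u)) * ENNReal.ofReal (Real.exp u) := by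
      rw [← ENNReal.ofReal_mul (by positivity), mul_assoc, ← Real.exp_add]; simp
    rw [this]; ring
  rw [s1, hintg, hn2, lintegral_withDensity_eq_lintegral_mul _ (by fun_prop) (by
    refine Measurable.lintegral_prod_left' (f := fun w : ℝ × ℝ => φ (w.1 + w.2) *
      ENNReal.ofReal (Real.exp (w.1 + w.2))) (by fun_prop)),
    ← lintegral_const_mul' _ _ ENNReal.ofReal_ne_top]
  congr 1; funext v
  simp only [Pi.mul_apply]
  rw [hn1, lintegral_withDensity_eq_lintegral_mul _ (by fun_prop) (by fun_prop),
    ← lintegral_const_mul' _ _ ENNReal.ofReal_ne_top, ← lintegral_const_mul' _ _ ENNReal.ofReal_ne_top]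
  refine lintegral_congr_ae ?_
  filter_upwards [ae_restrict_mem measurableSet_Ioi] with y hy
  have hy0 : 0 < y := hy
  simp only [Pi.mul_apply]
  have : ENNReal.ofReal (subC a) * ENNReal.ofReal (y ^ (-a)) = ENNReal.ofReal (Real.exp (-v)) *
      ENNReal.ofReal (subC a * (y ^ (-a) * Real.exp (-y))) * ENNReal.ofReal (Real.exp (y + v)) := by
    rw [← ENNReal.ofReal_mul (by positivity), ← ENNReal.ofReal_mul (by positivity),
      ← ENNReal.ofReal_mul (by positivity)]
    congr 1
    have : Real.exp (-v) * Real.exp (-y) * Real.exp (y + v) = 1 := by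
      rw [← Real.exp_add, ← Real.exp_add]; simp
    calc _ = subC a * y ^ (-a) * 1 := by ring
      _ = _ := by rw [← this]; ring
  rw [mul_left_comm (ENNReal.ofReal (subC a)), this]; ring

end

noncomputable section
open scoped ENNReal NNReal Topology

/-- time-`s` subordinator law -/
def etaT (a : ℝ) (η : Measure ℝ) (s : ℝ) : Measure ℝ := η.map (fun u => s ^ (1 / a) * u)

section
variable {a : ℝ} {η : Measure ℝ}

lemma lintegral_etaT (a : ℝ) (η : Measure ℝ) (s : ℝ) {φ : ℝ → ℝ≥0∞} (hφ : Measurable φ) :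
    ∫⁻ u, φ u ∂(etaT a η s) = ∫⁻ u, φ (s ^ (1 / a) * u) ∂η := by
  rw [etaT, lintegral_map hφ (by fun_prop)]

lemma IsSub.etaT_prob (h : IsSub a η) (s : ℝ) : IsProbabilityMeasure (etaT a η s) := by
  have := h.prob
  exact Measure.isProbabilityMeasure_map (by fun_prop)

lemma IsSub.etaT_ae_pos (h : IsSub a η) {s : ℝ} (hs : 0 < s) : ∀ᵐ u ∂(etaT a η s), 0 < u := by
  rw [etaT, ae_map_iff (by fun_prop) measurableSet_Ioi]
  filter_upwards [h.ae_pos] with u hu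
  have := Real.rpow_pos_of_pos hs (1 / a)
  positivity

lemma IsSub.etaT_llap (h : IsSub a η) (ha : 0 < a) {s l : ℝ} (hs : 0 < s) (hl : 0 ≤ l) :
    ∫⁻ u, ENNReal.ofReal (Real.exp (-(l * u))) ∂(etaT a η s) =
      ENNReal.ofReal (Real.exp (-(s * l ^ a))) := by
  rw [lintegral_etaT _ _ _ (by fun_prop)]
  have hp := Real.rpow_pos_of_pos hs (1 / a)
  have := h.llap (l := s ^ (1 / a) * l) (by positivity)
  rw [Real.mul_rpow hp.le hl, ← Real.rpow_mul hs.le, one_div_mul_cancel ha.ne', Real.rpow_one] at this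
  rw [← this]
  refine lintegral_congr fun u => ?_
  congr 3; ring

lemma IsSub.etaT_identity (h : IsSub a η) (ha : 0 < a) (ha1 : a < 1) {s : ℝ} (hs : 0 < s)
    {φ : ℝ → ℝ≥0∞} (hφ : Measurable φ) :
    ∫⁻ u, φ u * ENNReal.ofReal u ∂(etaT a η s) = ENNReal.ofReal (subC a * s) *
      ∫⁻ v, (∫⁻ y in Ioi (0:ℝ), φ (y + v) * ENNReal.ofReal (y ^ (-a))) ∂(etaT a η s) := by
  have hp := Real.rpow_pos_of_pos hs (1 / a)
  set σ := s ^ (1 / a) with hσ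
  have hσa : σ ^ a = s := by rw [hσ, ← Real.rpow_mul hs.le, one_div_mul_cancel ha.ne', Real.rpow_one]
  have hG : 0 < Real.Gamma (1 - a) := Real.Gamma_pos_of_pos (by linarith)
  have hc : 0 < subC a := by unfold subC; positivity
  have hpr := h.prob
  rw [lintegral_etaT _ _ _ (by fun_prop), lintegral_etaT]
  swap
  · exact Measurable.lintegral_prod_right' (f := fun w : ℝ × ℝ => φ (w.2 + w.1) *
      ENNReal.ofReal (w.2 ^ (-a))) (by fun_prop)
  rw [← hσ]
  have e1 : ∫⁻ u, φ (σ * u) * ENNReal.ofReal (σ * u) ∂η = ENNReal.ofReal σ *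
      ∫⁻ u, φ (σ * u) * ENNReal.ofReal u ∂η := by
    rw [← lintegral_const_mul' _ _ ENNReal.ofReal_ne_top]
    refine lintegral_congr fun u => ?_
    rw [ENNReal.ofReal_mul hp.le]; ring
  rw [e1, h.identity ha ha1 (φ := fun u => φ (σ * u)) (by fun_prop), ← mul_assoc,
    ← ENNReal.ofReal_mul hp.le]
  have e2 : ∀ v, ∫⁻ y in Ioi (0:ℝ), φ (y + σ * v) * ENNReal.ofReal (y ^ (-a)) =
      ENNReal.ofReal (σ ^ (1 - a)) * ∫⁻ y in Ioi (0:ℝ), φ (σ * (y + v)) * ENNReal.ofReal (y ^ (-a)) := by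
    intro v
    have := lintegral_image_eq_lintegral_abs_deriv_mul (s := Ioi (0:ℝ)) (f := fun y => σ * y)
      (f' := fun _ => σ) measurableSet_Ioi
      (fun x _ => by simpa using ((hasDerivAt_id x).const_mul σ).hasDerivWithinAt)
      (fun x _ y _ hxy => mul_left_cancel₀ hp.ne' hxy)
      (fun y => φ (y + σ * v) * ENNReal.ofReal (y ^ (-a)))
    have him : (fun y => σ * y) '' Ioi (0:ℝ) = Ioi 0 := by
      ext z; constructor
      · rintro ⟨y, hy, rfl⟩; exact mul_pos hp hy
      · intro hz; exact ⟨z / σ, div_pos hz hp, by field_simp⟩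
    rw [him] at this
    rw [this, ← lintegral_const_mul' _ _ ENNReal.ofReal_ne_top]
    refine setLIntegral_congr_fun measurableSet_Ioi fun y hy => ?_
    have hy0 : 0 < y := hy
    rw [abs_of_pos hp, Real.mul_rpow hp.le hy0.le, ENNReal.ofReal_mul (by positivity), mul_add,
      show (1:ℝ) - a = 1 + -a by ring, Real.rpow_add hp, Real.rpow_one, ENNReal.ofReal_mul hp.le]
    ring
  simp_rw [e2]
  rw [lintegral_const_mul' _ _ ENNReal.ofReal_ne_top, ← mul_assoc, ← ENNReal.ofReal_mul (by positivity)]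
  congr 2
  rw [Real.rpow_sub hp, hσa, Real.rpow_one]; field_simp

lemma IsSub.etaT_tail (h : IsSub a η) (ha : 0 < a) {s x : ℝ} (hs : 0 < s) (hx : 0 < x) :
    etaT a η s (Ici x) ≤ ENNReal.ofReal (2 * (s * x ^ (-a))) := by
  have := h.etaT_prob s
  have hl := h.etaT_llap ha hs (l := x⁻¹) (by positivity)
  have key : etaT a η s (Ici x) + 2 * ∫⁻ u, ENNReal.ofReal (Real.exp (-(x⁻¹ * u))) ∂(etaT a η s) ≤ 2 := by
    rw [← lintegral_indicator_one measurableSet_Ici, ← lintegral_const_mul' _ _ (by simp),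
      ← lintegral_add_right _ (by fun_prop)]
    calc _ ≤ ∫⁻ u, 2 ∂(etaT a η s) := by
          refine lintegral_mono_ae ?_
          filter_upwards [h.etaT_ae_pos hs] with u hu
          have h2 : (2:ℝ≥0∞) = ENNReal.ofReal 2 := by simp
          by_cases hux : u ∈ Ici x
          · rw [indicator_of_mem hux, h2, ← ENNReal.ofReal_mul (by norm_num), Pi.one_apply,
              ← ENNReal.ofReal_one, ← ENNReal.ofReal_add (by norm_num) (by positivity)]
            apply ENNReal.ofReal_le_ofReal
            have h1 : 1 ≤ x⁻¹ * u := by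
              rw [inv_mul_eq_div, le_div_iff₀ hx]; simpa using hux
            have : Real.exp (-(x⁻¹ * u)) ≤ 1 / 2 := by
              rw [Real.exp_neg, ← one_div]
              apply one_div_le_one_div_of_le (by norm_num)
              have := Real.add_one_le_exp (x⁻¹ * u)
              linarith
            linarith
          · rw [indicator_of_notMem hux, h2, ← ENNReal.ofReal_mul (by norm_num), zero_add]
            apply ENNReal.ofReal_le_ofReal
            have : Real.exp (-(x⁻¹ * u)) ≤ 1 := by
              rw [Real.exp_le_one_iff]; have : 0 < x⁻¹ * u := by positivity
              linarith
            linarith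
      _ = 2 := by simp
  rw [hl] at key
  have h3 : ENNReal.ofReal (1 - s * x ^ (-a)) ≤ ENNReal.ofReal (Real.exp (-(s * x⁻¹ ^ a))) := by
    apply ENNReal.ofReal_le_ofReal
    have := Real.add_one_le_exp (-(s * x⁻¹ ^ a))
    rw [Real.rpow_neg hx.le, ← Real.inv_rpow hx.le]; linarith
  rcases le_total (s * x ^ (-a)) 1 with h1 | h1
  · have h4 : etaT a η s (Ici x) + ENNReal.ofReal (2 * (1 - s * x ^ (-a))) ≤ 2 := by
      rw [ENNReal.ofReal_mul (by norm_num)]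
      refine le_trans ?_ key
      gcongr; simp
    have h5 := ENNReal.le_sub_of_add_le_right ENNReal.ofReal_ne_top h4
    refine h5.trans (le_of_eq ?_)
    rw [show (2:ℝ≥0∞) = ENNReal.ofReal 2 by simp, ← ENNReal.ofReal_sub _ (by linarith)]
    congr 1; ring
  · refine prob_le_one.trans ?_
    rw [← ENNReal.ofReal_one]
    exact ENNReal.ofReal_le_ofReal (by linarith)

lemma subC_pos (ha : 0 < a) (ha1 : a < 1) : 0 < subC a := by
  have hG : 0 < Real.Gamma (1 - a) := Real.Gamma_pos_of_pos (by linarith)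
  unfold subC; positivity

lemma lint_Ioc_rpow (ha : 0 < a) (ha1 : a < 1) (z : ℝ) :
    ∫⁻ y in Ioc z (z + 1) ∩ Ioi 0, ENNReal.ofReal (y ^ (-a)) ≤ ENNReal.ofReal (1 + 1 / (1 - a)) := by
  have e01 : ∫⁻ y in Ioc (0:ℝ) 1, ENNReal.ofReal (y ^ (-a)) = ENNReal.ofReal (1 / (1 - a)) := by
    rw [← ofReal_integral_eq_lintegral_ofReal]
    · rw [← intervalIntegral.integral_of_le zero_le_one, integral_rpow (Or.inl (by linarith))]
      congr 1
      rw [Real.one_rpow, Real.zero_rpow (by linarith)]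
      ring
    · have := (intervalIntegral.intervalIntegrable_rpow' (a := 0) (b := 1) (r := -a) (by linarith))
      rwa [intervalIntegrable_iff_integrableOn_Ioc_of_le zero_le_one] at this
    · filter_upwards [ae_restrict_mem measurableSet_Ioc] with y hy
      exact Real.rpow_nonneg hy.1.le _
  have hsub : Ioc z (z + 1) ∩ Ioi 0 ⊆ (Ioc z (z + 1) ∩ Ioi 1) ∪ Ioc 0 1 := by
    rintro y ⟨h1, h2⟩
    by_cases hy : y ≤ 1
    · exact Or.inr ⟨h2, hy⟩
    · exact Or.inl ⟨h1, not_le.1 hy⟩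
  refine (lintegral_mono_set hsub).trans ((lintegral_union_le _ _ _).trans ?_)
  rw [e01, ENNReal.ofReal_add (by norm_num) (div_nonneg (by norm_num) (by linarith))]
  gcongr
  calc _ ≤ ∫⁻ y in Ioc z (z + 1) ∩ Ioi 1, 1 := by
        refine setLIntegral_mono' (measurableSet_Ioc.inter measurableSet_Ioi) fun y hy => ?_
        rw [← ENNReal.ofReal_one]
        apply ENNReal.ofReal_le_ofReal
        exact Real.rpow_le_one_of_one_le_of_nonpos (le_of_lt hy.2) (by linarith)
    _ ≤ volume (Ioc z (z+1)) := by
        rw [setLIntegral_one]; exact measure_mono inter_subset_left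
    _ = _ := by simp

lemma IsSub.etaT_mass_aux (h : IsSub a η) (ha : 0 < a) (ha1 : a < 1) : ∃ C : ℝ, 0 < C ∧
    ∀ s ∈ Ioc (0:ℝ) 1, ∀ x : ℝ, 1 ≤ x → etaT a η s (Ioc x (x + 1)) ≤ ENNReal.ofReal (C * x ^ (-1 - a)) := by
  have hc := subC_pos ha ha1
  set D := 1 + 1 / (1 - a) with hD
  have hDp : 0 < D := by
    have : 0 < 1 - a := by linarith
    positivity
  refine ⟨subC a * (1 + 2 * D) * 2, by positivity, fun s hs x hx => ?_⟩
  have hx0 : 0 < x := by linarith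
  have hpr := h.etaT_prob s
  have hs0 := hs.1
  have step1 : etaT a η s (Ioc x (x + 1)) ≤ ENNReal.ofReal x⁻¹ *
      ∫⁻ u, (Ioc x (x+1)).indicator 1 u * ENNReal.ofReal u ∂(etaT a η s) := by
    rw [← lintegral_indicator_one measurableSet_Ioc, ← lintegral_const_mul' _ _ ENNReal.ofReal_ne_top]
    refine lintegral_mono fun u => ?_
    by_cases hu : u ∈ Ioc x (x+1)
    · simp only [indicator_of_mem hu, Pi.one_apply, one_mul]
      rw [← ENNReal.ofReal_mul (by positivity), ← ENNReal.ofReal_one]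
      apply ENNReal.ofReal_le_ofReal
      rw [inv_mul_eq_div, le_div_iff₀ hx0]; linarith [hu.1]
    · simp [indicator_of_notMem hu]
  have hB : ∀ᵐ v ∂(etaT a η s), (∫⁻ y in Ioi (0:ℝ), (Ioc x (x+1)).indicator 1 (y + v) *
      ENNReal.ofReal (y ^ (-a))) ≤ ENNReal.ofReal ((x/2) ^ (-a)) + ENNReal.ofReal D *
        (Ici (x/2)).indicator 1 v := by
    filter_upwards [h.etaT_ae_pos hs0] with v hv
    have e : (∫⁻ y in Ioi (0:ℝ), (Ioc x (x+1)).indicator 1 (y + v) * ENNReal.ofReal (y ^ (-a))) =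
        ∫⁻ y in Ioc (x - v) (x - v + 1) ∩ Ioi 0, ENNReal.ofReal (y ^ (-a)) := by
      rw [← Measure.restrict_restrict measurableSet_Ioc, ← lintegral_indicator measurableSet_Ioc]
      refine lintegral_congr fun y => ?_
      have : y + v ∈ Ioc x (x+1) ↔ y ∈ Ioc (x - v) (x - v + 1) := by
        constructor <;> intro ⟨h1, h2⟩ <;> constructor <;> linarith
      by_cases hy : y ∈ Ioc (x - v) (x - v + 1)
      · rw [indicator_of_mem hy, indicator_of_mem (this.2 hy)]; simp
      · rw [indicator_of_notMem hy, indicator_of_notMem (fun h => hy (this.1 h))]; simp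
    rw [e]
    by_cases hvx : x / 2 ≤ v
    · rw [indicator_of_mem (show v ∈ Ici (x/2) from hvx)]
      refine (lint_Ioc_rpow ha ha1 _).trans ?_
      simp [hD]
    · push Not at hvx
      refine le_trans ?_ le_self_add
      calc _ ≤ ∫⁻ y in Ioc (x - v) (x - v + 1) ∩ Ioi 0, ENNReal.ofReal ((x/2) ^ (-a)) := by
            refine setLIntegral_mono' (measurableSet_Ioc.inter measurableSet_Ioi) fun y hy => ?_
            apply ENNReal.ofReal_le_ofReal
            exact Real.rpow_le_rpow_of_nonpos (by positivity) (by linarith [hy.1.1]) (by linarith)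
        _ ≤ ∫⁻ y in Ioc (x - v) (x - v + 1), ENNReal.ofReal ((x/2) ^ (-a)) :=
            lintegral_mono_set inter_subset_left
        _ = _ := by simp
  have step2 := lintegral_mono_ae hB
  rw [lintegral_add_left (by fun_prop), lintegral_const_mul' _ _ ENNReal.ofReal_ne_top,
    lintegral_indicator_one measurableSet_Ici, lintegral_const, measure_univ, mul_one] at step2
  have ht := h.etaT_tail ha hs0 (x := x/2) (by positivity)
  rw [h.etaT_identity ha ha1 hs0 (by
    exact (measurable_const.indicator measurableSet_Ioc : Measurable ((Ioc x (x+1)).indicator (fun _ => (1:ℝ≥0∞)))))] at step1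
  refine step1.trans ?_
  calc _ ≤ ENNReal.ofReal x⁻¹ * (ENNReal.ofReal (subC a * s) * (ENNReal.ofReal ((x/2) ^ (-a)) +
        ENNReal.ofReal D * ENNReal.ofReal (2 * (s * (x/2) ^ (-a))))) := by
        gcongr; exact step2.trans (by gcongr)
    _ = ENNReal.ofReal (x⁻¹ * (subC a * s * ((x/2) ^ (-a) + D * (2 * (s * (x/2) ^ (-a)))))) := by
        have : 0 ≤ (x/2) ^ (-a) := by positivity
        rw [← ENNReal.ofReal_mul (by positivity), ← ENNReal.ofReal_add (by positivity) (by positivity),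
          ← ENNReal.ofReal_mul (by positivity), ← ENNReal.ofReal_mul (by positivity)]
    _ ≤ _ := by
        apply ENNReal.ofReal_le_ofReal
        have h2a : (x/2) ^ (-a) ≤ 2 * x ^ (-a) := by
          rw [Real.div_rpow hx0.le (by norm_num), div_le_iff₀ (by positivity)]
          have : (1:ℝ) ≤ 2 * 2 ^ (-a) := by
            rw [show (2:ℝ) * 2 ^ (-a) = 2 ^ (1 + -a) by rw [Real.rpow_add (by norm_num), Real.rpow_one]]
            exact Real.one_le_rpow (by norm_num) (by linarith)
          have h0 : 0 ≤ x ^ (-a) := by positivity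
          nlinarith
        have hxx : x ^ (-1 - a) = x⁻¹ * x ^ (-a) := by
          rw [show -1 - a = -1 + -a by ring, Real.rpow_add hx0, Real.rpow_neg_one]
        rw [hxx]
        have hs1 := hs.2
        calc _ = x⁻¹ * subC a * s * (1 + 2 * D * s) * (x/2) ^ (-a) := by ring
          _ ≤ x⁻¹ * subC a * 1 * (1 + 2 * D * 1) * (2 * x ^ (-a)) := by gcongr
          _ = _ := by ring

lemma IsSub.etaT_mass (h : IsSub a η) (ha : 0 < a) (ha1 : a < 1) : ∃ C : ℝ, 0 < C ∧
    ∀ s ∈ Ioc (0:ℝ) 1, ∀ x : ℝ, -1 ≤ x →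
      etaT a η s (Ioc x (x + 1)) ≤ ENNReal.ofReal (C * (x + 2) ^ (-1 - a)) := by
  obtain ⟨C, hC, H⟩ := h.etaT_mass_aux ha ha1
  refine ⟨9 * (1 + C), by positivity, fun s hs x hx => ?_⟩
  have hx2 : 0 < x + 2 := by linarith
  have h9 : (3:ℝ) ^ (-1 - a) * 9 ≥ 1 := by
    have : (9:ℝ) = 3 ^ (2:ℝ) := by norm_num
    rw [this, ← Real.rpow_add (by norm_num)]
    exact Real.one_le_rpow (by norm_num) (by linarith)
  rcases le_total x 1 with h1 | h1
  · have := h.etaT_prob s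
    refine prob_le_one.trans ?_
    rw [← ENNReal.ofReal_one]
    apply ENNReal.ofReal_le_ofReal
    have h3 : (3:ℝ) ^ (-1 - a) ≤ (x + 2) ^ (-1 - a) :=
      Real.rpow_le_rpow_of_nonpos hx2 (by linarith) (by linarith)
    nlinarith
  · refine (H s hs x h1).trans (ENNReal.ofReal_le_ofReal ?_)
    have hx0 : 0 < x := by linarith
    have h3 : (3 * x) ^ (-1 - a) ≤ (x + 2) ^ (-1 - a) :=
      Real.rpow_le_rpow_of_nonpos hx2 (by linarith) (by linarith)
    rw [Real.mul_rpow (by norm_num) hx0.le] at h3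
    have h0 : 0 < x ^ (-1 - a) := by positivity
    have h4 : 0 < (x + 2) ^ (-1 - a) := by positivity
    have : x ^ (-1 - a) ≤ 9 * (x + 2) ^ (-1 - a) := by nlinarith
    nlinarith

/-- upper comparison -/
lemma IsSub.cmp_up (h : IsSub a η) (ha : 0 < a) (ha1 : a < 1) : ∃ C : ℝ, 0 < C ∧
    ∀ s ∈ Ioc (0:ℝ) 1, ∀ φ ψ : ℝ → ℝ≥0∞, Measurable φ → Measurable ψ →
      (∀ u, 0 < u → ∀ y ∈ Ico (10:ℝ) 11, φ u ≤ ψ (u + y)) →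
      ∫⁻ u, φ u ∂(etaT a η s) ≤ ENNReal.ofReal C * ∫⁻ r in Ioi 1, ψ r * ENNReal.ofReal (r ^ (-1 - a)) := by
  obtain ⟨C, hC, H⟩ := h.etaT_mass ha ha1
  refine ⟨C * 121, by positivity, fun s hs φ ψ hφ hψ hle => ?_⟩
  have hpr := h.etaT_prob s
  have hm : Measurable (fun w : ℝ × ℝ => (Ico (10:ℝ) 11).indicator (fun _ => (1:ℝ≥0∞)) (w.2 - w.1)) :=
    (measurable_const.indicator measurableSet_Ico).comp (by fun_prop)
  have st1 : ∀ᵐ u ∂(etaT a η s), φ u ≤ ∫⁻ r, (Ico (10:ℝ) 11).indicator (fun _ => (1:ℝ≥0∞)) (r - u) * ψ r := by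
    filter_upwards [h.etaT_ae_pos hs.1] with u hu
    calc φ u = ∫⁻ y in Ico (10:ℝ) 11, φ u := by
          rw [setLIntegral_const, Real.volume_Ico]; norm_num
      _ ≤ ∫⁻ y in Ico (10:ℝ) 11, ψ (u + y) :=
          setLIntegral_mono' measurableSet_Ico fun y hy => hle u hu y hy
      _ = ∫⁻ y, (Ico (10:ℝ) 11).indicator (fun _ => (1:ℝ≥0∞)) (y + u - u) * ψ (y + u) := by
          rw [← lintegral_indicator measurableSet_Ico]
          refine lintegral_congr fun y => ?_
          by_cases hy : y ∈ Ico (10:ℝ) 11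
          · simp [hy, add_comm]
          · simp [hy]
      _ = _ := lintegral_add_right_eq_self
          (fun r => (Ico (10:ℝ) 11).indicator (fun _ => (1:ℝ≥0∞)) (r - u) * ψ r) u
  refine (lintegral_mono_ae st1).trans ?_
  rw [lintegral_lintegral_swap (by fun_prop), ← lintegral_const_mul' _ _ ENNReal.ofReal_ne_top,
    ← lintegral_indicator measurableSet_Ioi]
  refine lintegral_mono fun r => ?_
  have hmr : Measurable (fun u : ℝ => (Ico (10:ℝ) 11).indicator (fun _ => (1:ℝ≥0∞)) (r - u)) :=
    (measurable_const.indicator measurableSet_Ico).comp (by fun_prop)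
  rw [lintegral_mul_const _ hmr]
  have hset : ∫⁻ u, (Ico (10:ℝ) 11).indicator (fun _ => (1:ℝ≥0∞)) (r - u) ∂(etaT a η s) =
      etaT a η s (Ioc (r - 11) (r - 11 + 1)) := by
    rw [← lintegral_indicator_one measurableSet_Ioc]
    refine lintegral_congr fun u => ?_
    have : r - u ∈ Ico (10:ℝ) 11 ↔ u ∈ Ioc (r - 11) (r - 11 + 1) := by
      constructor <;> intro ⟨h1, h2⟩ <;> constructor <;> linarith
    by_cases hu : u ∈ Ioc (r - 11) (r - 11 + 1)
    · rw [indicator_of_mem hu, indicator_of_mem (this.2 hu)]; rfl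
    · rw [indicator_of_notMem hu, indicator_of_notMem (fun h => hu (this.1 h))]
  rw [hset]
  by_cases hr : r ≤ 10
  · have : etaT a η s (Ioc (r - 11) (r - 11 + 1)) = 0 := by
      refine measure_mono_null (t := {u | ¬ 0 < u}) (fun u hu => ?_) (h.etaT_ae_pos hs.1)
      simp only [mem_ofPred_eq, not_lt]; linarith [hu.2]
    simp [this]
  · push Not at hr
    rw [indicator_of_mem (show r ∈ Ioi (1:ℝ) by simp; linarith)]
    have h1 := H s hs (r - 11) (by linarith)
    have h2 : C * (r - 11 + 2) ^ (-1 - a) ≤ C * 121 * r ^ (-1 - a) := by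
      have hr0 : 0 < r := by linarith
      have h3 : (r - 11 + 2) ^ (-1 - a) ≤ (r / 10) ^ (-1 - a) :=
        Real.rpow_le_rpow_of_nonpos (by linarith) (by linarith) (by linarith)
      have h4 : (r / 10) ^ (-1 - a) ≤ 121 * r ^ (-1 - a) := by
        rw [Real.div_rpow hr0.le (by norm_num), div_le_iff₀ (by positivity)]
        have : (1:ℝ) ≤ 121 * 10 ^ (-1 - a) := by
          have h100 : (1:ℝ) ≤ 10 ^ (2:ℝ) * 10 ^ (-1 - a) := by
            rw [← Real.rpow_add (by norm_num)]
            exact Real.one_le_rpow (by norm_num) (by linarith)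
          have : (10:ℝ) ^ (2:ℝ) = 100 := by norm_num
          have hp : (0:ℝ) < 10 ^ (-1 - a) := by positivity
          nlinarith
        have h0 : 0 ≤ r ^ (-1 - a) := by positivity
        nlinarith
      nlinarith
    calc _ ≤ ENNReal.ofReal (C * 121 * r ^ (-1 - a)) * ψ r := by
          gcongr; exact h1.trans (ENNReal.ofReal_le_ofReal h2)
      _ = _ := by rw [ENNReal.ofReal_mul (by positivity)]; ring

lemma IsSub.cmp_low (h : IsSub a η) (ha : 0 < a) (ha1 : a < 1) : ∃ A : ℝ, 0 < A ∧ ∀ s0 > 0, ∃ C : ℝ, 0 < C ∧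
    ∀ s ∈ Icc s0 1, ∀ φ ψ : ℝ → ℝ≥0∞, Measurable φ → Measurable ψ →
      (∀ y, 1 < y → ∀ v ∈ Ioo 0 A, ψ y ≤ φ (y + v)) →
      ∫⁻ r in Ioi 1, ψ r * ENNReal.ofReal (r ^ (-1 - a)) ≤ ENNReal.ofReal C * ∫⁻ u, φ u ∂(etaT a η s) := by
  set A : ℝ := 4 ^ (1 / a) with hA
  have hA0 : 0 < A := by positivity
  have hAa : A ^ (-a) = 1 / 4 := by
    rw [hA, ← Real.rpow_mul (by norm_num)]
    rw [show 1 / a * -a = -1 by field_simp, Real.rpow_neg_one]; norm_num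
  have hc := subC_pos ha ha1
  refine ⟨A, hA0, fun s0 hs0 => ⟨2 * (1 + A) / (subC a * s0), by positivity, fun s hs φ ψ hφ hψ hle => ?_⟩⟩
  have hsp : 0 < s := lt_of_lt_of_le hs0 hs.1
  have hpr := h.etaT_prob s
  have hmass : ENNReal.ofReal (1/2) ≤ etaT a η s (Ioo 0 A) := by
    have h1 := h.etaT_tail ha hsp hA0
    rw [hAa] at h1
    have h2 : etaT a η s (Iic 0) = 0 := by
      have := h.etaT_ae_pos hsp
      rw [ae_iff] at this; simpa [Iic] using this
    have h3 : (1:ℝ≥0∞) ≤ etaT a η s (Iic 0) + etaT a η s (Ioo 0 A) + etaT a η s (Ici A) := by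
      rw [← measure_univ (μ := etaT a η s)]
      refine (measure_mono ?_).trans ((measure_union_le _ _).trans (by gcongr; exact measure_union_le _ _))
      intro u _
      simp only [mem_union, mem_Iic, mem_Ioo, mem_Ici]
      rcases le_or_gt u 0 with h | h
      · simp [h]
      · rcases le_or_gt A u with h' | h'
        · simp [h']
        · simp [h, h']
    rw [h2, zero_add] at h3
    have h4 : (1:ℝ≥0∞) ≤ etaT a η s (Ioo 0 A) + ENNReal.ofReal (1/2) := by
      refine h3.trans ?_
      gcongr
      refine h1.trans (ENNReal.ofReal_le_ofReal ?_)
      linarith [hs.2]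
    have h5 : (1:ℝ≥0∞) = ENNReal.ofReal (1/2) + ENNReal.ofReal (1/2) := by
      rw [← ENNReal.ofReal_add (by norm_num) (by norm_num)]; norm_num
    rw [h5] at h4
    exact (ENNReal.add_le_add_iff_right ENNReal.ofReal_ne_top).1 h4
  have e : ∫⁻ u, φ u ∂(etaT a η s) = ∫⁻ u, (φ u * ENNReal.ofReal u⁻¹) * ENNReal.ofReal u ∂(etaT a η s) := by
    refine lintegral_congr_ae ?_
    filter_upwards [h.etaT_ae_pos hsp] with u hu
    rw [mul_assoc, ← ENNReal.ofReal_mul (by positivity), inv_mul_cancel₀ hu.ne']; simp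
  rw [e, h.etaT_identity ha ha1 hsp (by fun_prop)]
  set J := ∫⁻ r in Ioi 1, ψ r * ENNReal.ofReal (r ^ (-1 - a)) with hJ
  have low : ENNReal.ofReal ((1 + A)⁻¹) * J * ENNReal.ofReal (1/2) ≤
      ∫⁻ v, (∫⁻ y in Ioi (0:ℝ), φ (y + v) * ENNReal.ofReal (y + v)⁻¹ * ENNReal.ofReal (y ^ (-a))) ∂(etaT a η s) := by
    calc _ ≤ ENNReal.ofReal ((1 + A)⁻¹) * J * etaT a η s (Ioo 0 A) := by gcongr
      _ = ∫⁻ v in Ioo 0 A, ENNReal.ofReal ((1 + A)⁻¹) * J ∂(etaT a η s) := by rw [setLIntegral_const]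
      _ ≤ ∫⁻ v in Ioo 0 A, (∫⁻ y in Ioi (0:ℝ), φ (y + v) * ENNReal.ofReal (y + v)⁻¹ * ENNReal.ofReal (y ^ (-a))) ∂(etaT a η s) := by
          refine setLIntegral_mono' measurableSet_Ioo fun v hv => ?_
          rw [hJ, ← lintegral_const_mul' _ _ ENNReal.ofReal_ne_top]
          refine le_trans ?_ (lintegral_mono_set (Ioi_subset_Ioi zero_le_one))
          refine setLIntegral_mono' measurableSet_Ioi fun y hy => ?_
          have hy1 : 1 < y := hy
          have hy0 : 0 < y := by linarith
          rw [show ENNReal.ofReal ((1 + A)⁻¹) * (ψ y * ENNReal.ofReal (y ^ (-1 - a))) =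
            ψ y * (ENNReal.ofReal ((1 + A)⁻¹) * ENNReal.ofReal (y ^ (-1 - a))) by ring, mul_assoc]
          gcongr ?_ * ?_
          · exact hle y hy1 v hv
          · have hv0 := hv.1
            rw [← ENNReal.ofReal_mul (by positivity), ← ENNReal.ofReal_mul (by positivity)]
            apply ENNReal.ofReal_le_ofReal
            rw [show -1 - a = -1 + -a by ring, Real.rpow_add hy0, Real.rpow_neg_one, ← mul_assoc]
            gcongr
            rw [← mul_inv]
            apply inv_anti₀ (by positivity)
            nlinarith [hv.2]
      _ ≤ _ := setLIntegral_le_lintegral _ _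
  calc J = ENNReal.ofReal (2 * (1 + A) / (subC a * s0)) * (ENNReal.ofReal (subC a * s0) *
        (ENNReal.ofReal ((1 + A)⁻¹) * J * ENNReal.ofReal (1/2))) := by
        rw [show ∀ p q r w : ℝ≥0∞, p * (q * (r * J * w)) = (p * q * r * w) * J by intros; ring,
          ← ENNReal.ofReal_mul (by positivity), ← ENNReal.ofReal_mul (by positivity),
          ← ENNReal.ofReal_mul (by positivity)]
        rw [show 2 * (1 + A) / (subC a * s0) * (subC a * s0) * (1 + A)⁻¹ * (1 / 2) = 1 by field_simp]
        simp
    _ ≤ _ := by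
        gcongr
        exact hs.1

/-- negative moments -/
lemma IsSub.neg_moment (h : IsSub a η) (ha : 0 < a) {b : ℝ} (hb : 0 < b) :
    ∫⁻ u, ENNReal.ofReal (u ^ (-b)) ∂η = ENNReal.ofReal (Real.Gamma (b / a) / (a * Real.Gamma b)) := by
  have hpr := h.prob
  have hG := Real.Gamma_pos_of_pos hb
  have e1 : ∀ᵐ u ∂η, ENNReal.ofReal (u ^ (-b)) = ENNReal.ofReal (Real.Gamma b)⁻¹ *
      ∫⁻ l in Ioi (0:ℝ), ENNReal.ofReal (l ^ (b - 1)) * ENNReal.ofReal (Real.exp (-(l * u))) := by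
    filter_upwards [h.ae_pos] with u hu
    have h1 := Real.integral_rpow_mul_exp_neg_mul_Ioi hb hu
    have h2 := integrableOn_rpow_mul_exp_neg_mul_rpow (p := 1) (s := b - 1) (b := u) (by linarith) (by norm_num) hu
    have h3 : ∫⁻ l in Ioi (0:ℝ), ENNReal.ofReal (l ^ (b - 1)) * ENNReal.ofReal (Real.exp (-(l * u))) =
        ENNReal.ofReal ((1 / u) ^ b * Real.Gamma b) := by
      rw [← h1, ofReal_integral_eq_lintegral_ofReal]
      · refine setLIntegral_congr_fun measurableSet_Ioi fun l hl => ?_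
        have hl0 : 0 < l := hl
        rw [ENNReal.ofReal_mul (by positivity), mul_comm l u]
      · refine h2.congr_fun (fun l hl => ?_) measurableSet_Ioi
        simp
      · filter_upwards [ae_restrict_mem measurableSet_Ioi] with l hl
        have hl0 : 0 < l := hl
        positivity
    rw [h3, ← ENNReal.ofReal_mul (by positivity)]
    congr 1
    rw [one_div, Real.inv_rpow hu.le, Real.rpow_neg hu.le]; field_simp
  rw [lintegral_congr_ae e1, lintegral_const_mul' _ _ ENNReal.ofReal_ne_top,
    lintegral_lintegral_swap (by fun_prop)]
  have e2 : ∫⁻ l in Ioi (0:ℝ), ∫⁻ u, ENNReal.ofReal (l ^ (b - 1)) * ENNReal.ofReal (Real.exp (-(l * u))) ∂η =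
      ENNReal.ofReal (1 / a * Real.Gamma (b / a)) := by
    have h1 := _root_.integral_rpow_mul_exp_neg_rpow (p := a) (q := b - 1) ha (by linarith)
    have h2 := integrableOn_rpow_mul_exp_neg_rpow (p := a) (s := b - 1) (by linarith) ha
    rw [show b - 1 + 1 = b by ring] at h1
    rw [← h1, ofReal_integral_eq_lintegral_ofReal h2]
    · refine setLIntegral_congr_fun measurableSet_Ioi fun l hl => ?_
      have hl0 : 0 < l := hl
      rw [lintegral_const_mul' _ _ ENNReal.ofReal_ne_top, h.llap hl0.le, ENNReal.ofReal_mul (by positivity)]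
    · filter_upwards [ae_restrict_mem measurableSet_Ioi] with l hl
      have hl0 : 0 < l := hl
      positivity
  rw [e2, ← ENNReal.ofReal_mul (by positivity)]
  congr 1; field_simp

/-- convolution semigroup -/
lemma IsSub.etaT_add (h : IsSub a η) (ha : 0 < a) {s t : ℝ} (hs : 0 < s) (ht : 0 < t)
    {φ : ℝ → ℝ≥0∞} (hφ : Measurable φ) :
    ∫⁻ w, φ w ∂(etaT a η (s + t)) = ∫⁻ u, (∫⁻ v, φ (u + v) ∂(etaT a η t)) ∂(etaT a η s) := by
  have p1 := h.etaT_prob s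
  have p2 := h.etaT_prob t
  have p3 := h.etaT_prob (s + t)
  have hE : etaT a η (s + t) = ((etaT a η s).prod (etaT a η t)).map (fun p => p.1 + p.2) := by
    have : IsProbabilityMeasure (((etaT a η s).prod (etaT a η t)).map (fun p : ℝ × ℝ => p.1 + p.2)) :=
      Measure.isProbabilityMeasure_map (by fun_prop)
    have z0 : ∀ (ρ : Measure ℝ), (∀ᵐ u ∂ρ, 0 < u) → ρ (Iio 0) = 0 := by
      intro ρ hρ
      refine measure_mono_null (t := {u | ¬ 0 < u}) (fun u hu => ?_) hρ
      simp only [mem_ofPred_eq, not_lt]; exact le_of_lt hu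
    apply laplace_ext _ _ (z0 _ (h.etaT_ae_pos (by positivity)))
    · apply z0
      rw [ae_map_iff (by fun_prop) measurableSet_Ioi]
      have q1 := Measure.quasiMeasurePreserving_fst (μ := etaT a η s) (ν := etaT a η t) |>.ae (h.etaT_ae_pos hs)
      have q2 := Measure.quasiMeasurePreserving_snd (μ := etaT a η s) (ν := etaT a η t) |>.ae (h.etaT_ae_pos ht)
      filter_upwards [q1, q2] with p h1 h2
      exact add_pos h1 h2
    · intro n
      rw [integral_eq_lintegral_of_nonneg_ae (Eventually.of_forall fun u => (Real.exp_pos _).le)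
        (by fun_prop), integral_eq_lintegral_of_nonneg_ae (Eventually.of_forall fun u =>
        (Real.exp_pos _).le) (by fun_prop), h.etaT_llap ha (by positivity) (by positivity)]
      congr 1
      rw [lintegral_map (by fun_prop) (by fun_prop)]
      have : ∀ p : ℝ × ℝ, ENNReal.ofReal (Real.exp (-(n * (p.1 + p.2)))) =
          ENNReal.ofReal (Real.exp (-(n * p.1))) * ENNReal.ofReal (Real.exp (-(n * p.2))) := by
        intro p
        rw [← ENNReal.ofReal_mul (by positivity), ← Real.exp_add]; congr 2; ring
      simp_rw [this]
      rw [lintegral_prod_mul (f := fun u => ENNReal.ofReal (Real.exp (-(n * u))))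
        (g := fun u => ENNReal.ofReal (Real.exp (-(n * u)))) (by fun_prop) (by fun_prop),
        h.etaT_llap ha hs (by positivity), h.etaT_llap ha ht (by positivity),
        ← ENNReal.ofReal_mul (by positivity), ← Real.exp_add]
      congr 2; ring
  rw [hE, lintegral_map hφ (by fun_prop), lintegral_prod _ (by fun_prop)]

end

noncomputable section
open scoped ENNReal NNReal Topology

/-- radial Gaussian with killing -/
def gk (d : ℕ) (M r u : ℝ) : ℝ :=
  (4 * π * u) ^ (-(d:ℝ) / 2) * Real.exp (-(r ^ 2 / (4 * u))) * Real.exp (-(M * u))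

def kP (d : ℕ) (a : ℝ) (η : Measure ℝ) (M : ℝ) : ℝ × Ed d × Ed d → ℝ≥0∞ :=
  fun p => if 0 < p.1 then ∫⁻ u, ENNReal.ofReal (gk d M ‖p.2.2 - p.2.1‖ u) ∂(etaT a η p.1) else 0

@[fun_prop]
lemma measurable_gk (d : ℕ) (M : ℝ) : Measurable (fun p : ℝ × ℝ => gk d M p.1 p.2) := by
  unfold gk; fun_prop

@[fun_prop]
lemma measurable_gk1 (d : ℕ) (M r : ℝ) : Measurable (fun u : ℝ => gk d M r u) := by
  unfold gk; fun_prop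

lemma gk_nonneg (d : ℕ) (M r : ℝ) {u : ℝ} (hu : 0 < u) : 0 ≤ gk d M r u := by
  unfold gk; positivity

lemma gk_pos (d : ℕ) (M r : ℝ) {u : ℝ} (hu : 0 < u) : 0 < gk d M r u := by
  unfold gk; positivity

lemma gk_anti_r (d : ℕ) (M : ℝ) {r r' u : ℝ} (hu : 0 < u) (hr : 0 ≤ r) (h : r ≤ r') :
    gk d M r' u ≤ gk d M r u := by
  unfold gk; gcongr

lemma gk_anti_M (d : ℕ) (r : ℝ) {M M' u : ℝ} (hu : 0 < u) (h : M ≤ M') :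
    gk d M' r u ≤ gk d M r u := by
  unfold gk; gcongr

lemma gk_scale (d : ℕ) (M r : ℝ) {l u : ℝ} (hl : 0 < l) (hu : 0 < u) :
    gk d M r u = l ^ d * gk d (M / l ^ 2) (l * r) (l ^ 2 * u) := by
  unfold gk
  have e0 : (4 * π * (l ^ 2 * u)) ^ (-(d:ℝ) / 2) = (l ^ 2) ^ (-(d:ℝ) / 2) * (4 * π * u) ^ (-(d:ℝ) / 2) := by
    rw [← Real.mul_rpow (by positivity) (by positivity)]; congr 1; ring
  rw [e0,
    show (l * r) ^ 2 / (4 * (l ^ 2 * u)) = r ^ 2 / (4 * u) by field_simp,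
    show M / l ^ 2 * (l ^ 2 * u) = M * u by field_simp]
  have : l ^ d * (l ^ 2) ^ (-(d:ℝ) / 2) = 1 := by
    rw [← Real.rpow_natCast l d, ← Real.rpow_natCast l 2, ← Real.rpow_mul hl.le, ← Real.rpow_add hl]
    rw [show (d:ℝ) + ((2:ℕ):ℝ) * (-(d:ℝ) / 2) = 0 by push_cast; ring, Real.rpow_zero]
  calc _ = 1 * ((4 * π * u) ^ (-(d:ℝ) / 2) * Real.exp (-(r ^ 2 / (4 * u))) * Real.exp (-(M * u))) := by ring
    _ = _ := by rw [← this]; ring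

section
variable {d : ℕ} {a M : ℝ} {η : Measure ℝ}

lemma kP_eq {t : ℝ} (ht : 0 < t) (x y : Ed d) :
    kP d a η M (t, x, y) = ∫⁻ u, ENNReal.ofReal (gk d M ‖y - x‖ u) ∂(etaT a η t) := by
  simp [kP, ht]

lemma kP_zero (t : ℝ) (x y : Ed d) (ht : t ≤ 0) : kP d a η M (t, x, y) = 0 := by
  simp [kP, not_lt.2 ht]

lemma kP_symm (t : ℝ) (x y : Ed d) : kP d a η M (t, x, y) = kP d a η M (t, y, x) := by
  simp only [kP]; rw [norm_sub_rev]

lemma measurable_kP (h : IsSub a η) : Measurable (kP d a η M) := by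
  have := h.prob
  have e : kP d a η M = fun p => if 0 < p.1 then
      ∫⁻ u, ENNReal.ofReal (gk d M ‖p.2.2 - p.2.1‖ (p.1 ^ (1 / a) * u)) ∂η else 0 := by
    funext p
    simp only [kP]
    rw [lintegral_etaT _ _ _ (by fun_prop)]
  rw [e]
  refine Measurable.ite (measurableSet_lt (by fun_prop) (by fun_prop)) ?_ measurable_const
  refine Measurable.lintegral_prod_right' (f := fun w : (ℝ × Ed d × Ed d) × ℝ =>
    ENNReal.ofReal (gk d M ‖w.1.2.2 - w.1.2.1‖ (w.1.1 ^ (1 / a) * w.2))) ?_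
  unfold gk
  fun_prop

lemma gauss_lint {b : ℝ} (hb : 0 < b) (c : Ed d) :
    ∫⁻ z : Ed d, ENNReal.ofReal (Real.exp (-b * ‖z - c‖ ^ 2)) = ENNReal.ofReal ((π / b) ^ ((d:ℝ) / 2)) := by
  rw [lintegral_sub_right_eq_self (fun z : Ed d => ENNReal.ofReal (Real.exp (-b * ‖z‖ ^ 2))) c]
  have h1 := GaussianFourier.integral_rexp_neg_mul_sq_norm (V := Ed d) hb
  have hintg : Integrable (fun v : Ed d => Real.exp (-b * ‖v‖ ^ 2)) := by
    by_contra hn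
    rw [integral_undef hn] at h1
    have : 0 < (π / b) ^ ((Module.finrank ℝ (Ed d) : ℝ) / 2) := by positivity
    linarith
  rw [← ofReal_integral_eq_lintegral_ofReal hintg (Eventually.of_forall fun v => (Real.exp_pos _).le), h1]
  simp

lemma gk_conv (x y : Ed d) {u v : ℝ} (hu : 0 < u) (hv : 0 < v) :
    ∫⁻ z : Ed d, ENNReal.ofReal (gk d M ‖z - x‖ u) * ENNReal.ofReal (gk d M ‖y - z‖ v) =
      ENNReal.ofReal (gk d M ‖y - x‖ (u + v)) := by
  set b := (u + v) / (4 * u * v) with hb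
  have hb0 : 0 < b := by positivity
  set c : Ed d := (v / (u + v)) • x + (u / (u + v)) • y with hc
  have hsq : ∀ z : Ed d, ‖z - x‖ ^ 2 / (4 * u) + ‖y - z‖ ^ 2 / (4 * v) =
      b * ‖z - c‖ ^ 2 + ‖y - x‖ ^ 2 / (4 * (u + v)) := by
    intro z
    have e1 : z - c = (v / (u + v)) • (z - x) - (u / (u + v)) • (y - z) := by
      have : z = ((v / (u + v)) + (u / (u + v))) • z := by
        rw [show v / (u + v) + u / (u + v) = 1 by field_simp; ring, one_smul]
      rw [hc]; nth_rewrite 1 [this]; module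
    have e2 : y - x = (z - x) + (y - z) := by abel
    rw [e1, e2]
    generalize z - x = X
    generalize y - z = Y
    rw [norm_sub_sq_real, norm_add_sq_real, norm_smul, norm_smul, inner_smul_left, inner_smul_right,
      Real.norm_of_nonneg (by positivity), Real.norm_of_nonneg (by positivity), hb]
    simp only [conj_trivial]
    field_simp
    ring
  have e : ∀ z : Ed d, ENNReal.ofReal (gk d M ‖z - x‖ u) * ENNReal.ofReal (gk d M ‖y - z‖ v) =
      ENNReal.ofReal ((4 * π * u) ^ (-(d:ℝ) / 2) * (4 * π * v) ^ (-(d:ℝ) / 2) *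
        Real.exp (-(‖y - x‖ ^ 2 / (4 * (u + v)))) * Real.exp (-(M * (u + v)))) *
        ENNReal.ofReal (Real.exp (-b * ‖z - c‖ ^ 2)) := by
    intro z
    rw [← ENNReal.ofReal_mul (gk_nonneg _ _ _ hu), ← ENNReal.ofReal_mul (by positivity)]
    congr 1
    unfold gk
    have : Real.exp (-(‖z - x‖ ^ 2 / (4 * u))) * Real.exp (-(‖y - z‖ ^ 2 / (4 * v))) =
        Real.exp (-(‖y - x‖ ^ 2 / (4 * (u + v)))) * Real.exp (-b * ‖z - c‖ ^ 2) := by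
      rw [← Real.exp_add, ← Real.exp_add]; congr 1; linarith [hsq z]
    have h2 : Real.exp (-(M * u)) * Real.exp (-(M * v)) = Real.exp (-(M * (u + v))) := by
      rw [← Real.exp_add]; congr 1; ring
    calc _ = (4 * π * u) ^ (-(d:ℝ) / 2) * (4 * π * v) ^ (-(d:ℝ) / 2) *
        (Real.exp (-(‖z - x‖ ^ 2 / (4 * u))) * Real.exp (-(‖y - z‖ ^ 2 / (4 * v)))) *
        (Real.exp (-(M * u)) * Real.exp (-(M * v))) := by ring
      _ = _ := by rw [this, h2]; ring
  simp_rw [e]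
  rw [lintegral_const_mul' _ _ ENNReal.ofReal_ne_top, gauss_lint hb0, ← ENNReal.ofReal_mul (by positivity)]
  congr 1
  unfold gk
  have : (4 * π * u) ^ (-(d:ℝ) / 2) * (4 * π * v) ^ (-(d:ℝ) / 2) * (π / b) ^ ((d:ℝ) / 2) =
      (4 * π * (u + v)) ^ (-(d:ℝ) / 2) := by
    have h1 : (π / b) ^ ((d:ℝ) / 2) = (b / π) ^ (-(d:ℝ) / 2) := by
      rw [neg_div, Real.rpow_neg (by positivity), ← Real.inv_rpow (by positivity), inv_div]
    rw [h1, ← Real.mul_rpow (by positivity) (by positivity), ← Real.mul_rpow (by positivity) (by positivity)]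
    congr 1
    rw [hb]; field_simp
  rw [← this]; ring

lemma kP_CK (h : IsSub a η) (ha : 0 < a) : CKprop (kP d a η M) := by
  intro s t x y hs ht
  rw [kP_eq (by positivity), h.etaT_add ha hs ht (by fun_prop)]
  simp_rw [kP_eq hs, kP_eq ht]
  have p1 := h.etaT_prob s
  have p2 := h.etaT_prob t
  have e : ∀ z : Ed d, (∫⁻ u, ENNReal.ofReal (gk d M ‖z - x‖ u) ∂(etaT a η s)) *
      ∫⁻ v, ENNReal.ofReal (gk d M ‖y - z‖ v) ∂(etaT a η t) =
      ∫⁻ u, (∫⁻ v, ENNReal.ofReal (gk d M ‖z - x‖ u) * ENNReal.ofReal (gk d M ‖y - z‖ v) ∂(etaT a η t))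
        ∂(etaT a η s) := by
    intro z
    rw [← lintegral_mul_const _ (by fun_prop)]
    refine lintegral_congr fun u => ?_
    rw [lintegral_const_mul _ (by fun_prop)]
  simp_rw [e]
  have hm : Measurable (fun w : (Ed d × ℝ) × ℝ => ENNReal.ofReal (gk d M ‖w.1.1 - x‖ w.1.2) *
      ENNReal.ofReal (gk d M ‖y - w.1.1‖ w.2)) := by unfold gk; fun_prop
  rw [lintegral_lintegral_swap (f := fun (z : Ed d) (u : ℝ) => ∫⁻ v, ENNReal.ofReal (gk d M ‖z - x‖ u) *
    ENNReal.ofReal (gk d M ‖y - z‖ v) ∂(etaT a η t)) (by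
      exact (Measurable.lintegral_prod_right' hm).aemeasurable)]
  refine lintegral_congr_ae ?_
  filter_upwards [h.etaT_ae_pos hs] with u hu
  rw [lintegral_lintegral_swap (by unfold gk; fun_prop)]
  refine lintegral_congr_ae ?_
  filter_upwards [h.etaT_ae_pos ht] with v hv
  rw [gk_conv x y hu hv]

lemma kP_anti_M (h : IsSub a η) {M M' : ℝ} (hM : M ≤ M') (p) : kP d a η M' p ≤ kP d a η M p := by
  unfold kP
  split_ifs with ht
  · refine lintegral_mono_ae ?_
    filter_upwards [h.etaT_ae_pos ht] with u hu
    exact ENNReal.ofReal_le_ofReal (gk_anti_M _ _ hu hM)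
  · exact le_rfl

lemma gk_mass (x : Ed d) {u : ℝ} (hu : 0 < u) : ∫⁻ z : Ed d, ENNReal.ofReal (gk d 0 ‖z - x‖ u) = 1 := by
  have := gauss_lint (d := d) (b := 1 / (4 * u)) (by positivity) x
  have e : ∀ z : Ed d, ENNReal.ofReal (gk d 0 ‖z - x‖ u) = ENNReal.ofReal ((4 * π * u) ^ (-(d:ℝ) / 2)) *
      ENNReal.ofReal (Real.exp (-(1 / (4 * u)) * ‖z - x‖ ^ 2)) := by
    intro z
    rw [← ENNReal.ofReal_mul (by positivity)]
    congr 1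
    unfold gk
    rw [zero_mul, neg_zero, Real.exp_zero, mul_one]
    congr 2; ring
  simp_rw [e]
  rw [lintegral_const_mul' _ _ ENNReal.ofReal_ne_top, this, ← ENNReal.ofReal_mul (by positivity)]
  rw [show π / (1 / (4 * u)) = 4 * π * u by field_simp, ← Real.rpow_add (by positivity)]
  rw [show -(d:ℝ) / 2 + d / 2 = 0 by ring, Real.rpow_zero, ENNReal.ofReal_one]

lemma kP_mass (h : IsSub a η) {t : ℝ} (ht : 0 < t) (x : Ed d) :
    ∫⁻ z, kP d a η 0 (t, x, z) = 1 := by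
  have := h.etaT_prob t
  simp_rw [kP_eq ht]
  rw [lintegral_lintegral_swap (by unfold gk; fun_prop)]
  calc _ = ∫⁻ u, 1 ∂(etaT a η t) := by
        refine lintegral_congr_ae ?_
        filter_upwards [h.etaT_ae_pos ht] with u hu
        exact gk_mass x hu
    _ = 1 := by simp

lemma kP_mass_le (h : IsSub a η) (hM : 0 ≤ M) (t : ℝ) (x : Ed d) :
    ∫⁻ z, kP d a η M (t, x, z) ≤ 1 := by
  rcases lt_or_ge 0 t with ht | ht
  · rw [← kP_mass h ht x]; exact lintegral_mono fun z => kP_anti_M h hM _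
  · simp [kP_zero _ _ _ ht]

/-- scaling -/
lemma kP_scale (h : IsSub a η) {c l : ℝ} (hc : 0 < c) (hl : 0 < l) (hcl : c ^ (1 / a) = l ^ 2)
    (t : ℝ) (x y : Ed d) :
    kP d a η M (t, x, y) = ENNReal.ofReal (l ^ d) * kP d a η (M / l ^ 2) (c * t, l • x, l • y) := by
  rcases lt_or_ge 0 t with ht | ht
  · rw [kP_eq ht, kP_eq (by positivity), lintegral_etaT _ _ _ (by fun_prop),
      lintegral_etaT _ _ _ (by fun_prop), ← lintegral_const_mul' _ _ ENNReal.ofReal_ne_top]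
    refine lintegral_congr_ae ?_
    filter_upwards [h.ae_pos] with u hu
    have hp : 0 < t ^ (1 / a) * u := mul_pos (Real.rpow_pos_of_pos ht _) hu
    rw [← ENNReal.ofReal_mul (by positivity), gk_scale d M _ hl hp, ← smul_sub, norm_smul,
      Real.norm_of_nonneg hl.le, Real.mul_rpow hc.le ht.le, hcl, mul_assoc (l ^ 2)]
  · rw [kP_zero _ _ _ ht, kP_zero _ _ _ (by nlinarith), mul_zero]

end

noncomputable section
open scoped ENNReal NNReal Topology

lemma rpow_le_exp (b : ℝ) (hb : 0 ≤ b) : ∃ C : ℝ, 0 < C ∧ ∀ w : ℝ, 0 < w → w ^ b ≤ C * Real.exp w := by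
  set n := ⌈b⌉₊
  refine ⟨n.factorial * Real.exp 1, by positivity, fun w hw => ?_⟩
  have h1 : w ^ b ≤ (1 + w) ^ (n:ℝ) :=
    (Real.rpow_le_rpow hw.le (by linarith) hb).trans
      (Real.rpow_le_rpow_of_exponent_le (by linarith) (Nat.le_ceil b))
  rw [Real.rpow_natCast] at h1
  have h2 := Real.pow_div_factorial_le_exp (x := 1 + w) (by linarith) n
  rw [div_le_iff₀ (by positivity), Real.exp_add] at h2
  linarith

section
variable {d : ℕ} {a M : ℝ} {η : Measure ℝ}

lemma gk_le_u (hM : 0 ≤ M) (r : ℝ) {u : ℝ} (hu : 0 < u) :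
    gk d M r u ≤ (4 * π) ^ (-(d:ℝ) / 2) * u ^ (-(d:ℝ) / 2) := by
  unfold gk
  rw [Real.mul_rpow (by positivity) hu.le, mul_assoc _ (Real.exp _)]
  have h1 : Real.exp (-(r ^ 2 / (4 * u))) ≤ 1 := Real.exp_le_one_iff.2 (by
    have : 0 ≤ r ^ 2 / (4 * u) := by positivity
    linarith)
  have h2 : Real.exp (-(M * u)) ≤ 1 := Real.exp_le_one_iff.2 (by
    have : 0 ≤ M * u := by positivity
    linarith)
  have : Real.exp (-(r ^ 2 / (4 * u))) * Real.exp (-(M * u)) ≤ 1 :=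
    mul_le_one₀ h1 (Real.exp_pos _).le h2
  exact mul_le_of_le_one_right (by positivity) this

lemma kP_le_time (h : IsSub a η) (ha : 0 < a) (hd : 0 < d) : ∃ C : ℝ, 0 < C ∧ ∀ M : ℝ, 0 ≤ M → ∀ s, 0 < s →
    ∀ x y : Ed d, kP d a η M (s, x, y) ≤ ENNReal.ofReal (C * s ^ (-(d:ℝ) / (2 * a))) := by
  have hd' : (0:ℝ) < d := by exact_mod_cast hd
  have hm := h.neg_moment ha (b := d / 2) (by positivity)
  set N := Real.Gamma ((d:ℝ) / 2 / a) / (a * Real.Gamma (d / 2))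
  have hN : 0 < N := by
    have h1 := Real.Gamma_pos_of_pos (show 0 < (d:ℝ) / 2 / a by positivity)
    have h2 := Real.Gamma_pos_of_pos (show 0 < (d:ℝ) / 2 by positivity)
    positivity
  refine ⟨(4 * π) ^ (-(d:ℝ) / 2) * N, by positivity, fun M hM s hs x y => ?_⟩
  rw [kP_eq hs, lintegral_etaT _ _ _ (by fun_prop)]
  calc _ ≤ ∫⁻ u, ENNReal.ofReal ((4 * π) ^ (-(d:ℝ) / 2) * s ^ (-(d:ℝ) / (2 * a))) *
        ENNReal.ofReal (u ^ (-((d:ℝ) / 2))) ∂η := by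
        refine lintegral_mono_ae ?_
        filter_upwards [h.ae_pos] with u hu
        have hp : 0 < s ^ (1 / a) := Real.rpow_pos_of_pos hs _
        rw [← ENNReal.ofReal_mul (by positivity)]
        apply ENNReal.ofReal_le_ofReal
        refine (gk_le_u hM _ (mul_pos hp hu)).trans (le_of_eq ?_)
        rw [Real.mul_rpow hp.le hu.le, ← Real.rpow_mul hs.le]
        rw [show 1 / a * (-(d:ℝ) / 2) = -(d:ℝ) / (2 * a) by field_simp, show -(d:ℝ) / 2 = -((d:ℝ) / 2) by ring]
        ring
    _ = _ := by
        rw [lintegral_const_mul' _ _ ENNReal.ofReal_ne_top, hm, ← ENNReal.ofReal_mul (by positivity)]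
        congr 1; ring

lemma gk_le_r (d : ℕ) : ∃ C : ℝ, 0 < C ∧ ∀ M : ℝ, 0 ≤ M → ∀ r u : ℝ, 0 < r → 0 < u →
    gk d M r u ≤ C * r ^ (-(d:ℝ)) := by
  obtain ⟨C, hC, H⟩ := rpow_le_exp ((d:ℝ) / 2) (by positivity)
  refine ⟨C, hC, fun M hM r u hr hu => ?_⟩
  have hw : 0 < r ^ 2 / (4 * u) := by positivity
  have h2 : Real.exp (-(M * u)) ≤ 1 := Real.exp_le_one_iff.2 (by
    have : 0 ≤ M * u := by positivity
    linarith)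
  unfold gk
  have e : (4 * π * u) ^ (-(d:ℝ) / 2) = π ^ (-(d:ℝ) / 2) * (r ^ (-(d:ℝ)) * (r ^ 2 / (4 * u)) ^ ((d:ℝ) / 2)) := by
    rw [Real.div_rpow (by positivity) (by positivity), ← Real.rpow_natCast r 2, ← Real.rpow_mul hr.le]
    rw [show ((2:ℕ):ℝ) * ((d:ℝ) / 2) = d by push_cast; ring, show 4 * π * u = π * (4 * u) by ring,
      Real.mul_rpow (by positivity) (by positivity), neg_div, Real.rpow_neg (show 0 ≤ 4 * u by positivity),
      Real.rpow_neg hr.le]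
    have : r ^ (d:ℝ) ≠ 0 := by positivity
    field_simp
  rw [e]
  have hpi : π ^ (-(d:ℝ) / 2) ≤ 1 :=
    Real.rpow_le_one_of_one_le_of_nonpos (by linarith [Real.pi_gt_three]) (by
      have : (0:ℝ) ≤ d := by positivity
      linarith)
  have h3 : (r ^ 2 / (4 * u)) ^ ((d:ℝ) / 2) * Real.exp (-(r ^ 2 / (4 * u))) ≤ C := by
    have := H _ hw
    rw [Real.exp_neg, ← div_eq_mul_inv, div_le_iff₀ (Real.exp_pos _)]; exact this
  calc _ = π ^ (-(d:ℝ) / 2) * (r ^ (-(d:ℝ)) * ((r ^ 2 / (4 * u)) ^ ((d:ℝ) / 2) *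
        Real.exp (-(r ^ 2 / (4 * u))))) * Real.exp (-(M * u)) := by ring
    _ ≤ 1 * (r ^ (-(d:ℝ)) * C) * 1 := by gcongr
    _ = _ := by ring

lemma kP_le_space (h : IsSub a η) (d : ℕ) : ∃ C : ℝ, 0 < C ∧ ∀ M : ℝ, 0 ≤ M → ∀ s,
    ∀ x y : Ed d, x ≠ y → kP d a η M (s, x, y) ≤ ENNReal.ofReal (C * ‖y - x‖ ^ (-(d:ℝ))) := by
  obtain ⟨C, hC, H⟩ := gk_le_r d
  refine ⟨C, hC, fun M hM s x y hxy => ?_⟩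
  rcases lt_or_ge 0 s with hs | hs
  · have := h.etaT_prob s
    rw [kP_eq hs]
    calc _ ≤ ∫⁻ u, ENNReal.ofReal (C * ‖y - x‖ ^ (-(d:ℝ))) ∂(etaT a η s) := by
          refine lintegral_mono_ae ?_
          filter_upwards [h.etaT_ae_pos hs] with u hu
          exact ENNReal.ofReal_le_ofReal (H M hM _ _ (norm_pos_iff.2 (sub_ne_zero.2 hxy.symm)) hu)
      _ = _ := by simp
  · rw [kP_zero _ _ _ hs]; simp

lemma kP_pos (h : IsSub a η) {t : ℝ} (ht : 0 < t) (x y : Ed d) : 0 < kP d a η M (t, x, y) := by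
  have := h.etaT_prob t
  rw [kP_eq ht, pos_iff_ne_zero]
  intro h0
  rw [lintegral_eq_zero_iff (by fun_prop)] at h0
  have : ∀ᵐ u ∂(etaT a η t), False := by
    filter_upwards [h0, h.etaT_ae_pos ht] with u h1 hu
    have := ENNReal.ofReal_pos.2 (gk_pos d M ‖y - x‖ hu)
    simp only [Pi.zero_apply] at h1
    exact absurd h1 this.ne'
  rw [eventually_false_iff_eq_bot, ae_eq_bot] at this
  exact IsProbabilityMeasure.ne_zero _ this

lemma cos_gauss (w : Ed d) {u : ℝ} (hu : 0 < u) :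
    ∫ z : Ed d, Real.cos ⟪w, z⟫ * Real.exp (-(u * ‖z‖ ^ 2)) =
      (π / u) ^ ((d:ℝ) / 2) * Real.exp (-(‖w‖ ^ 2 / (4 * u))) := by
  have h1 := GaussianFourier.integral_cexp_neg_mul_sq_norm_add (b := (u:ℂ)) (by simpa using hu) Complex.I w
  have hi := GaussianFourier.integrable_cexp_neg_mul_sq_norm_add (b := (u:ℂ)) (by simpa using hu) Complex.I w
  have h2 := congrArg Complex.re h1
  rw [← RCLike.re_eq_complex_re, ← integral_re hi] at h2
  have e1 : ∀ z : Ed d, Real.cos ⟪w, z⟫ * Real.exp (-(u * ‖z‖ ^ 2)) =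
      RCLike.re (Complex.exp (-(u:ℂ) * (‖z‖:ℂ) ^ 2 + Complex.I * (⟪w, z⟫ : ℝ))) := by
    intro z
    rw [RCLike.re_eq_complex_re, Complex.exp_re]
    simp [← Complex.ofReal_pow]
    ring
  simp_rw [e1]
  rw [h2]
  have e2 : ((π:ℂ) / (u:ℂ)) ^ ((Module.finrank ℝ (Ed d) : ℂ) / 2) *
      Complex.exp (Complex.I ^ 2 * (‖w‖:ℂ) ^ 2 / (4 * (u:ℂ))) =
      (((π / u) ^ ((d:ℝ) / 2) * Real.exp (-(‖w‖ ^ 2 / (4 * u))) : ℝ) : ℂ) := by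
    rw [Complex.ofReal_mul, Complex.ofReal_cpow (by positivity), Complex.ofReal_exp]
    congr 2
    · push_cast; rfl
    · simp
    · push_cast; rw [Complex.I_sq]; ring
  rw [e2]; exact Complex.ofReal_re _

lemma kP_ident (h : IsSub a η) (ha : 0 < a) (hd : 0 < d) (hM : 0 ≤ M) {t : ℝ} (ht : 0 < t) (x y : Ed d) :
    (2 * π) ^ (-(d:ℝ)) * ∫ z : Ed d, Real.cos ⟪y - x, z⟫ * Real.exp (-t * (‖z‖ ^ 2 + M) ^ a) =
      (kP d a η M (t, x, y)).toReal := by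
  set w := y - x with hw
  have hpr := h.etaT_prob t
  have hd' : (0:ℝ) < d := by exact_mod_cast hd
  have e1 : ∀ z : Ed d, Real.exp (-t * (‖z‖ ^ 2 + M) ^ a) =
      ∫ u, Real.exp (-((‖z‖ ^ 2 + M) * u)) ∂(etaT a η t) := by
    intro z
    rw [integral_eq_lintegral_of_nonneg_ae (Eventually.of_forall fun u => (Real.exp_pos _).le)
      (by fun_prop), h.etaT_llap ha ht (by positivity), ENNReal.toReal_ofReal (by positivity)]
    congr 1; ring
  have hintg : Integrable (fun p : Ed d × ℝ => Real.cos ⟪w, p.1⟫ * Real.exp (-((‖p.1‖ ^ 2 + M) * p.2)))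
      (volume.prod (etaT a η t)) := by
    refine ⟨by fun_prop, ?_⟩
    have hmm : Measurable (fun p : Ed d × ℝ => ENNReal.ofReal (Real.exp (-(p.2) * ‖p.1 - 0‖ ^ 2))) := by
      fun_prop
    have fin : ∫⁻ p : Ed d × ℝ, ENNReal.ofReal (Real.exp (-(p.2) * ‖p.1 - 0‖ ^ 2))
        ∂(volume.prod (etaT a η t)) < ∞ := by
      rw [lintegral_prod_symm' _ hmm]
      have : ∫⁻ u, (∫⁻ z : Ed d, ENNReal.ofReal (Real.exp (-u * ‖z - 0‖ ^ 2))) ∂(etaT a η t) =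
          ∫⁻ u, ENNReal.ofReal ((π / u) ^ ((d:ℝ) / 2)) ∂(etaT a η t) := by
        refine lintegral_congr_ae ?_
        filter_upwards [h.etaT_ae_pos ht] with u hu
        exact gauss_lint hu 0
      refine lt_of_eq_of_lt this ?_
      rw [lintegral_etaT _ _ _ (by fun_prop)]
      have hp : 0 < t ^ (1 / a) := Real.rpow_pos_of_pos ht _
      have : ∫⁻ u, ENNReal.ofReal ((π / (t ^ (1 / a) * u)) ^ ((d:ℝ) / 2)) ∂η =
          ENNReal.ofReal ((π / t ^ (1 / a)) ^ ((d:ℝ) / 2)) * ∫⁻ u, ENNReal.ofReal (u ^ (-((d:ℝ) / 2))) ∂η := by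
        rw [← lintegral_const_mul' _ _ ENNReal.ofReal_ne_top]
        refine lintegral_congr_ae ?_
        filter_upwards [h.ae_pos] with u hu
        rw [← ENNReal.ofReal_mul (by positivity), ← div_div, Real.div_rpow (by positivity) hu.le,
          Real.rpow_neg hu.le]
        rfl
      rw [this, h.neg_moment ha (by positivity)]
      exact ENNReal.mul_lt_top ENNReal.ofReal_lt_top ENNReal.ofReal_lt_top
    refine lt_of_le_of_lt ?_ fin
    have hae : ∀ᵐ p ∂((volume : Measure (Ed d)).prod (etaT a η t)), 0 < p.2 :=
      Measure.quasiMeasurePreserving_snd.ae (h.etaT_ae_pos ht)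
    refine lintegral_mono_ae ?_
    filter_upwards [hae] with p hp
    rw [← ofReal_norm]
    apply ENNReal.ofReal_le_ofReal
    rw [norm_mul, Real.norm_eq_abs, Real.norm_eq_abs, Real.abs_exp, sub_zero]
    have : Real.exp (-((‖p.1‖ ^ 2 + M) * p.2)) ≤ Real.exp (-(p.2) * ‖p.1‖ ^ 2) := by
      rw [Real.exp_le_exp]; nlinarith [mul_nonneg hM hp.le]
    calc _ ≤ 1 * Real.exp (-(p.2) * ‖p.1‖ ^ 2) := by
          gcongr; exact Real.abs_cos_le_one _
      _ = _ := one_mul _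
  have e4 : ∀ z : Ed d, Real.cos ⟪w, z⟫ * ∫ u, Real.exp (-((‖z‖ ^ 2 + M) * u)) ∂(etaT a η t) =
      ∫ u, Real.cos ⟪w, z⟫ * Real.exp (-((‖z‖ ^ 2 + M) * u)) ∂(etaT a η t) :=
    fun z => (integral_const_mul _ _).symm
  simp_rw [e1, e4]
  rw [integral_integral_swap (f := fun (z : Ed d) (u : ℝ) => Real.cos ⟪w, z⟫ * Real.exp (-((‖z‖ ^ 2 + M) * u))) hintg,
    kP_eq ht, ← hw, ← integral_const_mul, ← integral_toReal (by fun_prop) (by simp)]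
  refine integral_congr_ae ?_
  filter_upwards [h.etaT_ae_pos ht] with u hu
  rw [ENNReal.toReal_ofReal (gk_nonneg _ _ _ hu)]
  have e2 : ∀ z : Ed d, Real.cos ⟪w, z⟫ * Real.exp (-((‖z‖ ^ 2 + M) * u)) =
      Real.cos ⟪w, z⟫ * Real.exp (-(u * ‖z‖ ^ 2)) * Real.exp (-(M * u)) := by
    intro z; rw [mul_assoc, ← Real.exp_add]; congr 2; ring
  simp_rw [e2]
  rw [integral_mul_const, cos_gauss w hu]
  unfold gk
  have e3 : (2 * π) ^ (-(d:ℝ)) * (π / u) ^ ((d:ℝ) / 2) = (4 * π * u) ^ (-(d:ℝ) / 2) := by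
    have h1 : (2 * π) ^ (-(d:ℝ)) = (4 * π ^ 2) ^ (-(d:ℝ) / 2) := by
      rw [show 4 * π ^ 2 = (2 * π) ^ 2 by ring, ← Real.rpow_natCast (2 * π) 2, ← Real.rpow_mul (by positivity)]
      congr 1; push_cast; ring
    have h2 : (π / u) ^ ((d:ℝ) / 2) = (u / π) ^ (-(d:ℝ) / 2) := by
      rw [neg_div, Real.rpow_neg (by positivity), ← Real.inv_rpow (by positivity), inv_div]
    rw [h1, h2, ← Real.mul_rpow (by positivity) (by positivity)]
    congr 1; field_simp
  rw [← e3]; ring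

lemma kP_ne_top (h : IsSub a η) (ha : 0 < a) (hd : 0 < d) (hM : 0 ≤ M) (t : ℝ) (x y : Ed d) :
    kP d a η M (t, x, y) ≠ ∞ := by
  rcases lt_or_ge 0 t with ht | ht
  · obtain ⟨C, -, H⟩ := kP_le_time (d := d) h ha hd
    exact ne_top_of_le_ne_top ENNReal.ofReal_ne_top (H M hM t ht x y)
  · rw [kP_zero _ _ _ ht]; simp

lemma relKernel_eq (h : IsSub a η) (ha : 0 < a) (hd : 0 < d) {t : ℝ} (ht : 0 < t) (x y : Ed d) :
    relKernel d (2 * a) 1 t x y = (kP d a η 1 (t, x, y)).toReal := by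
  rw [← kP_ident h ha hd zero_le_one ht, relKernel, Real.one_rpow, mul_div_cancel_left₀ _ two_ne_zero]

lemma fracKernel_eq (h : IsSub a η) (ha : 0 < a) (hd : 0 < d) {t : ℝ} (ht : 0 < t) (x y : Ed d) :
    fracKernel d (2 * a) t x y = (kP d a η 0 (t, x, y)).toReal := by
  rw [← kP_ident h ha hd le_rfl ht, fracKernel]
  congr 2; funext z
  rw [add_zero, ← Real.rpow_natCast ‖z‖ 2, ← Real.rpow_mul (norm_nonneg _)]
  norm_num

end

noncomputable section
open scoped ENNReal NNReal Topology

def JJ (d : ℕ) (a M v : ℝ) : ℝ≥0∞ :=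
  ∫⁻ r in Ioi (1:ℝ), ENNReal.ofReal (gk d M v r) * ENNReal.ofReal (r ^ (-1 - a))

section
variable {d : ℕ} {a M : ℝ} {η : Measure ℝ}

lemma titu {w A p q : ℝ} (hp : 0 < p) (hq : 0 < q) : (w + A) ^ 2 / (p + q) ≤ w ^ 2 / p + A ^ 2 / q := by
  rw [div_add_div _ _ hp.ne' hq.ne', div_le_div_iff₀ (by positivity) (by positivity)]
  nlinarith [sq_nonneg (w * q - A * p), mul_pos hp hq]

lemma gk_shift (d : ℕ) (M0 : ℝ) : ∃ C : ℝ, 0 < C ∧ ∀ M, 0 ≤ M → M ≤ M0 → ∀ w v u y : ℝ, 1 ≤ w → 0 ≤ v →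
    v ≤ w + 4 → 0 < u → y ∈ Ico (10:ℝ) 11 → gk d M w u ≤ C * gk d M v (u + y) := by
  obtain ⟨C, hC, H⟩ := rpow_le_exp ((d:ℝ) / 2) (by positivity)
  refine ⟨(288 / 5) ^ ((d:ℝ) / 2) * C * Real.exp 2 * Real.exp (11 * M0), by positivity, ?_⟩
  intro M hM hM0 w v u y hw hv hvw hu hy
  obtain ⟨hy1, hy2⟩ := hy
  have hw' := H (5 / 24 * (1 / u + 1)) (by positivity)
  have hv2 : v ^ 2 / (4 * (u + y)) ≤ w ^ 2 / (4 * (u + 5)) + 4 / 5 := by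
    have h1 : v ^ 2 / (4 * (u + y)) ≤ (w + 4) ^ 2 / (4 * (u + 5) + 20) := by
      apply div_le_div₀ (by positivity) _ (by positivity) (by linarith)
      nlinarith
    have := titu (w := w) (A := 4) (p := 4 * (u + 5)) (q := 20) (by positivity) (by norm_num)
    norm_num at this ⊢
    linarith
  have hw2 : 5 / 24 * (1 / u - 1) ≤ w ^ 2 / (4 * u) - w ^ 2 / (4 * (u + 5)) := by
    have e : w ^ 2 / (4 * u) - w ^ 2 / (4 * (u + 5)) = w ^ 2 * (5 / (4 * u * (u + 5))) := by
      field_simp; ring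
    rw [e]
    have h1 : 5 / (4 * u * (u + 5)) ≤ w ^ 2 * (5 / (4 * u * (u + 5))) := by
      apply le_mul_of_one_le_left (by positivity); nlinarith
    refine le_trans ?_ h1
    rw [show 5 / 24 * (1 / u - 1) = 5 * (1 - u) / (24 * u) by field_simp,
      div_le_div_iff₀ (by positivity) (by positivity)]
    nlinarith [sq_nonneg u, mul_pos hu hu, mul_pos (mul_pos hu hu) hu, sq_nonneg (u-1)]
  have e1 : (4 * π * u) ^ (-(d:ℝ) / 2) = (4 * π * (u + y)) ^ (-(d:ℝ) / 2) * ((u + y) / u) ^ ((d:ℝ) / 2) := by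
    have huy : 0 < u + y := by linarith
    rw [Real.div_rpow huy.le hu.le, Real.mul_rpow (by positivity) hu.le, Real.mul_rpow (by positivity) huy.le,
      neg_div, Real.rpow_neg hu.le, Real.rpow_neg huy.le]
    have : (u + y) ^ ((d:ℝ) / 2) ≠ 0 := by positivity
    field_simp
  have e2 : ((u + y) / u) ^ ((d:ℝ) / 2) ≤ (288 / 5) ^ ((d:ℝ) / 2) * (C * Real.exp (5 / 24 * (1 / u + 1))) := by
    calc _ ≤ (288 / 5 * (5 / 24 * (1 / u + 1))) ^ ((d:ℝ) / 2) := by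
          apply Real.rpow_le_rpow (by positivity) _ (by positivity)
          rw [show 288 / 5 * (5 / 24 * (1 / u + 1)) = 12 * (1 + u) / u by field_simp; ring]
          apply div_le_div_of_nonneg_right _ hu.le
          linarith
      _ = (288 / 5) ^ ((d:ℝ) / 2) * (5 / 24 * (1 / u + 1)) ^ ((d:ℝ) / 2) :=
          Real.mul_rpow (by positivity) (by positivity)
      _ ≤ _ := by gcongr
  unfold gk
  rw [e1]
  have e3 : Real.exp (5 / 24 * (1 / u + 1)) * Real.exp (-(w ^ 2 / (4 * u))) * Real.exp (-(M * u)) ≤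
      Real.exp 2 * Real.exp (11 * M0) * Real.exp (-(v ^ 2 / (4 * (u + y)))) * Real.exp (-(M * (u + y))) := by
    simp only [← Real.exp_add]
    rw [Real.exp_le_exp]
    nlinarith [mul_le_mul hM0 hy2.le (by linarith) (by linarith)]
  calc _ ≤ (4 * π * (u + y)) ^ (-(d:ℝ) / 2) * ((288 / 5) ^ ((d:ℝ) / 2) * (C * Real.exp (5 / 24 * (1 / u + 1)))) *
        Real.exp (-(w ^ 2 / (4 * u))) * Real.exp (-(M * u)) := by
        have : 0 < u + y := by linarith
        gcongr
    _ = (4 * π * (u + y)) ^ (-(d:ℝ) / 2) * (288 / 5) ^ ((d:ℝ) / 2) * C * (Real.exp (5 / 24 * (1 / u + 1)) *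
        Real.exp (-(w ^ 2 / (4 * u))) * Real.exp (-(M * u))) := by ring
    _ ≤ (4 * π * (u + y)) ^ (-(d:ℝ) / 2) * (288 / 5) ^ ((d:ℝ) / 2) * C * (Real.exp 2 * Real.exp (11 * M0) * Real.exp (-(v ^ 2 / (4 * (u + y)))) * Real.exp (-(M * (u + y)))) := by
        have : 0 < u + y := by linarith
        gcongr
    _ = _ := by ring

lemma measurable_JJ_int (v : ℝ) :
    Measurable (fun r => ENNReal.ofReal (gk d M v r) * ENNReal.ofReal (r ^ (-1 - a))) := by
  fun_prop

lemma kP_le_J1 (h : IsSub a η) (ha : 0 < a) (ha1 : a < 1) (d : ℕ) (M0 : ℝ) : ∃ C : ℝ, 0 < C ∧ ∀ M, 0 ≤ M → M ≤ M0 →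
    ∀ s ∈ Ioc (0:ℝ) 1, ∀ x y : Ed d, 1 ≤ ‖y - x‖ → ∀ v, 0 ≤ v → v ≤ ‖y - x‖ + 4 →
    kP d a η M (s, x, y) ≤ ENNReal.ofReal C * JJ d a M v := by
  obtain ⟨C1, hC1, H1⟩ := gk_shift d M0
  obtain ⟨C2, hC2, H2⟩ := h.cmp_up ha ha1
  refine ⟨C2 * C1, by positivity, fun M hM hM0 s hs x y hw v hv hvw => ?_⟩
  rw [kP_eq hs.1]
  refine (H2 s hs (fun u => ENNReal.ofReal (gk d M ‖y - x‖ u)) (fun u => ENNReal.ofReal C1 * ENNReal.ofReal (gk d M v u))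
    (by fun_prop) (by fun_prop) ?_).trans (le_of_eq ?_)
  · intro u hu y' hy'
    rw [← ENNReal.ofReal_mul hC1.le]
    exact ENNReal.ofReal_le_ofReal (H1 M hM hM0 _ _ _ _ hw hv hvw hu hy')
  · simp_rw [mul_assoc]
    rw [lintegral_const_mul' _ _ ENNReal.ofReal_ne_top, ENNReal.ofReal_mul hC2.le, mul_assoc]; rfl

lemma J_le_kP (h : IsSub a η) (ha : 0 < a) (ha1 : a < 1) (d : ℕ) (M0 s0 : ℝ) (hs0 : 0 < s0) : ∃ C : ℝ, 0 < C ∧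
    ∀ M, 0 ≤ M → M ≤ M0 → ∀ s ∈ Icc s0 1, ∀ x y : Ed d,
    JJ d a M ‖y - x‖ ≤ ENNReal.ofReal C * kP d a η M (s, x, y) := by
  obtain ⟨A, hA, H⟩ := h.cmp_low ha ha1
  obtain ⟨C2, hC2, H2⟩ := H s0 hs0
  set c := (1 + A) ^ (-(d:ℝ) / 2) * Real.exp (-(M0 * A)) with hc
  have hc0 : 0 < c := by positivity
  refine ⟨c⁻¹ * C2, by positivity, fun M hM hM0 s hs x y => ?_⟩
  set v := ‖y - x‖
  have key := H2 s hs (fun u => ENNReal.ofReal (gk d M v u)) (fun u => ENNReal.ofReal c * ENNReal.ofReal (gk d M v u))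
    (by fun_prop) (by fun_prop) (by
      intro y' hy' v' hv'
      rw [← ENNReal.ofReal_mul hc0.le]
      apply ENNReal.ofReal_le_ofReal
      have hy0 : 0 < y' := by linarith
      obtain ⟨h1, h2⟩ := hv'
      unfold gk
      have b1 : (1 + A) ^ (-(d:ℝ) / 2) * (4 * π * y') ^ (-(d:ℝ) / 2) ≤ (4 * π * (y' + v')) ^ (-(d:ℝ) / 2) := by
        rw [← Real.mul_rpow (by positivity) (by positivity)]
        apply Real.rpow_le_rpow_of_nonpos (by positivity)
        · rw [show (1 + A) * (4 * π * y') = 4 * π * (y' + A * y') by ring]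
          gcongr
          nlinarith
        · have : (0:ℝ) ≤ d := by positivity
          linarith
      have b2 : Real.exp (-(v ^ 2 / (4 * y'))) ≤ Real.exp (-(v ^ 2 / (4 * (y' + v')))) := by
        gcongr; linarith
      have b3 : Real.exp (-(M0 * A)) * Real.exp (-(M * y')) ≤ Real.exp (-(M * (y' + v'))) := by
        rw [← Real.exp_add, Real.exp_le_exp]
        nlinarith [mul_le_mul hM0 h2.le h1.le (by linarith)]
      calc _ = ((1 + A) ^ (-(d:ℝ) / 2) * (4 * π * y') ^ (-(d:ℝ) / 2)) * Real.exp (-(v ^ 2 / (4 * y'))) *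
            (Real.exp (-(M0 * A)) * Real.exp (-(M * y'))) := by rw [hc]; ring
        _ ≤ _ := by gcongr)
  simp_rw [mul_assoc] at key
  rw [lintegral_const_mul' _ _ ENNReal.ofReal_ne_top] at key
  rw [kP_eq (lt_of_lt_of_le hs0 hs.1), ENNReal.ofReal_mul (by positivity), mul_assoc]
  calc JJ d a M v = ENNReal.ofReal c⁻¹ * (ENNReal.ofReal c * JJ d a M v) := by
        rw [← mul_assoc, ← ENNReal.ofReal_mul (by positivity), inv_mul_cancel₀ hc0.ne']; simp
    _ ≤ _ := mul_le_mul_right key _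

lemma lint_tail (ha : 0 < a) : ∫⁻ r in Ioi (1:ℝ), ENNReal.ofReal (r ^ (-1 - a)) = ENNReal.ofReal (1 / a) := by
  rw [← ofReal_integral_eq_lintegral_ofReal (integrableOn_Ioi_rpow_of_lt (by linarith) one_pos)
    ((ae_restrict_iff' measurableSet_Ioi).2 (Eventually.of_forall fun r hr => by
      have : (0:ℝ) < r := lt_trans one_pos hr
      simp only [Pi.zero_apply]; positivity)), integral_Ioi_rpow_of_lt (by linarith) one_pos]
  congr 1
  rw [Real.one_rpow, show -1 - a + 1 = -a by ring, neg_div_neg_eq]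

lemma JJ_le (ha : 0 < a) (hM : 0 ≤ M) (v : ℝ) : JJ d a M v ≤ ENNReal.ofReal (1 / a) := by
  rw [← lint_tail ha]
  unfold JJ
  refine setLIntegral_mono (by fun_prop) fun r hr => ?_
  have hr1 : (1:ℝ) < r := hr
  have hr0 : (0:ℝ) < r := by linarith
  refine mul_le_of_le_one_left zero_le ?_
  rw [← ENNReal.ofReal_one]
  apply ENNReal.ofReal_le_ofReal
  refine (gk_le_u hM v hr0).trans ?_
  have hd : -(d:ℝ) / 2 ≤ 0 := by
    have : (0:ℝ) ≤ d := by positivity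
    linarith
  exact mul_le_one₀ (Real.rpow_le_one_of_one_le_of_nonpos (by linarith [Real.pi_gt_three]) hd) (by positivity)
    (Real.rpow_le_one_of_one_le_of_nonpos hr1.le hd)

lemma JJ_anti {v v' M M' : ℝ} (hv : 0 ≤ v) (hvv : v ≤ v') (hM : M ≤ M') : JJ d a M' v' ≤ JJ d a M v := by
  unfold JJ
  refine setLIntegral_mono (by fun_prop) fun r hr => ?_
  have hr0 : (0:ℝ) < r := lt_trans one_pos hr
  gcongr
  exact (gk_anti_r d _ hr0 hv hvv).trans (gk_anti_M d _ hr0 hM)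

lemma JJ_pos (v : ℝ) : 0 < JJ d a M v := by
  rw [pos_iff_ne_zero]
  intro h0
  unfold JJ at h0
  rw [lintegral_eq_zero_iff (by fun_prop)] at h0
  have : ∀ᵐ u ∂((volume : Measure ℝ).restrict (Ioi 1)), False := by
    filter_upwards [h0, ae_restrict_mem measurableSet_Ioi] with u h1 hu
    have hu0 : (0:ℝ) < u := lt_trans one_pos hu
    have h2 := ENNReal.ofReal_pos.2 (gk_pos d M v hu0)
    have h3 := ENNReal.ofReal_pos.2 (Real.rpow_pos_of_pos hu0 (-1 - a))
    simp only [Pi.zero_apply, mul_eq_zero] at h1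
    rcases h1 with h1 | h1
    · exact h2.ne' h1
    · exact h3.ne' h1
  rw [eventually_false_iff_eq_bot, ae_eq_bot, Measure.restrict_eq_zero] at this
  simp at this

lemma JJ_low (ha : 0 < a) (d : ℕ) (M0 R : ℝ) : ∃ C : ℝ, 0 < C ∧ ∀ M, 0 ≤ M → M ≤ M0 → ∀ v, 0 ≤ v → v ≤ R →
    1 ≤ ENNReal.ofReal C * JJ d a M v := by
  have hp := JJ_pos (d := d) (a := a) (M := max M0 0) R
  have hf : JJ d a (max M0 0) R ≠ ∞ := ne_top_of_le_ne_top ENNReal.ofReal_ne_top (JJ_le ha (le_max_right _ _) R)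
  refine ⟨((JJ d a (max M0 0) R).toReal)⁻¹, inv_pos.2 (ENNReal.toReal_pos hp.ne' hf), fun M hM hM0 v hv hvR => ?_⟩
  rw [ENNReal.ofReal_inv_of_pos (ENNReal.toReal_pos hp.ne' hf), ENNReal.ofReal_toReal hf]
  calc 1 = (JJ d a (max M0 0) R)⁻¹ * JJ d a (max M0 0) R := (ENNReal.inv_mul_cancel hp.ne' hf).symm
    _ ≤ _ := by gcongr; exact JJ_anti hv hvR (hM0.trans (le_max_left _ _))

lemma kP_le_J (h : IsSub a η) (ha : 0 < a) (ha1 : a < 1) (hd : 0 < d) (M0 s0 : ℝ) (hs0 : 0 < s0) : ∃ C : ℝ, 0 < C ∧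
    ∀ M, 0 ≤ M → M ≤ M0 → ∀ s ∈ Icc s0 1, ∀ x y : Ed d, ∀ v, 0 ≤ v → v ≤ ‖y - x‖ + 4 →
    kP d a η M (s, x, y) ≤ ENNReal.ofReal C * JJ d a M v := by
  obtain ⟨C1, hC1, H1⟩ := kP_le_J1 h ha ha1 d M0
  obtain ⟨C2, hC2, H2⟩ := JJ_low ha d M0 5
  obtain ⟨C3, hC3, H3⟩ := kP_le_time (d := d) h ha hd
  have hp : 0 < C3 * s0 ^ (-(d:ℝ) / (2 * a)) := by positivity
  refine ⟨C1 + C3 * s0 ^ (-(d:ℝ) / (2 * a)) * C2, by positivity, fun M hM hM0 s hs x y v hv hvw => ?_⟩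
  have hs' : 0 < s := lt_of_lt_of_le hs0 hs.1
  rcases le_or_gt 1 ‖y - x‖ with hw | hw
  · refine (H1 M hM hM0 s ⟨hs', hs.2⟩ x y hw v hv hvw).trans ?_
    gcongr
    have : 0 < C3 * s0 ^ (-(d:ℝ) / (2 * a)) * C2 := by positivity
    linarith
  · calc kP d a η M (s, x, y) ≤ ENNReal.ofReal (C3 * s0 ^ (-(d:ℝ) / (2 * a))) * 1 := by
          rw [mul_one]
          refine (H3 M hM s hs' x y).trans (ENNReal.ofReal_le_ofReal ?_)
          refine mul_le_mul_of_nonneg_left ?_ hC3.le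
          apply Real.rpow_le_rpow_of_nonpos hs0 hs.1
          rw [neg_div]; have : (0:ℝ) ≤ d / (2 * a) := by positivity
          linarith
      _ ≤ ENNReal.ofReal (C3 * s0 ^ (-(d:ℝ) / (2 * a))) * (ENNReal.ofReal C2 * JJ d a M v) := by
          gcongr; exact H2 M hM hM0 v hv (by linarith)
      _ ≤ _ := by
          rw [← mul_assoc, ← ENNReal.ofReal_mul hp.le]
          gcongr; linarith

lemma JJ_mul (ha : 0 < a) (d : ℕ) : ∃ C : ℝ, 0 < C ∧ ∀ M, 0 ≤ M → ∀ v1 v2 v, 0 ≤ v1 → 0 ≤ v2 → 0 ≤ v → v ≤ v1 + v2 →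
    JJ d a M v1 * JJ d a M v2 ≤ ENNReal.ofReal C * JJ d a M v := by
  refine ⟨2 ^ (1 + a) * (1 / a) + 2 ^ (1 + a) * (1 / a), by positivity, fun M hM v1 v2 v h1 h2 hv hvv => ?_⟩
  set F : ℝ → ℝ≥0∞ := fun r => ENNReal.ofReal (gk d M v r) * ENNReal.ofReal (r ^ (-1 - a)) with hF
  have hFm : Measurable F := measurable_JJ_int v
  set g : ℝ → ℝ≥0∞ := fun r => ENNReal.ofReal (r ^ (-1 - a)) with hg
  have hgm : Measurable g := by fun_prop
  have hpt : ∀ r1 ∈ Ioi (1:ℝ), ∀ r2 ∈ Ioi (1:ℝ),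
      ENNReal.ofReal (gk d M v1 r1) * ENNReal.ofReal (r1 ^ (-1 - a)) *
      (ENNReal.ofReal (gk d M v2 r2) * ENNReal.ofReal (r2 ^ (-1 - a))) ≤
      ENNReal.ofReal (2 ^ (1 + a)) * (g r1 * F (r1 + r2)) + ENNReal.ofReal (2 ^ (1 + a)) * (g r2 * F (r1 + r2)) := by
    intro r1 hr1 r2 hr2
    have hr1' : (1:ℝ) < r1 := hr1
    have hr2' : (1:ℝ) < r2 := hr2
    have p1 : 0 < r1 := by linarith
    have p2 : 0 < r2 := by linarith
    have p3 : 0 < r1 + r2 := by linarith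
    have g1 : gk d M v1 r1 * gk d M v2 r2 ≤ gk d M v (r1 + r2) := by
      unfold gk
      have b1 : (4 * π * r1) ^ (-(d:ℝ) / 2) * (4 * π * r2) ^ (-(d:ℝ) / 2) ≤ (4 * π * (r1 + r2)) ^ (-(d:ℝ) / 2) := by
        rw [← Real.mul_rpow (by positivity) (by positivity)]
        apply Real.rpow_le_rpow_of_nonpos (by positivity)
        · have : r1 + r2 ≤ 2 * (r1 * r2) := by nlinarith
          have hpi := Real.pi_gt_three
          calc 4 * π * (r1 + r2) ≤ 4 * π * (2 * (r1 * r2)) := by gcongr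
            _ ≤ 4 * π * (4 * π * (r1 * r2)) := by gcongr; linarith
            _ = _ := by ring
        · have : (0:ℝ) ≤ d := by positivity
          linarith
      have b2 : Real.exp (-(v1 ^ 2 / (4 * r1))) * Real.exp (-(v2 ^ 2 / (4 * r2))) ≤
          Real.exp (-(v ^ 2 / (4 * (r1 + r2)))) := by
        rw [← Real.exp_add, Real.exp_le_exp]
        have := titu (w := v1) (A := v2) (p := 4 * r1) (q := 4 * r2) (by positivity) (by positivity)
        have h3 : v ^ 2 / (4 * (r1 + r2)) ≤ (v1 + v2) ^ 2 / (4 * r1 + 4 * r2) := by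
          rw [← mul_add]; gcongr
        linarith
      calc _ = ((4 * π * r1) ^ (-(d:ℝ) / 2) * (4 * π * r2) ^ (-(d:ℝ) / 2)) *
            (Real.exp (-(v1 ^ 2 / (4 * r1))) * Real.exp (-(v2 ^ 2 / (4 * r2)))) *
            Real.exp (-(M * (r1 + r2))) := by
              rw [mul_add M, neg_add, Real.exp_add]; ring
        _ ≤ _ := by gcongr
    have g2 : r1 ^ (-1 - a) * r2 ^ (-1 - a) ≤ 2 ^ (1 + a) * (r1 ^ (-1 - a) * (r1 + r2) ^ (-1 - a)) +
        2 ^ (1 + a) * (r2 ^ (-1 - a) * (r1 + r2) ^ (-1 - a)) := by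
      have aux : ∀ r r' : ℝ, 0 < r → r ≤ r' → r' ^ (-1 - a) ≤ 2 ^ (1 + a) * (r + r') ^ (-1 - a) := by
        intro r r' hr hrr
        have : (0:ℝ) < r' := by linarith
        calc r' ^ (-1 - a) = 2 ^ (1 + a) * (2 * r') ^ (-1 - a) := by
              rw [Real.mul_rpow (by norm_num) this.le, ← mul_assoc, ← Real.rpow_add (by norm_num)]
              norm_num
          _ ≤ _ := by
              gcongr 1
              apply Real.rpow_le_rpow_of_nonpos (by linarith) (by linarith) (by linarith)
      have n1 : 0 ≤ 2 ^ (1 + a) * (r1 ^ (-1 - a) * (r1 + r2) ^ (-1 - a)) := by positivity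
      have n2 : 0 ≤ 2 ^ (1 + a) * (r2 ^ (-1 - a) * (r1 + r2) ^ (-1 - a)) := by positivity
      rcases le_total r1 r2 with hle | hle
      · have := mul_le_mul_of_nonneg_left (aux r1 r2 p1 hle) (show 0 ≤ r1 ^ (-1 - a) by positivity)
        linarith
      · have := mul_le_mul_of_nonneg_left (aux r2 r1 p2 hle) (show 0 ≤ r2 ^ (-1 - a) by positivity)
        rw [add_comm r2 r1] at this
        linarith
    have hk0 := gk_nonneg d M v p3
    have hk1 := gk_nonneg d M v1 p1
    have hk2 := gk_nonneg d M v2 p2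
    simp only [hg, hF]
    rw [← ENNReal.ofReal_mul hk1, ← ENNReal.ofReal_mul hk2, ← ENNReal.ofReal_mul (by positivity),
      ← ENNReal.ofReal_mul hk0, ← ENNReal.ofReal_mul (by positivity), ← ENNReal.ofReal_mul (by positivity),
      ← ENNReal.ofReal_mul (by positivity), ← ENNReal.ofReal_mul (by positivity),
      ← ENNReal.ofReal_add (by positivity) (by positivity)]
    apply ENNReal.ofReal_le_ofReal
    calc _ = (gk d M v1 r1 * gk d M v2 r2) * (r1 ^ (-1 - a) * r2 ^ (-1 - a)) := by ring
      _ ≤ gk d M v (r1 + r2) * (2 ^ (1 + a) * (r1 ^ (-1 - a) * (r1 + r2) ^ (-1 - a)) +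
        2 ^ (1 + a) * (r2 ^ (-1 - a) * (r1 + r2) ^ (-1 - a))) := by gcongr
      _ = _ := by ring
  have shiftle : ∀ r1 ∈ Ioi (1:ℝ), ∫⁻ r2 in Ioi (1:ℝ), F (r1 + r2) ≤ JJ d a M v := by
    intro r1 hr1
    have hr1' : (1:ℝ) < r1 := hr1
    have e : ∫⁻ r2 in Ioi (1:ℝ), F (r1 + r2) = ∫⁻ r2, (Ioi (1 + r1)).indicator F (r1 + r2) := by
      rw [← lintegral_indicator measurableSet_Ioi]
      congr 1; funext r
      by_cases hr : 1 < r
      · rw [indicator_of_mem (show r ∈ Ioi (1:ℝ) from hr), indicator_of_mem (by simp; linarith)]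
      · rw [indicator_of_notMem (by simpa using hr), indicator_of_notMem (by simp at hr ⊢; linarith)]
    rw [e, lintegral_add_left_eq_self (fun r => (Ioi (1 + r1)).indicator F r) r1, lintegral_indicator measurableSet_Ioi]
    exact lintegral_mono_set (Ioi_subset_Ioi (by linarith))
  have half : ∫⁻ r1 in Ioi (1:ℝ), (∫⁻ r2 in Ioi (1:ℝ), g r1 * F (r1 + r2)) ≤ ENNReal.ofReal (1 / a) * JJ d a M v := by
    rw [← lint_tail ha, ← lintegral_mul_const _ hgm]
    refine setLIntegral_mono (by fun_prop) fun r1 hr1 => ?_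
    rw [lintegral_const_mul _ (by fun_prop)]
    gcongr
    exact shiftle r1 hr1
  have half' : ∫⁻ r1 in Ioi (1:ℝ), (∫⁻ r2 in Ioi (1:ℝ), g r2 * F (r1 + r2)) ≤ ENNReal.ofReal (1 / a) * JJ d a M v := by
    rw [lintegral_lintegral_swap (by fun_prop)]
    refine le_trans (le_of_eq ?_) half
    congr 1; funext r; congr 1; funext r'; rw [add_comm]
  have hprod : JJ d a M v1 * JJ d a M v2 = ∫⁻ r1 in Ioi (1:ℝ), (∫⁻ r2 in Ioi (1:ℝ),
      ENNReal.ofReal (gk d M v1 r1) * ENNReal.ofReal (r1 ^ (-1 - a)) *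
      (ENNReal.ofReal (gk d M v2 r2) * ENNReal.ofReal (r2 ^ (-1 - a)))) := by
    have : ∀ r1 : ℝ, ∫⁻ r2 in Ioi (1:ℝ),
      ENNReal.ofReal (gk d M v1 r1) * ENNReal.ofReal (r1 ^ (-1 - a)) *
      (ENNReal.ofReal (gk d M v2 r2) * ENNReal.ofReal (r2 ^ (-1 - a))) =
      ENNReal.ofReal (gk d M v1 r1) * ENNReal.ofReal (r1 ^ (-1 - a)) * JJ d a M v2 := fun r1 =>
        lintegral_const_mul _ (by fun_prop)
    simp_rw [this]
    rw [lintegral_mul_const _ (by fun_prop)]; rfl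
  rw [hprod]
  calc _ ≤ ∫⁻ r1 in Ioi (1:ℝ), (∫⁻ r2 in Ioi (1:ℝ), (ENNReal.ofReal (2 ^ (1 + a)) * (g r1 * F (r1 + r2)) +
        ENNReal.ofReal (2 ^ (1 + a)) * (g r2 * F (r1 + r2)))) := by
        refine setLIntegral_mono (by fun_prop) fun r1 hr1 => ?_
        exact setLIntegral_mono (by fun_prop) fun r2 hr2 => hpt r1 hr1 r2 hr2
    _ = ENNReal.ofReal (2 ^ (1 + a)) * (∫⁻ r1 in Ioi (1:ℝ), (∫⁻ r2 in Ioi (1:ℝ), g r1 * F (r1 + r2))) +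
        ENNReal.ofReal (2 ^ (1 + a)) * (∫⁻ r1 in Ioi (1:ℝ), (∫⁻ r2 in Ioi (1:ℝ), g r2 * F (r1 + r2))) := by
        rw [← lintegral_const_mul' _ _ ENNReal.ofReal_ne_top, ← lintegral_const_mul' _ _ ENNReal.ofReal_ne_top,
          ← lintegral_add_left (by fun_prop)]
        congr 1; funext r1
        rw [lintegral_add_left (by fun_prop)]
        exact congrArg₂ _ (lintegral_const_mul' _ _ ENNReal.ofReal_ne_top)
          (lintegral_const_mul' _ _ ENNReal.ofReal_ne_top)
    _ ≤ ENNReal.ofReal (2 ^ (1 + a)) * (ENNReal.ofReal (1 / a) * JJ d a M v) +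
        ENNReal.ofReal (2 ^ (1 + a)) * (ENNReal.ofReal (1 / a) * JJ d a M v) := by gcongr
    _ = _ := by
        rw [ENNReal.ofReal_add (by positivity) (by positivity), ENNReal.ofReal_mul (by positivity)]; ring

end

noncomputable section
open scoped ENNReal NNReal Topology

/-- `G_ν` with squared argument -/
def Gf (ν ρ : ℝ) : ℝ := ∫ v in Ioi (0:ℝ), v ^ (ν - 1) * Real.exp (-v - ρ / (4 * v))

def kb (d : ℕ) (a : ℝ) (η : Measure ℝ) (M g : ℝ) (x : Ed d) : ℝ≥0∞ :=
  ∫⁻ t in Ioi (0:ℝ), ENNReal.ofReal (t ^ (g - 1)) * kP d a η M (t, x, 0)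

section
variable {d : ℕ} {a M : ℝ} {η : Measure ℝ}

lemma Gf_integrable {ν ρ : ℝ} (hν : 0 < ν) (hρ : 0 ≤ ρ) :
    IntegrableOn (fun v : ℝ => v ^ (ν - 1) * Real.exp (-v - ρ / (4 * v))) (Ioi 0) := by
  have h2 := Real.GammaIntegral_convergent hν
  refine Integrable.mono' h2 (by fun_prop) ?_
  filter_upwards [ae_restrict_mem measurableSet_Ioi] with v hv
  have hv0 : 0 < v := hv
  rw [Real.norm_of_nonneg (by positivity), mul_comm]
  gcongr
  have : 0 ≤ ρ / (4 * v) := by positivity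
  linarith

lemma Gf_lint {ν ρ : ℝ} (hν : 0 < ν) (hρ : 0 ≤ ρ) :
    ∫⁻ v in Ioi (0:ℝ), ENNReal.ofReal (v ^ (ν - 1) * Real.exp (-v - ρ / (4 * v))) = ENNReal.ofReal (Gf ν ρ) := by
  rw [Gf, ofReal_integral_eq_lintegral_ofReal (Gf_integrable hν hρ)]
  filter_upwards [ae_restrict_mem measurableSet_Ioi] with v hv
  have hv0 : 0 < v := hv
  simp only [Pi.zero_apply]; positivity

lemma Gf_pos {ν ρ : ℝ} (hν : 0 < ν) (hρ : 0 ≤ ρ) : 0 < Gf ν ρ := by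
  rw [Gf, setIntegral_pos_iff_support_of_nonneg_ae _ (Gf_integrable hν hρ)]
  · have : Ioi (0:ℝ) ⊆ (Function.support fun v : ℝ => v ^ (ν - 1) * Real.exp (-v - ρ / (4 * v))) ∩ Ioi 0 := by
      intro v hv
      have hv0 : 0 < v := hv
      refine ⟨?_, hv⟩
      rw [Function.mem_support]; positivity
    exact lt_of_lt_of_le (by simp) (measure_mono this)
  · filter_upwards [ae_restrict_mem measurableSet_Ioi] with v hv
    have hv0 : 0 < v := hv
    simp only [Pi.zero_apply]; positivity

lemma Gf_zero (ν : ℝ) (hν : 0 < ν) : Gf ν 0 = Real.Gamma ν := by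
  rw [Gf, Real.Gamma_eq_integral hν]
  congr 1; funext v; rw [zero_div, sub_zero, mul_comm]

@[fun_prop]
lemma measurable_kb (h : IsSub a η) (g : ℝ) : Measurable (kb d a η M g) := by
  have := measurable_kP (d := d) (M := M) h
  unfold kb
  refine Measurable.lintegral_prod_right' (f := fun w : (Ed d) × ℝ => ENNReal.ofReal (w.2 ^ (g - 1)) *
    kP d a η M (w.2, w.1, 0)) ?_
  fun_prop

lemma kb_sact (h : IsSub a η) (ha : 0 < a) (g : ℝ) {s : ℝ} (hs : 0 < s) (x : Ed d) :
    ∫⁻ z, kP d a η M (s, x, z) * kb d a η M g z =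
      ∫⁻ t in Ioi (0:ℝ), (Ioi s).indicator (fun t => ENNReal.ofReal ((t - s) ^ (g - 1))) t * kP d a η M (t, x, 0) := by
  have hm := measurable_kP (d := d) (M := M) h
  have e1 : ∀ z, kP d a η M (s, x, z) * kb d a η M g z = ∫⁻ t in Ioi (0:ℝ),
      ENNReal.ofReal (t ^ (g - 1)) * (kP d a η M (s, x, z) * kP d a η M (t, z, 0)) := by
    intro z
    rw [kb, ← lintegral_const_mul _ (by fun_prop)]
    congr 1; funext t; ring
  simp_rw [e1]
  rw [lintegral_lintegral_swap (by fun_prop)]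
  have e2 : ∫⁻ t in Ioi (0:ℝ), ∫⁻ z, ENNReal.ofReal (t ^ (g - 1)) * (kP d a η M (s, x, z) * kP d a η M (t, z, 0)) =
      ∫⁻ t in Ioi (0:ℝ), ENNReal.ofReal (t ^ (g - 1)) * kP d a η M (s + t, x, 0) := by
    refine setLIntegral_congr_fun measurableSet_Ioi fun t ht => ?_
    rw [lintegral_const_mul _ (by fun_prop), ← kP_CK h ha s t x 0 hs ht]
  rw [e2, ← lintegral_indicator measurableSet_Ioi, ← lintegral_indicator measurableSet_Ioi]
  rw [← lintegral_add_left_eq_self (fun t => (Ioi 0).indicator (fun t => (Ioi s).indicator (fun t => ENNReal.ofReal ((t - s) ^ (g - 1))) t * kP d a η M (t, x, 0)) t) s]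
  congr 1; funext t
  by_cases ht : 0 < t
  · rw [indicator_of_mem (show t ∈ Ioi (0:ℝ) from ht), indicator_of_mem (by simp; linarith),
      indicator_of_mem (by simp; linarith)]
    simp
  · rw [indicator_of_notMem (by simpa using ht)]
    by_cases h2 : 0 < s + t
    · rw [indicator_of_mem (show s + t ∈ Ioi (0:ℝ) from h2), indicator_of_notMem (by simp at ht ⊢; linarith), zero_mul]
    · rw [indicator_of_notMem (by simpa using h2)]

lemma inner_lint {g s t : ℝ} (hg : 1 < g) (hs : 0 < s) (ht : 0 < t) :
    (Ioi s).indicator (fun t => ENNReal.ofReal ((t - s) ^ (g - 1))) t + ENNReal.ofReal (g - 1) *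
      ∫⁻ r in Ioo 0 s, (Ioi r).indicator (fun t => ENNReal.ofReal ((t - r) ^ (g - 1 - 1))) t =
    ENNReal.ofReal (t ^ (g - 1)) := by
  set m := min s t with hm
  have hm0 : 0 < m := lt_min hs ht
  have e1 : ∫⁻ r in Ioo 0 s, (Ioi r).indicator (fun t => ENNReal.ofReal ((t - r) ^ (g - 1 - 1))) t =
      ∫⁻ r in Ioo 0 m, ENNReal.ofReal ((t - r) ^ (g - 1 - 1)) := by
    rw [← lintegral_indicator measurableSet_Ioo, ← lintegral_indicator measurableSet_Ioo]
    congr 1; funext r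
    by_cases h1 : r ∈ Ioo 0 m
    · rw [indicator_of_mem h1, indicator_of_mem (show r ∈ Ioo 0 s from ⟨h1.1, lt_of_lt_of_le h1.2 (min_le_left _ _)⟩),
        indicator_of_mem (show t ∈ Ioi r from lt_of_lt_of_le h1.2 (min_le_right _ _))]
    · rw [indicator_of_notMem h1]
      by_cases h2 : r ∈ Ioo 0 s
      · rw [indicator_of_mem h2, indicator_of_notMem]
        intro h3
        exact h1 ⟨h2.1, lt_min h2.2 h3⟩
      · rw [indicator_of_notMem h2]
  have hii : IntervalIntegrable (fun r : ℝ => (t - r) ^ (g - 1 - 1)) volume 0 m := by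
    have := (intervalIntegral.intervalIntegrable_rpow' (a := t - 0) (b := t - m) (r := g - 1 - 1) (by linarith)).comp_sub_left t
    simpa using this
  have e2 : ∫⁻ r in Ioo 0 m, ENNReal.ofReal ((t - r) ^ (g - 1 - 1)) =
      ENNReal.ofReal ((t ^ (g - 1) - (t - m) ^ (g - 1)) / (g - 1)) := by
    rw [setLIntegral_congr Ioo_ae_eq_Ioc, ← ofReal_integral_eq_lintegral_ofReal hii.1]
    · rw [← intervalIntegral.integral_of_le hm0.le, intervalIntegral.integral_comp_sub_left (fun r => r ^ (g - 1 - 1)),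
        integral_rpow (Or.inl (by linarith))]
      simp
    · filter_upwards [ae_restrict_mem measurableSet_Ioc] with r hr
      have : 0 ≤ t - r := by linarith [hr.2, min_le_right s t]
      simp only [Pi.zero_apply]; positivity
  have e3 : (Ioi s).indicator (fun t => ENNReal.ofReal ((t - s) ^ (g - 1))) t = ENNReal.ofReal ((t - m) ^ (g - 1)) := by
    by_cases h1 : s < t
    · rw [indicator_of_mem (show t ∈ Ioi s from h1), hm, min_eq_left h1.le]
    · rw [indicator_of_notMem (by simpa using h1), hm, min_eq_right (not_lt.1 h1), sub_self,
        Real.zero_rpow (by linarith)]; simp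
  have hle : (t - m) ^ (g - 1) ≤ t ^ (g - 1) :=
    Real.rpow_le_rpow (by linarith [min_le_right s t]) (by linarith) (by linarith)
  have htm : 0 ≤ t - m := by linarith [min_le_right s t]
  have hg0 : 0 < g - 1 := by linarith
  rw [e1, e2, e3, ← ENNReal.ofReal_mul hg0.le, ← ENNReal.ofReal_add (by positivity)
    (mul_nonneg hg0.le (div_nonneg (by linarith) hg0.le))]
  congr 1; field_simp; ring

lemma kb_ident (h : IsSub a η) (ha : 0 < a) {g : ℝ} (hg : 1 < g) {s : ℝ} (hs : 0 < s) (x : Ed d) :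
    sact (kP d a η M) (kb d a η M g) (s, x) + ENNReal.ofReal (g - 1) * act (kb d a η M (g - 1)) (kP d a η M) onePos (s, x)
      = kb d a η M g x := by
  have hm := measurable_kP (d := d) (M := M) h
  rw [act_onePos_eq hm kP_zero (measurable_kb h _)]
  have e1 : ∫⁻ r in Ioo 0 s, ∫⁻ z, kP d a η M (r, x, z) * kb d a η M (g - 1) z =
      ∫⁻ t in Ioi (0:ℝ), (∫⁻ r in Ioo 0 s, (Ioi r).indicator (fun t => ENNReal.ofReal ((t - r) ^ (g - 1 - 1))) t) *
        kP d a η M (t, x, 0) := by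
    have e0 : ∫⁻ r in Ioo 0 s, ∫⁻ z, kP d a η M (r, x, z) * kb d a η M (g - 1) z =
        ∫⁻ r in Ioo 0 s, ∫⁻ t in Ioi (0:ℝ), (Ioi r).indicator (fun t => ENNReal.ofReal ((t - r) ^ (g - 1 - 1))) t *
        kP d a η M (t, x, 0) := by
      refine setLIntegral_congr_fun measurableSet_Ioo fun r hr => ?_
      exact kb_sact h ha (g - 1) hr.1 x
    have hmi : Measurable (fun p : ℝ × ℝ => (Ioi p.1).indicator (fun t => ENNReal.ofReal ((t - p.1) ^ (g - 1 - 1))) p.2) := by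
      have : (fun p : ℝ × ℝ => (Ioi p.1).indicator (fun t => ENNReal.ofReal ((t - p.1) ^ (g - 1 - 1))) p.2) =
        {p : ℝ × ℝ | p.1 < p.2}.indicator (fun p => ENNReal.ofReal ((p.2 - p.1) ^ (g - 1 - 1))) := by
        funext p; simp [indicator]
      rw [this]
      exact Measurable.indicator (by fun_prop) (measurableSet_lt measurable_fst measurable_snd)
    rw [e0, lintegral_lintegral_swap]
    · congr 1; funext t
      rw [lintegral_mul_const]
      exact hmi.comp (measurable_id.prodMk measurable_const)
    · exact (hmi.mul (by fun_prop)).aemeasurable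
  rw [e1, ← lintegral_const_mul' _ _ ENNReal.ofReal_ne_top, show sact (kP d a η M) (kb d a η M g) (s, x) =
    ∫⁻ z, kP d a η M (s, x, z) * kb d a η M g z from rfl, kb_sact h ha g hs, ← lintegral_add_left, kb]
  · refine setLIntegral_congr_fun measurableSet_Ioi fun t ht => ?_
    rw [← inner_lint hg hs ht, add_mul, mul_assoc]
  · refine Measurable.mul ?_ (by fun_prop)
    exact Measurable.indicator (by fun_prop) measurableSet_Ioi

lemma subst_pow (ha : 0 < a) (g : ℝ) {u : ℝ} (hu : 0 < u) (F : ℝ → ℝ≥0∞) :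
    ∫⁻ t in Ioi (0:ℝ), ENNReal.ofReal (t ^ (g - 1)) * F (t ^ (1 / a) * u) =
      ∫⁻ w in Ioi (0:ℝ), ENNReal.ofReal (a * w ^ (a * g - 1) * u ^ (-(a * g))) * F w := by
  have himg : (fun w : ℝ => (w / u) ^ a) '' Ioi 0 = Ioi 0 := by
    ext t; constructor
    · rintro ⟨w, hw, rfl⟩
      have hw0 : 0 < w := hw
      show 0 < (w / u) ^ a
      positivity
    · intro ht
      have ht0 : 0 < t := ht
      refine ⟨t ^ (1 / a) * u, by simp; positivity, ?_⟩
      show (t ^ (1 / a) * u / u) ^ a = t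
      rw [mul_div_assoc, div_self hu.ne', mul_one, ← Real.rpow_mul ht0.le, one_div_mul_cancel ha.ne', Real.rpow_one]
  have hroot : ∀ w : ℝ, 0 < w → ((w / u) ^ a) ^ (1 / a) * u = w := by
    intro w hw
    rw [← Real.rpow_mul (by positivity), mul_one_div_cancel ha.ne', Real.rpow_one]; field_simp
  conv_lhs => rw [← himg]
  rw [lintegral_image_eq_lintegral_abs_deriv_mul measurableSet_Ioi (f' := fun w => a * (w / u) ^ (a - 1) / u)]
  · refine setLIntegral_congr_fun measurableSet_Ioi fun w hw => ?_
    have hw0 : 0 < w := hw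
    rw [hroot w hw0, ← mul_assoc, ← ENNReal.ofReal_mul (by positivity), abs_of_pos (by positivity)]
    congr 2
    rw [← Real.rpow_mul (by positivity)]
    have : a * (w / u) ^ (a - 1) / u * (w / u) ^ (a * (g - 1)) = a * (w / u) ^ (a * g - 1) / u := by
      rw [show a * g - 1 = (a - 1) + a * (g - 1) by ring, Real.rpow_add (by positivity)]; ring
    rw [this, Real.div_rpow hw0.le hu.le, show a * g = (a * g - 1) + 1 by ring, neg_add, Real.rpow_add hu,
      Real.rpow_neg hu.le, Real.rpow_neg_one]
    simp only [add_sub_cancel_right]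
    field_simp
  · intro w hw
    have hw0 : 0 < w := hw
    have := ((hasDerivAt_id w).div_const u).rpow_const (p := a) (Or.inl (by simp; exact ⟨hw0.ne', hu.ne'⟩))
    refine (this.congr_deriv ?_).hasDerivWithinAt
    simp; ring
  · intro w hw w' hw' he
    have := congrArg (fun r => r ^ (1 / a) * u) he
    change ((w / u) ^ a) ^ (1 / a) * u = ((w' / u) ^ a) ^ (1 / a) * u at this
    rwa [hroot w hw, hroot w' hw'] at this

lemma subst_inv {ρ : ℝ} (hρ : 0 < ρ) (F : ℝ → ℝ≥0∞) :
    ∫⁻ w in Ioi (0:ℝ), F w = ∫⁻ v in Ioi (0:ℝ), ENNReal.ofReal (ρ / v ^ 2) * F (ρ / v) := by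
  have himg : (fun v : ℝ => ρ / v) '' Ioi 0 = Ioi 0 := by
    ext t; constructor
    · rintro ⟨w, hw, rfl⟩
      have hw0 : 0 < w := hw
      show 0 < ρ / w
      positivity
    · intro ht
      have ht0 : 0 < t := ht
      refine ⟨ρ / t, by simp; positivity, ?_⟩
      show ρ / (ρ / t) = t
      field_simp
  conv_lhs => rw [← himg]
  rw [lintegral_image_eq_lintegral_abs_deriv_mul measurableSet_Ioi (f' := fun v => -(ρ / v ^ 2))]
  · refine setLIntegral_congr_fun measurableSet_Ioi fun w hw => ?_
    have hw0 : 0 < w := hw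
    rw [abs_neg, abs_of_pos (by positivity)]
  · intro w hw
    have hw0 : 0 < w := hw
    have := (hasDerivAt_inv hw0.ne').const_mul ρ
    refine HasDerivAt.hasDerivWithinAt ?_
    exact this.congr_deriv (by simp [div_eq_mul_inv])
  · intro w hw w' hw' he
    have hw0 : 0 < w := hw
    have hw1 : 0 < w' := hw'
    change ρ / w = ρ / w' at he
    rw [div_eq_div_iff hw0.ne' hw1.ne'] at he
    exact (mul_left_cancel₀ hρ.ne' he).symm

/-- normalising constant -/
def cb (d : ℕ) (g β : ℝ) : ℝ := (4 * π) ^ (-(d:ℝ) / 2) * Real.Gamma g * 4 ^ (β / 2) / Real.Gamma (((d:ℝ) - β) / 2)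

lemma kb_val (h : IsSub a η) (ha : 0 < a) (hM : 0 ≤ M) {β g : ℝ} (hβ : 0 < β) (hβd : β < d) (hg : a * g = ((d:ℝ) - β) / 2)
    (x : Ed d) (hx : x ≠ 0) :
    kb d a η M g x = ENNReal.ofReal (cb d g β * (‖x‖ ^ (-β) * Gf (β / 2) (M * ‖x‖ ^ 2))) := by
  have hx0 : 0 < ‖x‖ := norm_pos_iff.2 hx
  have hpr := h.prob
  have hag : 0 < a * g := by rw [hg]; linarith
  have hg0 : 0 < g := pos_of_mul_pos_right hag ha.le
  have hGa := Real.Gamma_pos_of_pos hag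
  have hGg := Real.Gamma_pos_of_pos hg0
  have e1 : kb d a η M g x = ∫⁻ t in Ioi (0:ℝ), ∫⁻ u, ENNReal.ofReal (t ^ (g - 1)) * ENNReal.ofReal (gk d M ‖x‖ (t ^ (1 / a) * u)) ∂η := by
    refine setLIntegral_congr_fun measurableSet_Ioi fun t ht => ?_
    rw [kP_eq ht, lintegral_etaT _ _ _ (by fun_prop), lintegral_const_mul' _ _ ENNReal.ofReal_ne_top]
    simp
  have hgm := measurable_gk d M
  rw [e1, lintegral_lintegral_swap (by
    refine (Measurable.mul (by fun_prop) (ENNReal.measurable_ofReal.comp ?_)).aemeasurable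
    exact hgm.comp (f := fun p : ℝ × ℝ => (‖x‖, p.1 ^ (1 / a) * p.2)) (by fun_prop))]
  set I := ∫⁻ w in Ioi (0:ℝ), ENNReal.ofReal (w ^ (a * g - 1)) * ENNReal.ofReal (gk d M ‖x‖ w) with hI
  have e2 : ∫⁻ u, (∫⁻ t in Ioi (0:ℝ), ENNReal.ofReal (t ^ (g - 1)) * ENNReal.ofReal (gk d M ‖x‖ (t ^ (1 / a) * u))) ∂η =
      ∫⁻ u, ENNReal.ofReal a * I * ENNReal.ofReal (u ^ (-(a * g))) ∂η := by
    refine lintegral_congr_ae ?_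
    filter_upwards [h.ae_pos] with u hu
    rw [subst_pow ha g hu (fun w => ENNReal.ofReal (gk d M ‖x‖ w)), hI,
      ← lintegral_const_mul _ (by fun_prop), ← lintegral_mul_const _ (by fun_prop)]
    refine setLIntegral_congr_fun measurableSet_Ioi fun w hw => ?_
    have hw0 : 0 < w := hw
    rw [ENNReal.ofReal_mul (by positivity), ENNReal.ofReal_mul ha.le]; ring
  rw [e2, lintegral_const_mul _ (by fun_prop), h.neg_moment ha hag, mul_div_cancel_left₀ _ ha.ne']
  have e3 : I = ENNReal.ofReal ((4 * π) ^ (-(d:ℝ) / 2) * (‖x‖ ^ 2 / 4) ^ (-(β / 2)) * Gf (β / 2) (M * ‖x‖ ^ 2)) := by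
    rw [hI, subst_inv (ρ := ‖x‖ ^ 2 / 4) (by positivity), ENNReal.ofReal_mul (by positivity), ← Gf_lint (by positivity) (by positivity),
      ← lintegral_const_mul' _ _ ENNReal.ofReal_ne_top]
    refine setLIntegral_congr_fun measurableSet_Ioi fun v hv => ?_
    have hv0 : 0 < v := hv
    have hgk := gk_nonneg d M ‖x‖ (show 0 < ‖x‖ ^ 2 / 4 / v by positivity)
    rw [← ENNReal.ofReal_mul (by positivity), ← ENNReal.ofReal_mul (by positivity), ← ENNReal.ofReal_mul (by positivity)]
    congr 1
    unfold gk
    set ρ := ‖x‖ ^ 2 / 4 with hρ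
    have hρ0 : 0 < ρ := by positivity
    have f1 : Real.exp (-(‖x‖ ^ 2 / (4 * (ρ / v)))) * Real.exp (-(M * (ρ / v))) =
        Real.exp (-v - M * ‖x‖ ^ 2 / (4 * v)) := by
      rw [← Real.exp_add]
      congr 1
      have : ‖x‖ ^ 2 = 4 * ρ := by rw [hρ]; ring
      rw [this]; field_simp; ring
    have f2 : ρ / v ^ 2 * ((ρ / v) ^ (a * g - 1) * (4 * π * (ρ / v)) ^ (-(d:ℝ) / 2)) =
        (4 * π) ^ (-(d:ℝ) / 2) * ρ ^ (-(β / 2)) * v ^ (β / 2 - 1) := by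
      rw [Real.mul_rpow (by positivity) (by positivity)]
      have k1 : (ρ / v) ^ (a * g - 1) * (ρ / v) ^ (-(d:ℝ) / 2) = (ρ / v) ^ (-(β / 2) - 1) := by
        rw [← Real.rpow_add (by positivity)]; congr 1; rw [hg]; ring
      have k2 : (ρ / v) ^ (-(β / 2) - 1) = ρ ^ (-(β / 2)) / ρ * (v ^ (β / 2 - 1) * v ^ 2) := by
        rw [Real.div_rpow hρ0.le hv0.le, Real.rpow_sub_one hρ0.ne', div_eq_mul_inv _ (v ^ _), ← Real.rpow_neg hv0.le,
          ← Real.rpow_natCast v 2, ← Real.rpow_add hv0]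
        congr 2; push_cast; ring
      calc _ = ρ / v ^ 2 * ((4 * π) ^ (-(d:ℝ) / 2) * ((ρ / v) ^ (a * g - 1) * (ρ / v) ^ (-(d:ℝ) / 2))) := by ring
        _ = _ := by rw [k1, k2]; field_simp
    calc _ = (ρ / v ^ 2 * ((ρ / v) ^ (a * g - 1) * (4 * π * (ρ / v)) ^ (-(d:ℝ) / 2))) *
        (Real.exp (-(‖x‖ ^ 2 / (4 * (ρ / v)))) * Real.exp (-(M * (ρ / v)))) := by ring
      _ = _ := by rw [f1, f2]; ring
  have hGf := Gf_pos (ν := β / 2) (ρ := M * ‖x‖ ^ 2) (by positivity) (by positivity)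
  rw [e3, ← ENNReal.ofReal_mul ha.le, ← ENNReal.ofReal_mul (by positivity)]
  congr 1
  have k3 : (‖x‖ ^ 2 / 4) ^ (-(β / 2)) = ‖x‖ ^ (-β) * 4 ^ (β / 2) := by
    rw [Real.div_rpow (by positivity) (by norm_num), ← Real.rpow_natCast ‖x‖ 2, ← Real.rpow_mul hx0.le,
      Real.rpow_neg (show (0:ℝ) ≤ 4 by norm_num), div_inv_eq_mul]
    congr 2; push_cast; ring
  rw [k3, cb, ← hg]
  field_simp

end

noncomputable section
open scoped ENNReal NNReal Topology

def th (β ρ : ℝ) : ℝ := Gf (β / 2) ρ / Real.Gamma (β / 2)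

def phi {d : ℕ} (β M : ℝ) (x : Ed d) : ℝ := ‖x‖ ^ (-β) * th β (M * ‖x‖ ^ 2)

section
variable {d : ℕ} {a M : ℝ} {η : Measure ℝ}

@[fun_prop]
lemma measurable_Gf (ν : ℝ) : Measurable (Gf ν) := by
  unfold Gf
  have : StronglyMeasurable (fun p : ℝ × ℝ => p.2 ^ (ν - 1) * Real.exp (-p.2 - p.1 / (4 * p.2))) := by
    apply Measurable.stronglyMeasurable; fun_prop
  exact (this.integral_prod_right (ν := volume.restrict (Ioi (0:ℝ)))).measurable

@[fun_prop]
lemma measurable_phi (β M : ℝ) : Measurable (phi (d := d) β M) := by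
  unfold phi th
  have := measurable_Gf (β / 2)
  fun_prop

lemma th_pos {β ρ : ℝ} (hβ : 0 < β) (hρ : 0 ≤ ρ) : 0 < th β ρ :=
  div_pos (Gf_pos (by positivity) hρ) (Real.Gamma_pos_of_pos (by positivity))

lemma th_zero {β : ℝ} (hβ : 0 < β) : th β 0 = 1 := by
  rw [th, Gf_zero _ (by positivity), div_self (Real.Gamma_pos_of_pos (by positivity)).ne']

lemma Gf_anti {ν ρ ρ' : ℝ} (hν : 0 < ν) (hρ : 0 ≤ ρ) (h : ρ ≤ ρ') : Gf ν ρ' ≤ Gf ν ρ := by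
  unfold Gf
  refine setIntegral_mono_on (Gf_integrable hν (hρ.trans h)) (Gf_integrable hν hρ) measurableSet_Ioi fun v hv => ?_
  have hv0 : 0 < v := hv
  gcongr

lemma th_anti {β ρ ρ' : ℝ} (hβ : 0 < β) (hρ : 0 ≤ ρ) (h : ρ ≤ ρ') : th β ρ' ≤ th β ρ := by
  unfold th
  have := Real.Gamma_pos_of_pos (show 0 < β / 2 by positivity)
  exact div_le_div_of_nonneg_right (Gf_anti (by positivity) hρ h) this.le

lemma th_le_one {β ρ : ℝ} (hβ : 0 < β) (hρ : 0 ≤ ρ) : th β ρ ≤ 1 := by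
  rw [← th_zero hβ]; exact th_anti hβ le_rfl hρ

lemma th_mono {β β' ρ : ℝ} (hβ : 0 < β) (hβ' : β ≤ β') (hρ : 0 ≤ ρ) : th β ρ ≤ th β' ρ := by
  rcases eq_or_lt_of_le hβ' with rfl | hlt
  · exact le_rfl
  set ν := β / 2
  set ν' := β' / 2
  have hν : 0 < ν := by simp only [ν]; positivity
  have hνν : 0 < ν' - ν := by simp only [ν, ν']; linarith
  have hν' : 0 < ν' := by linarith
  have hG := Real.Gamma_pos_of_pos hν
  have hG' := Real.Gamma_pos_of_pos hν'
  set c := (Real.Gamma ν' / Real.Gamma ν) ^ (1 / (ν' - ν)) with hc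
  have hc0 : 0 < c := by positivity
  have hcp : c ^ (ν' - ν) = Real.Gamma ν' / Real.Gamma ν := by
    rw [hc, ← Real.rpow_mul (by positivity), one_div_mul_cancel hνν.ne', Real.rpow_one]
  set f : ℝ → ℝ := fun v => Real.exp (-(ρ / (4 * v)))
  have i1 := Gf_integrable hν' hρ
  have i2 := (Gf_integrable hν hρ).const_mul (c ^ (ν' - ν))
  have i3 := (Gf_integrable hν' le_rfl).const_mul (f c)
  have i4 := (Gf_integrable hν le_rfl).const_mul (f c * c ^ (ν' - ν))
  have key : 0 ≤ ∫ v in Ioi (0:ℝ), (v ^ (ν' - 1) * Real.exp (-v - ρ / (4 * v)) -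
      c ^ (ν' - ν) * (v ^ (ν - 1) * Real.exp (-v - ρ / (4 * v)))) -
      (f c * (v ^ (ν' - 1) * Real.exp (-v - 0 / (4 * v))) - f c * c ^ (ν' - ν) * (v ^ (ν - 1) * Real.exp (-v - 0 / (4 * v)))) := by
    refine setIntegral_nonneg measurableSet_Ioi fun v hv => ?_
    have hv0 : 0 < v := hv
    have e : v ^ (ν' - 1) = v ^ (ν' - ν) * v ^ (ν - 1) := by rw [← Real.rpow_add hv0]; congr 1; ring
    have e2 : Real.exp (-v - ρ / (4 * v)) = f v * Real.exp (-v) := by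
      simp only [f]; rw [← Real.exp_add]; congr 1; ring
    rw [e, e2, zero_div, sub_zero]
    have : 0 ≤ (v ^ (ν' - ν) - c ^ (ν' - ν)) * (f v - f c) := by
      rcases le_total v c with hvc | hvc
      · apply mul_nonneg_of_nonpos_of_nonpos
        · have := Real.rpow_le_rpow hv0.le hvc hνν.le
          linarith
        · have : f v ≤ f c := by simp only [f]; gcongr
          linarith
      · apply mul_nonneg
        · have := Real.rpow_le_rpow hc0.le hvc hνν.le
          linarith
        · have : f c ≤ f v := by simp only [f]; gcongr
          linarith
    calc 0 ≤ (v ^ (ν' - ν) - c ^ (ν' - ν)) * (f v - f c) * (v ^ (ν - 1) * Real.exp (-v)) := by positivity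
      _ = _ := by ring
  replace key := key.trans_eq (integral_sub (i1.sub i2) (i3.sub i4))
  have k1 := integral_sub i1 i2
  have k2 := integral_sub i3 i4
  rw [integral_const_mul] at k1
  rw [integral_const_mul, integral_const_mul] at k2
  replace key := key.trans_eq (congrArg₂ (· - ·) k1 k2)
  change 0 ≤ Gf ν' ρ - c ^ (ν' - ν) * Gf ν ρ - (f c * Gf ν' 0 - f c * c ^ (ν' - ν) * Gf ν 0) at key
  rw [Gf_zero _ hν, Gf_zero _ hν', hcp] at key
  have e5 : f c * Real.Gamma ν' - f c * (Real.Gamma ν' / Real.Gamma ν) * Real.Gamma ν = 0 := by field_simp; ring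
  rw [e5, sub_zero] at key
  unfold th
  change Gf ν ρ / Real.Gamma ν ≤ Gf ν' ρ / Real.Gamma ν'
  rw [div_le_div_iff₀ hG hG']
  rw [div_mul_eq_mul_div, sub_nonneg, div_le_iff₀ hG] at key
  linarith

lemma one_sub_exp_le {x e : ℝ} (hx : 0 ≤ x) (he : 0 ≤ e) (he1 : e ≤ 1) : 1 - Real.exp (-x) ≤ x ^ e := by
  rcases le_total 1 x with h | h
  · have := Real.one_le_rpow h he
    linarith [Real.exp_pos (-x)]
  · have h1 : x ≤ x ^ e := by
      rcases eq_or_lt_of_le hx with rfl | hx0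
      · positivity
      · simpa using Real.rpow_le_rpow_of_exponent_ge hx0 h he1
    linarith [Real.add_one_le_exp (-x)]

lemma one_sub_th {β ε : ℝ} (hε : 0 < ε) (hεβ : ε < β) (hε2 : ε ≤ 2) : ∃ K : ℝ, 0 < K ∧ ∀ ρ, 0 ≤ ρ →
    1 - th β ρ ≤ K * ρ ^ (ε / 2) := by
  have hβ : 0 < β := hε.trans hεβ
  have hG := Real.Gamma_pos_of_pos (show 0 < β / 2 by positivity)
  have hG' := Real.Gamma_pos_of_pos (show 0 < β / 2 - ε / 2 by linarith)
  refine ⟨Real.Gamma (β / 2 - ε / 2) / Real.Gamma (β / 2), by positivity, fun ρ hρ => ?_⟩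
  have i1 := Gf_integrable (ν := β / 2) (ρ := 0) (by positivity) le_rfl
  have i2 := Gf_integrable (ν := β / 2) (ρ := ρ) (by positivity) hρ
  have i3 := (Gf_integrable (ν := β / 2 - ε / 2) (ρ := 0) (by linarith) le_rfl).const_mul (ρ ^ (ε / 2))
  have key : Gf (β / 2) 0 - Gf (β / 2) ρ ≤ ρ ^ (ε / 2) * Gf (β / 2 - ε / 2) 0 := by
    unfold Gf
    rw [← integral_sub i1 i2, ← integral_const_mul]
    refine setIntegral_mono_on (i1.sub i2) i3 measurableSet_Ioi fun v hv => ?_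
    have hv0 : 0 < v := hv
    have h1 := one_sub_exp_le (x := ρ / (4 * v)) (e := ε / 2) (by positivity) (by positivity) (by linarith)
    have h2 : (ρ / (4 * v)) ^ (ε / 2) ≤ ρ ^ (ε / 2) * v ^ (-(ε / 2)) := by
      rw [Real.div_rpow hρ (by positivity), Real.rpow_neg hv0.le, ← div_eq_mul_inv]
      gcongr; linarith
    have e2 : Real.exp (-v - ρ / (4 * v)) = Real.exp (-(ρ / (4 * v))) * Real.exp (-v) := by
      rw [← Real.exp_add]; congr 1; ring
    have e3 : v ^ (β / 2 - ε / 2 - 1) = v ^ (-(ε / 2)) * v ^ (β / 2 - 1) := by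
      rw [← Real.rpow_add hv0]; congr 1; ring
    rw [e2, e3, zero_div, sub_zero]
    calc _ = (1 - Real.exp (-(ρ / (4 * v)))) * (v ^ (β / 2 - 1) * Real.exp (-v)) := by ring
      _ ≤ (ρ ^ (ε / 2) * v ^ (-(ε / 2))) * (v ^ (β / 2 - 1) * Real.exp (-v)) := by
          gcongr; exact h1.trans h2
      _ = _ := by ring
  rw [Gf_zero _ (by positivity), Gf_zero _ (by linarith)] at key
  unfold th
  rw [one_sub_div hG.ne', div_mul_eq_mul_div, div_le_div_iff_of_pos_right hG]
  linarith

lemma Gf_ratio {ν b : ℝ} (hν : 0 < ν) (hb : 0 < b) : ∃ C : ℝ, 0 < C ∧ ∀ r, 1 ≤ r →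
    Gf (ν + b) (r ^ 2) ≤ C * r ^ b * Gf ν (r ^ 2) := by
  obtain ⟨K, hK, H⟩ := rpow_le_exp b hb.le
  refine ⟨1 + 2 ^ (ν - 1) * (4 ^ b * K) * 2, by positivity, fun r hr => ?_⟩
  have hr0 : 0 < r := by linarith
  set F : ℝ → ℝ := fun v => v ^ (ν - 1) * Real.exp (-v - r ^ 2 / (4 * v)) with hF
  have iF : IntegrableOn F (Ioi 0) := Gf_integrable hν (by positivity)
  have iF2 : IntegrableOn (fun v => F (1 / 2 * v)) (Ioi 0) := by
    have := (integrableOn_Ioi_comp_mul_left_iff F 0 (show (0:ℝ) < 1 / 2 by norm_num)).2 (by simpa using iF)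
    exact this
  have e2 : ∫ v in Ioi (0:ℝ), F (1 / 2 * v) = 2 * Gf ν (r ^ 2) := by
    rw [integral_comp_mul_left_Ioi F 0 (by norm_num)]
    simp; rfl
  have key : Gf (ν + b) (r ^ 2) ≤ ∫ v in Ioi (0:ℝ), (r ^ b * F v + 2 ^ (ν - 1) * (4 ^ b * K) * F (1 / 2 * v)) := by
    refine setIntegral_mono_on (Gf_integrable (by linarith) (by positivity))
      ((iF.const_mul _).add (iF2.const_mul _)) measurableSet_Ioi fun v hv => ?_
    have hv0 : 0 < v := hv
    have p1 : 0 ≤ r ^ b * F v := by simp only [hF]; positivity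
    have p2 : 0 ≤ 2 ^ (ν - 1) * (4 ^ b * K) * F (1 / 2 * v) := by simp only [hF]; positivity
    rw [show ν + b - 1 = b + (ν - 1) by ring, Real.rpow_add hv0]
    rcases le_total v r with hvr | hvr
    · have : v ^ b * v ^ (ν - 1) * Real.exp (-v - r ^ 2 / (4 * v)) ≤ r ^ b * F v := by
        simp only [hF]; rw [mul_assoc]; gcongr
      linarith
    · have h1 : v ^ b ≤ 4 ^ b * (K * Real.exp (v / 4)) := by
        calc v ^ b = 4 ^ b * (v / 4) ^ b := by
              rw [← Real.mul_rpow (by norm_num) (by positivity)]; congr 1; ring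
          _ ≤ _ := by gcongr; exact H _ (by positivity)
      have h2 : v ^ (ν - 1) = 2 ^ (ν - 1) * (1 / 2 * v) ^ (ν - 1) := by
        rw [← Real.mul_rpow (by norm_num) (by positivity)]; congr 1; ring
      have h3 : Real.exp (v / 4) * Real.exp (-v - r ^ 2 / (4 * v)) ≤ Real.exp (-(1 / 2 * v) - r ^ 2 / (4 * (1 / 2 * v))) := by
        rw [← Real.exp_add, Real.exp_le_exp]
        have h4 : r ^ 2 / (4 * (1 / 2 * v)) - r ^ 2 / (4 * v) ≤ v / 4 := by
          rw [show r ^ 2 / (4 * (1 / 2 * v)) - r ^ 2 / (4 * v) = r ^ 2 / (4 * v) by field_simp; ring,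
            div_le_iff₀ (by positivity)]
          nlinarith
        linarith
      have : v ^ b * v ^ (ν - 1) * Real.exp (-v - r ^ 2 / (4 * v)) ≤ 2 ^ (ν - 1) * (4 ^ b * K) * F (1 / 2 * v) := by
        calc _ ≤ 4 ^ b * (K * Real.exp (v / 4)) * v ^ (ν - 1) * Real.exp (-v - r ^ 2 / (4 * v)) := by gcongr
          _ = 4 ^ b * K * v ^ (ν - 1) * (Real.exp (v / 4) * Real.exp (-v - r ^ 2 / (4 * v))) := by ring
          _ ≤ 4 ^ b * K * v ^ (ν - 1) * Real.exp (-(1 / 2 * v) - r ^ 2 / (4 * (1 / 2 * v))) := by gcongr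
          _ = _ := by simp only [hF]; rw [h2]; ring
      linarith
  rw [integral_add (iF.const_mul _) (iF2.const_mul _), integral_const_mul, integral_const_mul, e2] at key
  change _ ≤ r ^ b * Gf ν (r ^ 2) + _ at key
  have hGp := Gf_pos hν (sq_nonneg r)
  have hrb : 1 ≤ r ^ b := Real.one_le_rpow hr hb.le
  have h5 : 2 ^ (ν - 1) * (4 ^ b * K) * (2 * Gf ν (r ^ 2)) ≤ r ^ b * (2 ^ (ν - 1) * (4 ^ b * K) * (2 * Gf ν (r ^ 2))) :=
    le_mul_of_one_le_left (by positivity) hrb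
  calc _ ≤ _ := key
    _ ≤ _ := by nlinarith

lemma phi_nonneg {β : ℝ} (hβ : 0 < β) (hM : 0 ≤ M) (x : Ed d) : 0 ≤ phi β M x := by
  have := th_pos hβ (show 0 ≤ M * ‖x‖ ^ 2 by positivity)
  unfold phi; positivity

lemma kappa_pos {α β : ℝ} (hα : 0 < α) (hβ : 0 < β) (hβd : β < d - α) : 0 < kappa d α β := by
  have h1 := Real.Gamma_pos_of_pos (show 0 < (β + α) / 2 by positivity)
  have h2 := Real.Gamma_pos_of_pos (show 0 < ((d:ℝ) - β) / 2 by linarith)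
  have h3 := Real.Gamma_pos_of_pos (show 0 < β / 2 by positivity)
  have h4 := Real.Gamma_pos_of_pos (show 0 < ((d:ℝ) - β - α) / 2 by linarith)
  unfold kappa; positivity

lemma ae_ne_zero (hd : 0 < d) : ∀ᵐ z : Ed d, z ≠ 0 := by
  have : Nonempty (Fin d) := ⟨⟨0, hd⟩⟩
  have : Nontrivial (Ed d) := inferInstance
  simp [ae_iff, measure_singleton]

lemma phi_ident (h : IsSub a η) (ha : 0 < a) (hM : 0 ≤ M) {β : ℝ} (hβ : 0 < β) (hβd : β < d - 2 * a)
    {s : ℝ} (hs : 0 < s) (x : Ed d) (hx : x ≠ 0) :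
    sact (kP d a η M) (fun z => ENNReal.ofReal (phi β M z)) (s, x) +
      act (fun z => ENNReal.ofReal (kappa d (2 * a) β * phi (β + 2 * a) M z)) (kP d a η M) onePos (s, x) =
      ENNReal.ofReal (phi β M x) := by
  have hd : 0 < d := by
    rcases Nat.eq_zero_or_pos d with h0 | h0
    · subst h0; norm_num at hβd; linarith
    · exact h0
  have hm := measurable_kP (d := d) (M := M) h
  set g := ((d:ℝ) - β) / (2 * a) with hg
  have hg1 : 1 < g := by rw [hg, lt_div_iff₀ (by positivity)]; linarith
  have hag : a * g = ((d:ℝ) - β) / 2 := by rw [hg]; field_simp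
  have hag' : a * (g - 1) = ((d:ℝ) - (β + 2 * a)) / 2 := by rw [mul_sub, hag]; ring
  have hGb := Real.Gamma_pos_of_pos (show 0 < β / 2 by positivity)
  have hGb' := Real.Gamma_pos_of_pos (show 0 < (β + 2 * a) / 2 by positivity)
  have hGg := Real.Gamma_pos_of_pos (show 0 < g by linarith)
  have hGg' := Real.Gamma_pos_of_pos (show 0 < g - 1 by linarith)
  have hGd := Real.Gamma_pos_of_pos (show 0 < ((d:ℝ) - β) / 2 by linarith)
  have hGd' := Real.Gamma_pos_of_pos (show 0 < ((d:ℝ) - (β + 2 * a)) / 2 by linarith)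
  set C := cb d g β * Real.Gamma (β / 2) with hC
  have hC0 : 0 < C := by rw [hC, cb]; positivity
  have v1 : ∀ z : Ed d, z ≠ 0 → kb d a η M g z = ENNReal.ofReal C * ENNReal.ofReal (phi β M z) := by
    intro z hz
    rw [kb_val h ha hM hβ (by linarith) hag z hz, ← ENNReal.ofReal_mul hC0.le]
    congr 1
    rw [phi, th, hC]; field_simp
  have hGrec : Real.Gamma g = (g - 1) * Real.Gamma (g - 1) := by
    have := Real.Gamma_add_one (s := g - 1) (by linarith)
    rwa [sub_add_cancel] at this
  have v2 : ∀ z : Ed d, z ≠ 0 → ENNReal.ofReal (g - 1) * kb d a η M (g - 1) z =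
      ENNReal.ofReal C * ENNReal.ofReal (kappa d (2 * a) β * phi (β + 2 * a) M z) := by
    intro z hz
    rw [kb_val h ha hM (by positivity) (by linarith) hag' z hz, ← ENNReal.ofReal_mul hC0.le, ← ENNReal.ofReal_mul (by linarith)]
    congr 1
    rw [phi, th, hC, cb, cb, kappa, hGrec]
    have e4 : (4:ℝ) ^ ((β + 2 * a) / 2) = 4 ^ (β / 2) * 2 ^ (2 * a) := by
      rw [show (β + 2 * a) / 2 = β / 2 + a by ring, Real.rpow_add (by norm_num)]
      congr 1
      rw [show (4:ℝ) = 2 ^ (2:ℝ) by norm_num, ← Real.rpow_mul (by norm_num)]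
    rw [e4, show (d:ℝ) - β - 2 * a = (d:ℝ) - (β + 2 * a) by ring]
    field_simp
  have key := kb_ident (M := M) h ha hg1 hs x
  have e1 : sact (kP d a η M) (kb d a η M g) (s, x) = ENNReal.ofReal C * sact (kP d a η M) (fun z => ENNReal.ofReal (phi β M z)) (s, x) := by
    unfold sact
    rw [← lintegral_const_mul' _ _ ENNReal.ofReal_ne_top]
    refine lintegral_congr_ae ?_
    filter_upwards [ae_ne_zero hd] with z hz
    rw [v1 z hz]; ring
  have e2 : ENNReal.ofReal (g - 1) * act (kb d a η M (g - 1)) (kP d a η M) onePos (s, x) = ENNReal.ofReal C *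
      act (fun z => ENNReal.ofReal (kappa d (2 * a) β * phi (β + 2 * a) M z)) (kP d a η M) onePos (s, x) := by
    unfold act
    rw [← lintegral_const_mul' _ _ ENNReal.ofReal_ne_top, ← lintegral_const_mul' _ _ ENNReal.ofReal_ne_top]
    refine lintegral_congr_ae ?_
    filter_upwards [ae_snd (ae_ne_zero hd)] with r hr
    calc _ = kP d a η M (r.1, x, r.2) * (ENNReal.ofReal (g - 1) * kb d a η M (g - 1) r.2) * onePos (s - r.1, r.2) := by ring
      _ = _ := by rw [v2 r.2 hr]; ring
  rw [e1, e2, v1 x hx, ← mul_add] at key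
  have hne : ENNReal.ofReal C ≠ 0 := by simpa using hC0
  exact (ENNReal.mul_right_inj hne ENNReal.ofReal_ne_top).1 key

/-- strict monotonicity of the Hardy constant -/
lemma kappa_symm {α β : ℝ} : kappa d α (d - α - β) = kappa d α β := by
  unfold kappa
  rw [show ((d:ℝ) - α - β + α) / 2 = ((d:ℝ) - β) / 2 by ring, show ((d:ℝ) - (d - α - β)) / 2 = (β + α) / 2 by ring,
    show ((d:ℝ) - (d - α - β) - α) / 2 = β / 2 by ring, show ((d:ℝ) - β - α) / 2 = (d - α - β) / 2 by ring]
  ring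

lemma kappa_strict {α β β' : ℝ} (hα : 0 < α) (hβ : 0 < β) (hlt : β < β') (hβ' : β' ≤ (d - α) / 2) :
    kappa d α β < kappa d α β' := by
  set c := ((d:ℝ) - α) / 2 with hc
  set b := α / 2 with hb
  have hb0 : 0 < b := by positivity
  -- product formula
  set Q : ℝ → ℕ → ℝ := fun s n => Real.GammaSeq (s + b) n * Real.GammaSeq (c - s + b) n /
    (Real.GammaSeq s n * Real.GammaSeq (c - s) n) with hQ
  have hk : ∀ s, 0 < s → s < c → kappa d α (2 * s) = 2 ^ α * (Real.Gamma (s + b) * Real.Gamma (c - s + b) /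
    (Real.Gamma s * Real.Gamma (c - s))) := by
    intro s hs hsc
    unfold kappa
    rw [show (2 * s + α) / 2 = s + b by rw [hb]; ring, show ((d:ℝ) - 2 * s) / 2 = c - s + b by rw [hb, hc]; ring,
      show 2 * s / 2 = s by ring, show ((d:ℝ) - 2 * s - α) / 2 = c - s by rw [hc]; ring]
    ring
  have hlim : ∀ s, 0 < s → s < c → Tendsto (Q s) atTop (𝓝 (Real.Gamma (s + b) * Real.Gamma (c - s + b) /
    (Real.Gamma s * Real.Gamma (c - s)))) := by
    intro s hs hsc
    have h1 := Real.Gamma_pos_of_pos hs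
    have h2 := Real.Gamma_pos_of_pos (show 0 < c - s by linarith)
    exact ((Real.GammaSeq_tendsto_Gamma _).mul (Real.GammaSeq_tendsto_Gamma _)).div
      ((Real.GammaSeq_tendsto_Gamma _).mul (Real.GammaSeq_tendsto_Gamma _)) (by positivity)
  have hform : ∀ s, 0 < s → s < c → ∀ n : ℕ, 0 < n → Q s n = (n:ℝ) ^ (2 * b) *
      ∏ j ∈ Finset.range (n + 1), (s + j) * (c - s + j) / ((s + b + j) * (c - s + b + j)) := by
    intro s hs hsc n hn
    have hn0 : (0:ℝ) < n := by exact_mod_cast hn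
    have hcs : 0 < c - s := by linarith
    have pp : ∀ r : ℝ, 0 < r → 0 < ∏ j ∈ Finset.range (n + 1), (r + (j:ℝ)) := fun r hr =>
      Finset.prod_pos fun j _ => by positivity
    have p1 := pp s hs
    have p2 := pp (c - s) hcs
    have p3 := pp (s + b) (by positivity)
    have p4 := pp (c - s + b) (by positivity)
    simp only [hQ, Real.GammaSeq]
    rw [Finset.prod_div_distrib, Finset.prod_mul_distrib, Finset.prod_mul_distrib,
      Real.rpow_add hn0, Real.rpow_add hn0, show 2 * b = b + b by ring, Real.rpow_add hn0]
    have f1 : (0:ℝ) < n.factorial := by positivity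
    have f2 : 0 < (n:ℝ) ^ s := by positivity
    have f3 : 0 < (n:ℝ) ^ (c - s) := by positivity
    field_simp
  set s1 := β / 2 with hs1
  set s2 := β' / 2 with hs2
  have h1 : 0 < s1 := by positivity
  have h12 : s1 < s2 := by simp only [hs1, hs2]; linarith
  have h2c : s2 ≤ c / 2 := by simp only [hs2]; linarith
  have h2 : 0 < s2 := by linarith
  have hc1 : s1 < c := by linarith
  have hc2 : s2 < c := by linarith
  set T : ℝ → ℝ → ℝ := fun s j => (s + j) * (c - s + j) / ((s + b + j) * (c - s + b + j)) with hT
  have hTpos : ∀ s, 0 < s → s < c → ∀ j : ℝ, 0 ≤ j → 0 < T s j := by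
    intro s hs hsc j hj
    have : 0 < c - s := by linarith
    simp only [hT]; positivity
  have hTlt : ∀ j : ℝ, 0 ≤ j → T s1 j < T s2 j := by
    intro j hj
    have q1 : 0 < c - s1 := by linarith
    have q2 : 0 < c - s2 := by linarith
    have hP : s1 * (c - s1) < s2 * (c - s2) := by nlinarith
    simp only [hT]
    rw [div_lt_div_iff₀ (by positivity) (by positivity)]
    have hA : 0 < b * c + b ^ 2 + 2 * b * j := by
      have : 0 < c := by linarith
      positivity
    have e1 : (s1 + j) * (c - s1 + j) * ((s2 + b + j) * (c - s2 + b + j)) - (s2 + j) * (c - s2 + j) * ((s1 + b + j) * (c - s1 + b + j))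
      = (b * c + b ^ 2 + 2 * b * j) * (s1 * (c - s1) - s2 * (c - s2)) := by ring
    nlinarith [mul_pos hA (sub_pos.2 hP)]
  set r0 := T s1 0 / T s2 0 with hr0
  have hr1 : r0 < 1 := (div_lt_one (hTpos s2 h2 hc2 0 le_rfl)).2 (hTlt 0 le_rfl)
  have hle : ∀ᶠ n in atTop, Q s1 n ≤ r0 * Q s2 n := by
    filter_upwards [eventually_gt_atTop 0] with n hn
    rw [hform s1 h1 hc1 n hn, hform s2 h2 hc2 n hn]
    rw [Finset.prod_range_succ', Finset.prod_range_succ']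
    have t2 := hTpos s2 h2 hc2 0 le_rfl
    have hpr : ∏ j ∈ Finset.range n, T s1 ((j + 1 : ℕ):ℝ) ≤ ∏ j ∈ Finset.range n, T s2 ((j + 1 : ℕ):ℝ) :=
      Finset.prod_le_prod (fun j _ => (hTpos s1 h1 hc1 _ (by positivity)).le) (fun j _ => (hTlt _ (by positivity)).le)
    have h0 := hTpos s1 h1 hc1 0 le_rfl
    have e : T s1 0 = r0 * T s2 0 := by rw [hr0]; field_simp
    change (n:ℝ) ^ (2 * b) * ((∏ j ∈ Finset.range n, T s1 ((j + 1 : ℕ):ℝ)) * T s1 ((0:ℕ):ℝ)) ≤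
      r0 * ((n:ℝ) ^ (2 * b) * ((∏ j ∈ Finset.range n, T s2 ((j + 1 : ℕ):ℝ)) * T s2 ((0:ℕ):ℝ)))
    rw [Nat.cast_zero, e]
    have hr00 : 0 < r0 := div_pos h0 t2
    calc _ ≤ (n:ℝ) ^ (2 * b) * ((∏ j ∈ Finset.range n, T s2 ((j + 1 : ℕ):ℝ)) * (r0 * T s2 0)) := by gcongr
      _ = _ := by ring
  have hfin := le_of_tendsto_of_tendsto (hlim s1 h1 hc1) ((hlim s2 h2 hc2).const_mul r0) hle
  rw [show β = 2 * s1 by rw [hs1]; ring, show β' = 2 * s2 by rw [hs2]; ring, hk s1 h1 hc1, hk s2 h2 hc2]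
  have hp : 0 < Real.Gamma (s2 + b) * Real.Gamma (c - s2 + b) / (Real.Gamma s2 * Real.Gamma (c - s2)) := by
    have g1 := Real.Gamma_pos_of_pos h2
    have g2 := Real.Gamma_pos_of_pos (show 0 < c - s2 by linarith)
    have g3 := Real.Gamma_pos_of_pos (show 0 < s2 + b by linarith)
    have g4 := Real.Gamma_pos_of_pos (show 0 < c - s2 + b by linarith)
    positivity
  have : (0:ℝ) < 2 ^ α := by positivity
  refine mul_lt_mul_of_pos_left ?_ this
  nlinarith

end

noncomputable section
open scoped ENNReal NNReal Topology

section
variable {d : ℕ}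

lemma besselK_eq {ν r : ℝ} (hν : 0 < ν) (hr : 0 < r) :
    besselK ν r = 1 / 2 * (r / 2) ^ (-ν) * Gf ν (r ^ 2) := by
  have key : ∫ u in Ioi (0 : ℝ), u ^ (-ν - 1) * Real.exp (-u - r ^ 2 / (4 * u)) =
      (r / 2) ^ (-ν) * (r / 2) ^ (-ν) * Gf ν (r ^ 2) := by
    rw [integral_eq_lintegral_of_nonneg_ae]
    · rw [subst_inv (show 0 < (r / 2) ^ 2 by positivity)]
      have : ∫⁻ v in Ioi (0:ℝ), ENNReal.ofReal ((r / 2) ^ 2 / v ^ 2) * ENNReal.ofReal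
          (((r / 2) ^ 2 / v) ^ (-ν - 1) * Real.exp (-((r / 2) ^ 2 / v) - r ^ 2 / (4 * ((r / 2) ^ 2 / v)))) =
          ∫⁻ v in Ioi (0:ℝ), ENNReal.ofReal ((r / 2) ^ (-ν) * (r / 2) ^ (-ν)) *
            ENNReal.ofReal (v ^ (ν - 1) * Real.exp (-v - r ^ 2 / (4 * v))) := by
        refine setLIntegral_congr_fun measurableSet_Ioi fun v hv => ?_
        have hv0 : 0 < v := hv
        rw [← ENNReal.ofReal_mul (by positivity), ← ENNReal.ofReal_mul (by positivity)]
        congr 1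
        have e1 : -((r / 2) ^ 2 / v) - r ^ 2 / (4 * ((r / 2) ^ 2 / v)) = -v - r ^ 2 / (4 * v) := by
          field_simp; ring
        rw [e1, Real.div_rpow (by positivity) hv0.le, ← Real.rpow_natCast, ← Real.rpow_natCast,
          ← Real.rpow_mul (by positivity)]
        have e2 : (r / 2) ^ (((2:ℕ):ℝ) * (-ν - 1)) = (r / 2) ^ (-ν) * (r / 2) ^ (-ν) / (r / 2) ^ ((2:ℕ):ℝ) := by
          rw [← Real.rpow_add (by positivity), ← Real.rpow_sub (by positivity)]
          congr 1; push_cast; ring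
        have e3 : v ^ (-ν - 1) = (v ^ (ν - 1))⁻¹ / v ^ ((2:ℕ):ℝ) := by
          rw [← Real.rpow_neg hv0.le, ← Real.rpow_sub hv0]; congr 1; push_cast; ring
        rw [e2, e3]
        have : 0 < (r / 2) ^ ((2:ℕ):ℝ) := by positivity
        have : 0 < v ^ ((2:ℕ):ℝ) := by positivity
        have : 0 < v ^ (ν - 1) := by positivity
        field_simp
      rw [this, lintegral_const_mul' _ _ ENNReal.ofReal_ne_top, Gf_lint hν (by positivity),
        ← ENNReal.ofReal_mul (by positivity), ENNReal.toReal_ofReal]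
      have := Gf_pos hν (show 0 ≤ r ^ 2 by positivity)
      positivity
    · filter_upwards [ae_restrict_mem measurableSet_Ioi] with v hv
      have hv0 : 0 < v := hv
      simp only [Pi.zero_apply]; positivity
    · exact Measurable.aestronglyMeasurable (by fun_prop)
  rw [besselK, key]
  have : (r / 2) ^ ν * (r / 2) ^ (-ν) = 1 := by
    rw [← Real.rpow_add (by positivity)]; simp
  linear_combination (1 / 2 * (r / 2) ^ (-ν) * Gf ν (r ^ 2)) * this

lemma Vbeta_eq {α β : ℝ} (hα : 0 < α) (hβ : 0 < β) (hβd : β < d - α) {x : Ed d} (hx : x ≠ 0) :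
    Vbeta d α β x = kappa d α β * ‖x‖ ^ (-α) * (th (β + α) (‖x‖ ^ 2) / th β (‖x‖ ^ 2)) := by
  have hr : 0 < ‖x‖ := norm_pos_iff.2 hx
  rw [Vbeta, VProf, besselK_eq (by positivity) hr, besselK_eq (by positivity) hr, kappa, th, th]
  set r := ‖x‖
  have g1 := Gf_pos (show 0 < β / 2 by positivity) (show 0 ≤ r ^ 2 by positivity)
  have g3 := Real.Gamma_pos_of_pos (show 0 < β / 2 by positivity)
  have g4 := Real.Gamma_pos_of_pos (show 0 < ((d:ℝ) - β - α) / 2 by linarith)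
  have g5 := Real.Gamma_pos_of_pos (show 0 < (β + α) / 2 by linarith)
  have e1 : (r / 2) ^ (-((β + α) / 2)) = (r / 2) ^ (-(β / 2)) * (r ^ (-(α / 2)) * 2 ^ (α / 2)) := by
    rw [show -((β + α) / 2) = -(β / 2) + -(α / 2) by ring, Real.rpow_add (by positivity)]
    congr 1
    rw [Real.div_rpow hr.le (by norm_num), Real.rpow_neg (by norm_num : (0:ℝ) ≤ 2), div_inv_eq_mul]
  have e2 : r ^ (-α) = r ^ (-(α / 2)) * r ^ (-(α / 2)) := by rw [← Real.rpow_add hr]; congr 1; ring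
  have e3 : (2:ℝ) ^ α = 2 ^ (α / 2) * 2 ^ (α / 2) := by rw [← Real.rpow_add (by norm_num)]; congr 1; ring
  rw [e1, e2, e3]
  have : 0 < (r / 2) ^ (-(β / 2)) := by positivity
  field_simp

lemma Vbeta_ge {α β : ℝ} (hα : 0 < α) (hβ : 0 < β) (hβd : β < d - α) {x : Ed d} (hx : x ≠ 0) :
    kappa d α β * ‖x‖ ^ (-α) ≤ Vbeta d α β x := by
  rw [Vbeta_eq hα hβ hβd hx]
  have := kappa_pos hα hβ hβd
  refine le_mul_of_one_le_right (by positivity) ?_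
  rw [one_le_div (th_pos hβ (by positivity))]
  exact th_mono hβ (by linarith) (by positivity)

lemma Vbeta_le {α β ε : ℝ} (hα : 0 < α) (hβ : 0 < β) (hβd : β < d - α) (hε : 0 < ε) (hεβ : ε < β)
    (hε2 : ε ≤ 2) : ∃ B : ℝ, 0 < B ∧ ∀ x : Ed d, x ≠ 0 →
    Vbeta d α β x ≤ kappa d α β * ‖x‖ ^ (-α) + B * (1 + ‖x‖ ^ (-α + ε)) := by
  have hk := kappa_pos hα hβ hβd
  obtain ⟨K, hK, H⟩ := one_sub_th hε hεβ hε2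
  obtain ⟨C, hC, H2⟩ := Gf_ratio (show 0 < β / 2 by positivity) (show 0 < α / 2 by positivity)
  have g3 := Real.Gamma_pos_of_pos (show 0 < β / 2 by positivity)
  have g5 := Real.Gamma_pos_of_pos (show 0 < (β + α) / 2 by linarith)
  have ht1 := th_pos hβ (zero_le_one)
  set B1 := kappa d α β * K / th β 1
  set B2 := kappa d α β * (C * Real.Gamma (β / 2) / Real.Gamma ((β + α) / 2))
  have hB1 : 0 < B1 := by positivity
  have hB2 : 0 < B2 := by positivity
  refine ⟨B1 + B2, by positivity, fun x hx => ?_⟩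
  have hr : 0 < ‖x‖ := norm_pos_iff.2 hx
  rw [Vbeta_eq hα hβ hβd hx]
  set r := ‖x‖
  have ht := th_pos hβ (show 0 ≤ r ^ 2 by positivity)
  rcases le_total r 1 with h1 | h1
  · have ht1' : th β 1 ≤ th β (r ^ 2) := th_anti hβ (by positivity) (by nlinarith)
    have hh := H (r ^ 2) (by positivity)
    have e : (r ^ 2) ^ (ε / 2) = r ^ ε := by
      rw [← Real.rpow_natCast, ← Real.rpow_mul hr.le]; congr 1; push_cast; ring
    rw [e] at hh
    have : th (β + α) (r ^ 2) / th β (r ^ 2) ≤ 1 + K * r ^ ε / th β 1 := by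
      have t1 := th_le_one (show 0 < β + α by positivity) (show 0 ≤ r ^ 2 by positivity)
      calc th (β + α) (r ^ 2) / th β (r ^ 2) ≤ 1 / th β (r ^ 2) := by gcongr
        _ = 1 + (1 - th β (r ^ 2)) / th β (r ^ 2) := by field_simp; ring
        _ ≤ 1 + K * r ^ ε / th β (r ^ 2) := by gcongr
        _ ≤ _ := by gcongr
    calc kappa d α β * r ^ (-α) * (th (β + α) (r ^ 2) / th β (r ^ 2)) ≤
        kappa d α β * r ^ (-α) * (1 + K * r ^ ε / th β 1) := by gcongr
      _ = kappa d α β * r ^ (-α) + B1 * r ^ (-α + ε) := by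
        rw [Real.rpow_add hr]; simp only [B1]; ring
      _ ≤ _ := by
        have : 0 ≤ r ^ (-α + ε) := by positivity
        nlinarith
  · have h2 := H2 r h1
    have : th (β + α) (r ^ 2) / th β (r ^ 2) ≤ (C * Real.Gamma (β / 2) / Real.Gamma ((β + α) / 2)) * r ^ (α / 2) := by
      rw [div_le_iff₀ ht]
      unfold th
      rw [show (β + α) / 2 = β / 2 + α / 2 by ring, div_le_iff₀ (by rw [← add_div]; exact g5)]
      rw [show (β + α) / 2 = β / 2 + α / 2 by ring] at g5
      calc _ ≤ _ := h2
        _ = _ := by field_simp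
    calc kappa d α β * r ^ (-α) * (th (β + α) (r ^ 2) / th β (r ^ 2)) ≤
        kappa d α β * r ^ (-α) * ((C * Real.Gamma (β / 2) / Real.Gamma ((β + α) / 2)) * r ^ (α / 2)) := by gcongr
      _ = B2 * r ^ (-(α / 2)) := by
        rw [show -(α / 2) = -α + α / 2 by ring, Real.rpow_add hr]; simp only [B2]; ring
      _ ≤ B2 * 1 := by
        gcongr
        exact Real.rpow_le_one_of_one_le_of_nonpos h1 (by linarith)
      _ ≤ _ := by
        have : 0 ≤ r ^ (-α + ε) := by positivity
        have : 0 ≤ r ^ (-α) := by positivity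
        have := mul_nonneg hk.le this
        nlinarith

end
end

noncomputable section
open scoped ENNReal NNReal Topology

lemma lint_exp {C r t : ℝ} (hC : 0 ≤ C) (hrt : r ≤ t) :
    ∫⁻ s in Ioo r t, ENNReal.ofReal (C * Real.exp (-C * s)) = ENNReal.ofReal (Real.exp (-C * r) - Real.exp (-C * t)) := by
  have hcont : Continuous fun s : ℝ => C * Real.exp (-C * s) := by fun_prop
  have hintg : ∫ s in r..t, C * Real.exp (-C * s) = Real.exp (-C * r) - Real.exp (-C * t) := by
    rw [intervalIntegral.integral_eq_sub_of_hasDerivAt (f := fun s => - Real.exp (-C * s))]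
    · ring
    · intro s _
      have := (((hasDerivAt_id s).const_mul (-C)).exp).neg
      exact this.congr_deriv (by simp; ring)
    · exact hcont.intervalIntegrable _ _
  rw [← hintg, intervalIntegral.integral_of_le hrt, ofReal_integral_eq_lintegral_ofReal,
    restrict_Ioo_eq_restrict_Ioc]
  · exact (hcont.intervalIntegrable r t).1
  · exact Eventually.of_forall fun s => by simp only [Pi.zero_apply]; positivity

lemma kill_ident {m G : ℝ → ℝ≥0∞} (hm : Measurable m) (hG : Measurable G) {u : ℝ≥0∞}
    (H : ∀ t, 0 < t → m t + ∫⁻ s in Ioo 0 t, G s = u) {C : ℝ} (hC : 0 ≤ C) {t : ℝ} (ht : 0 < t) :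
    ENNReal.ofReal (Real.exp (-C * t)) * m t +
      ∫⁻ s in Ioo 0 t, ENNReal.ofReal (Real.exp (-C * s)) * (G s + ENNReal.ofReal C * m s) = u := by
  set f : ℝ → ℝ≥0∞ := fun s => ENNReal.ofReal (C * Real.exp (-C * s)) with hf
  have hfm : Measurable f := by fun_prop
  have A : ∫⁻ s in Ioo 0 t, f s * m s + f s * ∫⁻ r in Ioo 0 s, G r = ENNReal.ofReal (1 - Real.exp (-C * t)) * u := by
    calc _ = ∫⁻ s in Ioo 0 t, f s * u := by
          refine setLIntegral_congr_fun measurableSet_Ioo fun s hs => ?_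
          rw [← mul_add, H s hs.1]
      _ = (∫⁻ s in Ioo 0 t, f s) * u := by rw [lintegral_mul_const _ hfm]
      _ = _ := by rw [hf, lint_exp hC ht.le]; simp
  have Bq : ∫⁻ s in Ioo 0 t, f s * ∫⁻ r in Ioo 0 s, G r =
      ∫⁻ r in Ioo 0 t, G r * ENNReal.ofReal (Real.exp (-C * r) - Real.exp (-C * t)) := by
    calc _ = ∫⁻ s in Ioo 0 t, ∫⁻ r in Ioo 0 t, ((Ioi (0:ℝ)).indicator (fun _ => (1:ℝ≥0∞)) (s - r)) * (f s * G r) := by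
          refine setLIntegral_congr_fun measurableSet_Ioo fun s hs => ?_
          rw [← lintegral_const_mul _ hG, ← lintegral_indicator measurableSet_Ioo, ← lintegral_indicator measurableSet_Ioo]
          congr 1; funext r
          simp only [indicator, mem_Ioo, mem_Ioi, sub_pos]
          have := hs.1; have := hs.2
          by_cases h1 : 0 < r <;> by_cases h2 : r < s <;> by_cases h3 : r < t <;> simp [h1, h2, h3]
          exfalso; linarith
      _ = ∫⁻ r in Ioo 0 t, ∫⁻ s in Ioo 0 t, ((Ioi (0:ℝ)).indicator (fun _ => (1:ℝ≥0∞)) (s - r)) * (f s * G r) := by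
          rw [lintegral_lintegral_swap]
          have : Measurable fun p : ℝ × ℝ => (Ioi (0:ℝ)).indicator (fun _ => (1:ℝ≥0∞)) (p.1 - p.2) :=
            (measurable_const.indicator measurableSet_Ioi).comp (by fun_prop)
          apply Measurable.aemeasurable
          unfold Function.uncurry
          fun_prop
      _ = _ := by
          refine setLIntegral_congr_fun measurableSet_Ioo fun r hr => ?_
          rw [← lint_exp hC hr.2.le, ← lintegral_const_mul _ (by fun_prop), ← lintegral_indicator measurableSet_Ioo,
            ← lintegral_indicator measurableSet_Ioo]
          congr 1; funext s
          simp only [indicator, mem_Ioo, mem_Ioi, sub_pos]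
          have := hr.1; have := hr.2
          by_cases h1 : 0 < s <;> by_cases h2 : r < s <;> by_cases h3 : s < t <;> simp [h1, h2, h3, hf, mul_comm]
          exfalso; linarith
  rw [lintegral_add_left (by fun_prop), Bq] at A
  calc _ = ENNReal.ofReal (Real.exp (-C * t)) * m t + (∫⁻ s in Ioo 0 t, f s * m s) +
        ∫⁻ s in Ioo 0 t, ENNReal.ofReal (Real.exp (-C * s)) * G s := by
        rw [add_assoc, ← lintegral_add_left (by fun_prop)]
        congr 1; refine lintegral_congr fun s => ?_
        rw [hf]; simp only [ENNReal.ofReal_mul hC]; ring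
    _ = ENNReal.ofReal (Real.exp (-C * t)) * m t + (∫⁻ s in Ioo 0 t, f s * m s) +
        ((∫⁻ s in Ioo 0 t, G s * ENNReal.ofReal (Real.exp (-C * s) - Real.exp (-C * t))) + ENNReal.ofReal (Real.exp (-C * t)) * ∫⁻ s in Ioo 0 t, G s) := by
        rw [← lintegral_const_mul _ hG, ← lintegral_add_left (by fun_prop)]
        congr 1
        refine setLIntegral_congr_fun measurableSet_Ioo fun s hs => ?_
        rw [mul_comm (G s), ← add_mul, ← ENNReal.ofReal_add _ (by positivity)]
        · congr 2; ring
        · rw [sub_nonneg]; apply Real.exp_le_exp.2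
          have := hs.2.le
          nlinarith
    _ = ENNReal.ofReal (Real.exp (-C * t)) * (m t + ∫⁻ s in Ioo 0 t, G s) + ENNReal.ofReal (1 - Real.exp (-C * t)) * u := by
        rw [← A]; ring
    _ = u := by
        rw [H t ht, ← add_mul, ← ENNReal.ofReal_add (by positivity)]
        · simp
        · have : Real.exp (-C * t) ≤ 1 := Real.exp_le_one_iff.2 (by nlinarith)
          linarith

section
variable {d : ℕ} {a : ℝ} {η : Measure ℝ}

lemma kil_ident {k : ℝ × Ed d × Ed d → ℝ≥0∞} (hk : Measurable k) (h0 : ∀ t x y, t ≤ 0 → k (t, x, y) = 0)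
    {φ g : Ed d → ℝ≥0∞} (hφ : Measurable φ) (hg : Measurable g) {x : Ed d}
    (H : ∀ t, 0 < t → sact k φ (t, x) + act g k onePos (t, x) = φ x) {C : ℝ} (hC : 0 ≤ C) {t : ℝ} (ht : 0 < t) :
    sact (kil C k) φ (t, x) + act (fun z => g z + ENNReal.ofReal C * φ z) (kil C k) onePos (t, x) = φ x := by
  have hkm : Measurable (kil C k) := by unfold kil; fun_prop
  have hk0 : ∀ t x y, t ≤ 0 → kil C k (t, x, y) = 0 := fun t x y ht => by simp [kil, h0 t x y ht]
  have key := kill_ident (m := fun s => sact k φ (s, x)) (G := fun s => sact k g (s, x)) (u := φ x) (by fun_prop) (by fun_prop)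
    (fun t ht => by rw [← H t ht, act_onePos_eq hk h0 hg]; rfl) hC ht
  rw [act_onePos_eq hkm hk0 (by fun_prop), ← key]
  congr 1
  · simp only [sact, kil]; rw [← lintegral_const_mul _ (by fun_prop)]; congr 1; funext z; ring
  · congr 1; funext s
    simp only [sact, kil]; rw [← lintegral_const_mul _ (by fun_prop), ← lintegral_add_left (by fun_prop),
      ← lintegral_const_mul _ (by fun_prop)]; congr 1; funext z; ring

def HH {d : ℕ} (δ : ℝ) (x : Ed d) : ℝ≥0∞ := ENNReal.ofReal (1 + ‖x‖ ^ (-δ))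

def qs (d : ℕ) (α δ ε B : ℝ) (x : Ed d) : ℝ≥0∞ :=
  ENNReal.ofReal (kappa d α δ * ‖x‖ ^ (-α) + B * (1 + ‖x‖ ^ (-α + ε)))

@[fun_prop]
lemma measurable_HH (δ : ℝ) : Measurable (HH (d := d) δ) := by unfold HH; fun_prop

@[fun_prop]
lemma measurable_qs (α δ ε B : ℝ) : Measurable (qs d α δ ε B) := by unfold qs; fun_prop

end
end

noncomputable section
open scoped ENNReal NNReal Topology

lemma pow_young {β β' A θ : ℝ} (hβ : 0 ≤ β) (hβ' : β < β') (hA : 0 ≤ A) (hθ : 0 < θ) :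
    ∃ K : ℝ, 0 ≤ K ∧ ∀ X : ℝ, 0 < X → A * X ^ (-β) ≤ θ * X ^ (-β') + K := by
  set r := (θ / (A + 1)) ^ (1 / (β' - β)) with hr
  have hr0 : 0 < r := by positivity
  have hb : 0 < β' - β := by linarith
  refine ⟨A * r ^ (-β), by positivity, fun X hX => ?_⟩
  rcases le_total X r with h | h
  · have e : X ^ (-β) = X ^ (β' - β) * X ^ (-β') := by rw [← Real.rpow_add hX]; congr 1; ring
    have e2 : X ^ (β' - β) ≤ θ / (A + 1) := by
      calc X ^ (β' - β) ≤ r ^ (β' - β) := Real.rpow_le_rpow hX.le h hb.le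
        _ = θ / (A + 1) := by
          rw [hr, ← Real.rpow_mul (by positivity), one_div, inv_mul_cancel₀ hb.ne', Real.rpow_one]
    have e3 : A * (θ / (A + 1)) ≤ θ := by
      rw [mul_div_assoc', div_le_iff₀ (by positivity)]; nlinarith
    have : 0 ≤ A * r ^ (-β) := by positivity
    calc A * X ^ (-β) = A * X ^ (β' - β) * X ^ (-β') := by rw [e]; ring
      _ ≤ A * (θ / (A + 1)) * X ^ (-β') := by gcongr
      _ ≤ θ * X ^ (-β') := by gcongr
      _ ≤ _ := by linarith
  · have : X ^ (-β) ≤ r ^ (-β) := Real.rpow_le_rpow_of_nonpos hr0 h (by linarith)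
    have : 0 ≤ θ * X ^ (-β') := by positivity
    nlinarith

section
variable {d : ℕ} {a : ℝ} {η : Measure ℝ}

def LN (k : ℝ × Ed d × Ed d → ℝ≥0∞) (t : ℝ) (x : Ed d) (φ g : Ed d → ℝ≥0∞) : ℝ≥0∞ :=
  sact k φ (t, x) + act g k onePos (t, x)

lemma LN_add {k : ℝ × Ed d × Ed d → ℝ≥0∞} (hk : Measurable k) {φ g φ' g' : Ed d → ℝ≥0∞} (hφ : Measurable φ)
    (hg : Measurable g) (t x) :
    LN k t x (fun z => φ z + φ' z) (fun z => g z + g' z) = LN k t x φ g + LN k t x φ' g' := by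
  unfold LN
  rw [act_add_pot hk hg (by fun_prop)]
  have : sact k (fun z => φ z + φ' z) (t, x) = sact k φ (t, x) + sact k φ' (t, x) := by
    unfold sact; rw [← lintegral_add_left (by fun_prop)]; congr 1; funext z; ring
  rw [this]; ring

lemma LN_smul {k : ℝ × Ed d × Ed d → ℝ≥0∞} {φ g : Ed d → ℝ≥0∞} (t x) {c : ℝ≥0∞} (hc : c ≠ ∞) :
    LN k t x (fun z => c * φ z) (fun z => c * g z) = c * LN k t x φ g := by
  unfold LN
  rw [mul_add]
  unfold sact act
  rw [← lintegral_const_mul' _ _ hc, ← lintegral_const_mul' _ _ hc]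
  congr 1
  · congr 1; funext z; ring
  · congr 1; funext z; ring

lemma LN_mono {k : ℝ × Ed d × Ed d → ℝ≥0∞} {φ g φ' g' : Ed d → ℝ≥0∞} (t x)
    (h1 : ∀ᵐ z, φ z ≤ φ' z) (h2 : ∀ᵐ z, g z ≤ g' z) : LN k t x φ g ≤ LN k t x φ' g' := by
  unfold LN
  refine add_le_add ?_ (act_mono (fun _ => le_rfl) h2 (fun t => Eventually.of_forall fun _ => le_rfl) (by fun_prop) (by fun_prop) _)
  unfold sact
  refine lintegral_mono_ae ?_
  filter_upwards [h1] with z hz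
  gcongr

lemma kP0_ident (h : IsSub a η) (ha : 0 < a) {β : ℝ} (hβ : 0 < β) (hβd : β < d - 2 * a)
    {s : ℝ} (hs : 0 < s) (x : Ed d) (hx : x ≠ 0) :
    sact (kP d a η 0) (fun z => ENNReal.ofReal (‖z‖ ^ (-β))) (s, x) +
      act (fun z => ENNReal.ofReal (kappa d (2 * a) β * ‖z‖ ^ (-(β + 2 * a)))) (kP d a η 0) onePos (s, x) =
      ENNReal.ofReal (‖x‖ ^ (-β)) := by
  have key := phi_ident h ha le_rfl hβ hβd hs x hx
  simpa only [phi, zero_mul, th_zero hβ, th_zero (show 0 < β + 2 * a by positivity), mul_one] using key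

theorem U13 (h : IsSub a η) (ha : 0 < a) (hd : 0 < d) {δ ε B : ℝ} (hδ : δ ≤ (d - 2 * a) / 2)
    (hε : 0 < ε) (hεδ : ε < δ) (hεa : ε < 2 * a) (hB : 0 ≤ B) :
    ∃ C : ℝ, 0 < C ∧ ∀ t ∈ Ioc (0:ℝ) 1, ∀ x : Ed d, x ≠ 0 →
      sact (ET (kP d a η 0) (qs d (2 * a) δ ε B)) (HH δ) (t, x) +
        act (fun z => ENNReal.ofReal (1 + ‖z‖ ^ (-(δ - ε + 2 * a)))) (ET (kP d a η 0) (qs d (2 * a) δ ε B)) onePos (t, x)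
        ≤ ENNReal.ofReal C * HH δ x := by
  have hδ0 : 0 < δ := hε.trans hεδ
  have hδ' : 0 < δ - ε := by linarith
  set q := qs d (2 * a) δ ε B with hq
  set κ := kappa d (2 * a) δ with hκ
  set κ' := kappa d (2 * a) (δ - ε) with hκ'
  have hκκ : κ' < κ := kappa_strict (by positivity) hδ' (by linarith) hδ
  have hκ0 : 0 < κ := kappa_pos (by positivity) hδ0 (by linarith)
  have hκ'0 : 0 < κ' := kappa_pos (by positivity) hδ' (by linarith)
  set A := (2 + B) / (κ - κ') with hA
  have hA0 : 0 < A := div_pos (by positivity) (by linarith)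
  have hAe : A * (κ - κ') = 2 + B := by rw [hA]; exact div_mul_cancel₀ _ (by linarith)
  obtain ⟨K0, hK0, Y0⟩ := pow_young hδ'.le (show δ - ε < δ by linarith) hA0.le (show (0:ℝ) < 1 / 2 by norm_num)
  set b := 1 + K0 with hb
  obtain ⟨K1, hK1, Y1⟩ := pow_young (show 0 ≤ 2 * a by positivity) (show 2 * a < δ - ε + 2 * a by linarith)
    (show 0 ≤ κ * b by positivity) (show (0:ℝ) < 1 / 2 by norm_num)
  obtain ⟨K2, hK2, Y2⟩ := pow_young (show 0 ≤ 2 * a - ε by linarith) (show 2 * a - ε < δ - ε + 2 * a by linarith)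
    (show 0 ≤ B * b by positivity) (show (0:ℝ) < 1 / 2 by norm_num)
  set C := B + 1 + K1 + K2 with hC
  have hC0 : 0 ≤ C := by positivity
  set hr : Ed d → ℝ := fun z => ‖z‖ ^ (-δ) - A * ‖z‖ ^ (-(δ - ε)) + b with hhr
  have hr1 : ∀ z : Ed d, z ≠ 0 → 1 / 2 * ‖z‖ ^ (-δ) + 1 ≤ hr z := fun z hz => by
    have := Y0 ‖z‖ (norm_pos_iff.2 hz)
    simp only [hhr]; linarith
  have hr2 : ∀ z : Ed d, hr z ≤ ‖z‖ ^ (-δ) + b := fun z => by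
    have : 0 ≤ A * ‖z‖ ^ (-(δ - ε)) := by positivity
    simp only [hhr]; linarith
  have pw : ∀ z : Ed d, z ≠ 0 → (κ * ‖z‖ ^ (-(2 * a)) + B * (1 + ‖z‖ ^ (-(2 * a) + ε))) * hr z + (1 + ‖z‖ ^ (-(δ - ε + 2 * a))) +
      A * (κ' * ‖z‖ ^ (-(δ - ε + 2 * a)) + C * ‖z‖ ^ (-(δ - ε))) ≤
      κ * ‖z‖ ^ (-(δ + 2 * a)) + C * ‖z‖ ^ (-δ) + b * C := fun z hz => by
    have hX : 0 < ‖z‖ := norm_pos_iff.2 hz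
    have y1 := Y1 _ hX
    have y2 := Y2 _ hX
    have h1 := hr1 z hz
    have h2 := hr2 z
    set X := ‖z‖
    have eP : X ^ (-(δ + 2 * a)) = X ^ (-δ) * X ^ (-(2 * a)) := by rw [← Real.rpow_add hX]; congr 1; ring
    have eQ : X ^ (-(δ - ε + 2 * a)) = X ^ (-(δ - ε)) * X ^ (-(2 * a)) := by rw [← Real.rpow_add hX]; congr 1; ring
    have eW : X ^ (-δ) * X ^ (-(2 * a) + ε) = X ^ (-(δ - ε)) * X ^ (-(2 * a)) := by
      rw [← Real.rpow_add hX, ← Real.rpow_add hX]; congr 1; ring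
    rw [show -(2 * a - ε) = -(2 * a) + ε by ring, eQ] at y2
    rw [eQ] at y1
    rw [eP, eQ]
    have hh : hr z = X ^ (-δ) - A * X ^ (-(δ - ε)) + b := rfl
    have p1 : 0 < X ^ (-δ) := by positivity
    have p2 : 0 < X ^ (-(δ - ε)) := by positivity
    have p3 : 0 < X ^ (-(2 * a)) := by positivity
    have p4 : 0 < X ^ (-(2 * a) + ε) := by positivity
    set P := X ^ (-δ)
    set Q := X ^ (-(δ - ε))
    set U := X ^ (-(2 * a))
    set W := X ^ (-(2 * a) + ε)
    have s1 : B * W * hr z ≤ B * (Q * U) + B * b * W := by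
      calc B * W * hr z ≤ B * W * (P + b) := by gcongr
        _ = B * (P * W) + B * b * W := by ring
        _ = _ := by rw [eW]
    have s2 : (K1 + K2 + 1) * 1 ≤ (K1 + K2 + 1) * hr z := by gcongr; linarith
    have s3 : κ * U * hr z + A * κ' * (Q * U) = κ * (P * U) - (2 + B) * (Q * U) + κ * b * U := by
      rw [hh, ← hAe]; ring
    have s4 : C * P + b * C = C * hr z + A * C * Q := by rw [hh]; ring
    have s5 : C * hr z = B * hr z + (K1 + K2 + 1) * hr z := by rw [hC]; ring
    nlinarith
  set k := kil C (kP d a η 0) with hk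
  have hPm : Measurable (kP d a η 0) := measurable_kP (d := d) h
  have hP0 : ∀ t (x y : Ed d), t ≤ 0 → kP d a η 0 (t, x, y) = 0 := fun t x y => kP_zero t x y
  have hkm : Measurable k := by rw [hk]; unfold kil; fun_prop
  have hk0 : ∀ t (x y : Ed d), t ≤ 0 → k (t, x, y) = 0 := fun t x y ht => by simp [hk, kil, hP0 t x y ht]
  have hqm : Measurable q := by fun_prop
  have hrm : Measurable hr := by fun_prop
  have idβ : ∀ β, 0 < β → β < d - 2 * a → ∀ t, 0 < t → ∀ x : Ed d, x ≠ 0 →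
      LN k t x (fun z => ENNReal.ofReal (‖z‖ ^ (-β))) (fun z => ENNReal.ofReal (kappa d (2 * a) β * ‖z‖ ^ (-(β + 2 * a))) +
        ENNReal.ofReal C * ENNReal.ofReal (‖z‖ ^ (-β))) = ENNReal.ofReal (‖x‖ ^ (-β)) := fun β hβ hβd t ht x hx =>
    kil_ident hPm hP0 (by fun_prop) (by fun_prop) (fun s hs => kP0_ident h ha hβ hβd hs x hx) hC0 ht
  have id1 : ∀ t, 0 < t → ∀ x : Ed d, LN k t x (fun _ => 1) (fun _ => 0 + ENNReal.ofReal C * 1) = 1 := fun t ht x =>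
    kil_ident (φ := fun _ => 1) (g := fun _ => 0) hPm hP0 (by fun_prop) (by fun_prop) (fun s hs => by
      simp only [sact, act, mul_one, kP_mass h hs, mul_zero, zero_mul, lintegral_zero, add_zero]) hC0 ht
  have hyp : ∀ t, 0 < t → ∀ x ∈ {x : Ed d | x ≠ 0}, sact k (fun z => ENNReal.ofReal (hr z)) (t, x) +
      act (fun z => q z * ENNReal.ofReal (hr z) + ENNReal.ofReal (1 + ‖z‖ ^ (-(δ - ε + 2 * a)))) k onePos (t, x)
      ≤ ENNReal.ofReal (hr x) := by
    intro t ht x hx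
    have hx : x ≠ 0 := hx
    have i1 := idβ δ hδ0 (by linarith) t ht x hx
    have i2 := idβ (δ - ε) hδ' (by linarith) t ht x hx
    have i3 := id1 t ht x
    change LN k t x _ _ ≤ _
    have fin : ENNReal.ofReal A * ENNReal.ofReal (‖x‖ ^ (-(δ - ε))) ≠ ∞ := ENNReal.mul_ne_top ENNReal.ofReal_ne_top ENNReal.ofReal_ne_top
    refine (ENNReal.add_le_add_iff_right fin).1 ?_
    have hxr : ENNReal.ofReal (hr x) + ENNReal.ofReal A * ENNReal.ofReal (‖x‖ ^ (-(δ - ε))) =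
        ENNReal.ofReal (‖x‖ ^ (-δ)) + ENNReal.ofReal b * 1 := by
      have h1 := hr1 x hx
      have : 0 ≤ ‖x‖ ^ (-δ) := by positivity
      rw [← ENNReal.ofReal_mul hA0.le, ← ENNReal.ofReal_add (by linarith) (by positivity), mul_one,
        ← ENNReal.ofReal_add (by positivity) (by positivity)]
      congr 1; simp only [hhr]; ring
    rw [hxr, ← i1, ← i2, ← i3, ← LN_smul _ _ ENNReal.ofReal_ne_top, ← LN_smul _ _ ENNReal.ofReal_ne_top,
      ← LN_add hkm (by fun_prop) (by fun_prop), ← LN_add hkm (by fun_prop) (by fun_prop)]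
    refine LN_mono _ _ ?_ ?_
    · filter_upwards [ae_ne_zero hd] with z hz
      have h1 := hr1 z hz
      have : 0 ≤ ‖z‖ ^ (-δ) := by positivity
      rw [← ENNReal.ofReal_mul hA0.le, ← ENNReal.ofReal_add (by linarith) (by positivity), mul_one,
        ← ENNReal.ofReal_add (by positivity) (by positivity)]
      apply ENNReal.ofReal_le_ofReal; simp only [hhr]; linarith
    · filter_upwards [ae_ne_zero hd] with z hz
      have h1 := hr1 z hz
      have : 0 ≤ ‖z‖ ^ (-δ) := by positivity
      have h10 : 0 ≤ hr z := by linarith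
      rw [zero_add, mul_one, hq, qs, ← ENNReal.ofReal_mul (by positivity), ← ENNReal.ofReal_mul (by positivity),
        ← ENNReal.ofReal_mul (by positivity), ← ENNReal.ofReal_mul (by positivity),
        ← ENNReal.ofReal_add (by positivity) (by positivity), ← ENNReal.ofReal_add (by positivity) (by positivity),
        ← ENNReal.ofReal_mul (by positivity), ← ENNReal.ofReal_add (by positivity) (by positivity),
        ← ENNReal.ofReal_add (by positivity) (by positivity), ← ENNReal.ofReal_add (by positivity) (by positivity)]
      exact ENNReal.ofReal_le_ofReal (pw z hz)
  have hS : ∀ᵐ z : Ed d, z ∈ {x : Ed d | x ≠ 0} := ae_ne_zero hd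
  have sup := ET_super hkm hqm hk0 (by fun_prop) (by fun_prop) hS hyp
  rw [hk, ET_kil] at sup
  set F := ET (kP d a η 0) q with hF
  have hFm : Measurable F := measurable_ET hPm hqm
  have hF0 : ∀ t (x y : Ed d), t ≤ 0 → F (t, x, y) = 0 := fun t x y ht => ET_zero hP0 t x y ht
  refine ⟨Real.exp C * 2 * (1 + b), by positivity, fun t ht x hx => ?_⟩
  have s1 := sup t ht.1 x hx
  have hmono : ∀ p : ℝ × Ed d × Ed d, p.1 ≤ 1 → F p ≤ ENNReal.ofReal (Real.exp C) * kil C F p := fun p hp => by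
    unfold kil
    rw [← mul_assoc, ← ENNReal.ofReal_mul (by positivity), ← Real.exp_add]
    refine le_mul_of_one_le_left (zero_le) ?_
    rw [ENNReal.one_le_ofReal]
    apply Real.one_le_exp
    nlinarith
  have e1 : sact F (HH δ) (t, x) ≤ ENNReal.ofReal (Real.exp C * 2) * sact (kil C F) (fun z => ENNReal.ofReal (hr z)) (t, x) := by
    unfold sact
    rw [← lintegral_const_mul' _ _ ENNReal.ofReal_ne_top]
    refine lintegral_mono_ae ?_
    filter_upwards [ae_ne_zero hd] with z hz
    have : HH δ z ≤ ENNReal.ofReal 2 * ENNReal.ofReal (hr z) := by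
      rw [HH, ← ENNReal.ofReal_mul (by norm_num)]
      apply ENNReal.ofReal_le_ofReal
      linarith [hr1 z hz]
    calc _ ≤ (ENNReal.ofReal (Real.exp C) * kil C F (t, x, z)) * (ENNReal.ofReal 2 * ENNReal.ofReal (hr z)) :=
          mul_le_mul' (hmono _ ht.2) this
      _ = _ := by rw [ENNReal.ofReal_mul (by positivity)]; ring
  have e2 : act (fun z => ENNReal.ofReal (1 + ‖z‖ ^ (-(δ - ε + 2 * a)))) F onePos (t, x) ≤ ENNReal.ofReal (Real.exp C * 2) *
      act (fun z => ENNReal.ofReal (1 + ‖z‖ ^ (-(δ - ε + 2 * a)))) (kil C F) onePos (t, x) := by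
    unfold act
    rw [← lintegral_const_mul' _ _ ENNReal.ofReal_ne_top]
    refine lintegral_mono fun r => ?_
    dsimp only
    by_cases hrt : r.1 < t
    · have hr1 : r.1 ≤ 1 := hrt.le.trans ht.2
      rw [← mul_assoc, ← mul_assoc]
      gcongr
      refine (hmono (r.1, x, r.2) hr1).trans ?_
      gcongr
      nlinarith [Real.exp_pos C]
    · have : onePos (d := d) (t - r.1, r.2) = 0 := by
        simp only [onePos]; rw [if_neg (by linarith)]
      rw [this]; simp
  calc _ ≤ _ := add_le_add e1 e2
    _ ≤ ENNReal.ofReal (Real.exp C * 2) * ENNReal.ofReal (hr x) := by rw [← mul_add]; gcongr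
    _ ≤ ENNReal.ofReal (Real.exp C * 2) * (ENNReal.ofReal (1 + b) * HH δ x) := by
      gcongr
      rw [HH, ← ENNReal.ofReal_mul (by positivity)]
      apply ENNReal.ofReal_le_ofReal
      have := hr2 x
      have : 0 ≤ b * ‖x‖ ^ (-δ) := by positivity
      linarith
    _ = _ := by rw [← mul_assoc, ← ENNReal.ofReal_mul (by positivity)]

end
end

noncomputable section
open scoped ENNReal NNReal Topology

structure Ctx (d : ℕ) (a : ℝ) (η : Measure ℝ) (δ ε B : ℝ) : Prop where
  h : IsSub a η
  ha : 0 < a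
  ha1 : a < 1
  hd : 0 < d
  hδ : δ ≤ (d - 2 * a) / 2
  hε : 0 < ε
  hεδ : ε < δ
  hεa : ε < 2 * a
  hB : 0 ≤ B

def FF (d : ℕ) (a : ℝ) (η : Measure ℝ) (δ ε B M : ℝ) : ℝ × Ed d × Ed d → ℝ≥0∞ :=
  ET (kP d a η M) (qs d (2 * a) δ ε B)

lemma pow_le_one_add {β β' X : ℝ} (hX : 0 ≤ X) (hβ : 0 ≤ β) (hβ' : β ≤ β') :
    X ^ (-β) ≤ 1 + X ^ (-β') := by
  rcases eq_or_lt_of_le hX with rfl | hX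
  · have : (0:ℝ) ^ (-β) ≤ 1 := by
      rcases eq_or_lt_of_le hβ with rfl | hb
      · simp
      · rw [Real.zero_rpow (by linarith)]; norm_num
    have : (0:ℝ) ≤ 0 ^ (-β') := by positivity
    linarith
  rcases le_total X 1 with h | h
  · have := Real.rpow_le_rpow_of_exponent_ge hX h (neg_le_neg hβ')
    linarith
  · have := Real.rpow_le_one_of_one_le_of_nonpos h (neg_nonpos.2 hβ)
    have : 0 ≤ X ^ (-β') := by positivity
    linarith

namespace Ctx
variable {d : ℕ} {a δ ε B M : ℝ} {η : Measure ℝ}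

lemma δ0 (c : Ctx d a η δ ε B) : 0 < δ := c.hε.trans c.hεδ
lemma κ0 (c : Ctx d a η δ ε B) : 0 < kappa d (2 * a) δ := kappa_pos (by linarith [c.ha]) c.δ0 (by linarith [c.hδ, c.δ0])

lemma meas (c : Ctx d a η δ ε B) : Measurable (FF d a η δ ε B M) := measurable_ET (measurable_kP c.h) (by fun_prop)
lemma zero (c : Ctx d a η δ ε B) (t : ℝ) (x y : Ed d) (ht : t ≤ 0) : FF d a η δ ε B M (t, x, y) = 0 :=
  ET_zero (fun t x y => kP_zero t x y) t x y ht
lemma CK (c : Ctx d a η δ ε B) : CKprop (FF d a η δ ε B M) :=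
  ET_CK (measurable_kP c.h) (by fun_prop) (fun t x y => kP_zero t x y) (kP_CK c.h c.ha)
lemma symm (c : Ctx d a η δ ε B) (t : ℝ) (x y : Ed d) : FF d a η δ ε B M (t, x, y) = FF d a η δ ε B M (t, y, x) :=
  ET_symm (measurable_kP c.h) (by fun_prop) (fun t x y => kP_symm t x y) t x y
lemma mono_M (c : Ctx d a η δ ε B) (hM : 0 ≤ M) (p) : FF d a η δ ε B M p ≤ FF d a η δ ε B 0 p :=
  ET_mono (fun p => kP_anti_M c.h hM p) (Eventually.of_forall fun _ => le_rfl) p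

lemma U1 (c : Ctx d a η δ ε B) : ∃ C : ℝ, 0 < C ∧ ∀ t ∈ Ioc (0:ℝ) 1, ∀ x : Ed d, x ≠ 0 →
    ∫⁻ z, FF d a η δ ε B 0 (t, x, z) * HH δ z ≤ ENNReal.ofReal C * HH δ x := by
  obtain ⟨C, hC, H⟩ := U13 c.h c.ha c.hd c.hδ c.hε c.hεδ c.hεa c.hB
  exact ⟨C, hC, fun t ht x hx => le_self_add.trans (H t ht x hx)⟩

lemma U3 (c : Ctx d a η δ ε B) : ∃ C : ℝ, 0 < C ∧ ∀ t ∈ Ioc (0:ℝ) 1, ∀ x : Ed d, x ≠ 0 →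
    ∫⁻ s in Ioo 0 t, ∫⁻ z, FF d a η δ ε B 0 (s, x, z) * ENNReal.ofReal (1 + ‖z‖ ^ (-(δ - ε + 2 * a)))
      ≤ ENNReal.ofReal C * HH δ x := by
  obtain ⟨C, hC, H⟩ := U13 c.h c.ha c.hd c.hδ c.hε c.hεδ c.hεa c.hB
  refine ⟨C, hC, fun t ht x hx => ?_⟩
  have := le_add_self.trans (H t ht x hx)
  change act _ (FF d a η δ ε B 0) onePos (t, x) ≤ _ at this
  rwa [act_onePos_eq c.meas (fun t x y => c.zero t x y) (by fun_prop)] at this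

lemma qs_le (c : Ctx d a η δ ε B) (z : Ed d) : qs d (2 * a) δ ε B z ≤
    ENNReal.ofReal (kappa d (2 * a) δ + 2 * B) * ENNReal.ofReal (1 + ‖z‖ ^ (-(δ - ε + 2 * a))) := by
  have hκ := c.κ0
  have hB := c.hB
  have ha := c.ha
  rw [qs, ← ENNReal.ofReal_mul (by positivity)]
  apply ENNReal.ofReal_le_ofReal
  have h1 := pow_le_one_add (norm_nonneg z) (show 0 ≤ 2 * a by positivity) (show 2 * a ≤ δ - ε + 2 * a by linarith [c.hεδ])
  have h2 := pow_le_one_add (norm_nonneg z) (show 0 ≤ 2 * a - ε by linarith [c.hεa]) (show 2 * a - ε ≤ δ - ε + 2 * a by linarith [c.δ0])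
  rw [show -(2 * a - ε) = -(2 * a) + ε by ring] at h2
  have : 0 ≤ ‖z‖ ^ (-(δ - ε + 2 * a)) := by positivity
  nlinarith

lemma qs_le' (c : Ctx d a η δ ε B) {r : ℝ} (hr : 0 < r) (hr1 : r ≤ 1) {z : Ed d} (hz : r / 2 ≤ ‖z‖) : qs d (2 * a) δ ε B z ≤
    ENNReal.ofReal ((kappa d (2 * a) δ + 2 * B) * 2 ^ (2 * a) * r ^ (-(2 * a))) := by
  have hκ := c.κ0
  have hB := c.hB
  have ha := c.ha
  rw [qs]
  apply ENNReal.ofReal_le_ofReal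
  have e : (r / 2) ^ (-(2 * a)) = 2 ^ (2 * a) * r ^ (-(2 * a)) := by
    rw [Real.div_rpow hr.le (by norm_num), Real.rpow_neg (by norm_num : (0:ℝ) ≤ 2), div_inv_eq_mul, mul_comm]
  have h1 : ‖z‖ ^ (-(2 * a)) ≤ (r / 2) ^ (-(2 * a)) := Real.rpow_le_rpow_of_nonpos (by positivity) hz (by linarith)
  have h2 : ‖z‖ ^ (-(2 * a) + ε) ≤ (r / 2) ^ (-(2 * a) + ε) := Real.rpow_le_rpow_of_nonpos (by positivity) hz (by linarith [c.hεa])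
  have h3 : (r / 2) ^ (-(2 * a) + ε) ≤ (r / 2) ^ (-(2 * a)) :=
    Real.rpow_le_rpow_of_exponent_ge (by positivity) (by linarith) (by linarith [c.hε])
  have h4 : 1 ≤ (r / 2) ^ (-(2 * a)) := Real.one_le_rpow_of_pos_of_le_one_of_nonpos (by positivity) (by linarith) (by linarith)
  rw [mul_assoc, ← e]
  nlinarith

lemma one_le_HH (c : Ctx d a η δ ε B) (x : Ed d) : 1 ≤ HH δ x := by
  rw [HH, ENNReal.one_le_ofReal]
  have : 0 ≤ ‖x‖ ^ (-δ) := by positivity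
  linarith

/-- crude bound -/
lemma U4 (c : Ctx d a η δ ε B) {s0 : ℝ} (hs0 : 0 < s0) (hs1 : s0 ≤ 1) : ∃ C : ℝ, 0 < C ∧ ∀ s ∈ Icc s0 1, ∀ x y : Ed d, x ≠ 0 → y ≠ 0 →
    FF d a η δ ε B 0 (s, x, y) ≤ ENNReal.ofReal C * HH δ x * ENNReal.ofReal (1 + ‖y‖ ^ (-(d:ℝ))) := by
  have hκ := c.κ0
  have hB := c.hB
  have ha := c.ha
  obtain ⟨C1, hC1, H1⟩ := c.U1
  obtain ⟨C3, hC3, H3⟩ := c.U3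
  obtain ⟨Ct, hCt, Ht⟩ := kP_le_time c.h c.ha c.hd
  obtain ⟨Cs, hCs, Hs⟩ := kP_le_space c.h d
  set Q := kappa d (2 * a) δ + 2 * B with hQ
  have hQ0 : 0 < Q := by positivity
  -- constants
  set E := Real.exp (Q * 2 ^ (2 * a) * (s0 / 2)) with hE
  set D1 := Ct * (s0 / 2) ^ (-(d:ℝ) / (2 * a)) with hD1
  set D2 := Cs * 2 ^ (d:ℝ) with hD2
  have hE0 : 0 < E := by positivity
  have hD10 : 0 < D1 := by positivity
  have hD20 : 0 < D2 := by positivity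
  refine ⟨E * (D1 + D2 * (Q * C3)) * C1, by positivity, fun s hs x y hx hy => ?_⟩
  set r := min ‖y‖ 1 with hr
  have hy0 : 0 < ‖y‖ := norm_pos_iff.2 hy
  have hr0 : 0 < r := lt_min hy0 one_pos
  have hr1 : r ≤ 1 := min_le_right _ _
  have hry : r ≤ ‖y‖ := min_le_left _ _
  set τ := s0 / 2 * r ^ (2 * a) with hτ
  have hτ0 : 0 < τ := by positivity
  have hrp1 : r ^ (2 * a) ≤ 1 := Real.rpow_le_one hr0.le hr1 (by positivity)
  have hτs : τ ≤ s0 / 2 := by rw [hτ]; nlinarith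
  have hτ1 : τ ≤ 1 := by linarith
  have hst : 0 < s - τ := by linarith [hs.1]
  have hkm : Measurable (kP d a η 0) := measurable_kP (d := d) c.h
  have hk0 : ∀ t (x y : Ed d), t ≤ 0 → kP d a η 0 (t, x, y) = 0 := fun t x y => kP_zero t x y
  set q := qs d (2 * a) δ ε B with hq
  set q1 : Ed d → ℝ≥0∞ := (Metric.ball (0:Ed d) (r / 2)).indicator q with hq1
  have hqm : Measurable q := by fun_prop
  have hq1m : Measurable q1 := hqm.indicator measurableSet_ball
  have hq1q : ∀ z, q1 z ≤ q z := fun z => indicator_le_self _ _ z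
  have hr1d : r ^ (-(d:ℝ)) ≤ 1 + ‖y‖ ^ (-(d:ℝ)) := by
    rcases le_total ‖y‖ 1 with h | h
    · rw [hr, min_eq_left h]; linarith
    · rw [hr, min_eq_right h, Real.one_rpow]
      have : 0 ≤ ‖y‖ ^ (-(d:ℝ)) := by positivity
      linarith
  have main : ∀ z : Ed d, z ≠ 0 → FF d a η δ ε B 0 (τ, z, y) ≤
      ENNReal.ofReal (E * (D1 + D2 * (Q * C3)) * r ^ (-(d:ℝ))) * HH δ z := by
    intro z hz
    have s1 : FF d a η δ ε B 0 (τ, z, y) ≤ ENNReal.ofReal E * ET (kP d a η 0) q1 (τ, z, y) := by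
      calc FF d a η δ ε B 0 (τ, z, y) ≤ ET (kP d a η 0) (fun z => q1 z + ENNReal.ofReal (Q * 2 ^ (2 * a) * r ^ (-(2 * a)))) (τ, z, y) := by
            refine ET_mono (fun _ => le_rfl) (Eventually.of_forall fun w => ?_) _
            by_cases hw : w ∈ Metric.ball (0:Ed d) (r / 2)
            · simp only [hq1, indicator_of_mem hw]; exact le_self_add
            · simp only [hq1, indicator_of_notMem hw, zero_add]
              refine c.qs_le' hr0 hr1 ?_
              simpa [dist_eq_norm] using hw
        _ ≤ ENNReal.ofReal (Real.exp (Q * 2 ^ (2 * a) * r ^ (-(2 * a)) * τ)) * ET (kP d a η 0) q1 (τ, z, y) :=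
            ET_add_const hkm hq1m hk0 (kP_CK c.h c.ha) _ (by positivity) _ _ _
        _ = _ := by
            congr 3
            have : r ^ (-(2 * a)) * r ^ (2 * a) = 1 := by rw [← Real.rpow_add hr0]; simp
            rw [hτ]; linear_combination (Q * 2 ^ (2 * a) * (s0 / 2)) * this
    have s2 : kP d a η 0 (τ, z, y) ≤ ENNReal.ofReal (D1 * r ^ (-(d:ℝ))) := by
      refine (Ht 0 le_rfl τ hτ0 z y).trans_eq ?_
      congr 1
      rw [hτ, Real.mul_rpow (by positivity) (by positivity), ← Real.rpow_mul hr0.le, hD1,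
        show 2 * a * (-(d:ℝ) / (2 * a)) = -(d:ℝ) by field_simp]
      ring
    have s3 : cnv q1 (ET (kP d a η 0) q1) (kP d a η 0) (τ, z, y) ≤ ENNReal.ofReal (D2 * r ^ (-(d:ℝ))) * (ENNReal.ofReal (Q * C3) * HH δ z) := by
      rw [cnv_const_eq hkm (measurable_ET hkm hq1m) hk0 (fun t x y => ET_zero hk0 t x y) hq1m]
      calc _ ≤ ∫⁻ s' in Ioo 0 τ, ∫⁻ w, ENNReal.ofReal (D2 * r ^ (-(d:ℝ))) * ENNReal.ofReal Q *
            (FF d a η δ ε B 0 (s', z, w) * ENNReal.ofReal (1 + ‖w‖ ^ (-(δ - ε + 2 * a)))) := by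
            refine lintegral_mono fun s' => lintegral_mono fun w => ?_
            dsimp only
            by_cases hw : w ∈ Metric.ball (0:Ed d) (r / 2)
            · have hw' : ‖w‖ < r / 2 := by simpa [dist_eq_norm] using hw
              have hwy : r / 2 ≤ ‖y - w‖ := by
                have := norm_sub_norm_le y w
                linarith
              have hne : w ≠ y := by rintro rfl; linarith
              have b1 : kP d a η 0 (τ - s', w, y) ≤ ENNReal.ofReal (D2 * r ^ (-(d:ℝ))) := by
                refine (Hs 0 le_rfl _ w y hne).trans (ENNReal.ofReal_le_ofReal ?_)
                have e : (r / 2) ^ (-(d:ℝ)) = 2 ^ (d:ℝ) * r ^ (-(d:ℝ)) := by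
                  rw [Real.div_rpow hr0.le (by norm_num), Real.rpow_neg (by norm_num : (0:ℝ) ≤ 2), div_inv_eq_mul, mul_comm]
                rw [hD2, mul_assoc, ← e]
                refine mul_le_mul_of_nonneg_left ?_ hCs.le
                exact Real.rpow_le_rpow_of_nonpos (by positivity) hwy (neg_nonpos.2 (Nat.cast_nonneg d))
              have b2 : q1 w ≤ ENNReal.ofReal Q * ENNReal.ofReal (1 + ‖w‖ ^ (-(δ - ε + 2 * a))) := (hq1q w).trans (c.qs_le w)
              have b3 : ET (kP d a η 0) q1 (s', z, w) ≤ FF d a η δ ε B 0 (s', z, w) :=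
                ET_mono (fun _ => le_rfl) (Eventually.of_forall hq1q) _
              calc _ ≤ FF d a η δ ε B 0 (s', z, w) * (ENNReal.ofReal Q * ENNReal.ofReal (1 + ‖w‖ ^ (-(δ - ε + 2 * a)))) *
                    ENNReal.ofReal (D2 * r ^ (-(d:ℝ))) := mul_le_mul' (mul_le_mul' b3 b2) b1
                _ = _ := by ring
            · simp [hq1, indicator_of_notMem hw]
        _ = ENNReal.ofReal (D2 * r ^ (-(d:ℝ))) * ENNReal.ofReal Q * ∫⁻ s' in Ioo 0 τ, ∫⁻ w, 
            (FF d a η δ ε B 0 (s', z, w) * ENNReal.ofReal (1 + ‖w‖ ^ (-(δ - ε + 2 * a)))) := by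
            have hfin : ENNReal.ofReal (D2 * r ^ (-(d:ℝ))) * ENNReal.ofReal Q ≠ ∞ := ENNReal.mul_ne_top ENNReal.ofReal_ne_top ENNReal.ofReal_ne_top
            rw [← lintegral_const_mul' _ _ hfin]
            congr 1; funext s'
            rw [← lintegral_const_mul' _ _ hfin]
        _ ≤ ENNReal.ofReal (D2 * r ^ (-(d:ℝ))) * ENNReal.ofReal Q * (ENNReal.ofReal C3 * HH δ z) := by
            gcongr
            exact H3 τ ⟨hτ0, hτ1⟩ z hz
        _ = _ := by rw [ENNReal.ofReal_mul hQ0.le]; ring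
    calc FF d a η δ ε B 0 (τ, z, y) ≤ ENNReal.ofReal E * ET (kP d a η 0) q1 (τ, z, y) := s1
      _ = ENNReal.ofReal E * (kP d a η 0 (τ, z, y) + cnv q1 (ET (kP d a η 0) q1) (kP d a η 0) (τ, z, y)) := by
          rw [ET_duhamel hkm hq1m]
      _ ≤ ENNReal.ofReal E * (ENNReal.ofReal (D1 * r ^ (-(d:ℝ))) * HH δ z + ENNReal.ofReal (D2 * r ^ (-(d:ℝ))) * (ENNReal.ofReal (Q * C3) * HH δ z)) := by
          gcongr
          exact s2.trans (le_mul_of_one_le_right zero_le (c.one_le_HH z))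
      _ = _ := by
          rw [← mul_assoc (ENNReal.ofReal (D2 * r ^ (-(d:ℝ)))), ← ENNReal.ofReal_mul (by positivity), ← add_mul,
            ← ENNReal.ofReal_add (by positivity) (by positivity), ← mul_assoc, ← ENNReal.ofReal_mul (by positivity)]
          congr 2; ring
  have ck := c.CK (M := 0) (s - τ) τ x y hst hτ0
  rw [sub_add_cancel] at ck
  rw [ck]
  calc _ ≤ ∫⁻ z, ENNReal.ofReal (E * (D1 + D2 * (Q * C3)) * r ^ (-(d:ℝ))) * (FF d a η δ ε B 0 (s - τ, x, z) * HH δ z) := by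
        refine lintegral_mono_ae ?_
        filter_upwards [ae_ne_zero c.hd] with z hz
        calc _ ≤ FF d a η δ ε B 0 (s - τ, x, z) * _ := mul_le_mul_right (main z hz) _
          _ = _ := by ring
    _ = ENNReal.ofReal (E * (D1 + D2 * (Q * C3)) * r ^ (-(d:ℝ))) * ∫⁻ z, FF d a η δ ε B 0 (s - τ, x, z) * HH δ z := by
        rw [lintegral_const_mul' _ _ ENNReal.ofReal_ne_top]
    _ ≤ ENNReal.ofReal (E * (D1 + D2 * (Q * C3)) * (1 + ‖y‖ ^ (-(d:ℝ)))) * (ENNReal.ofReal C1 * HH δ x) := by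
        gcongr
        exact H1 _ ⟨hst, by linarith [hs.2]⟩ x hx
    _ = _ := by
        rw [ENNReal.ofReal_mul (p := E * (D1 + D2 * (Q * C3))) (by positivity),
          ENNReal.ofReal_mul (p := E * (D1 + D2 * (Q * C3))) (q := C1) (by positivity)]; ring

end Ctx
end

noncomputable section
open scoped ENNReal NNReal Topology

lemma HH_ne_top {d : ℕ} {δ : ℝ} (x : Ed d) : HH δ x ≠ ∞ := ENNReal.ofReal_ne_top

lemma min_pow {Y Z γ e : ℝ} (hY : 0 < Y) (hZ : 0 < Z) (he : 0 ≤ e) (heγ : e ≤ γ) :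
    min (1 + Y ^ (-γ)) (1 + Z ^ (-γ)) ≤ (1 + Y ^ (-(γ - e))) * (1 + Z ^ (-e)) := by
  have p1 : 0 < Y ^ (-(γ - e)) := by positivity
  have p2 : 0 < Z ^ (-e) := by positivity
  rcases le_total Y Z with h | h
  · refine (min_le_right _ _).trans ?_
    have e1 : Z ^ (-γ) = Z ^ (-(γ - e)) * Z ^ (-e) := by rw [← Real.rpow_add hZ]; congr 1; ring
    have e2 : Z ^ (-(γ - e)) ≤ Y ^ (-(γ - e)) := Real.rpow_le_rpow_of_nonpos hY h (by linarith)
    rw [e1]; nlinarith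
  · refine (min_le_left _ _).trans ?_
    have e1 : Y ^ (-γ) = Y ^ (-(γ - e)) * Y ^ (-e) := by rw [← Real.rpow_add hY]; congr 1; ring
    have e2 : Y ^ (-e) ≤ Z ^ (-e) := Real.rpow_le_rpow_of_nonpos hZ h (by linarith)
    rw [e1]; nlinarith

namespace Ctx
variable {d : ℕ} {a δ ε B M : ℝ} {η : Measure ℝ}

lemma U5 (c : Ctx d a η δ ε B) {γ e : ℝ} (he : 0 ≤ e) (heγ : e ≤ γ) (hea : e ≤ 2 * a - ε)
    (H : ∀ s0, 0 < s0 → s0 ≤ 1 → ∃ C : ℝ, 0 < C ∧ ∀ s ∈ Icc s0 1, ∀ x y : Ed d, x ≠ 0 → y ≠ 0 →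
      FF d a η δ ε B 0 (s, x, y) ≤ ENNReal.ofReal C * HH δ x * HH δ y * ENNReal.ofReal (1 + ‖y‖ ^ (-γ))) :
    ∀ s0, 0 < s0 → s0 ≤ 1 → ∃ C : ℝ, 0 < C ∧ ∀ s ∈ Icc s0 1, ∀ x y : Ed d, x ≠ 0 → y ≠ 0 →
      FF d a η δ ε B 0 (s, x, y) ≤ ENNReal.ofReal C * HH δ x * HH δ y * ENNReal.ofReal (1 + ‖y‖ ^ (-(γ - e))) := by
  intro s0 hs0 hs1
  have hδ0 := c.δ0
  obtain ⟨C, hC, HC⟩ := H (s0 / 4) (by positivity) (by linarith)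
  obtain ⟨C3, hC3, H3⟩ := c.U3
  refine ⟨2 / s0 * (C * 4 * C3), by positivity, fun s hs x y hx hy => ?_⟩
  have hs00 : 0 < s := hs0.trans_le hs.1
  set F := FF d a η δ ε B 0 with hF
  set K := ENNReal.ofReal (C * 4) * HH δ y * ENNReal.ofReal (1 + ‖y‖ ^ (-(γ - e))) with hK
  have hKt : K ≠ ∞ := ENNReal.mul_ne_top (ENNReal.mul_ne_top ENNReal.ofReal_ne_top (HH_ne_top _)) ENNReal.ofReal_ne_top
  have hY : 0 < ‖y‖ := norm_pos_iff.2 hy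
  have step : ∀ r ∈ Ioo (s / 4) (3 * s / 4), F (s, x, y) ≤
      K * ∫⁻ z, F (r, x, z) * ENNReal.ofReal (1 + ‖z‖ ^ (-(δ - ε + 2 * a))) := by
    intro r hr
    have ck := c.CK (M := 0) r (s - r) x y (by linarith [hr.1]) (by linarith [hr.2])
    rw [add_sub_cancel] at ck
    rw [hF, ck, ← lintegral_const_mul' _ _ hKt]
    refine lintegral_mono_ae ?_
    filter_upwards [ae_ne_zero c.hd] with z hz
    have hZ : 0 < ‖z‖ := norm_pos_iff.2 hz
    have hsr : s - r ∈ Icc (s0 / 4) 1 := ⟨by linarith [hr.2, hs.1], by linarith [hr.1, hs.2]⟩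
    have b1 := HC _ hsr z y hz hy
    have b2 := HC _ hsr y z hy hz
    rw [hF, c.symm] at b2
    have b3 : FF d a η δ ε B 0 (s - r, z, y) ≤ ENNReal.ofReal C * HH δ z * HH δ y *
        ENNReal.ofReal (min (1 + ‖y‖ ^ (-γ)) (1 + ‖z‖ ^ (-γ))) := by
      rcases min_choice (1 + ‖y‖ ^ (-γ)) (1 + ‖z‖ ^ (-γ)) with h | h
      · rw [h]; exact b1
      · rw [h]; refine b2.trans_eq (by ring)
    have b4 : HH δ z * ENNReal.ofReal (1 + ‖z‖ ^ (-e)) ≤ ENNReal.ofReal 4 * ENNReal.ofReal (1 + ‖z‖ ^ (-(δ - ε + 2 * a))) := by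
      rw [HH, ← ENNReal.ofReal_mul (by positivity), ← ENNReal.ofReal_mul (by positivity)]
      apply ENNReal.ofReal_le_ofReal
      have h1 := pow_le_one_add hZ.le hδ0.le (show δ ≤ δ - ε + 2 * a by linarith [c.hεa])
      have h2 := pow_le_one_add hZ.le he (show e ≤ δ - ε + 2 * a by linarith)
      have h3 := pow_le_one_add hZ.le (show 0 ≤ δ + e by linarith) (show δ + e ≤ δ - ε + 2 * a by linarith)
      have h4 : ‖z‖ ^ (-(δ + e)) = ‖z‖ ^ (-δ) * ‖z‖ ^ (-e) := by rw [← Real.rpow_add hZ]; congr 1; ring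
      have : 0 < ‖z‖ ^ (-(δ - ε + 2 * a)) := by positivity
      nlinarith
    calc FF d a η δ ε B 0 (r, x, z) * FF d a η δ ε B 0 (s - r, z, y) ≤ FF d a η δ ε B 0 (r, x, z) *
          (ENNReal.ofReal C * HH δ z * HH δ y * ENNReal.ofReal ((1 + ‖y‖ ^ (-(γ - e))) * (1 + ‖z‖ ^ (-e)))) := by
          refine mul_le_mul_right (b3.trans (mul_le_mul_right ?_ _)) _
          exact ENNReal.ofReal_le_ofReal (min_pow hY hZ he heγ)
      _ = FF d a η δ ε B 0 (r, x, z) * (ENNReal.ofReal C * HH δ y * ENNReal.ofReal (1 + ‖y‖ ^ (-(γ - e))) *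
          (HH δ z * ENNReal.ofReal (1 + ‖z‖ ^ (-e)))) := by
          rw [ENNReal.ofReal_mul (by positivity)]; ring
      _ ≤ FF d a η δ ε B 0 (r, x, z) * (ENNReal.ofReal C * HH δ y * ENNReal.ofReal (1 + ‖y‖ ^ (-(γ - e))) *
          (ENNReal.ofReal 4 * ENNReal.ofReal (1 + ‖z‖ ^ (-(δ - ε + 2 * a))))) :=
          mul_le_mul_right (mul_le_mul_right b4 _) _
      _ = _ := by rw [hK, ENNReal.ofReal_mul hC.le]; ring
  have avg : ENNReal.ofReal (s / 2) * F (s, x, y) ≤ K * (ENNReal.ofReal C3 * HH δ x) := by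
    calc ENNReal.ofReal (s / 2) * F (s, x, y) = ∫⁻ r in Ioo (s / 4) (3 * s / 4), F (s, x, y) := by
          rw [setLIntegral_const, Real.volume_Ioo, mul_comm]; congr 2; ring
      _ ≤ ∫⁻ r in Ioo (s / 4) (3 * s / 4), K * ∫⁻ z, F (r, x, z) * ENNReal.ofReal (1 + ‖z‖ ^ (-(δ - ε + 2 * a))) :=
          setLIntegral_mono' measurableSet_Ioo step
      _ ≤ ∫⁻ r in Ioo 0 s, K * ∫⁻ z, F (r, x, z) * ENNReal.ofReal (1 + ‖z‖ ^ (-(δ - ε + 2 * a))) :=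
          lintegral_mono_set (Ioo_subset_Ioo (by positivity) (by linarith))
      _ = K * ∫⁻ r in Ioo 0 s, ∫⁻ z, F (r, x, z) * ENNReal.ofReal (1 + ‖z‖ ^ (-(δ - ε + 2 * a))) := by
          rw [lintegral_const_mul' _ _ hKt]
      _ ≤ _ := by
          refine mul_le_mul_right (H3 s ⟨hs00, hs.2⟩ x hx) _
  calc F (s, x, y) = ENNReal.ofReal (2 / s) * (ENNReal.ofReal (s / 2) * F (s, x, y)) := by
        rw [← mul_assoc, ← ENNReal.ofReal_mul (by positivity), show 2 / s * (s / 2) = 1 by field_simp]; simp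
    _ ≤ ENNReal.ofReal (2 / s0) * (K * (ENNReal.ofReal C3 * HH δ x)) := by
        refine mul_le_mul' (ENNReal.ofReal_le_ofReal ?_) avg
        exact div_le_div_of_nonneg_left (by norm_num) hs0 hs.1
    _ = _ := by
        rw [hK, ENNReal.ofReal_mul (p := 2 / s0) (by positivity), ENNReal.ofReal_mul (p := C * 4) (by positivity)]; ring

lemma U6 (c : Ctx d a η δ ε B) {s0 : ℝ} (hs0 : 0 < s0) (hs1 : s0 ≤ 1) : ∃ C : ℝ, 0 < C ∧ ∀ s ∈ Icc s0 1, ∀ x y : Ed d, x ≠ 0 → y ≠ 0 →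
    FF d a η δ ε B 0 (s, x, y) ≤ ENNReal.ofReal C * HH δ x * HH δ y := by
  have hd : (0:ℝ) < d := by exact_mod_cast c.hd
  have hea : 0 < 2 * a - ε := by linarith [c.hεa]
  obtain ⟨n, hn⟩ := exists_nat_gt ((d:ℝ) / (2 * a - ε))
  have hn0 : 0 < (n:ℝ) := lt_of_le_of_lt (by positivity) hn
  set e := (d:ℝ) / n with he
  have he0 : 0 < e := by positivity
  have hea' : e ≤ 2 * a - ε := by
    rw [he, div_le_iff₀ hn0]; rw [div_lt_iff₀ hea] at hn; linarith
  have hne : n * e = d := by rw [he]; field_simp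
  have key : ∀ j : ℕ, j ≤ n → ∀ s0, 0 < s0 → s0 ≤ 1 → ∃ C : ℝ, 0 < C ∧ ∀ s ∈ Icc s0 1, ∀ x y : Ed d, x ≠ 0 → y ≠ 0 →
      FF d a η δ ε B 0 (s, x, y) ≤ ENNReal.ofReal C * HH δ x * HH δ y * ENNReal.ofReal (1 + ‖y‖ ^ (-((d:ℝ) - j * e))) := by
    intro j
    induction j with
    | zero =>
      intro _ s0 hs0 hs1
      obtain ⟨C, hC, H⟩ := c.U4 hs0 hs1
      refine ⟨C, hC, fun s hs x y hx hy => (H s hs x y hx hy).trans ?_⟩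
      simp only [Nat.cast_zero, zero_mul, sub_zero]
      refine mul_le_mul_left ?_ _
      exact le_mul_of_one_le_right zero_le (c.one_le_HH y)
    | succ j ih =>
      intro hj
      have := c.U5 he0.le (γ := (d:ℝ) - j * e) (by
        have : ((j + 1 : ℕ):ℝ) ≤ n := by exact_mod_cast hj
        push_cast at this
        nlinarith) hea' (ih (by omega))
      rw [show (d:ℝ) - j * e - e = (d:ℝ) - ((j + 1 : ℕ):ℝ) * e by push_cast; ring] at this
      exact this
  obtain ⟨C, hC, H⟩ := key n le_rfl s0 hs0 hs1
  refine ⟨C * 2, by positivity, fun s hs x y hx hy => (H s hs x y hx hy).trans_eq ?_⟩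
  rw [hne, sub_self, neg_zero, Real.rpow_zero, ENNReal.ofReal_mul hC.le, show (1:ℝ) + 1 = 2 by norm_num]
  ring

end Ctx
end

noncomputable section
open scoped ENNReal NNReal Topology

lemma lint_ball {d : ℕ} (hd : 0 < d) {γ : ℝ} (hγ : γ < d) :
    ∫⁻ z in Metric.ball (0 : Ed d) 1, ENNReal.ofReal (‖z‖ ^ (-γ)) ≠ ∞ := by
  have hne : Nontrivial (Ed d) := by
    have : Nonempty (Fin d) := ⟨⟨0, hd⟩⟩
    infer_instance
  set f : ℝ → ℝ := (Iio (1:ℝ)).indicator (fun r => r ^ (-γ)) with hf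
  have hi : Integrable (fun z : Ed d => f ‖z‖) := by
    rw [integrable_fun_norm_addHaar]
    have h1 : IntegrableOn (fun r : ℝ => r ^ ((d:ℝ) - 1 - γ)) (Ioo 0 1) := by
      rw [intervalIntegral.integrableOn_Ioo_rpow_iff (by norm_num)]; linarith
    have h2 : IntegrableOn ((Iio (1:ℝ)).indicator (fun r : ℝ => r ^ ((d:ℝ) - 1 - γ))) (Ioi 0) := by
      rw [IntegrableOn, integrable_indicator_iff measurableSet_Iio, IntegrableOn, Measure.restrict_restrict measurableSet_Iio]
      rwa [Iio_inter_Ioi]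
    refine h2.congr_fun (fun r hr => ?_) measurableSet_Ioi
    have hr : 0 < r := hr
    simp only [hf, smul_eq_mul, finrank_euclideanSpace, Fintype.card_fin]
    by_cases h : r ∈ Iio (1:ℝ)
    · rw [indicator_of_mem h, indicator_of_mem h, ← Real.rpow_natCast, ← Real.rpow_add hr, Nat.cast_sub hd]
      push_cast; congr 1
    · rw [indicator_of_notMem h, indicator_of_notMem h, mul_zero]
  have := hi.hasFiniteIntegral
  rw [hasFiniteIntegral_iff_norm] at this
  refine ne_top_of_le_ne_top this.ne ?_
  rw [← lintegral_indicator measurableSet_ball]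
  refine lintegral_mono fun z => ?_
  by_cases h : z ∈ Metric.ball (0 : Ed d) 1
  · have h' : ‖z‖ ∈ Iio (1:ℝ) := by simpa using h
    rw [indicator_of_mem h, hf, indicator_of_mem h', Real.norm_of_nonneg (by positivity)]
  · rw [indicator_of_notMem h]; exact zero_le

namespace Ctx
variable {d : ℕ} {a δ ε B M : ℝ} {η : Measure ℝ}

lemma d2a (c : Ctx d a η δ ε B) : 2 * a < d := by linarith [c.hδ, c.δ0]

lemma qs_le_ball (c : Ctx d a η δ ε B) {z : Ed d} (hz : z ≠ 0) (hz1 : ‖z‖ < 1) : qs d (2 * a) δ ε B z ≤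
    ENNReal.ofReal ((kappa d (2 * a) δ + 2 * B) * ‖z‖ ^ (-(2 * a))) := by
  have hκ := c.κ0
  have hB := c.hB
  have ha := c.ha
  have hz0 : 0 < ‖z‖ := norm_pos_iff.2 hz
  rw [qs]
  apply ENNReal.ofReal_le_ofReal
  have h3 : ‖z‖ ^ (-(2 * a) + ε) ≤ ‖z‖ ^ (-(2 * a)) :=
    Real.rpow_le_rpow_of_exponent_ge hz0 hz1.le (by linarith [c.hε])
  have h4 : 1 ≤ ‖z‖ ^ (-(2 * a)) := Real.one_le_rpow_of_pos_of_le_one_of_nonpos hz0 hz1.le (by linarith)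
  nlinarith

lemma int_qH (c : Ctx d a η δ ε B) : ∫⁻ z in Metric.ball (0 : Ed d) 1, qs d (2 * a) δ ε B z * HH δ z ≠ ∞ := by
  have hκ := c.κ0
  have hB := c.hB
  have ha := c.ha
  have hδ := c.δ0
  refine ne_top_of_le_ne_top (ENNReal.mul_ne_top (ENNReal.ofReal_ne_top (r := (kappa d (2 * a) δ + 2 * B) * 2))
    (lint_ball c.hd (γ := 2 * a + δ) (by linarith [c.hδ, c.d2a]))) ?_
  rw [← lintegral_const_mul' _ _ ENNReal.ofReal_ne_top]
  refine lintegral_mono_ae ?_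
  filter_upwards [ae_restrict_of_ae (ae_ne_zero c.hd), ae_restrict_mem measurableSet_ball] with z hz hz1
  have hz1 : ‖z‖ < 1 := by simpa using hz1
  have hz0 : 0 < ‖z‖ := norm_pos_iff.2 hz
  refine (mul_le_mul_left (c.qs_le_ball hz hz1) _).trans ?_
  rw [HH, ← ENNReal.ofReal_mul (by positivity), ← ENNReal.ofReal_mul (by positivity)]
  apply ENNReal.ofReal_le_ofReal
  have h4 : 1 ≤ ‖z‖ ^ (-δ) := Real.one_le_rpow_of_pos_of_le_one_of_nonpos hz0 hz1.le (by linarith)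
  have h5 : ‖z‖ ^ (-(2 * a + δ)) = ‖z‖ ^ (-(2 * a)) * ‖z‖ ^ (-δ) := by rw [← Real.rpow_add hz0]; congr 1; ring
  rw [h5]
  have : 0 < ‖z‖ ^ (-(2 * a)) := by positivity
  have : 0 < (kappa d (2 * a) δ + 2 * B) * ‖z‖ ^ (-(2 * a)) := by positivity
  nlinarith

/-- potential restricted to the unit ball -/
abbrev q1 (_ : Ctx d a η δ ε B) : Ed d → ℝ≥0∞ := (Metric.ball (0:Ed d) 1).indicator (qs d (2 * a) δ ε B)

lemma q1_meas (c : Ctx d a η δ ε B) : Measurable c.q1 := Measurable.indicator (by fun_prop) measurableSet_ball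
lemma q1_le (c : Ctx d a η δ ε B) (z) : c.q1 z ≤ qs d (2 * a) δ ε B z := indicator_le_self _ _ z

lemma E_le (c : Ctx d a η δ ε B) (hM : 0 ≤ M) (p) : ET (kP d a η M) c.q1 p ≤ FF d a η δ ε B 0 p :=
  ET_mono (fun p => kP_anti_M c.h hM p) (Eventually.of_forall c.q1_le) p

lemma F_le_E (c : Ctx d a η δ ε B) : ∃ C : ℝ, 0 < C ∧ ∀ M, ∀ x y : Ed d, FF d a η δ ε B M (1, x, y) ≤ ENNReal.ofReal C * ET (kP d a η M) c.q1 (1, x, y) := by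
  have hκ := c.κ0
  have hB := c.hB
  refine ⟨Real.exp ((kappa d (2 * a) δ + 2 * B) * 2 ^ (2 * a) * 1 ^ (-(2 * a)) * 1), by positivity, fun M x y => ?_⟩
  calc FF d a η δ ε B M (1, x, y) ≤ ET (kP d a η M) (fun z => c.q1 z + ENNReal.ofReal ((kappa d (2 * a) δ + 2 * B) * 2 ^ (2 * a) * 1 ^ (-(2 * a)))) (1, x, y) := by
        refine ET_mono (fun _ => le_rfl) (Eventually.of_forall fun w => ?_) _
        by_cases hw : w ∈ Metric.ball (0:Ed d) 1
        · simp only [q1, indicator_of_mem hw]; exact le_self_add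
        · simp only [q1, indicator_of_notMem hw, zero_add]
          refine c.qs_le' one_pos le_rfl ?_
          have : 1 ≤ ‖w‖ := by simpa using hw
          linarith
    _ ≤ _ :=
        ET_add_const (measurable_kP c.h) c.q1_meas (fun t x y => kP_zero t x y) (kP_CK c.h c.ha) _ (by positivity) _ _ _

lemma W (c : Ctx d a η δ ε B) (M0 : ℝ) : ∃ C : ℝ, 0 < C ∧ ∀ M, 0 ≤ M → M ≤ M0 → ∀ s ∈ Ioc (0:ℝ) 1, ∀ x y : Ed d, x ≠ 0 → 2 ≤ ‖y‖ →
    ∀ v, 0 ≤ v → v ≤ ‖y‖ + 3 →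
    ET (kP d a η M) c.q1 (s, x, y) ≤ kP d a η M (s, x, y) + ENNReal.ofReal C * JJ d a M v * HH δ x := by
  have hκ := c.κ0
  have hB := c.hB
  have ha := c.ha
  obtain ⟨C3, hC3, H3⟩ := c.U3
  obtain ⟨C1, hC1, H1⟩ := kP_le_J1 c.h c.ha c.ha1 d M0
  set Q := kappa d (2 * a) δ + 2 * B with hQ
  have hQ0 : 0 < Q := by positivity
  refine ⟨C1 * Q * C3, by positivity, fun M hM hM0 s hs x y hx hy v hv hvy => ?_⟩
  have hkm : Measurable (kP d a η M) := measurable_kP (d := d) c.h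
  have hk0 : ∀ t (x y : Ed d), t ≤ 0 → kP d a η M (t, x, y) = 0 := fun t x y => kP_zero t x y
  rw [ET_duhamel hkm c.q1_meas]
  refine add_le_add_right ?_ _
  rw [cnv_const_eq hkm (measurable_ET hkm c.q1_meas) hk0 (fun t x y => ET_zero hk0 t x y) c.q1_meas]
  have hJ : JJ d a M v ≠ ∞ := ne_top_of_le_ne_top ENNReal.ofReal_ne_top (JJ_le ha hM v)
  have hfin : ENNReal.ofReal C1 * JJ d a M v * ENNReal.ofReal Q ≠ ∞ := ENNReal.mul_ne_top (ENNReal.mul_ne_top ENNReal.ofReal_ne_top hJ) ENNReal.ofReal_ne_top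
  calc _ ≤ ∫⁻ s' in Ioo 0 s, ∫⁻ w, ENNReal.ofReal C1 * JJ d a M v * ENNReal.ofReal Q *
        (FF d a η δ ε B 0 (s', x, w) * ENNReal.ofReal (1 + ‖w‖ ^ (-(δ - ε + 2 * a)))) := by
        refine setLIntegral_mono' measurableSet_Ioo fun s' hs' => lintegral_mono fun w => ?_
        dsimp only
        by_cases hw : w ∈ Metric.ball (0:Ed d) 1
        · have hw' : ‖w‖ < 1 := by simpa [dist_eq_norm] using hw
          have hwy := norm_sub_norm_le y w
          have b1 : kP d a η M (s - s', w, y) ≤ ENNReal.ofReal C1 * JJ d a M v := 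
            H1 M hM hM0 _ ⟨by linarith [hs'.2], by linarith [hs'.1, hs.2]⟩ w y (by linarith) v hv (by linarith)
          have b2 : c.q1 w ≤ ENNReal.ofReal Q * ENNReal.ofReal (1 + ‖w‖ ^ (-(δ - ε + 2 * a))) := (c.q1_le w).trans (c.qs_le w)
          calc _ ≤ FF d a η δ ε B 0 (s', x, w) * (ENNReal.ofReal Q * ENNReal.ofReal (1 + ‖w‖ ^ (-(δ - ε + 2 * a)))) *
                (ENNReal.ofReal C1 * JJ d a M v) := mul_le_mul' (mul_le_mul' (c.E_le hM _) b2) b1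
            _ = _ := by ring
        · simp [q1, indicator_of_notMem hw]
    _ = ENNReal.ofReal C1 * JJ d a M v * ENNReal.ofReal Q * ∫⁻ s' in Ioo 0 s, ∫⁻ w, 
        (FF d a η δ ε B 0 (s', x, w) * ENNReal.ofReal (1 + ‖w‖ ^ (-(δ - ε + 2 * a)))) := by
        rw [← lintegral_const_mul' _ _ hfin]
        congr 1; funext s'
        rw [← lintegral_const_mul' _ _ hfin]
    _ ≤ ENNReal.ofReal C1 * JJ d a M v * ENNReal.ofReal Q * (ENNReal.ofReal C3 * HH δ x) :=
        mul_le_mul_right (H3 s hs x hx) _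
    _ = _ := by rw [ENNReal.ofReal_mul (p := C1 * Q) (by positivity), ENNReal.ofReal_mul hC1.le]; ring

lemma Wb (c : Ctx d a η δ ε B) (M0 : ℝ) : ∃ C : ℝ, 0 < C ∧ ∀ M, 0 ≤ M → M ≤ M0 → ∀ x y : Ed d, x ≠ 0 → ‖x‖ ≤ 2 → 2 ≤ ‖y‖ →
    ET (kP d a η M) c.q1 (1, x, y) ≤ ENNReal.ofReal C * kP d a η M (1, x, y) * HH δ x := by
  obtain ⟨C, hC, H⟩ := c.W M0
  obtain ⟨C2, hC2, H2⟩ := J_le_kP c.h c.ha c.ha1 d M0 1 one_pos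
  refine ⟨1 + C * C2, by positivity, fun M hM hM0 x y hx hx2 hy => ?_⟩
  refine (H M hM hM0 1 ⟨one_pos, le_rfl⟩ x y hx hy ‖y - x‖ (norm_nonneg _) (by linarith [norm_sub_le y x])).trans ?_
  have b := H2 M hM hM0 1 ⟨le_rfl, le_rfl⟩ x y
  calc _ ≤ kP d a η M (1, x, y) * HH δ x + ENNReal.ofReal C * (ENNReal.ofReal C2 * kP d a η M (1, x, y)) * HH δ x := by
        refine add_le_add (le_mul_of_one_le_right zero_le (c.one_le_HH x)) ?_
        exact mul_le_mul_left (mul_le_mul_right b _) _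
    _ = _ := by rw [ENNReal.ofReal_add (by norm_num) (by positivity), ENNReal.ofReal_mul hC.le, ENNReal.ofReal_one]; ring

lemma Wc (c : Ctx d a η δ ε B) (M0 : ℝ) : ∃ C : ℝ, 0 < C ∧ ∀ M, 0 ≤ M → M ≤ M0 → ∀ x y : Ed d, 2 ≤ ‖x‖ → 2 ≤ ‖y‖ →
    ET (kP d a η M) c.q1 (1, x, y) ≤ ENNReal.ofReal C * kP d a η M (1, x, y) := by
  obtain ⟨C, hC, H⟩ := c.W M0
  obtain ⟨C1, hC1, H1⟩ := kP_le_J1 c.h c.ha c.ha1 d M0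
  obtain ⟨C2, hC2, H2⟩ := J_le_kP c.h c.ha c.ha1 d M0 1 one_pos
  obtain ⟨C3, hC3, H3⟩ := JJ_mul c.ha d
  have hI := c.int_qH
  set I := ∫⁻ z in Metric.ball (0 : Ed d) 1, qs d (2 * a) δ ε B z * HH δ z with hId
  refine ⟨1 + (C1 + C) * C1 * C3 * C2 * I.toReal, by positivity, fun M hM hM0 x y hx hy => ?_⟩
  have hkm : Measurable (kP d a η M) := measurable_kP (d := d) c.h
  have hk0 : ∀ t (x y : Ed d), t ≤ 0 → kP d a η M (t, x, y) = 0 := fun t x y => kP_zero t x y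
  have hJ : ∀ v, JJ d a M v ≠ ∞ := fun v => ne_top_of_le_ne_top ENNReal.ofReal_ne_top (JJ_le c.ha hM v)
  set K := ENNReal.ofReal (C1 + C) * ENNReal.ofReal C1 * (JJ d a M ‖x‖ * JJ d a M ‖y‖) with hK
  have hKt : K ≠ ∞ := ENNReal.mul_ne_top (ENNReal.mul_ne_top ENNReal.ofReal_ne_top ENNReal.ofReal_ne_top) (ENNReal.mul_ne_top (hJ _) (hJ _))
  have e1 : cnv c.q1 (ET (kP d a η M) c.q1) (kP d a η M) (1, x, y) ≤ K * I := by
    rw [cnv_const_eq hkm (measurable_ET hkm c.q1_meas) hk0 (fun t x y => ET_zero hk0 t x y) c.q1_meas]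
    calc _ ≤ ∫⁻ s' in Ioo (0:ℝ) 1, K * I := by
          refine setLIntegral_mono' measurableSet_Ioo fun s' hs' => ?_
          rw [hId, ← lintegral_indicator measurableSet_ball, ← lintegral_const_mul' _ _ hKt]
          refine lintegral_mono_ae ?_
          filter_upwards [ae_ne_zero c.hd] with w hw0
          by_cases hw : w ∈ Metric.ball (0:Ed d) 1
          · have hw' : ‖w‖ < 1 := by simpa [dist_eq_norm] using hw
            have hwy := norm_sub_norm_le y w
            have hwx := norm_sub_norm_le x w
            have b1 : kP d a η M (1 - s', w, y) ≤ ENNReal.ofReal C1 * JJ d a M ‖y‖ := 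
              H1 M hM hM0 _ ⟨by linarith [hs'.2], by linarith [hs'.1]⟩ w y (by linarith) _ (norm_nonneg _) (by linarith)
            have b0 : kP d a η M (s', w, x) ≤ ENNReal.ofReal C1 * JJ d a M ‖x‖ := 
              H1 M hM hM0 _ ⟨hs'.1, hs'.2.le⟩ w x (by linarith) _ (norm_nonneg _) (by linarith)
            have b2 := H M hM hM0 s' ⟨hs'.1, hs'.2.le⟩ w x hw0 hx ‖x‖ (norm_nonneg _) (by linarith)
            rw [ET_symm hkm c.q1_meas (fun t x y => kP_symm t x y)] at b2
            have b3 : ET (kP d a η M) c.q1 (s', x, w) ≤ ENNReal.ofReal (C1 + C) * JJ d a M ‖x‖ * HH δ w := by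
              refine (b2.trans (add_le_add_left (b0.trans (le_mul_of_one_le_right zero_le (c.one_le_HH w))) _)).trans_eq ?_
              rw [ENNReal.ofReal_add hC1.le hC.le]; ring
            simp only [q1, indicator_of_mem hw]
            calc _ ≤ ENNReal.ofReal (C1 + C) * JJ d a M ‖x‖ * HH δ w * qs d (2 * a) δ ε B w * (ENNReal.ofReal C1 * JJ d a M ‖y‖) :=
                  mul_le_mul' (mul_le_mul_left b3 _) b1
              _ = _ := by rw [hK]; ring
          · simp [q1, indicator_of_notMem hw]
      _ = _ := by rw [setLIntegral_const]; simp
  rw [ET_duhamel hkm c.q1_meas]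
  have b4 : JJ d a M ‖x‖ * JJ d a M ‖y‖ ≤ ENNReal.ofReal C3 * (ENNReal.ofReal C2 * kP d a η M (1, x, y)) := by
    refine (H3 M hM ‖x‖ ‖y‖ ‖y - x‖ (norm_nonneg _) (norm_nonneg _) (norm_nonneg _) (by linarith [norm_sub_le y x])).trans ?_
    exact mul_le_mul_right (H2 M hM hM0 1 ⟨le_rfl, le_rfl⟩ x y) _
  calc _ ≤ kP d a η M (1, x, y) + ENNReal.ofReal (C1 + C) * ENNReal.ofReal C1 * (ENNReal.ofReal C3 * (ENNReal.ofReal C2 * kP d a η M (1, x, y))) * I := by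
        refine add_le_add_right (e1.trans ?_) _
        exact mul_le_mul_left (mul_le_mul_right b4 _) _
    _ = _ := by
        rw [ENNReal.ofReal_add (p := 1) (by norm_num) (by positivity), ENNReal.ofReal_one, ENNReal.ofReal_mul (by positivity), ENNReal.ofReal_mul (by positivity),
          ENNReal.ofReal_mul (by positivity), ENNReal.ofReal_mul (p := C1 + C) (by positivity), ENNReal.ofReal_toReal hI]; ring

/-- full upper bound at time one -/
lemma U7 (c : Ctx d a η δ ε B) (M0 : ℝ) : ∃ C : ℝ, 0 < C ∧ ∀ M, 0 ≤ M → M ≤ M0 → ∀ x y : Ed d, x ≠ 0 → y ≠ 0 →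
    FF d a η δ ε B M (1, x, y) ≤ ENNReal.ofReal C * kP d a η M (1, x, y) * HH δ x * HH δ y := by
  obtain ⟨Ce, hCe, He⟩ := c.F_le_E
  obtain ⟨Cb, hCb, Hb⟩ := c.Wb M0
  obtain ⟨Cc, hCc, Hc⟩ := c.Wc M0
  obtain ⟨C6, hC6, H6⟩ := c.U6 one_pos le_rfl
  obtain ⟨C2, hC2, H2⟩ := J_le_kP c.h c.ha c.ha1 d M0 1 one_pos
  obtain ⟨CJ, hCJ, HJ⟩ := JJ_low c.ha d M0 4
  refine ⟨Ce * Cb + Ce * Cc + C6 * CJ * C2, by positivity, fun M hM hM0 x y hx hy => ?_⟩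
  have h1x := c.one_le_HH x
  have h1y := c.one_le_HH y
  have comb : ∀ C' : ℝ, C' ≤ Ce * Cb + Ce * Cc + C6 * CJ * C2 → ENNReal.ofReal C' * kP d a η M (1, x, y) * HH δ x * HH δ y ≤
      ENNReal.ofReal (Ce * Cb + Ce * Cc + C6 * CJ * C2) * kP d a η M (1, x, y) * HH δ x * HH δ y := fun C' h => by gcongr
  have pb : 0 < Ce * Cb := by positivity
  have pc : 0 < Ce * Cc := by positivity
  have pa : 0 < C6 * CJ * C2 := by positivity
  rcases le_total ‖x‖ 2 with hx2 | hx2 <;> rcases le_total ‖y‖ 2 with hy2 | hy2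
  · refine le_trans ?_ (comb (C6 * CJ * C2) (by linarith))
    have b1 := HJ M hM hM0 ‖y - x‖ (norm_nonneg _) (by linarith [norm_sub_le y x])
    have b2 := H2 M hM hM0 1 ⟨le_rfl, le_rfl⟩ x y
    calc FF d a η δ ε B M (1, x, y) ≤ ENNReal.ofReal C6 * HH δ x * HH δ y * 1 := by
          rw [mul_one]; exact (c.mono_M hM _).trans (H6 1 ⟨le_rfl, le_rfl⟩ x y hx hy)
      _ ≤ ENNReal.ofReal C6 * HH δ x * HH δ y * (ENNReal.ofReal CJ * (ENNReal.ofReal C2 * kP d a η M (1, x, y))) :=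
          mul_le_mul_right (b1.trans (mul_le_mul_right b2 _)) _
      _ = _ := by rw [ENNReal.ofReal_mul (p := C6 * CJ) (by positivity), ENNReal.ofReal_mul hC6.le]; ring
  · refine le_trans ?_ (comb (Ce * Cb) (by linarith))
    refine le_trans ?_ (le_mul_of_one_le_right zero_le h1y)
    refine ((He M x y).trans (mul_le_mul_right (Hb M hM hM0 x y hx hx2 hy2) _)).trans_eq ?_
    rw [ENNReal.ofReal_mul hCe.le]; ring
  · refine le_trans ?_ (comb (Ce * Cb) (by linarith))
    rw [mul_right_comm]
    refine le_trans ?_ (le_mul_of_one_le_right zero_le h1x)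
    rw [c.symm, kP_symm]
    refine ((He M y x).trans (mul_le_mul_right (Hb M hM hM0 y x hy hy2 hx2) _)).trans_eq ?_
    rw [ENNReal.ofReal_mul hCe.le]; ring
  · refine le_trans ?_ (comb (Ce * Cc) (by linarith))
    refine le_trans ?_ (le_mul_of_one_le_right zero_le h1y)
    refine le_trans ?_ (le_mul_of_one_le_right zero_le h1x)
    refine ((He M x y).trans (mul_le_mul_right (Hc M hM hM0 x y hx2 hy2) _)).trans_eq ?_
    rw [ENNReal.ofReal_mul hCe.le]; ring

end Ctx
end

noncomputable section
open scoped ENNReal NNReal Topology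

lemma qs0 {d : ℕ} {α δ ε ε' : ℝ} : qs d α δ ε 0 = qs d α δ ε' 0 := by
  funext z; simp [qs]

namespace Ctx
variable {d : ℕ} {a δ ε M : ℝ} {η : Measure ℝ}

lemma L0 (c : Ctx d a η δ ε 0) (hε2 : ε ≤ 2) (hεδ2 : ε < δ / 2) : ∃ K : ℝ, 0 < K ∧ (∀ β, δ / 2 ≤ β → ∀ ρ, 0 ≤ ρ → 1 - th β ρ ≤ K * ρ ^ (ε / 2)) ∧
    ∀ M, 0 ≤ M → ∀ β, δ / 2 ≤ β → δ - 2 * a < β → β < δ →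
    ∀ x : Ed d, x ≠ 0 → ENNReal.ofReal (phi β M x) ≤
      (∫⁻ z, FF d a η δ ε 0 M (1, x, z) * ENNReal.ofReal (‖z‖ ^ (-β))) + ENNReal.ofReal (K * M ^ (ε / 2)) * HH δ x := by
  have hκ := c.κ0
  have ha := c.ha
  have hδ := c.δ0
  obtain ⟨K, hK, HK⟩ := one_sub_th (β := δ / 2) c.hε hεδ2 hε2
  obtain ⟨C3, hC3, H3⟩ := c.U3
  have hth : ∀ β, δ / 2 ≤ β → ∀ ρ, 0 ≤ ρ → 1 - th β ρ ≤ K * ρ ^ (ε / 2) := fun β hβ ρ hρ => by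
    have := th_mono (by positivity : 0 < δ / 2) hβ hρ
    linarith [HK ρ hρ]
  refine ⟨K + kappa d (2 * a) δ * K * C3, by positivity, fun β hβ ρ hρ => (hth β hβ ρ hρ).trans ?_, fun M hM β hβ hβa hβδ x hx => ?_⟩
  · have : 0 ≤ kappa d (2 * a) δ * K * C3 := by positivity
    have : 0 ≤ ρ ^ (ε / 2) := by positivity
    nlinarith
  have hβ0 : 0 < β := by linarith
  set k1 := kappa d (2 * a) δ * K * M ^ (ε / 2) with hk1
  have hk10 : 0 ≤ k1 := by positivity
  set w : Ed d → ℝ≥0∞ := fun z => ENNReal.ofReal (k1 * ‖z‖ ^ (-(β - ε + 2 * a))) with hw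
  have hwm : Measurable w := by fun_prop
  have hkm : Measurable (kP d a η M) := measurable_kP (d := d) c.h
  have hphim : Measurable (fun z : Ed d => ENNReal.ofReal (phi β M z)) := (measurable_phi β M).ennreal_ofReal
  have hphi : ∀ z : Ed d, phi β M z ≤ ‖z‖ ^ (-β) := fun z => by
    have := th_le_one hβ0 (show 0 ≤ M * ‖z‖ ^ 2 by positivity)
    have h2 : 0 ≤ ‖z‖ ^ (-β) := by positivity
    rw [phi]; nlinarith
  have key := ET_sub (k := kP d a η M) (q := qs d (2 * a) δ ε 0) (φ := fun z => ENNReal.ofReal (phi β M z)) (w := w)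
    hkm (by fun_prop) hphim hwm (S := {z | z ≠ 0}) (ae_ne_zero c.hd) ?_ 1 one_pos x hx ?_
  · refine key.trans (add_le_add ?_ ?_)
    · exact lintegral_mono fun z => mul_le_mul_right (ENNReal.ofReal_le_ofReal (hphi z)) _
    · change act w (FF d a η δ ε 0 M) onePos (1, x) ≤ _
      rw [act_onePos_eq c.meas (fun t x y => c.zero t x y) hwm]
      calc _ ≤ ∫⁻ s in Ioo (0:ℝ) 1, ∫⁻ z, ENNReal.ofReal k1 * (FF d a η δ ε 0 0 (s, x, z) * ENNReal.ofReal (1 + ‖z‖ ^ (-(δ - ε + 2 * a)))) := by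
            refine lintegral_mono fun s => lintegral_mono fun z => ?_
            have b := pow_le_one_add (norm_nonneg z) (show 0 ≤ β - ε + 2 * a by linarith [c.hεa]) (show β - ε + 2 * a ≤ δ - ε + 2 * a by linarith)
            calc _ ≤ FF d a η δ ε 0 0 (s, x, z) * (ENNReal.ofReal k1 * ENNReal.ofReal (1 + ‖z‖ ^ (-(δ - ε + 2 * a)))) := by
                  refine mul_le_mul' (c.mono_M hM _) ?_
                  rw [hw, ← ENNReal.ofReal_mul hk10]
                  exact ENNReal.ofReal_le_ofReal (mul_le_mul_of_nonneg_left b hk10)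
              _ = _ := by ring
        _ = ENNReal.ofReal k1 * ∫⁻ s in Ioo (0:ℝ) 1, ∫⁻ z, (FF d a η δ ε 0 0 (s, x, z) * ENNReal.ofReal (1 + ‖z‖ ^ (-(δ - ε + 2 * a)))) := by
            rw [← lintegral_const_mul' _ _ ENNReal.ofReal_ne_top]
            congr 1; funext s'
            rw [← lintegral_const_mul' _ _ ENNReal.ofReal_ne_top]
        _ ≤ ENNReal.ofReal k1 * (ENNReal.ofReal C3 * HH δ x) := mul_le_mul_right (H3 1 ⟨one_pos, le_rfl⟩ x hx) _
        _ ≤ _ := by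
            rw [← mul_assoc, ← ENNReal.ofReal_mul hk10]
            refine mul_le_mul_left (ENNReal.ofReal_le_ofReal ?_) _
            have : 0 ≤ K * M ^ (ε / 2) := by positivity
            rw [hk1]; nlinarith
  · intro t ht y hy
    change ENNReal.ofReal (phi β M y) ≤ _
    rw [← phi_ident c.h ha hM hβ0 (by linarith [c.hδ]) ht y hy]
    refine add_le_add_right (lintegral_mono fun r => ?_) _
    refine mul_le_mul_left (mul_le_mul_right ?_ _) _
    set z := r.2
    change ENNReal.ofReal (kappa d (2 * a) β * phi (β + 2 * a) M z) ≤ qs d (2 * a) δ ε 0 z * ENNReal.ofReal (phi β M z) + w z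
    rcases eq_or_ne z 0 with hz | hz
    · have : phi (β + 2 * a) M z = 0 := by
        rw [phi, hz, norm_zero, Real.zero_rpow (by linarith), zero_mul]
      rw [this, mul_zero, ENNReal.ofReal_zero]; exact zero_le
    have hz0 : 0 < ‖z‖ := norm_pos_iff.2 hz
    rw [qs, hw, ← ENNReal.ofReal_mul (by simp; positivity), ← ENNReal.ofReal_add
      (mul_nonneg (by simp; positivity) (phi_nonneg hβ0 hM z)) (by positivity)]
    apply ENNReal.ofReal_le_ofReal
    rw [zero_mul, add_zero, phi, phi, hk1]
    have e1 : ‖z‖ ^ (-(β + 2 * a)) = ‖z‖ ^ (-(2 * a)) * ‖z‖ ^ (-β) := by rw [← Real.rpow_add hz0]; congr 1; ring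
    have e2 : ‖z‖ ^ (-(β - ε + 2 * a)) = ‖z‖ ^ (-(2 * a)) * ‖z‖ ^ (-β) * ‖z‖ ^ ε := by
      rw [← Real.rpow_add hz0, ← Real.rpow_add hz0]; congr 1; ring
    have e3 : (M * ‖z‖ ^ 2) ^ (ε / 2) = M ^ (ε / 2) * ‖z‖ ^ ε := by
      rw [Real.mul_rpow hM (by positivity), ← Real.rpow_natCast, ← Real.rpow_mul hz0.le]; congr 2; push_cast; ring
    have b1 := hth β hβ (M * ‖z‖ ^ 2) (by positivity)
    have b2 := th_le_one (show 0 < β + 2 * a by positivity) (show 0 ≤ M * ‖z‖ ^ 2 by positivity)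
    have b3 := (th_pos (show 0 < β + 2 * a by positivity) (show 0 ≤ M * ‖z‖ ^ 2 by positivity)).le
    have b4 := (kappa_strict (d := d) (α := 2 * a) (by positivity) hβ0 hβδ c.hδ).le
    rw [e3] at b1
    rw [e1, e2]
    set P := ‖z‖ ^ (-(2 * a)) * ‖z‖ ^ (-β) with hP
    have hP0 : 0 < P := by positivity
    calc kappa d (2 * a) β * (P * th (β + 2 * a) (M * ‖z‖ ^ 2)) ≤ kappa d (2 * a) δ * (P * (th β (M * ‖z‖ ^ 2) + K * (M ^ (ε / 2) * ‖z‖ ^ ε))) := by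
          refine mul_le_mul b4 ?_ (by positivity) hκ.le
          exact mul_le_mul_of_nonneg_left (by linarith) hP0.le
      _ = _ := by rw [hP]; ring
  · have c' : Ctx d a η δ (δ - β) 0 := ⟨c.h, c.ha, c.ha1, c.hd, c.hδ, by linarith, by linarith, by linarith, c.hB⟩
    obtain ⟨C4, hC4, H4⟩ := c'.U3
    have hqm : Measurable (fun z : Ed d => qs d (2 * a) δ ε 0 z * ENNReal.ofReal (phi β M z)) := by fun_prop
    change act _ (FF d a η δ ε 0 M) onePos (1, x) ≠ _
    rw [act_onePos_eq c.meas (fun t x y => c.zero t x y) hqm]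
    refine ne_top_of_le_ne_top (ENNReal.mul_ne_top (ENNReal.ofReal_ne_top (r := kappa d (2 * a) δ))
      (ENNReal.mul_ne_top (ENNReal.ofReal_ne_top (r := C4)) (HH_ne_top (δ := δ) x))) ?_
    refine le_trans ?_ (mul_le_mul_right (H4 1 ⟨one_pos, le_rfl⟩ x hx) _)
    rw [← lintegral_const_mul' _ _ ENNReal.ofReal_ne_top]
    refine lintegral_mono fun s => ?_
    rw [← lintegral_const_mul' _ _ ENNReal.ofReal_ne_top]
    refine lintegral_mono_ae ?_
    filter_upwards [ae_ne_zero c.hd] with z hz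
    have hz0 : 0 < ‖z‖ := norm_pos_iff.2 hz
    have hFF : FF d a η δ ε 0 M (s, x, z) ≤ FF d a η δ (δ - β) 0 0 (s, x, z) := by
      refine (c.mono_M hM _).trans_eq ?_
      rw [FF, FF, qs0]
    calc _ ≤ FF d a η δ (δ - β) 0 0 (s, x, z) * (ENNReal.ofReal (kappa d (2 * a) δ) * ENNReal.ofReal (1 + ‖z‖ ^ (-(δ - (δ - β) + 2 * a)))) := by
          refine mul_le_mul' hFF ?_
          rw [qs, ← ENNReal.ofReal_mul (by simp; positivity), ← ENNReal.ofReal_mul hκ.le]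
          apply ENNReal.ofReal_le_ofReal
          have e1 : ‖z‖ ^ (-(δ - (δ - β) + 2 * a)) = ‖z‖ ^ (-(2 * a)) * ‖z‖ ^ (-β) := by rw [← Real.rpow_add hz0]; congr 1; ring
          rw [e1, zero_mul, add_zero, mul_assoc]
          refine mul_le_mul_of_nonneg_left ?_ hκ.le
          have := mul_le_mul_of_nonneg_left (hphi z) (show 0 ≤ ‖z‖ ^ (-(2 * a)) by positivity)
          linarith
      _ = _ := by ring

end Ctx
end

noncomputable section
open scoped ENNReal NNReal Topology

lemma small_ball {d : ℕ} (hd : 0 < d) {f : Ed d → ℝ≥0∞} (hf : ∫⁻ z in Metric.ball (0 : Ed d) 1, f z ≠ ∞)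
    {e : ℝ≥0∞} (he : e ≠ 0) : ∃ ρ : ℝ, 0 < ρ ∧ ρ ≤ 1 ∧ ∫⁻ z in Metric.ball (0 : Ed d) ρ, f z ≤ e := by
  have hv : Tendsto (fun ρ : ℝ => (volume.restrict (Metric.ball (0 : Ed d) 1)) (Metric.ball (0 : Ed d) ρ)) (𝓝[>] 0) (𝓝 0) := by
    have h1 : Tendsto (fun ρ : ℝ => ENNReal.ofReal (ρ ^ d) * volume (Metric.ball (0 : Ed d) 1)) (𝓝[>] 0) (𝓝 0) := by
      have : Tendsto (fun ρ : ℝ => ENNReal.ofReal (ρ ^ d) * volume (Metric.ball (0 : Ed d) 1)) (𝓝[>] 0)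
          (𝓝 (ENNReal.ofReal ((0:ℝ) ^ d) * volume (Metric.ball (0 : Ed d) 1))) := by
        refine ENNReal.Tendsto.mul_const ?_ (Or.inr measure_ball_lt_top.ne)
        refine tendsto_nhdsWithin_of_tendsto_nhds ?_
        exact ((ENNReal.continuous_ofReal.comp (continuous_pow d)).tendsto 0)
      simpa [hd.ne'] using this
    refine tendsto_of_tendsto_of_tendsto_of_le_of_le' tendsto_const_nhds h1 (Eventually.of_forall fun _ => zero_le) ?_
    filter_upwards [self_mem_nhdsWithin] with ρ hρ
    refine (Measure.restrict_apply_le _ _).trans_eq ?_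
    rw [Measure.addHaar_ball_of_pos _ _ hρ, finrank_euclideanSpace, Fintype.card_fin]
  have ht := tendsto_setLIntegral_zero hf hv
  have h1 : ∀ᶠ ρ in 𝓝[>] (0:ℝ), ρ ∈ Ioc (0:ℝ) 1 := Ioc_mem_nhdsGT one_pos
  obtain ⟨ρ, hρ, hρ1⟩ := (((tendsto_order.1 ht).2 e (pos_iff_ne_zero.2 he)).and h1).exists
  refine ⟨ρ, hρ1.1, hρ1.2, ?_⟩
  rw [Measure.restrict_restrict measurableSet_ball, inter_eq_left.2 (Metric.ball_subset_ball hρ1.2)] at hρ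
  exact hρ.le

namespace Ctx
variable {d : ℕ} {a δ ε M : ℝ} {η : Measure ℝ}

lemma int_HH (c : Ctx d a η δ ε 0) : ∫⁻ z in Metric.ball (0 : Ed d) 1, HH δ z * HH δ z ≠ ∞ := by
  have ha := c.ha
  have hδ := c.δ0
  refine ne_top_of_le_ne_top (ENNReal.mul_ne_top (ENNReal.ofReal_ne_top (r := 4))
    (lint_ball c.hd (γ := 2 * δ) (by linarith [c.hδ]))) ?_
  rw [← lintegral_const_mul' _ _ ENNReal.ofReal_ne_top]
  refine lintegral_mono_ae ?_
  filter_upwards [ae_restrict_of_ae (ae_ne_zero c.hd), ae_restrict_mem measurableSet_ball] with z hz hz1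
  have hz1 : ‖z‖ < 1 := by simpa using hz1
  have hz0 : 0 < ‖z‖ := norm_pos_iff.2 hz
  rw [HH, ← ENNReal.ofReal_mul (by positivity), ← ENNReal.ofReal_mul (by positivity)]
  apply ENNReal.ofReal_le_ofReal
  have h4 : 1 ≤ ‖z‖ ^ (-δ) := Real.one_le_rpow_of_pos_of_le_one_of_nonpos hz0 hz1.le (by linarith)
  have h5 : ‖z‖ ^ (-(2 * δ)) = ‖z‖ ^ (-δ) * ‖z‖ ^ (-δ) := by rw [← Real.rpow_add hz0]; congr 1; ring
  rw [h5]
  nlinarith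

lemma L1 (c : Ctx d a η δ ε 0) (hε2 : ε ≤ 2) (hεδ2 : ε < δ / 2) : ∃ M1 R C : ℝ, 0 < M1 ∧ 0 < R ∧ 0 < C ∧ ∀ M, 0 ≤ M → M ≤ M1 →
    ∀ x : Ed d, x ≠ 0 → ‖x‖ ≤ 1 → HH δ x ≤ ENNReal.ofReal C * ∫⁻ z in Metric.closedBall (0 : Ed d) R, FF d a η δ ε 0 M (1, x, z) := by
  have ha := c.ha
  have hδ := c.δ0
  have hε := c.hε
  obtain ⟨K, hK, HK, H0⟩ := c.L0 hε2 hεδ2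
  obtain ⟨C1, hC1, H1⟩ := c.U1
  obtain ⟨C6, hC6, H6⟩ := c.U6 one_pos le_rfl
  obtain ⟨ρ, hρ, hρ1, Hρ⟩ := small_ball c.hd c.int_HH (e := ENNReal.ofReal (1 / (32 * C6))) (by simp; positivity)
  set M1 := (1 / (32 * K)) ^ (2 / ε) with hM1
  set R := max 1 ((32 * C1) ^ (2 / δ)) with hR
  have hR1 : 1 ≤ R := le_max_left _ _
  have hR0 : 0 < R := by linarith
  have hRC : R ^ (-(δ / 2)) * C1 ≤ 1 / 32 := by
    have h1 : 32 * C1 ≤ R ^ (δ / 2) := by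
      calc 32 * C1 = ((32 * C1) ^ (2 / δ)) ^ (δ / 2) := by
            rw [← Real.rpow_mul (by positivity), show 2 / δ * (δ / 2) = 1 by field_simp, Real.rpow_one]
        _ ≤ _ := Real.rpow_le_rpow (by positivity) (le_max_right _ _) (by positivity)
    have h2 : R ^ (-(δ / 2)) * R ^ (δ / 2) = 1 := by rw [← Real.rpow_add hR0]; simp
    have h3 : 0 < R ^ (-(δ / 2)) := by positivity
    nlinarith
  refine ⟨M1, R, 32 / 5 * ρ ^ (-δ), by positivity, hR0, by positivity, fun M hM hMM x hx hx1 => ?_⟩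
  have hx0 : 0 < ‖x‖ := norm_pos_iff.2 hx
  have hKM : K * M ^ (ε / 2) ≤ 1 / 32 := by
    have : M ^ (ε / 2) ≤ 1 / (32 * K) := by
      calc M ^ (ε / 2) ≤ M1 ^ (ε / 2) := Real.rpow_le_rpow hM hMM (by positivity)
        _ = _ := by rw [hM1, ← Real.rpow_mul (by positivity), show 2 / ε * (ε / 2) = 1 by field_simp, Real.rpow_one]
    calc K * M ^ (ε / 2) ≤ K * (1 / (32 * K)) := mul_le_mul_of_nonneg_left this hK.le
      _ = 1 / 32 := by field_simp
  set mid := ∫⁻ z in Metric.closedBall (0 : Ed d) R, FF d a η δ ε 0 M (1, x, z) with hmid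
  have main : ∀ β, δ / 2 ≤ β → δ - 2 * a < β → β < δ → ENNReal.ofReal (‖x‖ ^ (-β) / 2) ≤
      ENNReal.ofReal (3 / 32) * HH δ x + ENNReal.ofReal (ρ ^ (-δ)) * mid := by
    intro β hβ hβa hβδ
    have hβ0 : 0 < β := by linarith
    have s1 : ENNReal.ofReal (‖x‖ ^ (-β) / 2) ≤ ENNReal.ofReal (phi β M x) := by
      apply ENNReal.ofReal_le_ofReal
      have b := HK β hβ (M * ‖x‖ ^ 2) (by positivity)
      have b2 : (M * ‖x‖ ^ 2) ^ (ε / 2) ≤ M ^ (ε / 2) := by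
        refine Real.rpow_le_rpow (by positivity) ?_ (by positivity)
        have : ‖x‖ ^ 2 ≤ 1 := by nlinarith
        nlinarith
      have b3 := mul_le_mul_of_nonneg_left b2 hK.le
      rw [phi, div_eq_mul_inv]
      refine mul_le_mul_of_nonneg_left ?_ (by positivity)
      norm_num; linarith
    have s2 : ∫⁻ z, FF d a η δ ε 0 M (1, x, z) * ENNReal.ofReal (‖z‖ ^ (-β)) ≤
        ENNReal.ofReal (1 / 32) * HH δ x + ENNReal.ofReal (1 / 32) * HH δ x + ENNReal.ofReal (ρ ^ (-δ)) * mid := by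
      have hms : Measurable fun z => FF d a η δ ε 0 M (1, x, z) := c.meas.comp (by fun_prop)
      have hms0 : Measurable fun z => FF d a η δ ε 0 0 (1, x, z) := c.meas.comp (by fun_prop)
      calc _ ≤ ∫⁻ z, (ENNReal.ofReal C6 * HH δ x * (Metric.ball (0 : Ed d) ρ).indicator (fun z => HH δ z * HH δ z) z +
            ENNReal.ofReal (R ^ (-(δ / 2))) * (FF d a η δ ε 0 0 (1, x, z) * HH δ z) + 
            ENNReal.ofReal (ρ ^ (-δ)) * (Metric.closedBall (0 : Ed d) R).indicator (fun z => FF d a η δ ε 0 M (1, x, z)) z) := by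
            refine lintegral_mono_ae ?_
            filter_upwards [ae_ne_zero c.hd] with z hz
            have hz0 : 0 < ‖z‖ := norm_pos_iff.2 hz
            rcases lt_or_ge ‖z‖ ρ with h1 | h1
            · have hm : z ∈ Metric.ball (0 : Ed d) ρ := by simpa using h1
              rw [add_assoc, indicator_of_mem hm]
              refine le_trans ?_ le_self_add
              calc _ ≤ (ENNReal.ofReal C6 * HH δ x * HH δ z) * HH δ z := by
                    refine mul_le_mul' ((c.mono_M hM _).trans (H6 1 ⟨le_rfl, le_rfl⟩ x z hx hz)) ?_
                    exact ENNReal.ofReal_le_ofReal (pow_le_one_add hz0.le hβ0.le hβδ.le)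
                _ = _ := by ring
            rcases lt_or_ge R ‖z‖ with h2 | h2
            · refine le_trans ?_ (le_self_add.trans' le_add_self)
              rw [mul_left_comm]
              refine mul_le_mul' (c.mono_M hM _) ?_
              refine le_trans ?_ (le_mul_of_one_le_right zero_le (c.one_le_HH z))
              apply ENNReal.ofReal_le_ofReal
              calc ‖z‖ ^ (-β) ≤ R ^ (-β) := Real.rpow_le_rpow_of_nonpos hR0 h2.le (by linarith)
                _ ≤ R ^ (-(δ / 2)) := Real.rpow_le_rpow_of_exponent_le hR1 (by linarith)
            · have hm : z ∈ Metric.closedBall (0 : Ed d) R := by simpa using h2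
              refine le_trans ?_ le_add_self
              rw [indicator_of_mem hm, mul_comm]
              refine mul_le_mul_left (ENNReal.ofReal_le_ofReal ?_) _
              calc ‖z‖ ^ (-β) ≤ ρ ^ (-β) := Real.rpow_le_rpow_of_nonpos hρ h1 (by linarith)
                _ ≤ ρ ^ (-δ) := Real.rpow_le_rpow_of_exponent_ge hρ hρ1 (by linarith)
        _ = ENNReal.ofReal C6 * HH δ x * (∫⁻ z in Metric.ball (0 : Ed d) ρ, HH δ z * HH δ z) +
            ENNReal.ofReal (R ^ (-(δ / 2))) * (∫⁻ z, FF d a η δ ε 0 0 (1, x, z) * HH δ z) + ENNReal.ofReal (ρ ^ (-δ)) * mid := by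
            have hi1 : Measurable ((Metric.ball (0 : Ed d) ρ).indicator (fun z => HH δ z * HH δ z)) :=
              Measurable.indicator (by fun_prop) measurableSet_ball
            rw [lintegral_add_left, lintegral_add_left, lintegral_const_mul' _ _ (ENNReal.mul_ne_top ENNReal.ofReal_ne_top (HH_ne_top _)),
              lintegral_const_mul' _ _ ENNReal.ofReal_ne_top, lintegral_const_mul' _ _ ENNReal.ofReal_ne_top,
              lintegral_indicator measurableSet_ball, lintegral_indicator Metric.isClosed_closedBall.measurableSet]
            · fun_prop
            · fun_prop
        _ ≤ ENNReal.ofReal C6 * HH δ x * ENNReal.ofReal (1 / (32 * C6)) + 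
            ENNReal.ofReal (R ^ (-(δ / 2))) * (ENNReal.ofReal C1 * HH δ x) + ENNReal.ofReal (ρ ^ (-δ)) * mid :=
            add_le_add_left (add_le_add (mul_le_mul_right Hρ _) (mul_le_mul_right (H1 1 ⟨one_pos, le_rfl⟩ x hx) _)) _
        _ ≤ _ := by
            refine add_le_add_left (add_le_add (le_of_eq ?_) ?_) _
            · rw [mul_right_comm, ← ENNReal.ofReal_mul hC6.le]; congr 2; field_simp
            · rw [← mul_assoc, ← ENNReal.ofReal_mul (by positivity)]
              exact mul_le_mul_left (ENNReal.ofReal_le_ofReal hRC) _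
    refine (s1.trans (H0 M hM β hβ hβa hβδ x hx)).trans ?_
    calc _ ≤ ENNReal.ofReal (1 / 32) * HH δ x + ENNReal.ofReal (1 / 32) * HH δ x + ENNReal.ofReal (ρ ^ (-δ)) * mid + ENNReal.ofReal (1 / 32) * HH δ x :=
          add_le_add s2 (mul_le_mul_left (ENNReal.ofReal_le_ofReal hKM) _)
      _ = _ := by
          rw [show (3:ℝ) / 32 = 1 / 32 + 1 / 32 + 1 / 32 by norm_num, ENNReal.ofReal_add (by norm_num) (by norm_num), ENNReal.ofReal_add (by norm_num) (by norm_num)]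
          ring
  have lim : ENNReal.ofReal (‖x‖ ^ (-δ) / 2) ≤ ENNReal.ofReal (3 / 32) * HH δ x + ENNReal.ofReal (ρ ^ (-δ)) * mid := by
    have ht : Tendsto (fun β => ENNReal.ofReal (‖x‖ ^ (-β) / 2)) (𝓝[<] δ) (𝓝 (ENNReal.ofReal (‖x‖ ^ (-δ) / 2))) := by
      refine tendsto_nhdsWithin_of_tendsto_nhds ?_
      have : Continuous fun β : ℝ => ENNReal.ofReal (‖x‖ ^ (-β) / 2) :=
        ENNReal.continuous_ofReal.comp (((Real.continuous_const_rpow hx0.ne').comp continuous_neg).div_const 2)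
      exact this.tendsto δ
    refine le_of_tendsto ht ?_
    have h1 : ∀ᶠ β in 𝓝[<] δ, β ∈ Ioo (max (δ / 2) (δ - 2 * a)) δ := Ioo_mem_nhdsLT (max_lt (by linarith) (by linarith))
    filter_upwards [h1] with β hβ
    exact main β ((le_max_left _ _).trans hβ.1.le) ((le_max_right _ _).trans_lt hβ.1) hβ.2
  have h5 : ENNReal.ofReal (3 / 32) * HH δ x + ENNReal.ofReal (5 / 32) * HH δ x ≤ ENNReal.ofReal (3 / 32) * HH δ x + ENNReal.ofReal (ρ ^ (-δ)) * mid := by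
    refine le_trans ?_ lim
    rw [← add_mul, ← ENNReal.ofReal_add (by norm_num) (by norm_num), HH, ← ENNReal.ofReal_mul (by norm_num)]
    apply ENNReal.ofReal_le_ofReal
    have h4 : 1 ≤ ‖x‖ ^ (-δ) := Real.one_le_rpow_of_pos_of_le_one_of_nonpos hx0 hx1 (by linarith)
    norm_num; linarith
  have h6 := (ENNReal.add_le_add_iff_left (ENNReal.mul_ne_top ENNReal.ofReal_ne_top (HH_ne_top x))).1 h5
  calc HH δ x = ENNReal.ofReal (32 / 5) * (ENNReal.ofReal (5 / 32) * HH δ x) := by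
        rw [← mul_assoc, ← ENNReal.ofReal_mul (by norm_num)]; norm_num
    _ ≤ ENNReal.ofReal (32 / 5) * (ENNReal.ofReal (ρ ^ (-δ)) * mid) := mul_le_mul_right h6 _
    _ = _ := by rw [← mul_assoc, ← ENNReal.ofReal_mul (by norm_num)]

end Ctx
end

noncomputable section
open scoped ENNReal NNReal Topology

lemma lint_scale {d : ℕ} {l : ℝ} (hl : 0 < l) (G : Ed d → ℝ≥0∞) (hG : Measurable G) :
    ENNReal.ofReal (l ^ d) * ∫⁻ z, G (l • z) = ∫⁻ z, G z := by
  have := Measure.map_addHaar_smul (volume : Measure (Ed d)) hl.ne'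
  rw [← lintegral_map (f := G) hG (measurable_const_smul l), this, lintegral_smul_measure,
    smul_eq_mul, ← mul_assoc, ← ENNReal.ofReal_mul (by positivity)]
  simp [abs_of_pos, hl, hl.ne']

lemma JJ_shift {d : ℕ} {a : ℝ} {η : Measure ℝ} (h : IsSub a η) (ha : 0 < a) (ha1 : a < 1) (hd : 0 < d) (M0 : ℝ) (n : ℕ) :
    ∃ C : ℝ, 0 < C ∧ ∀ M, 0 ≤ M → M ≤ M0 → ∀ v, 0 ≤ v → JJ d a M v ≤ ENNReal.ofReal C * JJ d a M (v + 4 * n) := by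
  induction n with
  | zero => exact ⟨1, one_pos, fun M _ _ v _ => by simp⟩
  | succ n ih =>
    obtain ⟨C, hC, H⟩ := ih
    obtain ⟨C2, hC2, H2⟩ := J_le_kP h ha ha1 d M0 1 one_pos
    obtain ⟨C4, hC4, H4⟩ := kP_le_J h ha ha1 hd M0 1 one_pos
    refine ⟨C * (C2 * C4), by positivity, fun M hM hM0 v hv => (H M hM hM0 v hv).trans ?_⟩
    set u := v + 4 * n with hu
    have hu0 : 0 ≤ u := by positivity
    set y : Ed d := EuclideanSpace.single ⟨0, hd⟩ u with hy
    have hyn : ‖y - 0‖ = u := by rw [sub_zero, hy, EuclideanSpace.norm_single, Real.norm_of_nonneg hu0]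
    have b1 := H2 M hM hM0 1 ⟨le_rfl, le_rfl⟩ 0 y
    have b2 := H4 M hM hM0 1 ⟨le_rfl, le_rfl⟩ 0 y (u + 4) (by positivity) (by rw [hyn])
    rw [hyn] at b1
    rw [ENNReal.ofReal_mul hC.le, ENNReal.ofReal_mul hC2.le, mul_assoc, mul_assoc,
      show v + 4 * ((n + 1 : ℕ):ℝ) = u + 4 by rw [hu]; push_cast; ring]
    exact mul_le_mul_right (b1.trans (mul_le_mul_right b2 _)) _

namespace Ctx
variable {d : ℕ} {a δ ε M : ℝ} {η : Measure ℝ}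

lemma scale (c : Ctx d a η δ ε 0) {l : ℝ} (hl : 0 < l) (t : ℝ) (x y : Ed d) : FF d a η δ ε 0 M (t, x, y) =
    ENNReal.ofReal (l ^ d) * FF d a η δ ε 0 (M / l ^ 2) (l ^ (2 * a) * t, l • x, l • y) := by
  have ha := c.ha
  refine ET_scale (measurable_kP c.h) (by fun_prop) (c := l ^ (2 * a)) (by positivity) hl _ ?_ ?_ t x y
  · intro t x y
    refine kP_scale c.h (by positivity) hl ?_ t x y
    rw [← Real.rpow_mul hl.le, show 2 * a * (1 / a) = ((2:ℕ):ℝ) by push_cast; field_simp, Real.rpow_natCast]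
  · intro x
    rw [qs, qs, ← ENNReal.ofReal_mul (by positivity), norm_smul, Real.norm_of_nonneg hl.le, Real.mul_rpow hl.le (norm_nonneg _)]
    congr 1
    have : l ^ (2 * a) * l ^ (-(2 * a)) = 1 := by rw [← Real.rpow_add hl]; simp
    linear_combination (-(kappa d (2 * a) δ * ‖x‖ ^ (-(2 * a)))) * this

lemma L2 (c : Ctx d a η δ ε 0) (hε2 : ε ≤ 2) (hεδ2 : ε < δ / 2) {M0 : ℝ} (hM0 : 0 ≤ M0) : ∃ t0 R C r0 : ℝ, 0 < t0 ∧ t0 ≤ 1 / 3 ∧ 0 < R ∧ 0 < C ∧ 0 < r0 ∧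
    ∀ M, 0 ≤ M → M ≤ M0 → ∀ x : Ed d, x ≠ 0 → ‖x‖ ≤ r0 →
    HH δ x ≤ ENNReal.ofReal C * ∫⁻ z in Metric.closedBall (0 : Ed d) R, FF d a η δ ε 0 M (t0, x, z) := by
  have ha := c.ha
  have hδ := c.δ0
  obtain ⟨M1, R, C, hM1, hR, hC, H⟩ := c.L1 hε2 hεδ2
  obtain ⟨l, ⟨hl3, hlM⟩, hl1⟩ := (((tendsto_rpow_atTop (show 0 < 2 * a by positivity)).eventually_ge_atTop 3).and
    ((tendsto_pow_atTop (α := ℝ) (n := 2) (by norm_num)).eventually_ge_atTop (M0 / M1)) |>.and (eventually_ge_atTop 1)).exists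
  have hl : 0 < l := by linarith
  refine ⟨(l ^ (2 * a))⁻¹, R / l, l ^ δ * C, 1 / l, by positivity, ?_, by positivity, by positivity, by positivity, fun M hM hMM x hx hxr => ?_⟩
  · rw [one_div]; exact inv_anti₀ (by norm_num) hl3
  have hx0 : 0 < ‖x‖ := norm_pos_iff.2 hx
  have hMl : M / l ^ 2 ≤ M1 := by
    rw [div_le_iff₀ hM1] at hlM
    rw [div_le_iff₀ (by positivity)]; linarith
  have hnl : ‖l • x‖ = l * ‖x‖ := by rw [norm_smul, Real.norm_of_nonneg hl.le]
  have b := H (M / l ^ 2) (by positivity) hMl (l • x) (smul_ne_zero hl.ne' hx) (by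
    rw [hnl]; rw [le_div_iff₀ hl] at hxr; linarith)
  have e1 : HH δ x ≤ ENNReal.ofReal (l ^ δ) * HH δ (l • x) := by
    rw [HH, HH, ← ENNReal.ofReal_mul (by positivity), hnl, Real.mul_rpow hl.le hx0.le]
    apply ENNReal.ofReal_le_ofReal
    have h1 : l ^ δ * l ^ (-δ) = 1 := by rw [← Real.rpow_add hl]; simp
    have h2 : 1 ≤ l ^ δ := Real.one_le_rpow hl1 hδ.le
    calc 1 + ‖x‖ ^ (-δ) ≤ l ^ δ + (l ^ δ * l ^ (-δ)) * ‖x‖ ^ (-δ) := by rw [h1]; linarith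
      _ = _ := by ring
  have e2 : ∫⁻ z in Metric.closedBall (0 : Ed d) R, FF d a η δ ε 0 (M / l ^ 2) (1, l • x, z) =
      ∫⁻ z in Metric.closedBall (0 : Ed d) (R / l), FF d a η δ ε 0 M ((l ^ (2 * a))⁻¹, x, z) := by
    have hm1 : Measurable fun z : Ed d => FF d a η δ ε 0 (M / l ^ 2) (1, l • x, z) := c.meas.comp (by fun_prop)
    rw [← lintegral_indicator Metric.isClosed_closedBall.measurableSet, ← lintegral_indicator Metric.isClosed_closedBall.measurableSet,
      ← lint_scale hl _ (hm1.indicator Metric.isClosed_closedBall.measurableSet),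
      ← lintegral_const_mul' _ _ ENNReal.ofReal_ne_top]
    congr 1; funext z
    have hiff : l • z ∈ Metric.closedBall (0 : Ed d) R ↔ z ∈ Metric.closedBall (0 : Ed d) (R / l) := by
      simp only [mem_closedBall_zero_iff, norm_smul, Real.norm_of_nonneg hl.le, le_div_iff₀ hl, mul_comm]
    by_cases hz : z ∈ Metric.closedBall (0 : Ed d) (R / l)
    · rw [indicator_of_mem hz, indicator_of_mem (hiff.2 hz), c.scale hl (l ^ (2 * a))⁻¹, mul_inv_cancel₀ (by positivity)]
    · rw [indicator_of_notMem hz, indicator_of_notMem (fun h => hz (hiff.1 h)), mul_zero]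
  rw [e2] at b
  refine (e1.trans (mul_le_mul_right b _)).trans_eq ?_
  rw [← mul_assoc, ← ENNReal.ofReal_mul (by positivity)]

lemma L3 (c : Ctx d a η δ ε 0) (hε2 : ε ≤ 2) (hεδ2 : ε < δ / 2) {M0 : ℝ} (hM0 : 0 ≤ M0) : ∃ t0 R C : ℝ, 0 < t0 ∧ t0 ≤ 1 / 3 ∧ 0 < R ∧ 0 < C ∧
    ∀ M, 0 ≤ M → M ≤ M0 → ∀ x : Ed d, x ≠ 0 →
    HH δ x ≤ ENNReal.ofReal C * ∫⁻ z in Metric.closedBall x R, FF d a η δ ε 0 M (t0, x, z) := by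
  have ha := c.ha
  have hδ := c.δ0
  obtain ⟨t0, R, C, r0, ht0, ht3, hR, hC, hr0, H⟩ := c.L2 hε2 hεδ2 hM0
  obtain ⟨C2, hC2, H2⟩ := J_le_kP c.h c.ha c.ha1 d M0 t0 ht0
  obtain ⟨CJ, hCJ, HJ⟩ := JJ_low c.ha d M0 (R + r0)
  set b := (volume (Metric.closedBall (0 : Ed d) (R + r0))).toReal with hb
  have hbt : volume (Metric.closedBall (0 : Ed d) (R + r0)) ≠ ∞ := measure_closedBall_lt_top.ne
  have hb0 : 0 < b := ENNReal.toReal_pos (Metric.measure_closedBall_pos _ _ (by positivity)).ne' hbt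
  set C' := (1 + r0 ^ (-δ)) * (CJ * C2 / b) with hC'
  have hC'0 : 0 < C' := by positivity
  refine ⟨t0, R + r0, C + C', ht0, ht3, by positivity, by positivity, fun M hM hMM x hx => ?_⟩
  have hx0 : 0 < ‖x‖ := norm_pos_iff.2 hx
  rcases le_total ‖x‖ r0 with h | h
  · refine (H M hM hMM x hx h).trans (mul_le_mul' (ENNReal.ofReal_le_ofReal (by linarith)) (lintegral_mono_set ?_))
    refine Metric.closedBall_subset_closedBall' ?_
    rw [dist_eq_norm, zero_sub, norm_neg]; linarith
  · have b1 : ∫⁻ z in Metric.closedBall x (R + r0), (1:ℝ≥0∞) ≤ ENNReal.ofReal (CJ * C2) * ∫⁻ z in Metric.closedBall x (R + r0), FF d a η δ ε 0 M (t0, x, z) := by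
      rw [← lintegral_const_mul' _ _ ENNReal.ofReal_ne_top]
      refine setLIntegral_mono' Metric.isClosed_closedBall.measurableSet fun z hz => ?_
      refine (HJ M hM hMM ‖z - x‖ (norm_nonneg _) (by rwa [Metric.mem_closedBall, dist_eq_norm] at hz)).trans ?_
      rw [ENNReal.ofReal_mul hCJ.le, mul_assoc]
      refine mul_le_mul_right ((H2 M hM hMM t0 ⟨le_rfl, by linarith⟩ x z).trans (mul_le_mul_right (le_ET _) _)) _
    rw [lintegral_const, one_mul, Measure.restrict_apply_univ, Measure.addHaar_closedBall_center, ← ENNReal.ofReal_toReal hbt, ← hb] at b1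
    calc HH δ x ≤ ENNReal.ofReal (1 + r0 ^ (-δ)) := by
          apply ENNReal.ofReal_le_ofReal
          linarith [Real.rpow_le_rpow_of_nonpos hr0 h (show -δ ≤ 0 by linarith)]
      _ = ENNReal.ofReal ((1 + r0 ^ (-δ)) / b) * ENNReal.ofReal b := by
          rw [← ENNReal.ofReal_mul (by positivity)]; congr 1; field_simp
      _ ≤ ENNReal.ofReal ((1 + r0 ^ (-δ)) / b) * _ := mul_le_mul_right b1 _
      _ = ENNReal.ofReal C' * ∫⁻ z in Metric.closedBall x (R + r0), FF d a η δ ε 0 M (t0, x, z) := by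
          rw [← mul_assoc, ← ENNReal.ofReal_mul (by positivity)]; congr 2; rw [hC']; field_simp
      _ ≤ _ := mul_le_mul_left (ENNReal.ofReal_le_ofReal (by linarith)) _

/-- full lower bound at time one -/
lemma L4 (c : Ctx d a η δ ε 0) (hε2 : ε ≤ 2) (hεδ2 : ε < δ / 2) {M0 : ℝ} (hM0 : 0 ≤ M0) : ∃ C : ℝ, 0 < C ∧
    ∀ M, 0 ≤ M → M ≤ M0 → ∀ x y : Ed d, x ≠ 0 → y ≠ 0 →
    kP d a η M (1, x, y) * HH δ x * HH δ y ≤ ENNReal.ofReal C * FF d a η δ ε 0 M (1, x, y) := by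
  have ha := c.ha
  obtain ⟨t0, R, C, ht0, ht3, hR, hC, H⟩ := c.L3 hε2 hεδ2 hM0
  obtain ⟨n, hn⟩ := exists_nat_ge R
  obtain ⟨C1, hC1, H1⟩ := JJ_shift c.h c.ha c.ha1 c.hd M0 n
  obtain ⟨C2, hC2, H2⟩ := J_le_kP c.h c.ha c.ha1 d M0 (1 - 2 * t0) (by linarith)
  obtain ⟨C4, hC4, H4⟩ := kP_le_J c.h c.ha c.ha1 c.hd M0 1 one_pos
  refine ⟨C * C * (C4 * C1 * C2), by positivity, fun M hM hMM x y hx hy => ?_⟩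
  set G := FF d a η δ ε 0 M with hG
  have hGm : Measurable G := c.meas
  set k := kP d a η M (1, x, y) with hk
  have hkt : k ≠ ∞ := kP_ne_top c.h c.ha c.hd hM _ _ _
  set D := ENNReal.ofReal (C4 * C1 * C2) with hD
  have hDt : D ≠ ∞ := ENNReal.ofReal_ne_top
  -- kernel comparison
  have cmp : ∀ z ∈ Metric.closedBall x R, ∀ w ∈ Metric.closedBall y R, k ≤ D * G (1 - 2 * t0, z, w) := by
    intro z hz w hw
    rw [Metric.mem_closedBall, dist_eq_norm] at hz hw
    have b1 := H4 M hM hMM 1 ⟨le_rfl, le_rfl⟩ x y ‖y - x‖ (norm_nonneg _) (by linarith)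
    have b2 := H1 M hM hMM ‖y - x‖ (norm_nonneg _)
    have b3 : ‖w - z‖ ≤ ‖y - x‖ + 4 * n := by
      have e : w - z = (w - y) + (y - x) - (z - x) := by abel
      have h1 := norm_sub_le ((w - y) + (y - x)) (z - x)
      have h2 := norm_add_le (w - y) (y - x)
      rw [e]; linarith
    have b4 := JJ_anti (d := d) (a := a) (norm_nonneg _) b3 (le_refl M)
    have b5 := H2 M hM hMM (1 - 2 * t0) ⟨le_rfl, by linarith⟩ z w
    have b6 : kP d a η M (1 - 2 * t0, z, w) ≤ G (1 - 2 * t0, z, w) := le_ET _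
    calc k ≤ ENNReal.ofReal C4 * (ENNReal.ofReal C1 * (ENNReal.ofReal C2 * G (1 - 2 * t0, z, w))) :=
          b1.trans (mul_le_mul_right (b2.trans (mul_le_mul_right (b4.trans (b5.trans (mul_le_mul_right b6 _))) _)) _)
      _ = _ := by rw [hD, ENNReal.ofReal_mul (by positivity), ENNReal.ofReal_mul hC4.le]; ring
  set X := ∫⁻ z in Metric.closedBall x R, G (t0, x, z) with hX
  set Y := ∫⁻ w in Metric.closedBall y R, G (t0, y, w) with hY
  have step1 : ∀ z ∈ Metric.closedBall x R, k * Y ≤ D * G (1 - t0, z, y) := by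
    intro z hz
    have ck := c.CK (M := M) (1 - 2 * t0) t0 z y (by linarith) ht0
    rw [show 1 - 2 * t0 + t0 = 1 - t0 by ring] at ck
    rw [hG, ck, ← lintegral_const_mul' _ _ hDt, hY, ← lintegral_const_mul' _ _ hkt]
    refine le_trans ?_ (setLIntegral_le_lintegral (Metric.closedBall y R) _)
    refine setLIntegral_mono' Metric.isClosed_closedBall.measurableSet fun w hw => ?_
    rw [hG, c.symm t0 y w, ← mul_assoc]
    exact mul_le_mul_left (cmp z hz w hw) _
  have step2 : X * (k * Y) ≤ D * G (1, x, y) := by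
    have ck := c.CK (M := M) t0 (1 - t0) x y ht0 (by linarith)
    rw [add_sub_cancel] at ck
    have hm2 : Measurable fun z : Ed d => G (t0, x, z) := hGm.comp (by fun_prop)
    rw [hG, ck, ← lintegral_const_mul' _ _ hDt, hX, ← lintegral_mul_const _ hm2]
    refine le_trans ?_ (setLIntegral_le_lintegral (Metric.closedBall x R) _)
    refine setLIntegral_mono' Metric.isClosed_closedBall.measurableSet fun z hz => ?_
    exact (mul_le_mul_right (step1 z hz) (G (t0, x, z))).trans_eq (mul_left_comm _ _ _)
  calc k * HH δ x * HH δ y ≤ k * (ENNReal.ofReal C * X) * (ENNReal.ofReal C * Y) :=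
        mul_le_mul' (mul_le_mul_right (H M hM hMM x hx) _) (H M hM hMM y hy)
    _ = ENNReal.ofReal C * ENNReal.ofReal C * (X * (k * Y)) := by ring
    _ ≤ ENNReal.ofReal C * ENNReal.ofReal C * (D * G (1, x, y)) := mul_le_mul_right step2 _
    _ = _ := by rw [hD, ENNReal.ofReal_mul (p := C * C) (by positivity), ENNReal.ofReal_mul hC.le]; ring

end Ctx
end

noncomputable section
open scoped ENNReal NNReal Topology

/-- the weight at time `t` -/
def HT {d : ℕ} (a δ t : ℝ) (x : Ed d) : ℝ := 1 + t ^ (δ / (2 * a)) * ‖x‖ ^ (-δ)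

lemma HT_pos {d : ℕ} (a δ : ℝ) {t : ℝ} (ht : 0 < t) (x : Ed d) : 0 < HT a δ t x := by
  unfold HT; positivity

lemma HH_smul {d : ℕ} {a : ℝ} (δ : ℝ) (ha : 0 < a) {t : ℝ} (ht : 0 < t) (x : Ed d) :
    HH δ (t ^ (-(1 / (2 * a))) • x) = ENNReal.ofReal (HT a δ t x) := by
  rw [HH, HT, norm_smul, Real.norm_of_nonneg (by positivity), Real.mul_rpow (by positivity) (norm_nonneg _),
    ← Real.rpow_mul ht.le]
  congr 4; field_simp

lemma scl_facts {a t : ℝ} (ha : 0 < a) (ht : 0 < t) : (t ^ (-(1 / (2 * a)))) ^ (2 * a) * t = 1 ∧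
    (t ^ (-(1 / (2 * a)))) ^ 2 = (t ^ (1 / a))⁻¹ := by
  constructor
  · rw [← Real.rpow_mul ht.le, show -(1 / (2 * a)) * (2 * a) = -1 by field_simp, Real.rpow_neg_one]
    field_simp
  · rw [← Real.rpow_natCast, ← Real.rpow_mul ht.le, ← Real.rpow_neg ht.le]
    congr 1; push_cast; field_simp

namespace Ctx
variable {d : ℕ} {a δ ε B : ℝ} {η : Measure ℝ}

lemma UT (c : Ctx d a η δ ε B) {T : ℝ} (hT : 0 < T) : ∃ C : ℝ, 0 < C ∧ ∀ M, 0 ≤ M → M ≤ 1 →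
    ∀ t ∈ Ioc (0:ℝ) T, ∀ x y : Ed d, x ≠ 0 → y ≠ 0 →
    FF d a η δ ε B M (t, x, y) ≤ ENNReal.ofReal C * kP d a η M (t, x, y) *
      ENNReal.ofReal (HT a δ t x) * ENNReal.ofReal (HT a δ t y) := by
  have ha := c.ha
  have hB := c.hB
  set B2 := B * (T + T ^ (ε / (2 * a))) with hB2
  have c2 : Ctx d a η δ ε B2 := { c with hB := by positivity }
  have hκ := c.κ0
  obtain ⟨C, hC, H⟩ := c2.U7 (T ^ (1 / a))
  refine ⟨C, hC, fun M hM hM1 t ht x y hx hy => ?_⟩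
  have ht0 := ht.1
  obtain ⟨s1, s2⟩ := scl_facts ha ht0
  have r1 := HH_smul δ ha ht0 x
  have r2 := HH_smul δ ha ht0 y
  have hle : t * (t ^ (-(1 / (2 * a)))) ^ (2 * a - ε) ≤ T ^ (ε / (2 * a)) := by
    rw [← Real.rpow_mul ht0.le]
    nth_rewrite 1 [← Real.rpow_one t]
    rw [← Real.rpow_add ht0, show 1 + -(1 / (2 * a)) * (2 * a - ε) = ε / (2 * a) by field_simp; ring]
    exact Real.rpow_le_rpow ht0.le ht.2 (by have := c.hε; positivity)
  set l := t ^ (-(1 / (2 * a))) with hl'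
  have hl : 0 < l := by positivity
  have hMl : M / l ^ 2 ≤ T ^ (1 / a) := by
    rw [s2, div_inv_eq_mul]
    calc M * t ^ (1 / a) ≤ 1 * T ^ (1 / a) := by
          refine mul_le_mul hM1 (Real.rpow_le_rpow ht0.le ht.2 (by positivity)) (by positivity) zero_le_one
      _ = _ := one_mul _
  have b := H (M / l ^ 2) (by positivity) hMl (l • x) (l • y) (smul_ne_zero hl.ne' hx) (smul_ne_zero hl.ne' hy)
  rw [r1, r2] at b
  have hcl : (l ^ (2 * a)) ^ (1 / a) = l ^ 2 := by
    rw [← Real.rpow_mul hl.le, show 2 * a * (1 / a) = ((2:ℕ):ℝ) by push_cast; field_simp, Real.rpow_natCast]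
  have hks : ∀ t (x y : Ed d), kP d a η M (t, x, y) = ENNReal.ofReal (l ^ d) * kP d a η (M / l ^ 2) (l ^ (2 * a) * t, l • x, l • y) :=
    fun t x y => kP_scale c.h (by positivity) hl hcl t x y
  set q : Ed d → ℝ≥0∞ := fun z => ENNReal.ofReal (kappa d (2 * a) δ * ‖z‖ ^ (-(2 * a)) +
    B * t * (1 + l ^ (2 * a - ε) * ‖z‖ ^ (-(2 * a) + ε))) with hq
  have hqm : Measurable q := by fun_prop
  have e := ET_scale (k := kP d a η (M / l ^ 2)) (q := q) (q' := qs d (2 * a) δ ε B) (measurable_kP c.h) hqm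
    (c := l ^ (2 * a)) (by positivity) hl (kP d a η M) hks (by
      intro x
      rw [hq, qs, ← ENNReal.ofReal_mul (by positivity), norm_smul, Real.norm_of_nonneg hl.le, Real.mul_rpow hl.le (norm_nonneg _),
        Real.mul_rpow hl.le (norm_nonneg _)]
      congr 1
      have h1 : l ^ (2 * a) * l ^ (-(2 * a)) = 1 := by rw [← Real.rpow_add hl]; simp
      have h2 : l ^ (2 * a - ε) * l ^ (-(2 * a) + ε) = 1 := by
        rw [← Real.rpow_add hl, show 2 * a - ε + (-(2 * a) + ε) = 0 by ring, Real.rpow_zero]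
      linear_combination (-(kappa d (2 * a) δ * ‖x‖ ^ (-(2 * a)))) * h1 -
        B * (1 + l ^ (2 * a - ε) * l ^ (-(2 * a) + ε) * ‖x‖ ^ (-(2 * a) + ε)) * s1 - B * ‖x‖ ^ (-(2 * a) + ε) * h2) t x y
  rw [s1] at e
  have mono : ET (kP d a η (M / l ^ 2)) q (1, l • x, l • y) ≤ FF d a η δ ε B2 (M / l ^ 2) (1, l • x, l • y) := by
    refine ET_mono (fun _ => le_rfl) (Eventually.of_forall fun z => ?_) _
    rw [hq, qs]
    apply ENNReal.ofReal_le_ofReal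
    have hp : 0 ≤ ‖z‖ ^ (-(2 * a) + ε) := by positivity
    have hTp : 0 ≤ T ^ (ε / (2 * a)) := by positivity
    have k1 : B * t ≤ B2 := by
      rw [hB2]; exact mul_le_mul_of_nonneg_left (by linarith [ht.2]) hB
    have k2 : B * (t * l ^ (2 * a - ε)) ≤ B2 := by
      rw [hB2]; exact mul_le_mul_of_nonneg_left (by linarith) hB
    have k3 := mul_le_mul_of_nonneg_right k2 hp
    linarith
  rw [FF, e, hks t x y, s1]
  refine (mul_le_mul_right (mono.trans b) _).trans_eq ?_
  ring

lemma LT (c : Ctx d a η δ ε 0) (hε2 : ε ≤ 2) (hεδ2 : ε < δ / 2) {T : ℝ} (hT : 0 < T) : ∃ C : ℝ, 0 < C ∧ ∀ M, 0 ≤ M → M ≤ 1 →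
    ∀ t ∈ Ioc (0:ℝ) T, ∀ x y : Ed d, x ≠ 0 → y ≠ 0 →
    kP d a η M (t, x, y) * ENNReal.ofReal (HT a δ t x) * ENNReal.ofReal (HT a δ t y) ≤
      ENNReal.ofReal C * FF d a η δ ε 0 M (t, x, y) := by
  have ha := c.ha
  obtain ⟨C, hC, H⟩ := c.L4 hε2 hεδ2 (M0 := T ^ (1 / a)) (by positivity)
  refine ⟨C, hC, fun M hM hM1 t ht x y hx hy => ?_⟩
  have ht0 := ht.1
  obtain ⟨s1, s2⟩ := scl_facts ha ht0
  have r1 := HH_smul δ ha ht0 x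
  have r2 := HH_smul δ ha ht0 y
  set l := t ^ (-(1 / (2 * a))) with hl'
  have hl : 0 < l := by positivity
  have hMl : M / l ^ 2 ≤ T ^ (1 / a) := by
    rw [s2, div_inv_eq_mul]
    calc M * t ^ (1 / a) ≤ 1 * T ^ (1 / a) := by
          refine mul_le_mul hM1 (Real.rpow_le_rpow ht0.le ht.2 (by positivity)) (by positivity) zero_le_one
      _ = _ := one_mul _
  have b := H (M / l ^ 2) (by positivity) hMl (l • x) (l • y) (smul_ne_zero hl.ne' hx) (smul_ne_zero hl.ne' hy)
  rw [r1, r2] at b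
  have hcl : (l ^ (2 * a)) ^ (1 / a) = l ^ 2 := by
    rw [← Real.rpow_mul hl.le, show 2 * a * (1 / a) = ((2:ℕ):ℝ) by push_cast; field_simp, Real.rpow_natCast]
  rw [c.scale hl t x y, kP_scale c.h (by positivity) hl hcl t x y, s1]
  calc _ = ENNReal.ofReal (l ^ d) * (kP d a η (M / l ^ 2) (1, l • x, l • y) * ENNReal.ofReal (HT a δ t x) * ENNReal.ofReal (HT a δ t y)) := by ring
    _ ≤ _ := mul_le_mul_right b _
    _ = _ := by ring

end Ctx

section transfer
variable {d : ℕ}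

lemma toReal_lint {X : Type*} [MeasurableSpace X] (μ : Measure X) (f : X → ℝ) (F : X → ℝ≥0∞) (hF : Measurable F)
    (hfF : ∀ᵐ z ∂μ, f z = (F z).toReal) (hfin : ∫⁻ z, F z ∂μ ≠ ∞) : ∫ z, f z ∂μ = (∫⁻ z, F z ∂μ).toReal := by
  rw [integral_congr_ae hfF, integral_toReal hF.aemeasurable (ae_lt_top hF hfin)]

lemma pertN_eq (hd : 0 < d) {k : ℝ × Ed d × Ed d → ℝ≥0∞} {kr : ℝ → Ed d → Ed d → ℝ} {q : Ed d → ℝ} (hk : Measurable k)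
    (hk0 : ∀ t x y, t ≤ 0 → k (t, x, y) = 0) (hkr : ∀ t, 0 < t → ∀ x y, kr t x y = (k (t, x, y)).toReal)
    (hq : Measurable q) (hq0 : ∀ x, x ≠ 0 → 0 ≤ q x)
    (hfin : ∀ t, 0 < t → ∀ x y, x ≠ 0 → y ≠ 0 → ET k (fun z => ENNReal.ofReal (q z)) (t, x, y) ≠ ∞) (n : ℕ) :
    ∀ t, 0 < t → ∀ x y, x ≠ 0 → y ≠ 0 → pertN d kr q n t x y = (EN k (fun z => ENNReal.ofReal (q z)) n (t, x, y)).toReal := by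
  set Q : Ed d → ℝ≥0∞ := fun z => ENNReal.ofReal (q z) with hQ
  have hQm : Measurable Q := hq.ennreal_ofReal
  induction n with
  | zero => intro t ht x y _ _; exact hkr t ht x y
  | succ n ih =>
    intro t ht x y hx hy
    have hm := measurable_EN hk hQm n
    have e : EN k Q (n + 1) (t, x, y) = ∫⁻ s in Ioo 0 t, ∫⁻ z, EN k Q n (s, x, z) * Q z * k (t - s, z, y) :=
      cnv_const_eq hk hm hk0 (EN_zero hk0 n) hQm t x y
    have hf : EN k Q (n + 1) (t, x, y) ≠ ∞ :=
      ne_top_of_le_ne_top (hfin t ht x y hx hy) (ENNReal.le_tsum (n + 1))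
    rw [e] at hf ⊢
    have hGm : Measurable fun w : ℝ × Ed d => EN k Q n (w.1, x, w.2) * Q w.2 * k (t - w.1, w.2, y) := by fun_prop
    have hIm : Measurable fun s => ∫⁻ z, EN k Q n (s, x, z) * Q z * k (t - s, z, y) := hGm.lintegral_prod_right'
    refine toReal_lint _ _ _ hIm ?_ hf
    filter_upwards [ae_lt_top hIm hf, ae_restrict_mem measurableSet_Ioo] with s hs hst
    refine toReal_lint _ _ _ (hGm.comp (by fun_prop : Measurable fun z : Ed d => (s, z))) ?_ hs.ne
    filter_upwards [ae_ne_zero hd] with z hz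
    rw [ih s hst.1 x z hx hz, hkr (t - s) (by linarith [hst.2]), ENNReal.toReal_mul, ENNReal.toReal_mul, hQ,
      ENNReal.toReal_ofReal (hq0 z hz)]

lemma pert_eq (hd : 0 < d) {k : ℝ × Ed d × Ed d → ℝ≥0∞} {kr : ℝ → Ed d → Ed d → ℝ} {q : Ed d → ℝ} (hk : Measurable k)
    (hk0 : ∀ t x y, t ≤ 0 → k (t, x, y) = 0) (hkr : ∀ t, 0 < t → ∀ x y, kr t x y = (k (t, x, y)).toReal)
    (hq : Measurable q) (hq0 : ∀ x, x ≠ 0 → 0 ≤ q x)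
    (hfin : ∀ t, 0 < t → ∀ x y, x ≠ 0 → y ≠ 0 → ET k (fun z => ENNReal.ofReal (q z)) (t, x, y) ≠ ∞)
    (t : ℝ) (ht : 0 < t) (x y : Ed d) (hx : x ≠ 0) (hy : y ≠ 0) :
    pert d kr q t x y = (ET k (fun z => ENNReal.ofReal (q z)) (t, x, y)).toReal := by
  rw [pert, ET, ENNReal.tsum_toReal_eq fun n => ne_top_of_le_ne_top (hfin t ht x y hx hy) (ENNReal.le_tsum n)]
  congr 1; funext n
  exact pertN_eq hd hk hk0 hkr hq hq0 hfin n t ht x y hx hy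

lemma measurable_besselK (ν : ℝ) : Measurable (besselK ν) := by
  unfold besselK
  have h : StronglyMeasurable fun r : ℝ => ∫ u in Ioi (0 : ℝ), u ^ (-ν - 1) * Real.exp (-u - r ^ 2 / (4 * u)) := by
    refine StronglyMeasurable.integral_prod_right' (f := fun w : ℝ × ℝ => w.2 ^ (-ν - 1) * Real.exp (-w.2 - w.1 ^ 2 / (4 * w.2))) ?_
    exact Measurable.stronglyMeasurable (by fun_prop)
  have := h.measurable
  fun_prop

lemma measurable_Vbeta (α β : ℝ) : Measurable (Vbeta d α β) := by
  have h1 := measurable_besselK ((β + α) / 2)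
  have h2 := measurable_besselK (β / 2)
  unfold Vbeta VProf
  fun_prop

/-- all the bounds for one kernel and one potential -/
lemma one_case {a δ ε B : ℝ} {η : Measure ℝ} (c : Ctx d a η δ ε B) (hε2 : ε ≤ 2) (hεδ2 : ε < δ / 2)
    {T : ℝ} (hT : 0 < T) : ∃ C : ℝ, 1 ≤ C ∧ ∀ M, 0 ≤ M → M ≤ 1 → ∀ (kr : ℝ → Ed d → Ed d → ℝ) (q : Ed d → ℝ),
    (∀ t, 0 < t → ∀ x y, kr t x y = (kP d a η M (t, x, y)).toReal) → Measurable q →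
    (∀ x, x ≠ 0 → kappa d (2 * a) δ * ‖x‖ ^ (-(2 * a)) ≤ q x) →
    (∀ x, x ≠ 0 → q x ≤ kappa d (2 * a) δ * ‖x‖ ^ (-(2 * a)) + B * (1 + ‖x‖ ^ (-(2 * a) + ε))) →
    ∀ t ∈ Ioc (0:ℝ) T, ∀ x y : Ed d, x ≠ 0 → y ≠ 0 →
      C⁻¹ * (kr t x y * HT a δ t x * HT a δ t y) ≤ pert d kr q t x y ∧
      pert d kr q t x y ≤ C * (kr t x y * HT a δ t x * HT a δ t y) := by
  have c0 : Ctx d a η δ ε 0 := { c with hB := le_rfl }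
  obtain ⟨C1, hC1, H1⟩ := c.UT hT
  obtain ⟨C2, hC2, H2⟩ := c0.LT hε2 hεδ2 hT
  have hκ := c.κ0
  refine ⟨max 1 (max C1 C2), le_max_left _ _, fun M hM hM1 kr q hkr hqm hqge hqle t ht x y hx hy => ?_⟩
  have kfin := kP_ne_top c.h c.ha c.hd hM
  have le1 : ∀ p, ET (kP d a η M) (fun z => ENNReal.ofReal (q z)) p ≤ FF d a η δ ε B M p := fun p =>
    ET_mono (fun _ => le_rfl) ((ae_ne_zero c.hd).mono fun z hz => ENNReal.ofReal_le_ofReal (hqle z hz)) p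
  have le2 : ∀ p, FF d a η δ ε 0 M p ≤ ET (kP d a η M) (fun z => ENNReal.ofReal (q z)) p := fun p =>
    ET_mono (fun _ => le_rfl) ((ae_ne_zero c.hd).mono fun z hz => ENNReal.ofReal_le_ofReal (by
      rw [zero_mul, add_zero]; exact hqge z hz)) p
  have hfin : ∀ t, 0 < t → ∀ x y, x ≠ 0 → y ≠ 0 → ET (kP d a η M) (fun z => ENNReal.ofReal (q z)) (t, x, y) ≠ ∞ := by
    intro t ht x y hx hy
    obtain ⟨C, hC, H⟩ := c.UT ht
    refine ne_top_of_le_ne_top ?_ ((le1 _).trans (H M hM hM1 t ⟨ht, le_rfl⟩ x y hx hy))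
    exact ENNReal.mul_ne_top (ENNReal.mul_ne_top (ENNReal.mul_ne_top ENNReal.ofReal_ne_top (kfin _ _ _)) ENNReal.ofReal_ne_top) ENNReal.ofReal_ne_top
  have ht0 := ht.1
  have p1 := HT_pos a δ ht0 x
  have p2 := HT_pos a δ ht0 y
  rw [pert_eq c.hd (measurable_kP c.h) (fun t x y => kP_zero t x y) hkr hqm
    (fun x hx => le_trans (by positivity) (hqge x hx)) hfin t ht0 x y hx hy, hkr t ht0]
  have u := (le1 _).trans (H1 M hM hM1 t ht x y hx hy)
  have v := (H2 M hM hM1 t ht x y hx hy).trans (mul_le_mul_right (le2 _) _)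
  have hf := hfin t ht0 x y hx hy
  set E := ET (kP d a η M) (fun z => ENNReal.ofReal (q z)) (t, x, y) with hE
  have u' := ENNReal.toReal_mono (ENNReal.mul_ne_top (ENNReal.mul_ne_top (ENNReal.mul_ne_top ENNReal.ofReal_ne_top (kfin _ _ _)) ENNReal.ofReal_ne_top) ENNReal.ofReal_ne_top) u
  have v' := ENNReal.toReal_mono (ENNReal.mul_ne_top ENNReal.ofReal_ne_top hf) v
  simp only [ENNReal.toReal_mul, ENNReal.toReal_ofReal p1.le, ENNReal.toReal_ofReal p2.le, ENNReal.toReal_ofReal hC1.le,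
    ENNReal.toReal_ofReal hC2.le] at u' v'
  set K := (kP d a η M (t, x, y)).toReal with hK
  have hK0 : 0 ≤ K := ENNReal.toReal_nonneg
  have hE0 : 0 ≤ E.toReal := ENNReal.toReal_nonneg
  have hP : 0 ≤ K * HT a δ t x * HT a δ t y := by positivity
  set C := max 1 (max C1 C2) with hC
  have hC0 : 1 ≤ C := le_max_left _ _
  have hCC1 : C1 ≤ C := (le_max_left _ _).trans (le_max_right _ _)
  have hCC2 : C2 ≤ C := (le_max_right _ _).trans (le_max_right _ _)
  constructor
  · rw [inv_mul_le_iff₀ (by linarith)]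
    exact v'.trans (mul_le_mul_of_nonneg_right hCC2 hE0)
  · refine u'.trans ?_
    have := mul_le_mul_of_nonneg_right hCC1 hP
    linarith

end transfer

end

/-- Sharp two-sided estimates of all four Schrödinger perturbations: of `p⁰` and `p` by
`V_δ` and `V⁰_δ` (Theorem 5.1). -/
theorem stmt_19 (d : ℕ) (α δ : ℝ) (hα : α ∈ Ioo 0 (min 2 (d : ℝ)))
    (hδ : δ ∈ Ioo 0 ((d : ℝ) - α)) (T : ℝ) (hT : 0 < T) :
    ∃ c : ℝ, 1 ≤ c ∧ ∀ t ∈ Ioc (0 : ℝ) T, ∀ x y : Ed d, x ≠ 0 → y ≠ 0 →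
      (c⁻¹ * (fracKernel d α t x y * Hzero d α δ t x * Hzero d α δ t y) ≤
          pert d (fracKernel d α) (Vbeta d α δ) t x y ∧
        pert d (fracKernel d α) (Vbeta d α δ) t x y ≤
          c * (fracKernel d α t x y * Hzero d α δ t x * Hzero d α δ t y)) ∧
      (c⁻¹ * (fracKernel d α t x y * Hzero d α δ t x * Hzero d α δ t y) ≤
          pert d (fracKernel d α) (fun z => kappa d α δ * ‖z‖ ^ (-α)) t x y ∧
        pert d (fracKernel d α) (fun z => kappa d α δ * ‖z‖ ^ (-α)) t x y ≤
          c * (fracKernel d α t x y * Hzero d α δ t x * Hzero d α δ t y)) ∧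
      (c⁻¹ * (relKernel d α 1 t x y * Hzero d α δ t x * Hzero d α δ t y) ≤
          pert d (relKernel d α 1) (Vbeta d α δ) t x y ∧
        pert d (relKernel d α 1) (Vbeta d α δ) t x y ≤
          c * (relKernel d α 1 t x y * Hzero d α δ t x * Hzero d α δ t y)) ∧
      (c⁻¹ * (relKernel d α 1 t x y * Hzero d α δ t x * Hzero d α δ t y) ≤
          pert d (relKernel d α 1) (fun z => kappa d α δ * ‖z‖ ^ (-α)) t x y ∧
        pert d (relKernel d α 1) (fun z => kappa d α δ * ‖z‖ ^ (-α)) t x y ≤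
          c * (relKernel d α 1 t x y * Hzero d α δ t x * Hzero d α δ t y)) := by
  obtain ⟨hα0, hαm⟩ := hα
  obtain ⟨hδ0, hδd⟩ := hδ
  have hα2 : α < 2 := hαm.trans_le (min_le_left _ _)
  have hαd : α < d := hαm.trans_le (min_le_right _ _)
  have hd : 0 < d := by
    have : (0:ℝ) < d := hα0.trans hαd
    exact_mod_cast this
  obtain ⟨a, rfl⟩ : ∃ a, α = 2 * a := ⟨α / 2, by ring⟩
  have ha : 0 < a := by linarith
  have ha1 : a < 1 := by linarith
  obtain ⟨η, hη1, hη2, hη3⟩ := exists_subordinator ha ha1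
  have hsub : IsSub a η := ⟨hη1, hη2, hη3⟩
  obtain ⟨δ', hδ'0, hδ'd, hδ'δ, hκ, hH⟩ : ∃ δ', 0 < δ' ∧ δ' ≤ ((d:ℝ) - 2 * a) / 2 ∧ δ' ≤ δ ∧
      kappa d (2 * a) δ = kappa d (2 * a) δ' ∧ ∀ t (x : Ed d), Hzero d (2 * a) δ t x = HT a δ' t x := by
    by_cases h : δ ≤ ((d:ℝ) - 2 * a) / 2
    · exact ⟨δ, hδ0, h, le_rfl, rfl, fun t x => by rw [Hzero, if_pos h, HT]⟩
    · push Not at h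
      exact ⟨d - 2 * a - δ, by linarith, by linarith, by linarith, kappa_symm.symm,
        fun t x => by rw [Hzero, if_neg (not_le.2 h), HT]⟩
  set ε := min (min (δ' / 4) a) 1 with hε'
  have hε : 0 < ε := by rw [hε']; positivity
  have hε1 : ε ≤ δ' / 4 := (min_le_left _ _).trans (min_le_left _ _)
  have hε2 : ε ≤ a := (min_le_left _ _).trans (min_le_right _ _)
  have hε3 : ε ≤ 1 := min_le_right _ _
  obtain ⟨B, hB, HB⟩ := Vbeta_le (d := d) hα0 hδ0 hδd hε (by linarith) (by linarith : ε ≤ 2)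
  have c : Ctx d a η δ' ε B :=
    { h := hsub, ha := ha, ha1 := ha1, hd := hd, hδ := hδ'd, hε := hε, hεδ := by linarith, hεa := by linarith, hB := hB.le }
  obtain ⟨C, hC, H⟩ := one_case c (by linarith) (by linarith) hT
  refine ⟨C, hC, fun t ht x y hx hy => ?_⟩
  simp only [hH]
  have V1 : ∀ x : Ed d, x ≠ 0 → kappa d (2 * a) δ' * ‖x‖ ^ (-(2 * a)) ≤ Vbeta d (2 * a) δ x := fun x hx => by
    rw [← hκ]; exact Vbeta_ge hα0 hδ0 hδd hx
  have V2 : ∀ x : Ed d, x ≠ 0 → Vbeta d (2 * a) δ x ≤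
      kappa d (2 * a) δ' * ‖x‖ ^ (-(2 * a)) + B * (1 + ‖x‖ ^ (-(2 * a) + ε)) := fun x hx => by
    rw [← hκ]; exact HB x hx
  have W1 : ∀ x : Ed d, x ≠ 0 → kappa d (2 * a) δ' * ‖x‖ ^ (-(2 * a)) ≤ kappa d (2 * a) δ * ‖x‖ ^ (-(2 * a)) :=
    fun x _ => by rw [hκ]
  have W2 : ∀ x : Ed d, x ≠ 0 → kappa d (2 * a) δ * ‖x‖ ^ (-(2 * a)) ≤
      kappa d (2 * a) δ' * ‖x‖ ^ (-(2 * a)) + B * (1 + ‖x‖ ^ (-(2 * a) + ε)) := fun x _ => by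
    rw [hκ]
    have : 0 ≤ B * (1 + ‖x‖ ^ (-(2 * a) + ε)) := by positivity
    linarith
  have Wm : Measurable fun z : Ed d => kappa d (2 * a) δ * ‖z‖ ^ (-(2 * a)) := by fun_prop
  have Vm : Measurable (Vbeta d (2 * a) δ) := measurable_Vbeta _ _
  have fk := fun t (ht : 0 < t) (x y : Ed d) => fracKernel_eq hsub ha hd ht x y
  have rk := fun t (ht : 0 < t) (x y : Ed d) => relKernel_eq hsub ha hd ht x y
  exact ⟨H 0 le_rfl zero_le_one _ _ fk Vm V1 V2 t ht x y hx hy,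
    H 0 le_rfl zero_le_one _ _ fk Wm W1 W2 t ht x y hx hy,
    H 1 zero_le_one le_rfl _ _ rk Vm V1 V2 t ht x y hx hy,
    H 1 zero_le_one le_rfl _ _ rk Wm W1 W2 t ht x y hx hy⟩
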